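/- For i ∈ {1,2}, let φ_i be a local Zhou weight related to |f_{0,i}|² near o, where f_{0,i} is a tuple of holomorphic functions near o. Assume that σ(log|f|, φ₁) ≤ σ(log|f|, φ₂) holds for every holomorphic function f near o. Then φ₁ ≤ φ₂ + O(1) near o. In particular, σ(log|f|, φ₁) = σ(log|f|, φ₂) for every holomorphic f near o if and only if φ₁ = φ₂ + O(1) near o. -/

import Mathlib

open MeasureTheory Filter Topology
open scoped ENNReal NNReal

noncomputable section

/-- `ℂⁿ`. -/
abbrev Cn (n : ℕ) : Type := Fin n → ℂ

variable {n : ℕ}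

/-- The exponential function `EReal → ℝ≥0∞`, with `exp ⊥ = 0` and `exp ⊤ = ⊤`. -/
def expE (x : EReal) : ℝ≥0∞ :=
  if x = ⊥ then 0 else if x = ⊤ then ⊤ else ENNReal.ofReal (Real.exp x.toReal)

/-- The logarithm `ℝ → EReal`, with value `⊥` for `x ≤ 0`. -/
def elog (x : ℝ) : EReal := if x ≤ 0 then (⊥ : EReal) else ((Real.log x : ℝ) : EReal)

/-- The density `e^{c·φ} : ℂⁿ → [0,∞]` associated to an extended-real-valued `φ`. -/
def wexp (c : ℝ) (φ : Cn n → EReal) (z : Cn n) : ℝ≥0∞ := expE ((c : EReal) * φ z)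

/-- `|f₀|² = ∑ⱼ |f₀ⱼ|²` as a `[0,∞]`-valued density, for a tuple `f₀` of functions. -/
def normSq2 {m : ℕ} (f₀ : Fin m → Cn n → ℂ) (z : Cn n) : ℝ≥0∞ :=
  ∑ j, (‖f₀ j z‖₊ : ℝ≥0∞) ^ 2

/-- `log |f₀| = (1/2) log ∑ⱼ |f₀ⱼ|²` for a tuple `f₀`. -/
def logAbsT {m : ℕ} (f₀ : Fin m → Cn n → ℂ) (z : Cn n) : EReal :=
  elog (Real.sqrt (∑ j, ‖f₀ j z‖ ^ 2))

/-- The weight `|f₀|² e^{-2φ₀}`. -/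
def dens0 {m : ℕ} (f₀ : Fin m → Cn n → ℂ) (φ₀ : Cn n → EReal) (z : Cn n) : ℝ≥0∞ :=
  normSq2 f₀ z * wexp (-2) φ₀ z

/-- A nonnegative function is (Lebesgue-)integrable near the origin. -/
def IntNear (g : Cn n → ℝ≥0∞) : Prop := ∃ U ∈ 𝓝 (0 : Cn n), (∫⁻ z in U, g z) < ⊤

/-- `ψ ≤ φ + O(1)` near the origin. -/
def leO (ψ φ : Cn n → EReal) : Prop := ∃ C : ℝ, ∀ᶠ z in 𝓝 (0 : Cn n), ψ z ≤ φ z + (C : EReal)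

/-- `ψ = φ + O(1)` near the origin. -/
def eqO (ψ φ : Cn n → EReal) : Prop := leO ψ φ ∧ leO φ ψ

/-- The truncated average of `u` over the circle `θ ↦ z + r e^{iθ} w`, truncated below at `-m`. -/
def circleAvg (u : Cn n → EReal) (z w : Cn n) (r : ℝ) (m : ℕ) : ℝ :=
  (2 * Real.pi)⁻¹ * ∫ θ in (0:ℝ)..(2 * Real.pi),
    (max (u (z + ((r : ℂ) * Complex.exp (Complex.I * (θ : ℂ))) • w)) ((-(m : ℝ) : ℝ) : EReal)).toReal

/-- `u` is plurisubharmonic on `Ω`: it is upper semicontinuous on `Ω`, takes values in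
`[-∞, ∞)`, is not identically `-∞` on any connected component of `Ω`, and satisfies the
sub-mean value inequality on all small circles inside complex lines. -/
structure PSHOn (u : Cn n → EReal) (Ω : Set (Cn n)) : Prop where
  usc : UpperSemicontinuousOn u Ω
  lt_top : ∀ z ∈ Ω, u z < ⊤
  not_botOnComponents : ∀ z ∈ Ω, ∃ w ∈ connectedComponentIn Ω z, u w ≠ ⊥
  submean : ∀ z ∈ Ω, ∀ w : Cn n, ∃ ε > 0, ∀ r : ℝ, 0 < r → r < ε →
    u z ≤ ⨅ m : ℕ, ((circleAvg u z w r m : ℝ) : EReal)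

/-- `u` is plurisubharmonic near the origin. -/
def PSHNear (u : Cn n → EReal) : Prop := ∃ U ∈ 𝓝 (0 : Cn n), IsOpen U ∧ PSHOn u U

/-- `f` is holomorphic near the origin. -/
def HoloNear (f : Cn n → ℂ) : Prop := ∃ U ∈ 𝓝 (0 : Cn n), IsOpen U ∧ DifferentiableOn ℂ f U

/-- `Φ` is a (local) Zhou weight near the origin related to a general nonnegative
weight `W`. -/
structure IsZhouWeightFor (W : Cn n → ℝ≥0∞) (Φ : Cn n → EReal) : Prop where
  psh : PSHNear Φ
  intN : ∃ N₁ : ℕ, ∀ N₀ : ℕ, N₁ ≤ N₀ →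
    IntNear fun z => W z * ENNReal.ofReal (‖z‖ ^ (2 * N₀)) * wexp (-2) Φ z
  nonint : ¬ IntNear fun z => W z * wexp (-2) Φ z
  maximal : ∀ φ' : Cn n → EReal, PSHNear φ' → leO Φ φ' →
    (¬ IntNear fun z => W z * wexp (-2) φ' z) → eqO φ' Φ

/-- `Φ` is a local Zhou weight related to `|f₀|² e^{-2φ₀}` near the origin (including the
standing assumptions that `f₀` is a tuple of holomorphic functions near `o`, `φ₀` is
plurisubharmonic near `o`, and `|f₀|² e^{-2φ₀}` is integrable near `o`). -/
structure IsLocalZhouWeight {m : ℕ} (f₀ : Fin m → Cn n → ℂ) (φ₀ : Cn n → EReal)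
    (Φ : Cn n → EReal) : Prop where
  holo : ∀ j, HoloNear (f₀ j)
  psh₀ : PSHNear φ₀
  int₀ : IntNear (dens0 f₀ φ₀)
  zhou : IsZhouWeightFor (dens0 f₀ φ₀) Φ

/-- The Zhou number (relative type) `σ(ψ, Φ) = sup { b ≥ 0 : ψ ≤ bΦ + O(1) near o }`. -/
def zhouNumber (ψ Φ : Cn n → EReal) : ℝ :=
  sSup {b : ℝ | 0 ≤ b ∧ leO ψ fun z => (b : EReal) * Φ z}

/-- `log ‖f‖ : ℂⁿ → EReal`. -/
def logAbs (f : Cn n → ℂ) (z : Cn n) : EReal := elog ‖f z‖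

/-- `ν(f, Φ) = σ(log|f|, Φ)`. -/
def nuNumber (f : Cn n → ℂ) (Φ : Cn n → EReal) : ℝ := zhouNumber (logAbs f) Φ

/-- The jumping number `c_o^G(Φ) = sup { c ≥ 0 : |G|² e^{-2cΦ} integrable near o }`. -/
def jumping (G : Cn n → ℂ) (Φ : Cn n → EReal) : ℝ :=
  sSup {c : ℝ | 0 ≤ c ∧ IntNear fun z => (‖G z‖₊ : ℝ≥0∞) ^ 2 * wexp (-2 * c) Φ z}

/-- The inclusion `ℐ(φ)ₒ ⊆ ℐ(ψ)ₒ` of multiplier ideals at the origin. -/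
def mIdealLE (φ ψ : Cn n → EReal) : Prop :=
  ∀ f : Cn n → ℂ, HoloNear f →
    (IntNear fun z => (‖f z‖₊ : ℝ≥0∞) ^ 2 * wexp (-2) φ z) →
    IntNear fun z => (‖f z‖₊ : ℝ≥0∞) ^ 2 * wexp (-2) ψ z

/-- The Tian function `Tn(t; f, v, φ₀) = sup { c ≥ 0 : |f|^{2t} e^{-2cv - 2φ₀} integrable near o }`. -/
def tian (t : ℝ) (f : Cn n → ℂ) (v φ₀ : Cn n → EReal) : ℝ :=
  sSup {c : ℝ | 0 ≤ c ∧
    IntNear fun z => ENNReal.ofReal (‖f z‖ ^ (2 * t)) * wexp (-2 * c) v z * wexp (-2) φ₀ z}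

open scoped ContDiff ComplexConjugate

/-! ### Wirtinger derivatives on `ℂⁿ` -/

/-- The standard basis vectors of `ℂⁿ`. -/
def eb (j : Fin n) : Cn n := Pi.single j 1

/-- The first-order operator `½(∂_{x_j} + s ∂_{y_j})`; `s = i` gives `∂/∂z̄_j` and `s = -i`
gives `∂/∂z_j`. -/
def wd (s : ℂ) (j : Fin n) (f : Cn n → ℂ) (z : Cn n) : ℂ :=
  (1 / 2) * (fderiv ℝ f z (eb j) + s * fderiv ℝ f z (Complex.I • eb j))

/-- The operator `∂/∂z̄_j`. -/
notation "dbar" => wd Complex.I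

/-- The operator `∂/∂z_j`. -/
notation "dd" => wd (-Complex.I)

lemma wd_add {s : ℂ} {j : Fin n} {f g : Cn n → ℂ} {z : Cn n}
    (hf : DifferentiableAt ℝ f z) (hg : DifferentiableAt ℝ g z) :
    wd s j (fun y => f y + g y) z = wd s j f z + wd s j g z := by
  simp only [wd, fderiv_fun_add hf hg, add_apply]; ring

lemma wd_sub {s : ℂ} {j : Fin n} {f g : Cn n → ℂ} {z : Cn n}
    (hf : DifferentiableAt ℝ f z) (hg : DifferentiableAt ℝ g z) :
    wd s j (fun y => f y - g y) z = wd s j f z - wd s j g z := by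
  simp only [wd, fderiv_fun_sub hf hg, sub_apply]; ring

lemma wd_mul {s : ℂ} {j : Fin n} {f g : Cn n → ℂ} {z : Cn n}
    (hf : DifferentiableAt ℝ f z) (hg : DifferentiableAt ℝ g z) :
    wd s j (fun y => f y * g y) z = wd s j f z * g z + f z * wd s j g z := by
  simp only [wd, fderiv_fun_mul hf hg, add_apply,
    smul_apply, smul_eq_mul]; ring

lemma wd_const {s : ℂ} {j : Fin n} {c : ℂ} {z : Cn n} : wd s j (fun _ => c) z = 0 := by
  simp [wd]

lemma wd_sum {ι : Type*} {s : ℂ} {j : Fin n} {u : Finset ι} {f : ι → Cn n → ℂ} {z : Cn n}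
    (hf : ∀ i ∈ u, DifferentiableAt ℝ (f i) z) :
    wd s j (fun y => ∑ i ∈ u, f i y) z = ∑ i ∈ u, wd s j (f i) z := by
  simp only [wd, fderiv_fun_sum hf, sum_apply, Finset.mul_sum,
    ← Finset.sum_add_distrib]

lemma wd_conj {s : ℂ} {j : Fin n} {f : Cn n → ℂ} {z : Cn n} (hf : DifferentiableAt ℝ f z) :
    wd s j (fun y => conj (f y)) z = conj (wd (conj s) j f z) := by
  have h : fderiv ℝ (fun y => conj (f y)) z = Complex.conjCLE.toContinuousLinearMap.comp
      (fderiv ℝ f z) :=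
    (Complex.conjCLE.toContinuousLinearMap.hasFDerivAt.comp z hf.hasFDerivAt).fderiv
  have h2 : (starRingEnd ℂ) 2 = 2 := Complex.conj_ofNat 2
  simp [wd, h, h2]

lemma wd_comp_real {s : ℂ} {j : Fin n} {f : Cn n → ℝ} {θ : ℝ → ℝ} {z : Cn n} {θ' : ℝ}
    (hθ : HasDerivAt θ θ' (f z)) (hf : DifferentiableAt ℝ f z) :
    wd s j (fun y => ((θ (f y) : ℝ) : ℂ)) z = θ' * wd s j (fun y => (f y : ℂ)) z := by
  have h1 : fderiv ℝ (fun y => (f y : ℂ)) z = Complex.ofRealCLM.comp (fderiv ℝ f z) :=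
    (Complex.ofRealCLM.hasFDerivAt.comp z hf.hasFDerivAt).fderiv
  have h2 : fderiv ℝ (fun y => ((θ (f y) : ℝ) : ℂ)) z
      = Complex.ofRealCLM.comp (θ' • fderiv ℝ f z) :=
    (Complex.ofRealCLM.hasFDerivAt.comp z (hθ.comp_hasFDerivAt z hf.hasFDerivAt)).fderiv
  simp [wd, h1, h2]; ring

lemma ContDiff.wd {s : ℂ} {j : Fin n} {f : Cn n → ℂ} (hf : ContDiff ℝ ∞ f) :
    ContDiff ℝ ∞ (wd s j f) := by
  have h : ContDiff ℝ ∞ (fderiv ℝ f) := hf.fderiv_right (by simp)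
  unfold _root_.wd
  fun_prop

lemma HasCompactSupport.wd {s : ℂ} {j : Fin n} {f : Cn n → ℂ} (hf : HasCompactSupport f) :
    HasCompactSupport (wd s j f) := by
  refine (hf.fderiv (𝕜 := ℝ)).mono fun z hz => ?_
  simp only [Function.mem_support, _root_.wd] at hz ⊢
  contrapose! hz
  simp [hz]

lemma wd_eq_zero_of_notMem {s : ℂ} {j : Fin n} {f : Cn n → ℂ} {z : Cn n}
    (hz : z ∉ tsupport f) : wd s j f z = 0 := by
  have : fderiv ℝ f z = 0 := by
    by_contra h
    exact hz (tsupport_fderiv_subset ℝ (subset_tsupport _ h))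
  simp [wd, this]

lemma wd_wd {s s' : ℂ} {j k : Fin n} {f : Cn n → ℂ} (hf : ContDiff ℝ ∞ f) (z : Cn n) :
    wd s j (wd s' k f) z = (1 / 4) * (fderiv ℝ (fderiv ℝ f) z (eb j) (eb k)
      + s' * fderiv ℝ (fderiv ℝ f) z (eb j) (Complex.I • eb k)
      + s * fderiv ℝ (fderiv ℝ f) z (Complex.I • eb j) (eb k)
      + s * s' * fderiv ℝ (fderiv ℝ f) z (Complex.I • eb j) (Complex.I • eb k)) := by
  have h : ContDiff ℝ ∞ (fderiv ℝ f) := hf.fderiv_right (by simp)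
  have hd : DifferentiableAt ℝ (fderiv ℝ f) z := h.differentiable (by simp) z
  have key : ∀ v : Cn n, fderiv ℝ (wd s' k f) z v = (1 / 2) *
      (fderiv ℝ (fderiv ℝ f) z v (eb k) + s' * fderiv ℝ (fderiv ℝ f) z v (Complex.I • eb k)) := by
    intro v
    have h1 : ∀ w : Cn n, HasFDerivAt (fun y => fderiv ℝ f y w)
        ((fderiv ℝ (fderiv ℝ f) z).flip w) z := fun w => by
      have := hd.hasFDerivAt.clm_apply (hasFDerivAt_const w z)
      simpa using this
    have h2 := ((h1 (eb k)).add ((h1 (Complex.I • eb k)).const_mul s')).const_mul (1 / 2 : ℂ)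
    have h3 : fderiv ℝ (wd s' k f) z = _ := h2.fderiv
    rw [h3]; simp; ring
  rw [wd, key, key]; ring

lemma wd_comm {s s' : ℂ} {j k : Fin n} {f : Cn n → ℂ} (hf : ContDiff ℝ ∞ f) (z : Cn n) :
    wd s j (wd s' k f) z = wd s' k (wd s j f) z := by
  have hs : IsSymmSndFDerivAt ℝ f z := hf.contDiffAt.isSymmSndFDerivAt
    (by simpa using WithTop.coe_le_coe.2 (le_top : (2 : ℕ∞) ≤ ⊤))
  rw [wd_wd hf, wd_wd hf, hs.eq (eb k), hs.eq (eb k), hs.eq (Complex.I • eb k),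
    hs.eq (Complex.I • eb k)]
  ring

lemma integral_fderiv_eq_zero {f : Cn n → ℂ} (hf : ContDiff ℝ ∞ f) (hc : HasCompactSupport f)
    (v : Cn n) : ∫ z, fderiv ℝ f z v = 0 := by
  have hcd : Continuous (fun z => fderiv ℝ f z v) :=
    (hf.continuous_fderiv (by simp)).clm_apply continuous_const
  have hcs : HasCompactSupport (fun z => fderiv ℝ f z v) := by
    refine (hc.fderiv (𝕜 := ℝ)).mono fun z hz => ?_
    simp only [Function.mem_support] at hz ⊢
    contrapose! hz; simp [hz]
  have h := integral_mul_fderiv_eq_neg_fderiv_mul_of_integrable (𝕜 := ℂ) (μ := volume)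
    (f := fun _ : Cn n => (1 : ℂ)) (g := f) (v := v) (by simp)
    (by simpa using hcd.integrable_of_hasCompactSupport hcs)
    (by simpa using hf.continuous.integrable_of_hasCompactSupport hc)
    (fun _ _ => differentiableAt_const _) (fun x _ => hf.differentiable (by simp) x)
  simpa using h

lemma integral_wd_eq_zero {s : ℂ} {j : Fin n} {f : Cn n → ℂ} (hf : ContDiff ℝ ∞ f)
    (hc : HasCompactSupport f) : ∫ z, wd s j f z = 0 := by
  have hi : ∀ v : Cn n, Integrable (fun z => fderiv ℝ f z v) := fun v => by
    refine Continuous.integrable_of_hasCompactSupport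
      ((hf.continuous_fderiv (by simp)).clm_apply continuous_const) ?_
    refine (hc.fderiv (𝕜 := ℝ)).mono fun z hz => ?_
    simp only [Function.mem_support] at hz ⊢
    contrapose! hz; simp [hz]
  unfold wd
  rw [integral_const_mul, integral_add (hi _) ((hi _).const_mul _), integral_const_mul,
    integral_fderiv_eq_zero hf hc, integral_fderiv_eq_zero hf hc]
  simp

/-! ### The basic inequality for weighted `∂̄` -/

/-- A real function viewed as a complex function. -/
abbrev cst (Ψ : Cn n → ℝ) : Cn n → ℂ := fun z => (Ψ z : ℂ)

/-- The complex density `e^{-Ψ}`. -/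
def gw (Ψ : Cn n → ℝ) : Cn n → ℂ := fun z => ((Real.exp (-Ψ z) : ℝ) : ℂ)

/-- Minus the formal adjoint of `∂/∂z̄_j` in `L²(e^{-Ψ})`. -/
def del (Ψ : Cn n → ℝ) (j : Fin n) (f : Cn n → ℂ) (z : Cn n) : ℂ :=
  dd j f z - dd j (cst Ψ) z * f z

/-- The Levi form of `Ψ`. -/
def levi (Ψ : Cn n → ℝ) (z : Cn n) (b : Fin n → ℂ) : ℝ :=
  (∑ j, ∑ k, dd j (dbar k (cst Ψ)) z * b j * conj (b k)).re

lemma ContDiff.cst {Ψ : Cn n → ℝ} (h : ContDiff ℝ ∞ Ψ) : ContDiff ℝ ∞ (cst Ψ) :=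
  Complex.ofRealCLM.contDiff.comp h

lemma ContDiff.gw {Ψ : Cn n → ℝ} (h : ContDiff ℝ ∞ Ψ) : ContDiff ℝ ∞ (gw Ψ) :=
  Complex.ofRealCLM.contDiff.comp (Real.contDiff_exp.comp h.neg)

lemma ContDiff.conj_comp {f : Cn n → ℂ} (h : ContDiff ℝ ∞ f) :
    ContDiff ℝ ∞ (fun z => conj (f z)) :=
  Complex.conjCLE.contDiff.comp h

lemma ContDiff.dAt {f : Cn n → ℂ} (h : ContDiff ℝ ∞ f) (z : Cn n) : DifferentiableAt ℝ f z :=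
  h.differentiable (by simp) z

lemma ContDiff.del {Ψ : Cn n → ℝ} (h : ContDiff ℝ ∞ Ψ) {j : Fin n} {f : Cn n → ℂ}
    (hf : ContDiff ℝ ∞ f) : ContDiff ℝ ∞ (del Ψ j f) :=
  hf.wd.sub (h.cst.wd.mul hf)

lemma HasCompactSupport.del {Ψ : Cn n → ℝ} {j : Fin n} {f : Cn n → ℂ}
    (hf : HasCompactSupport f) : HasCompactSupport (del Ψ j f) :=
  hf.wd.sub hf.mul_left

lemma wd_gw {s : ℂ} {Ψ : Cn n → ℝ} (h : ContDiff ℝ ∞ Ψ) (j : Fin n) (z : Cn n) :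
    wd s j (gw Ψ) z = - wd s j (cst Ψ) z * gw Ψ z := by
  have := wd_comp_real (s := s) (j := j) (f := Ψ) (θ := fun t => Real.exp (-t)) (z := z)
    (θ' := -Real.exp (-Ψ z)) (by simpa using (hasDerivAt_neg (Ψ z)).exp)
    (h.differentiable (by simp) z)
  unfold gw
  rw [this]; push_cast; ring

lemma dd_conj {j : Fin n} {f : Cn n → ℂ} {z : Cn n} (hf : DifferentiableAt ℝ f z) :
    dd j (fun y => conj (f y)) z = conj (dbar j f z) := by
  rw [wd_conj hf]; simp

lemma dbar_conj {j : Fin n} {f : Cn n → ℂ} {z : Cn n} (hf : DifferentiableAt ℝ f z) :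
    dbar j (fun y => conj (f y)) z = conj (dd j f z) := by
  rw [wd_conj hf]; simp

lemma conj_dbar_dd {Ψ : Cn n → ℝ} (h : ContDiff ℝ ∞ Ψ) (j k : Fin n) (z : Cn n) :
    conj (dbar j (dd k (cst Ψ)) z) = dd j (dbar k (cst Ψ)) z := by
  rw [← dd_conj (h.cst.wd.dAt z)]
  congr 1
  funext y
  rw [← dbar_conj (h.cst.dAt y)]
  simp

/-- Integration by parts in `L²(e^{-Ψ})`. -/
lemma integral_del_mul {Ψ : Cn n → ℝ} (h : ContDiff ℝ ∞ Ψ) (j : Fin n) {f g : Cn n → ℂ}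
    (hf : ContDiff ℝ ∞ f) (hg : ContDiff ℝ ∞ g) (hc : HasCompactSupport f) :
    ∫ z, del Ψ j f z * conj (g z) * gw Ψ z = - ∫ z, f z * conj (dbar j g z) * gw Ψ z := by
  have h0 := integral_wd_eq_zero (s := -Complex.I) (j := j)
    ((hf.mul hg.conj_comp).mul h.gw) (hc.mul_right.mul_right)
  have h1 : ∀ z, dd j (fun z => f z * conj (g z) * gw Ψ z) z
      = del Ψ j f z * conj (g z) * gw Ψ z + f z * conj (dbar j g z) * gw Ψ z := by
    intro z
    have e1 := wd_mul (s := -Complex.I) (j := j) ((hf.mul hg.conj_comp).dAt z) (h.gw.dAt z)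
    have e2 := wd_mul (s := -Complex.I) (j := j) (hf.dAt z) (hg.conj_comp.dAt z)
    rw [e1, e2, wd_gw h, dd_conj (hg.dAt z), del]
    ring
  rw [integral_congr_ae (ae_of_all _ h1), integral_add] at h0
  · exact eq_neg_of_add_eq_zero_left h0
  · exact (((h.del hf).mul hg.conj_comp).mul h.gw).continuous.integrable_of_hasCompactSupport
      (hc.del.mul_right.mul_right)
  · exact ((hf.mul hg.wd.conj_comp).mul h.gw).continuous.integrable_of_hasCompactSupport
      (hc.mul_right.mul_right)

lemma dbar_del {Ψ : Cn n → ℝ} (h : ContDiff ℝ ∞ Ψ) (j k : Fin n) {g : Cn n → ℂ}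
    (hg : ContDiff ℝ ∞ g) (z : Cn n) :
    dbar j (del Ψ k g) z = del Ψ k (dbar j g) z - dbar j (dd k (cst Ψ)) z * g z := by
  have e1 := wd_sub (s := Complex.I) (j := j) (hg.wd (s := -Complex.I) (j := k) |>.dAt z)
    ((h.cst.wd (s := -Complex.I) (j := k) |>.mul hg).dAt z)
  have e2 := wd_mul (s := Complex.I) (j := j) (h.cst.wd (s := -Complex.I) (j := k) |>.dAt z)
    (hg.dAt z)
  unfold del
  rw [e1, e2, wd_comm hg]
  ring

/-- The commutator identity underlying the basic inequality. -/
lemma integral_commutator {Ψ : Cn n → ℝ} (h : ContDiff ℝ ∞ Ψ) (j k : Fin n) {f g : Cn n → ℂ}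
    (hf : ContDiff ℝ ∞ f) (hg : ContDiff ℝ ∞ g) (hcf : HasCompactSupport f)
    (hcg : HasCompactSupport g) :
    ∫ z, (del Ψ j f z * conj (del Ψ k g z) - dbar k f z * conj (dbar j g z)
      - dd j (dbar k (cst Ψ)) z * f z * conj (g z)) * gw Ψ z = 0 := by
  have e1 := integral_del_mul h j hf (h.del hg (j := k)) hcf
  have e2 := integral_del_mul h k hg.wd hf (hcg.wd (s := Complex.I) (j := j))
  have hgw : ∀ z, conj (gw Ψ z) = gw Ψ z := fun z => Complex.conj_ofReal _
  have e3 : ∫ z, dbar k f z * conj (dbar j g z) * gw Ψ z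
      = - ∫ z, f z * conj (del Ψ k (dbar j g) z) * gw Ψ z := by
    have e4 := congrArg conj e2
    rw [map_neg, ← integral_conj, ← integral_conj] at e4
    rw [eq_neg_iff_add_eq_zero, ← neg_eq_iff_add_eq_zero, eq_comm]
    calc _ = _ := ?_
      _ = _ := e4
      _ = _ := ?_
    · congr 1; funext z; simp only [map_mul, hgw, Complex.conj_conj]; ring
    · congr 2; funext z; simp only [map_mul, hgw, Complex.conj_conj]; ring
  have i1 : Integrable fun z => del Ψ j f z * conj (del Ψ k g z) * gw Ψ z :=
    (((h.del hf).mul (h.del hg).conj_comp).mul h.gw).continuous.integrable_of_hasCompactSupport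
      (hcf.del.mul_right.mul_right)
  have i2 : Integrable fun z => dbar k f z * conj (dbar j g z) * gw Ψ z :=
    ((hf.wd.mul hg.wd.conj_comp).mul h.gw).continuous.integrable_of_hasCompactSupport
      (hcf.wd.mul_right.mul_right)
  have i3 : Integrable fun z => f z * conj (del Ψ k (dbar j g) z) * gw Ψ z :=
    ((hf.mul (h.del hg.wd).conj_comp).mul h.gw).continuous.integrable_of_hasCompactSupport
      (hcf.mul_right.mul_right)
  have i4 : Integrable fun z => dd j (dbar k (cst Ψ)) z * f z * conj (g z) * gw Ψ z :=
    (((h.cst.wd.wd.mul hf).mul hg.conj_comp).mul h.gw).continuous.integrable_of_hasCompactSupport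
      (hcf.mul_left.mul_right.mul_right)
  have e5 : ∫ z, f z * conj (dbar j (del Ψ k g) z) * gw Ψ z
      = (∫ z, f z * conj (del Ψ k (dbar j g) z) * gw Ψ z)
        - ∫ z, dd j (dbar k (cst Ψ)) z * f z * conj (g z) * gw Ψ z := by
    rw [← integral_sub i3 i4]
    congr 1; funext z
    rw [dbar_del h j k hg, map_sub, map_mul, conj_dbar_dd h]; ring
  have e6 : ∀ z, (del Ψ j f z * conj (del Ψ k g z) - dbar k f z * conj (dbar j g z)
      - dd j (dbar k (cst Ψ)) z * f z * conj (g z)) * gw Ψ z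
      = del Ψ j f z * conj (del Ψ k g z) * gw Ψ z - dbar k f z * conj (dbar j g z) * gw Ψ z
       - dd j (dbar k (cst Ψ)) z * f z * conj (g z) * gw Ψ z := fun z => by ring
  have i12 : Integrable fun z => del Ψ j f z * conj (del Ψ k g z) * gw Ψ z
      - dbar k f z * conj (dbar j g z) * gw Ψ z := i1.sub i2
  rw [integral_congr_ae (ae_of_all _ e6), integral_sub i12 i4, integral_sub i1 i2,
    e1, e5, e3]
  ring

lemma normSq_antisymm_sum (a : Fin n → Fin n → ℂ) :
    (1 / 2 : ℝ) * ∑ j, ∑ k, ‖a j k - a k j‖ ^ 2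
      = ∑ j, ∑ k, ‖a j k‖ ^ 2 - (∑ j, ∑ k, a j k * conj (a k j)).re := by
  have h1 : ∀ j k, ‖a j k - a k j‖ ^ 2
      = ‖a j k‖ ^ 2 + ‖a k j‖ ^ 2 - 2 * (a j k * conj (a k j)).re := fun j k => by
    rw [← Complex.normSq_eq_norm_sq, ← Complex.normSq_eq_norm_sq, ← Complex.normSq_eq_norm_sq,
      Complex.normSq_sub]
  simp only [h1, Finset.sum_sub_distrib, Finset.sum_add_distrib, ← Finset.mul_sum,
    Complex.re_sum]
  rw [Finset.sum_comm (f := fun j k => ‖a k j‖ ^ 2)]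
  ring

/-- The basic (Kohn–Morrey–Hörmander) inequality on test forms. -/
lemma basic_inequality {Ψ : Cn n → ℝ} (h : ContDiff ℝ ∞ Ψ) {β : Fin n → Cn n → ℂ}
    (hβ : ∀ j, ContDiff ℝ ∞ (β j)) (hc : ∀ j, HasCompactSupport (β j)) :
    ∫ z, levi Ψ z (fun j => β j z) * Real.exp (-Ψ z) ≤
      ∫ z, (‖∑ j, del Ψ j (β j) z‖ ^ 2
        + (1 / 2) * ∑ j, ∑ k, ‖dbar k (β j) z - dbar j (β k) z‖ ^ 2) * Real.exp (-Ψ z) := by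
  have hT : ∫ z, ∑ j, ∑ k, (del Ψ j (β j) z * conj (del Ψ k (β k) z)
      - dbar k (β j) z * conj (dbar j (β k) z)
      - dd j (dbar k (cst Ψ)) z * β j z * conj (β k z)) * gw Ψ z = 0 := by
    have hi : ∀ j k, Integrable fun z => (del Ψ j (β j) z * conj (del Ψ k (β k) z)
        - dbar k (β j) z * conj (dbar j (β k) z)
        - dd j (dbar k (cst Ψ)) z * β j z * conj (β k z)) * gw Ψ z := fun j k =>
      (((((h.del (hβ j)).mul (h.del (hβ k)).conj_comp).sub ((hβ j).wd.mul (hβ k).wd.conj_comp)).sub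
        ((h.cst.wd.wd.mul (hβ j)).mul (hβ k).conj_comp)).mul
        h.gw).continuous.integrable_of_hasCompactSupport
        (((((hc j).del.mul_right).sub (hc j).wd.mul_right).sub
          (hc j).mul_left.mul_right).mul_right)
    rw [integral_finsetSum _ fun j _ => integrable_finsetSum _ fun k _ => hi j k]
    refine Finset.sum_eq_zero fun j _ => ?_
    rw [integral_finsetSum _ fun k _ => hi j k]
    exact Finset.sum_eq_zero fun k _ => integral_commutator h j k (hβ j) (hβ k) (hc j) (hc k)
  set T : Cn n → ℂ := fun z => ∑ j, ∑ k, (del Ψ j (β j) z * conj (del Ψ k (β k) z)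
      - dbar k (β j) z * conj (dbar j (β k) z)
      - dd j (dbar k (cst Ψ)) z * β j z * conj (β k z)) * gw Ψ z with hTdef
  set L : Cn n → ℝ := fun z => levi Ψ z (fun j => β j z) * Real.exp (-Ψ z) with hLdef
  set M : Cn n → ℝ := fun z => (‖∑ j, del Ψ j (β j) z‖ ^ 2
        + (1 / 2) * ∑ j, ∑ k, ‖dbar k (β j) z - dbar j (β k) z‖ ^ 2) * Real.exp (-Ψ z) with hMdef
  have hle : ∀ z, L z ≤ M z - (T z).re := by
    intro z
    have e1 := normSq_antisymm_sum (fun j k => dbar k (β j) z)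
    have e2 : (T z).re = (‖∑ j, del Ψ j (β j) z‖ ^ 2
        - (∑ j, ∑ k, dbar k (β j) z * conj (dbar j (β k) z)).re
        - levi Ψ z (fun j => β j z)) * Real.exp (-Ψ z) := by
      rw [hTdef]
      simp only [← Finset.sum_mul, Finset.sum_sub_distrib, gw, Complex.re_mul_ofReal,
        Complex.sub_re, levi]
      congr 3
      rw [← Complex.normSq_eq_norm_sq, ← Complex.ofReal_re (Complex.normSq _), ← Complex.mul_conj,
        map_sum, Finset.sum_mul_sum]
    have e3 : 0 ≤ ∑ j, ∑ k, ‖dbar k (β j) z‖ ^ 2 := by positivity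
    rw [e2, hLdef, hMdef]
    have := mul_nonneg e3 (Real.exp_pos (-Ψ z)).le
    simp only
    rw [e1]
    nlinarith
  have hcont : ∀ j k s, Continuous (wd s k (β j)) := fun j k s => (hβ j).wd.continuous
  have hcdel : ∀ j, Continuous (del Ψ j (β j)) := fun j => (h.del (hβ j)).continuous
  have hclev : ∀ j k, Continuous (dd j (dbar k (cst Ψ))) := fun j k => h.cst.wd.wd.continuous
  have hcβ : ∀ j, Continuous (β j) := fun j => (hβ j).continuous
  have hcΨ : Continuous Ψ := h.continuous
  have hcL : Continuous L := by
    simp only [hLdef, levi]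
    fun_prop
  have hcM : Continuous M := by
    simp only [hMdef]
    fun_prop
  have hcT : Continuous T := by
    have := h.gw.continuous
    simp only [hTdef]
    fun_prop
  have hKc : IsCompact (⋃ j, tsupport (β j)) := isCompact_iUnion fun j => hc j
  have hz : ∀ z, z ∉ (⋃ j, tsupport (β j)) → ∀ j, (β j z = 0 ∧ ∀ s k, wd s k (β j) z = 0) := by
    intro z hz j
    have : z ∉ tsupport (β j) := fun h => hz (Set.mem_iUnion_of_mem j h)
    exact ⟨image_eq_zero_of_notMem_tsupport this, fun s k => wd_eq_zero_of_notMem this⟩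
  have iL : Integrable L := hcL.integrable_of_hasCompactSupport
    (HasCompactSupport.intro hKc fun z h => by simp [hLdef, levi, (hz z h _).1])
  have iM : Integrable M := hcM.integrable_of_hasCompactSupport
    (HasCompactSupport.intro hKc fun z h => by
      simp [hMdef, del, (hz z h _).1, fun j k => (hz z h j).2 Complex.I k,
        fun j k => (hz z h j).2 (-Complex.I) k])
  have iT : Integrable T := hcT.integrable_of_hasCompactSupport
    (HasCompactSupport.intro hKc fun z h => by
      simp [hTdef, del, (hz z h _).1, fun j k => (hz z h j).2 Complex.I k,
        fun j k => (hz z h j).2 (-Complex.I) k])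
  have hTre : ∫ z, (T z).re = 0 := by
    have := integral_re iT
    simp only [RCLike.re_eq_complex_re] at this
    rw [this, hT, Complex.zero_re]
  calc ∫ z, L z ≤ ∫ z, (M z - (T z).re) :=
        integral_mono iL (iM.sub iT.re) hle
    _ = _ := by
      have := integral_sub iM iT.re
      simp only [RCLike.re_eq_complex_re] at this
      rw [this, hTre, sub_zero]

/-! ### Convolutions -/

open scoped Convolution in
/-- Convolution of complex functions on `ℂⁿ`. -/
def cv (ρ f : Cn n → ℂ) : Cn n → ℂ := ρ ⋆[ContinuousLinearMap.mul ℝ ℂ, volume] f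

lemma cv_apply (ρ f : Cn n → ℂ) (z : Cn n) : cv ρ f z = ∫ t, ρ t * f (z - t) := rfl

lemma cv_swap (ρ f : Cn n → ℂ) (z : Cn n) : cv ρ f z = ∫ y, ρ (z - y) * f y := by
  rw [cv, convolution_eq_swap]; rfl

lemma cv_contDiff {ρ f : Cn n → ℂ} (hρ : ContDiff ℝ ∞ ρ) (hc : HasCompactSupport ρ)
    (hf : LocallyIntegrable f) : ContDiff ℝ ∞ (cv ρ f) :=
  hc.contDiff_convolution_left _ hρ hf

lemma cv_hasCompactSupport {ρ f : Cn n → ℂ} (hc : HasCompactSupport ρ)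
    (hf : HasCompactSupport f) : HasCompactSupport (cv ρ f) :=
  HasCompactSupport.convolution (μ := volume) (ContinuousLinearMap.mul ℝ ℂ) hc hf

lemma cv_integrable {ρ f : Cn n → ℂ} (hρ : Continuous ρ) (hc : HasCompactSupport ρ)
    (hf : LocallyIntegrable f) (z : Cn n) : Integrable fun t => ρ t * f (z - t) :=
  hc.convolutionExists_left (ContinuousLinearMap.mul ℝ ℂ) hρ hf z

lemma wd_cv {s : ℂ} {j : Fin n} {ρ f : Cn n → ℂ} (hρ : ContDiff ℝ ∞ ρ) (hc : HasCompactSupport ρ)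
    (hf : LocallyIntegrable f) (z : Cn n) : wd s j (cv ρ f) z = cv (wd s j ρ) f z := by
  have h1 := (hc.hasFDerivAt_convolution_left (ContinuousLinearMap.mul ℝ ℂ) (μ := volume)
    (hρ.of_le (by simp)) hf z).fderiv
  have h2 : ∀ v, fderiv ℝ (cv ρ f) z v = ∫ t, fderiv ℝ ρ t v * f (z - t) := by
    intro v
    rw [cv, h1]
    refine (ContinuousLinearMap.integral_apply ?_ v).trans ?_
    · exact (hc.fderiv (𝕜 := ℝ)).convolutionExists_left _ (hρ.continuous_fderiv (by simp)) hf z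
    · simp
  have hi : ∀ v, Integrable fun t => fderiv ℝ ρ t v * f (z - t) := fun v =>
    cv_integrable ((hρ.continuous_fderiv (by simp)).clm_apply continuous_const)
      ((hc.fderiv (𝕜 := ℝ)).mono fun z hz => by
        simp only [Function.mem_support] at hz ⊢
        contrapose! hz; simp [hz]) hf z
  rw [wd, h2, h2, cv_apply, ← integral_const_mul, ← integral_add (hi _) ((hi _).const_mul _),
    ← integral_const_mul]
  congr 1; funext t
  simp only [wd]; ring

lemma cv_comm {a b f : Cn n → ℂ} (ha : Continuous a) (hca : HasCompactSupport a)
    (hb : Continuous b) (hcb : HasCompactSupport b) (hf : LocallyIntegrable f) (z : Cn n) :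
    cv a (cv b f) z = cv b (cv a f) z := by
  have key : ∀ {a b : Cn n → ℂ}, Continuous a → HasCompactSupport a → Continuous b →
      HasCompactSupport b → cv (cv a b) f z = cv a (cv b f) z := by
    intro a b ha hca hb hcb
    refine convolution_assoc _ _ _ _ (fun x y z => mul_assoc x y z) ha.aestronglyMeasurable
      hb.aestronglyMeasurable hf.aestronglyMeasurable (ae_of_all _ fun y => ?_)
      (ae_of_all _ fun y => ?_) ?_
    · exact hca.convolutionExists_left _ ha hb.locallyIntegrable y
    · exact hcb.norm.convolutionExists_left _ hb.norm (fun x => (hf x).norm) y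
    · exact hca.norm.convolutionExists_left _ ha.norm
        (hcb.norm.continuous_convolution_left _ hb.norm (fun x => (hf x).norm)).locallyIntegrable z
  rw [← key ha hca hb hcb, ← key hb hcb ha hca]
  congr 1
  funext y
  rw [cv_swap, cv_apply]
  simp_rw [mul_comm]

/-! ### Averaging over the circle action -/

lemma measurePreserving_smul_circle {c : ℂ} (hc : ‖c‖ = 1) :
    MeasurePreserving (fun z : Cn n => c • z) volume volume := by
  have h : MeasurePreserving (fun w : ℂ => c • w) volume volume := by
    have := (rotation ⟨c, by simpa [Submonoid.unitSphere] using hc⟩).measurePreserving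
    exact this
  exact volume_preserving_pi (fun _ => h)

lemma integral_smul_circle {E : Type*} [NormedAddCommGroup E] [NormedSpace ℝ E]
    {c : ℂ} (hc : ‖c‖ = 1) (f : Cn n → E) : ∫ z, f (c • z) = ∫ z, f z := by
  have hc0 : c ≠ 0 := by rintro rfl; simp at hc
  exact (measurePreserving_smul_circle hc).integral_comp
    (Homeomorph.smulOfNeZero c hc0).measurableEmbedding f

lemma integral_circleAverage {E : Type*} [NormedAddCommGroup E] [NormedSpace ℝ E]
    [CompleteSpace E] [MeasurableSpace E] [BorelSpace E] [SecondCountableTopology E]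
    {p : Cn n → ℝ} {f : Cn n → E} {R : ℝ} (hp : Integrable p)
    (hinv : ∀ c : ℂ, ‖c‖ = 1 → ∀ z, p (c • z) = p z) (hs : ∀ z, R < ‖z‖ → p z = 0)
    (hf : ContinuousOn f (Metric.closedBall 0 R)) :
    ∫ z, p z • f z = ∫ z, p z • Real.circleAverage (fun ζ : ℂ => f (ζ • z)) 0 1 := by
  classical
  set g : Cn n → E := (Metric.closedBall 0 R).piecewise f 0 with hg
  have hgm : Measurable g := by
    refine hf.measurable_piecewise continuous_const.continuousOn
      Metric.isClosed_closedBall.measurableSet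
  obtain ⟨M, hM⟩ := (isCompact_closedBall (0 : Cn n) R).exists_bound_of_continuousOn hf
  have hgM : ∀ z, ‖g z‖ ≤ max M 0 := by
    intro z
    by_cases h : z ∈ Metric.closedBall (0 : Cn n) R
    · simp [hg, h, hM z h]
    · simp [hg, h]
  have hnorm : ∀ θ, ‖circleMap 0 1 θ‖ = 1 := fun θ => by simp
  have hpg : ∀ c : ℂ, ‖c‖ = 1 → ∀ z, p z • f (c • z) = p z • g (c • z) := by
    intro c hc z
    by_cases h : ‖z‖ ≤ R
    · have : c • z ∈ Metric.closedBall (0 : Cn n) R := by simpa [norm_smul, hc] using h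
      simp [hg, this]
    · rw [hs z (not_le.1 h)]; simp
  have h1 : ∀ θ, ∫ z, p z • g (circleMap 0 1 θ • z) = ∫ z, p z • f z := by
    intro θ
    rw [← integral_smul_circle (hnorm θ) (fun z => p z • f z)]
    congr 1; funext z
    rw [hinv _ (hnorm θ), hpg _ (hnorm θ)]
  have hinteg : Integrable (Function.uncurry fun (θ : ℝ) (z : Cn n) => p z • g (circleMap 0 1 θ • z))
      ((volume.restrict (Set.uIoc 0 (2 * Real.pi))).prod volume) := by
    have hpi : Integrable (fun q : ℝ × Cn n => p q.2)
        ((volume.restrict (Set.uIoc 0 (2 * Real.pi))).prod volume) := by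
      have : IsFiniteMeasure (volume.restrict (Set.uIoc 0 (2 * Real.pi))) := by
        rw [Set.uIoc]; infer_instance
      exact hp.comp_snd _
    refine hpi.smul_bdd (max M 0) ?_ (ae_of_all _ fun q => hgM _)
    refine (hgm.comp ?_).aestronglyMeasurable
    exact (((continuous_circleMap 0 1).comp continuous_fst).smul continuous_snd).measurable
  have h2 := intervalIntegral_integral_swap (μ := volume) hinteg
  simp_rw [h1] at h2
  simp only [Real.circleAverage_def]
  have h3 : ∀ z, p z • (2 * Real.pi)⁻¹ • ∫ θ in (0:ℝ)..2 * Real.pi, f (circleMap 0 1 θ • z)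
      = (2 * Real.pi)⁻¹ • ∫ θ in (0:ℝ)..2 * Real.pi, p z • g (circleMap 0 1 θ • z) := by
    intro z
    rw [smul_comm, ← intervalIntegral.integral_smul]
    simp_rw [hpg _ (hnorm _)]
  simp_rw [h3]
  rw [integral_smul, ← h2, intervalIntegral.integral_const, smul_smul, sub_zero,
    inv_mul_cancel₀ (by positivity), one_smul]

lemma integral_mul_of_holo {p : Cn n → ℝ} {f : Cn n → ℂ} {R R' : ℝ} (hp : Integrable p)
    (hinv : ∀ c : ℂ, ‖c‖ = 1 → ∀ z, p (c • z) = p z) (hs : ∀ z, R < ‖z‖ → p z = 0)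
    (hR : R < R') (hf : DifferentiableOn ℂ f (Metric.ball 0 R')) :
    ∫ z, (p z : ℂ) * f z = (∫ z, p z : ℝ) * f 0 := by
  have h := integral_circleAverage (f := f) hp hinv hs
    (hf.continuousOn.mono (Metric.closedBall_subset_ball hR))
  have h0 : ∀ z, p z • Real.circleAverage (fun ζ : ℂ => f (ζ • z)) 0 1 = p z • f 0 := by
    intro z
    by_cases hz : ‖z‖ ≤ R
    · congr 1
      have : DiffContOnCl ℂ (fun ζ : ℂ => f (ζ • z)) (Metric.ball 0 |1|) := by
        have hm : ∀ ζ ∈ Metric.closedBall (0:ℂ) |1|, ζ • z ∈ Metric.ball (0 : Cn n) R' := by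
          intro ζ hζ
          simp only [abs_one, Metric.mem_closedBall, dist_zero_right, Metric.mem_ball,
            norm_smul] at hζ ⊢
          nlinarith [norm_nonneg z, norm_nonneg ζ]
        have hd : DifferentiableOn ℂ (fun ζ : ℂ => f (ζ • z)) (Metric.closedBall 0 |1|) :=
          hf.comp (differentiable_id.smul_const z).differentiableOn hm
        exact DifferentiableOn.diffContOnCl (hd.mono Metric.closure_ball_subset_closedBall)
      rw [this.circleAverage]; simp
    · rw [hs z (not_le.1 hz)]; simp
  simp_rw [h0] at h
  rw [integral_smul_const] at h
  simpa using h

/-! ### The Cauchy–Riemann equations -/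

lemma sum_smul_eb (v : Cn n) : v = ∑ j, v j • eb j := by
  funext k
  simp [eb, Finset.sum_apply, Pi.single_apply]

lemma differentiableAt_of_dbar_eq_zero {f : Cn n → ℂ} {z : Cn n} (hf : DifferentiableAt ℝ f z)
    (h : ∀ j, dbar j f z = 0) : DifferentiableAt ℂ f z := by
  rw [differentiableAt_iff_restrictScalars ℝ hf]
  set L := fderiv ℝ f z with hL
  refine ⟨∑ j, (ContinuousLinearMap.proj (R := ℂ) (φ := fun _ : Fin n => ℂ) j).smulRight
    (L (eb j)), ?_⟩
  ext v
  have hI : ∀ j, L (Complex.I • eb j) = Complex.I * L (eb j) := by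
    intro j
    have := h j
    simp only [wd, ← hL] at this
    have h2 : L (eb j) + Complex.I * L (Complex.I • eb j) = 0 := by
      simpa using this
    linear_combination (-Complex.I) * h2 + L (Complex.I • eb j) * Complex.I_mul_I
  have hj : ∀ j, L (v j • eb j) = v j * L (eb j) := by
    intro j
    have e : v j • (eb j : Cn n) = (v j).re • eb j + (v j).im • (Complex.I • eb j) := by
      conv_lhs => rw [← Complex.re_add_im (v j)]
      rw [add_smul, mul_smul, Complex.coe_smul, Complex.coe_smul]
    rw [e, map_add, map_smul, map_smul, hI]
    conv_rhs => rw [← Complex.re_add_im (v j)]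
    simp only [Complex.real_smul]; ring
  conv_rhs => rw [sum_smul_eb v, map_sum]
  simp [hj]

lemma dbar_eq_zero_of_differentiableAt {f : Cn n → ℂ} {z : Cn n} (hf : DifferentiableAt ℂ f z)
    (j : Fin n) : dbar j f z = 0 := by
  rw [wd, hf.fderiv_restrictScalars ℝ]
  simp only [ContinuousLinearMap.coe_restrictScalars', map_smul, smul_eq_mul]
  linear_combination (1 / 2 : ℂ) * fderiv ℂ f z (eb j) * Complex.I_mul_I

lemma wd_comp_const_sub {s : ℂ} {j : Fin n} {ρ : Cn n → ℂ} (h : ContDiff ℝ ∞ ρ) (z y : Cn n) :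
    wd s j (fun y => ρ (z - y)) y = - wd s j ρ (z - y) := by
  have : HasFDerivAt (fun y => ρ (z - y)) (-fderiv ℝ ρ (z - y)) y := by
    have h1 := (h.dAt (z - y)).hasFDerivAt.comp y ((hasFDerivAt_id y).const_sub z)
    rw [ContinuousLinearMap.comp_neg, ContinuousLinearMap.comp_id] at h1
    exact h1
  rw [wd, this.fderiv, wd]
  simp only [neg_apply]; ring

/-! ### A circle-invariant mollifier -/

/-- An unnormalized circle-invariant bump function. -/
def eta (z : Cn n) : ℝ := expNegInvGlue (1 - ∑ j, ‖z j‖ ^ 2)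

/-- A circle-invariant mollifier supported in the closed ball of radius `ε`. -/
def rho (ε : ℝ) (z : Cn n) : ℝ := (∫ y : Cn n, eta (ε⁻¹ • y))⁻¹ * eta (ε⁻¹ • z)

lemma contDiff_sum_sq : ContDiff ℝ ∞ fun z : Cn n => ∑ j, ‖z j‖ ^ 2 :=
  ContDiff.sum fun j _ => (contDiff_apply ℝ ℂ j).norm_sq ℝ

lemma contDiff_eta : ContDiff ℝ ∞ (eta : Cn n → ℝ) :=
  (expNegInvGlue.contDiff (n := (⊤ : ℕ∞))).comp (contDiff_const.sub contDiff_sum_sq)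

lemma eta_eq_zero {z : Cn n} (h : 1 < ‖z‖) : eta z = 0 := by
  refine expNegInvGlue.zero_of_nonpos ?_
  have : ∃ j, 1 < ‖z j‖ := by
    by_contra! h'
    exact absurd ((pi_norm_le_iff_of_nonneg zero_le_one).2 h') (not_le.2 h)
  obtain ⟨j, hj⟩ := this
  have := Finset.single_le_sum (f := fun j => ‖z j‖ ^ 2) (fun i _ => by positivity)
    (Finset.mem_univ j)
  have h2 : (1 : ℝ) ≤ ‖z j‖ ^ 2 := by nlinarith
  linarith

section
variable {ε : ℝ}

lemma rho_eq_zero (hε : 0 < ε) {z : Cn n} (h : ε < ‖z‖) : rho ε z = 0 := by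
  rw [rho, eta_eq_zero, mul_zero]
  rw [norm_smul, norm_inv, Real.norm_of_nonneg hε.le, ← div_eq_inv_mul]
  exact (one_lt_div hε).2 h

lemma contDiff_rho (ε : ℝ) : ContDiff ℝ ∞ (rho ε : Cn n → ℝ) :=
  contDiff_const.mul (contDiff_eta.comp (contDiff_const_smul _))

lemma hasCompactSupport_rho (hε : 0 < ε) : HasCompactSupport (rho ε : Cn n → ℝ) :=
  HasCompactSupport.of_support_subset_isCompact (isCompact_closedBall (0 : Cn n) ε) fun z hz => by
    by_contra h
    exact hz (rho_eq_zero hε (by simpa using h))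

lemma rho_nonneg (ε : ℝ) (z : Cn n) : 0 ≤ rho ε z :=
  mul_nonneg (inv_nonneg.2 (integral_nonneg fun _ => expNegInvGlue.nonneg _))
    (expNegInvGlue.nonneg _)

lemma rho_smul (ε : ℝ) {c : ℂ} (hc : ‖c‖ = 1) (z : Cn n) : rho ε (c • z) = rho ε z := by
  simp [rho, eta, hc]

lemma integrable_rho (hε : 0 < ε) : Integrable (rho ε : Cn n → ℝ) :=
  (contDiff_rho ε).continuous.integrable_of_hasCompactSupport (hasCompactSupport_rho hε)

lemma integral_rho (hε : 0 < ε) : ∫ z : Cn n, rho ε z = 1 := by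
  simp only [rho]
  rw [integral_const_mul]
  refine inv_mul_cancel₀ (ne_of_gt ?_)
  have hc : Continuous fun z : Cn n => eta (ε⁻¹ • z) :=
    (contDiff_eta (n := n)).continuous.comp (continuous_const_smul _)
  refine hc.integral_pos_of_hasCompactSupport_nonneg_nonzero ?_
    (fun _ => expNegInvGlue.nonneg _) (x := 0) ?_
  · refine HasCompactSupport.of_support_subset_isCompact
      (isCompact_closedBall (0 : Cn n) ε) fun z hz => ?_
    by_contra h
    refine hz (eta_eq_zero ?_)
    rw [norm_smul, norm_inv, Real.norm_of_nonneg hε.le, ← div_eq_inv_mul]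
    exact (one_lt_div hε).2 (by simpa using h)
  · simp only [smul_zero, eta]
    exact (expNegInvGlue.pos_of_pos (by simp)).ne'

end

lemma contDiff_crho (ε : ℝ) : ContDiff ℝ ∞ (cst (rho ε : Cn n → ℝ)) := (contDiff_rho ε).cst

lemma hasCompactSupport_crho {ε : ℝ} (hε : 0 < ε) : HasCompactSupport (cst (rho ε : Cn n → ℝ)) :=
  (hasCompactSupport_rho hε).comp_left (g := fun x : ℝ => (x : ℂ)) (by simp)

/-- The mean value property for mollification of holomorphic functions. -/
lemma cv_rho_of_holo {ε R : ℝ} (hε : 0 < ε) (hR : ε < R) {f : Cn n → ℂ} {z : Cn n}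
    (hf : DifferentiableOn ℂ f (Metric.ball z R)) : cv (cst (rho ε)) f z = f z := by
  have := integral_mul_of_holo (p := rho ε) (f := fun t => f (z - t)) (R' := R) (integrable_rho hε)
    (fun c hc z => rho_smul ε hc z) (fun z h => rho_eq_zero hε h) hR
    (hf.comp (differentiable_id.const_sub z).differentiableOn (fun t ht => by
      simpa [dist_eq_norm] using ht))
  rw [cv_apply, this, integral_rho hε]
  simp

/-- A mollification of a weakly holomorphic function is holomorphic. -/
lemma differentiable_cv_of_weak {f ρ : Cn n → ℂ} (hf : LocallyIntegrable f)
    (hw : ∀ (j : Fin n) (χ : Cn n → ℂ), ContDiff ℝ ∞ χ → HasCompactSupport χ →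
      ∫ z, f z * dbar j χ z = 0) (hρ : ContDiff ℝ ∞ ρ) (hc : HasCompactSupport ρ) :
    Differentiable ℂ (cv ρ f) := by
  intro z
  refine differentiableAt_of_dbar_eq_zero ((cv_contDiff hρ hc hf).dAt z) fun j => ?_
  rw [wd_cv hρ hc hf, cv_swap]
  have h1 : ContDiff ℝ ∞ fun y => ρ (z - y) := hρ.comp (contDiff_const.sub contDiff_id)
  have h2 : HasCompactSupport fun y => ρ (z - y) :=
    hc.comp_homeomorph (Homeomorph.subLeft z)
  have := hw j _ h1 h2
  simp_rw [wd_comp_const_sub hρ] at this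
  rw [← neg_eq_zero, ← integral_neg, ← this]
  congr 1; funext y; ring

/-- Weyl's lemma. -/
lemma exists_holo_of_weak {f : Cn n → ℂ} (hf : LocallyIntegrable f)
    (hw : ∀ (j : Fin n) (χ : Cn n → ℂ), ContDiff ℝ ∞ χ → HasCompactSupport χ →
      ∫ z, f z * dbar j χ z = 0) :
    ∃ F : Cn n → ℂ, Differentiable ℂ F ∧ f =ᵐ[volume] F := by
  have hr : ContDiff ℝ ∞ (cst (rho 1 : Cn n → ℝ)) := contDiff_crho 1
  have hrc : HasCompactSupport (cst (rho 1 : Cn n → ℝ)) := hasCompactSupport_crho one_pos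
  refine ⟨cv (cst (rho 1)) f, differentiable_cv_of_weak hf hw hr hrc, ?_⟩
  set F := cv (cst (rho 1)) f with hF
  let b : ℕ → ContDiffBump (0 : Cn n) := fun k =>
    ⟨1 / (k + 1) / 2, 1 / (k + 1), by positivity, half_lt_self (by positivity)⟩
  set nb : ℕ → Cn n → ℝ := fun k => (b k).normed volume with hnb
  have hb : ∀ k, ContDiff ℝ ∞ (cst (nb k)) := fun k => (b k).contDiff_normed.cst
  have hbc : ∀ k, HasCompactSupport (cst (nb k)) := fun k =>
    (b k).hasCompactSupport_normed.comp_left (g := fun x : ℝ => (x : ℂ)) (by simp)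
  have hconv : ∀ (k : ℕ) (g : Cn n → ℂ) (z : Cn n), cv (cst (nb k)) g z
      = (convolution (nb k) g (ContinuousLinearMap.lsmul ℝ ℝ) volume : Cn n → ℂ) z := by
    intro k g z; rw [cv_apply, convolution_def]; simp
  have hR : Tendsto (fun k => (b k).rOut) atTop (𝓝 0) := by
    simpa [b] using tendsto_one_div_add_atTop_nhds_zero_nat (𝕜 := ℝ)
  have hae := ContDiffBump.ae_convolution_tendsto_right_of_locallyIntegrable (K := 2) (φ := b)
    (g := f) hR (Eventually.of_forall fun k => by simp only [b]; linarith) hf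
  filter_upwards [hae] with z hz
  have h2 := ContDiffBump.convolution_tendsto_right_of_continuous (φ := b) (g := F) (μ := volume) hR
    (differentiable_cv_of_weak hf hw hr hrc).continuous z
  refine tendsto_nhds_unique hz (h2.congr fun k => ?_)
  rw [← hconv k F, ← hconv k f, hF, cv_comm (hb k).continuous (hbc k) hr.continuous hrc hf]
  exact cv_rho_of_holo (R := 2) one_pos (by norm_num)
    (differentiable_cv_of_weak hf hw (hb k) (hbc k)).differentiableOn

/-! ### Mollification in `L²` -/

lemma sq_lintegral_mul_le {α : Type*} [MeasurableSpace α] {μ : Measure α} {ρ h : α → ℝ≥0∞}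
    (hρ : AEMeasurable ρ μ) (hh : AEMeasurable h μ) :
    (∫⁻ x, ρ x * h x ∂μ) ^ 2 ≤ (∫⁻ x, ρ x ∂μ) * ∫⁻ x, ρ x * h x ^ 2 ∂μ := by
  have h1 := ENNReal.lintegral_mul_le_Lp_mul_Lq μ Real.HolderConjugate.two_two
    (hρ.pow_const (1 / 2 : ℝ)) ((hρ.pow_const (1 / 2 : ℝ)).mul hh)
  have e1 : ∀ x, ((fun x => ρ x ^ (1 / 2 : ℝ)) * ((fun x => ρ x ^ (1 / 2 : ℝ)) * h)) x
      = ρ x * h x := by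
    intro x
    simp only [Pi.mul_apply]
    rw [← mul_assoc, ← ENNReal.rpow_add_of_nonneg _ _ (by norm_num) (by norm_num)]
    norm_num
  have e2 : ∀ x, (ρ x ^ (1 / 2 : ℝ)) ^ (2 : ℝ) = ρ x := by
    intro x; rw [← ENNReal.rpow_mul]; norm_num
  simp only [e1] at h1
  simp only [Pi.mul_apply, ENNReal.mul_rpow_of_nonneg _ _ (zero_le_two : (0:ℝ) ≤ 2), e2,
    ENNReal.rpow_two] at h1
  calc (∫⁻ x, ρ x * h x ∂μ) ^ 2
      ≤ ((∫⁻ x, ρ x ∂μ) ^ (1 / 2 : ℝ) * (∫⁻ x, ρ x * h x ^ 2 ∂μ) ^ (1 / 2 : ℝ)) ^ 2 := by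
        gcongr
    _ = _ := by
        rw [mul_pow, ← ENNReal.rpow_two, ← ENNReal.rpow_two, ← ENNReal.rpow_mul,
          ← ENNReal.rpow_mul]
        norm_num

lemma lintegral_rho {ε : ℝ} (hε : 0 < ε) : ∫⁻ z : Cn n, ENNReal.ofReal (rho ε z) = 1 := by
  rw [← ofReal_integral_eq_lintegral_ofReal (integrable_rho hε) (ae_of_all _ (rho_nonneg ε)),
    integral_rho hε, ENNReal.ofReal_one]

lemma enorm_cv_rho_sq_le {ε : ℝ} (hε : 0 < ε) {f : Cn n → ℂ} (hf : AEStronglyMeasurable f)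
    (z : Cn n) : ‖cv (cst (rho ε)) f z‖ₑ ^ 2
      ≤ ∫⁻ t, ENNReal.ofReal (rho ε t) * ‖f (z - t)‖ₑ ^ 2 := by
  have hr : AEMeasurable (fun t : Cn n => ENNReal.ofReal (rho ε t)) :=
    (contDiff_rho ε).continuous.measurable.ennreal_ofReal.aemeasurable
  have h1 : ‖cv (cst (rho ε)) f z‖ₑ ≤ ∫⁻ t, ENNReal.ofReal (rho ε t) * ‖f (z - t)‖ₑ := by
    rw [cv_apply]
    refine (enorm_integral_le_lintegral_enorm _).trans (le_of_eq ?_)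
    congr 1; funext t
    rw [enorm_mul]
    congr 1
    rw [← ofReal_norm, Complex.norm_real, Real.norm_of_nonneg (rho_nonneg ε t)]
  have hm : AEMeasurable (fun t => ‖f (z - t)‖ₑ) :=
    (hf.comp_measurePreserving (Measure.measurePreserving_sub_left volume z)).enorm
  calc _ ≤ (∫⁻ t, ENNReal.ofReal (rho ε t) * ‖f (z - t)‖ₑ) ^ 2 := by gcongr
    _ ≤ _ := sq_lintegral_mul_le hr hm
    _ = _ := by rw [lintegral_rho hε, one_mul]

lemma lintegral_enorm_cv_rho_le {ε : ℝ} (hε : 0 < ε) {f : Cn n → ℂ}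
    (hf : AEStronglyMeasurable f) :
    ∫⁻ z, ‖cv (cst (rho ε)) f z‖ₑ ^ 2 ≤ ∫⁻ z, ‖f z‖ₑ ^ 2 := by
  calc ∫⁻ z, ‖cv (cst (rho ε)) f z‖ₑ ^ 2
      ≤ ∫⁻ z, ∫⁻ t, ENNReal.ofReal (rho ε t) * ‖f (z - t)‖ₑ ^ 2 :=
        lintegral_mono fun z => enorm_cv_rho_sq_le hε hf z
    _ = ∫⁻ t, ∫⁻ z, ENNReal.ofReal (rho ε t) * ‖f (z - t)‖ₑ ^ 2 := by
        refine lintegral_lintegral_swap ?_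
        have h1 : AEMeasurable (fun q : Cn n × Cn n => ENNReal.ofReal (rho ε q.2))
            (volume.prod volume) := ((contDiff_rho ε).continuous.measurable.comp
            measurable_snd).ennreal_ofReal.aemeasurable
        have h2 : AEMeasurable (fun q : Cn n × Cn n => ‖f (q.1 - q.2)‖ₑ ^ 2)
            (volume.prod volume) := (hf.comp_quasiMeasurePreserving
              (quasiMeasurePreserving_sub (G := Cn n) volume volume)).enorm.pow_const 2
        exact h1.mul h2
    _ = ∫⁻ t, ENNReal.ofReal (rho ε t) * ∫⁻ z, ‖f z‖ₑ ^ 2 := by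
        congr 1; funext t
        rw [lintegral_const_mul' _ _ ENNReal.ofReal_ne_top]
        congr 1
        exact lintegral_sub_right_eq_self (fun z => ‖f z‖ₑ ^ 2) t
    _ = ∫⁻ z, ‖f z‖ₑ ^ 2 := by
        rw [lintegral_mul_const _ (contDiff_rho ε).continuous.measurable.ennreal_ofReal,
          lintegral_rho hε, one_mul]

lemma eLpNorm_two_sq {f : Cn n → ℂ} : eLpNorm f 2 volume ^ 2 = ∫⁻ z, ‖f z‖ₑ ^ 2 := by
  rw [eLpNorm_eq_lintegral_rpow_enorm_toReal (by norm_num) (by norm_num)]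
  simp only [ENNReal.toReal_ofNat, ENNReal.rpow_two]
  rw [← ENNReal.rpow_two, ← ENNReal.rpow_mul]; norm_num

lemma eLpNorm_cv_rho_le {ε : ℝ} (hε : 0 < ε) {f : Cn n → ℂ}
    (hf : AEStronglyMeasurable f) :
    eLpNorm (cv (cst (rho ε)) f) 2 volume ≤ eLpNorm f 2 volume := by
  rw [← ENNReal.pow_le_pow_left_iff two_ne_zero, eLpNorm_two_sq, eLpNorm_two_sq]
  exact lintegral_enorm_cv_rho_le hε hf

lemma cv_rho_sub {ε : ℝ} (hε : 0 < ε) {f g : Cn n → ℂ} (hf : LocallyIntegrable f)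
    (hg : LocallyIntegrable g) :
    cv (cst (rho ε)) (f - g) = cv (cst (rho ε)) f - cv (cst (rho ε)) g := by
  funext z
  have hc := (contDiff_crho (n := n) ε).continuous
  simp only [Pi.sub_apply, cv_apply]
  rw [← integral_sub (cv_integrable hc (hasCompactSupport_crho hε) hf z)
    (cv_integrable hc (hasCompactSupport_crho hε) hg z)]
  congr 1; funext t; ring

lemma norm_cv_rho_sub_le {ε δ : ℝ} (hε : 0 < ε) {f : Cn n → ℂ} (hf : LocallyIntegrable f)
    {z : Cn n} (h : ∀ t : Cn n, ‖t‖ ≤ ε → ‖f (z - t) - f z‖ ≤ δ) :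
    ‖cv (cst (rho ε)) f z - f z‖ ≤ δ := by
  have hc := (contDiff_crho (n := n) ε).continuous
  have hi : Integrable fun t => (rho ε t : ℂ) * f (z - t) :=
    cv_integrable hc (hasCompactSupport_crho hε) hf z
  have hi' : Integrable fun t : Cn n => (rho ε t : ℂ) * f z :=
    (integrable_rho hε).ofReal.mul_const _
  have e : cv (cst (rho ε)) f z - f z = ∫ t, (rho ε t : ℂ) * (f (z - t) - f z) := by
    simp_rw [mul_sub]
    rw [integral_sub hi hi', integral_mul_const,
      integral_complex_ofReal, integral_rho hε, cv_apply]
    simp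
  rw [e]
  calc _ ≤ ∫ t, rho ε t * δ := by
        refine norm_integral_le_of_norm_le ((integrable_rho hε).mul_const δ)
          (ae_of_all _ fun t => ?_)
        rw [norm_mul, Complex.norm_real, Real.norm_of_nonneg (rho_nonneg ε t)]
        by_cases ht : ‖t‖ ≤ ε
        · exact mul_le_mul_of_nonneg_left (h t ht) (rho_nonneg ε t)
        · rw [rho_eq_zero hε (not_le.1 ht)]; simp
    _ = δ := by rw [integral_mul_const, integral_rho hε, one_mul]

lemma tendsto_eLpNorm_cv_rho {f : Cn n → ℂ} (hf : MemLp f 2 volume) :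
    Tendsto (fun k : ℕ => eLpNorm (cv (cst (rho (1 / (k + 1 : ℝ)))) f - f) 2 volume)
      atTop (𝓝 0) := by
  have hpos : ∀ k : ℕ, (0 : ℝ) < 1 / (k + 1 : ℝ) := fun k => by positivity
  rw [ENNReal.tendsto_nhds_zero]
  intro δ hδ
  obtain ⟨δ', hδ', hδδ⟩ : ∃ δ' : ℝ≥0∞, 0 < δ' ∧ 3 * δ' ≤ δ := by
    refine ⟨δ / 3, ENNReal.div_pos hδ.ne' (by norm_num), ?_⟩
    rw [ENNReal.mul_div_cancel (by norm_num) (by norm_num)]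
  obtain ⟨g, hgc, hg1, hg2, hg3⟩ := hf.exists_hasCompactSupport_eLpNorm_sub_le
    (by norm_num) hδ'.ne'
  have hfl : LocallyIntegrable f := hf.locallyIntegrable (by norm_num)
  have hgl : LocallyIntegrable g := hg2.locallyIntegrable
  have hunif : UniformContinuous g := hgc.uniformContinuous_of_continuous hg2
  obtain ⟨R, hR⟩ := hgc.isBounded.subset_closedBall (0 : Cn n)
  set V := volume (Metric.closedBall (0 : Cn n) (R + 1)) with hV
  have hVt : V ≠ ⊤ := (isCompact_closedBall _ _).measure_lt_top.ne
  obtain ⟨κ, hκ, hκδ⟩ : ∃ κ : ℝ, 0 < κ ∧ V ^ (1 / 2 : ℝ) * ENNReal.ofReal κ ≤ δ' := by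
    have hV2 : V ^ (1 / 2 : ℝ) ≠ ⊤ := (ENNReal.rpow_lt_top_of_nonneg (by norm_num) hVt).ne
    have : Tendsto (fun κ : ℝ => V ^ (1 / 2 : ℝ) * ENNReal.ofReal κ) (𝓝[>] 0) (𝓝 0) := by
      have h0 : Tendsto (fun κ : ℝ => ENNReal.ofReal κ) (𝓝[>] 0) (𝓝 0) := by
        have := (ENNReal.continuous_ofReal.tendsto 0).mono_left
          (nhdsWithin_le_nhds (s := Set.Ioi (0:ℝ)))
        simpa using this
      simpa using ENNReal.Tendsto.const_mul h0 (Or.inr hV2)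
    obtain ⟨κ, h1, h2⟩ := ((ENNReal.tendsto_nhds_zero.1 this δ' hδ').and
      self_mem_nhdsWithin).exists
    exact ⟨κ, h2, h1⟩
  obtain ⟨r, hr, hrg⟩ := Metric.uniformContinuous_iff.1 hunif κ hκ
  have hev : ∀ᶠ k : ℕ in atTop, 1 / (k + 1 : ℝ) < r :=
    tendsto_one_div_add_atTop_nhds_zero_nat.eventually (gt_mem_nhds hr)
  filter_upwards [hev] with k hk
  set ε := 1 / (k + 1 : ℝ) with hεd
  have hε : 0 < ε := hpos k
  have hε1 : ε ≤ 1 := by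
    rw [hεd]; exact (div_le_one (by positivity)).2 (by linarith [(Nat.cast_nonneg k : (0:ℝ) ≤ k)])
  have hgε : eLpNorm (cv (cst (rho ε)) g - g) 2 volume ≤ δ' := by
    have hb : ∀ z, ‖(cv (cst (rho ε)) g - g) z‖ ≤ κ := fun z =>
      norm_cv_rho_sub_le hε hgl fun t ht => by
        rw [← dist_eq_norm]
        refine (hrg ?_).le
        rw [dist_eq_norm]; simpa using ht.trans_lt hk
    have hz : ∀ z, z ∉ Metric.closedBall (0 : Cn n) (R + 1) → (cv (cst (rho ε)) g - g) z = 0 := by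
      intro z hz
      have hz' : R + 1 < ‖z‖ := by simpa using hz
      have h0 : ∀ t : Cn n, ‖t‖ ≤ ε → g (z - t) = 0 := by
        intro t ht
        refine image_eq_zero_of_notMem_tsupport fun h => ?_
        have := hR h
        simp only [Metric.mem_closedBall, dist_zero_right] at this
        have h3 := norm_sub_norm_le z t
        linarith
      have : ‖(cv (cst (rho ε)) g - g) z‖ ≤ 0 := norm_cv_rho_sub_le hε hgl fun t ht => by
        rw [h0 t ht]; have := h0 0 (by simpa using hε.le); simp at this; simp [this]
      simpa using this
    have : cv (cst (rho ε)) g - g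
        = (Metric.closedBall (0 : Cn n) (R + 1)).indicator (cv (cst (rho ε)) g - g) := by
      funext z
      by_cases h : z ∈ Metric.closedBall (0 : Cn n) (R + 1)
      · simp [h]
      · rw [hz z h, Set.indicator_of_notMem h]
    rw [this, eLpNorm_indicator_eq_eLpNorm_restrict Metric.isClosed_closedBall.measurableSet]
    refine (eLpNorm_le_of_ae_bound (ae_of_all _ hb)).trans ?_
    simpa [hV] using hκδ
  have hdec : cv (cst (rho ε)) f - f
      = cv (cst (rho ε)) (f - g) + (cv (cst (rho ε)) g - g) + (g - f) := by
    rw [cv_rho_sub hε hfl hgl]; abel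
  have hcvm : ∀ {h : Cn n → ℂ}, LocallyIntegrable h →
      AEStronglyMeasurable (cv (cst (rho ε)) h) volume := fun hh =>
    (cv_contDiff (contDiff_crho ε) (hasCompactSupport_crho hε) hh).continuous.aestronglyMeasurable
  have hfg := hfl.aestronglyMeasurable.sub hgl.aestronglyMeasurable
  rw [hdec]
  calc _ ≤ eLpNorm (cv (cst (rho ε)) (f - g) + (cv (cst (rho ε)) g - g)) 2 volume
        + eLpNorm (g - f) 2 volume :=
        eLpNorm_add_le ((hcvm (hfl.sub hgl)).add ((hcvm hgl).sub hgl.aestronglyMeasurable))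
          (hgl.aestronglyMeasurable.sub hfl.aestronglyMeasurable) (by norm_num)
    _ ≤ (eLpNorm (cv (cst (rho ε)) (f - g)) 2 volume + eLpNorm (cv (cst (rho ε)) g - g) 2 volume)
        + eLpNorm (g - f) 2 volume := by
        gcongr
        exact eLpNorm_add_le (hcvm (hfl.sub hgl)) ((hcvm hgl).sub hgl.aestronglyMeasurable)
          (by norm_num)
    _ ≤ (δ' + δ') + δ' := by
        gcongr
        · exact (eLpNorm_cv_rho_le hε hfg).trans hg1
        · rw [eLpNorm_sub_comm]; exact hg1
    _ = 3 * δ' := by ring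
    _ ≤ δ := hδδ

/-! ### Convergence in `L²` -/

/-- Convergence of a sequence of functions in `L²`. -/
structure L2T (q : ℕ → Cn n → ℂ) (f : Cn n → ℂ) : Prop where
  memk : ∀ k, MemLp (q k) 2 volume
  mem : MemLp f 2 volume
  lim : Tendsto (fun k => eLpNorm (q k - f) 2 volume) atTop (𝓝 0)

namespace L2T

variable {q r : ℕ → Cn n → ℂ} {f g : Cn n → ℂ}

lemma add (h : L2T q f) (h' : L2T r g) :
    L2T (fun k z => q k z + r k z) (fun z => f z + g z) where
  memk k := (h.memk k).add (h'.memk k)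
  mem := h.mem.add h'.mem
  lim := by
    have := h.lim.add h'.lim
    rw [add_zero] at this
    refine tendsto_of_tendsto_of_tendsto_of_le_of_le tendsto_const_nhds this
      (fun _ => zero_le) fun k => ?_
    have e : ((fun z => q k z + r k z) - fun z => f z + g z) = (q k - f) + (r k - g) := by
      funext z; simp only [Pi.sub_apply, Pi.add_apply]; ring
    rw [e]
    exact eLpNorm_add_le ((h.memk k).sub h.mem).1 ((h'.memk k).sub h'.mem).1 (by norm_num)

lemma mul_bdd {c : Cn n → ℂ} {M : ℝ} (h : L2T q f) (hc : AEStronglyMeasurable c volume)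
    (hM : ∀ z, ‖c z‖ ≤ M) : L2T (fun k z => c z * q k z) (fun z => c z * f z) where
  memk k := (h.memk k).of_le_mul (c := M) (hc.mul (h.memk k).1) (ae_of_all _ fun z => by
    rw [norm_mul]; gcongr; exact hM z)
  mem := h.mem.of_le_mul (c := M) (hc.mul h.mem.1) (ae_of_all _ fun z => by
    rw [norm_mul]; gcongr; exact hM z)
  lim := by
    have := ENNReal.Tendsto.const_mul h.lim (Or.inr (ENNReal.ofReal_ne_top (r := M)))
    rw [mul_zero] at this
    refine tendsto_of_tendsto_of_tendsto_of_le_of_le tendsto_const_nhds this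
      (fun _ => zero_le) fun k => ?_
    refine eLpNorm_le_mul_eLpNorm_of_ae_le_mul (ae_of_all _ fun z => ?_) 2
    simp only [Pi.sub_apply]
    rw [← mul_sub, norm_mul]; gcongr; exact hM z

lemma zero : L2T (fun _ _ => 0) (fun _ : Cn n => 0) where
  memk _ := MemLp.zero'
  mem := MemLp.zero'
  lim := by
    have e : ((fun _ => 0 : Cn n → ℂ) - fun _ => 0) = 0 := by funext; simp
    simp only [e, eLpNorm_zero]; exact tendsto_const_nhds

lemma sub (h : L2T q f) (h' : L2T r g) :
    L2T (fun k z => q k z - r k z) (fun z => f z - g z) := by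
  have := h.add (h'.mul_bdd (c := fun _ => -1) (M := 1) aestronglyMeasurable_const (by simp))
  simpa [sub_eq_add_neg] using this

lemma sum {ι : Type*} {s : Finset ι} {q : ι → ℕ → Cn n → ℂ} {f : ι → Cn n → ℂ}
    (h : ∀ i ∈ s, L2T (q i) (f i)) :
    L2T (fun k z => ∑ i ∈ s, q i k z) (fun z => ∑ i ∈ s, f i z) := by
  classical
  induction s using Finset.induction_on with
  | empty => simpa using zero
  | insert a s ha ih =>
    simp only [Finset.sum_insert ha]
    exact (h a (by simp)).add (ih fun i hi => h i (by simp [hi]))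

lemma tendsto_toLp (h : L2T q f) :
    Tendsto (fun k => (h.memk k).toLp (q k)) atTop (𝓝 (h.mem.toLp f)) :=
  (Lp.tendsto_Lp_iff_tendsto_eLpNorm'' _ h.memk _ h.mem).2 h.lim

lemma tendsto_integral_mul_conj (h : L2T q f) (h' : L2T r g) :
    Tendsto (fun k => ∫ z, q k z * conj (r k z)) atTop (𝓝 (∫ z, f z * conj (g z))) := by
  have h1 := h'.tendsto_toLp.inner (𝕜 := ℂ) h.tendsto_toLp
  have e : ∀ {u v : Cn n → ℂ} (hu : MemLp u 2 volume) (hv : MemLp v 2 volume),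
      inner ℂ (hv.toLp v) (hu.toLp u) = ∫ z, u z * conj (v z) := by
    intro u v hu hv
    rw [L2.inner_def]
    refine integral_congr_ae ?_
    filter_upwards [hu.coeFn_toLp, hv.coeFn_toLp] with z h1 h2
    rw [h1, h2]; simp
  simpa only [e] using h1

lemma tendsto_integral_sq (h : L2T q f) :
    Tendsto (fun k => ∫ z, ‖q k z‖ ^ 2) atTop (𝓝 (∫ z, ‖f z‖ ^ 2)) := by
  have h1 := (Complex.continuous_re.tendsto _).comp (h.tendsto_integral_mul_conj h)
  have e : ∀ {u : Cn n → ℂ}, (∫ z, u z * conj (u z)).re = ∫ z, ‖u z‖ ^ 2 := by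
    intro u
    simp_rw [Complex.mul_conj, Complex.normSq_eq_norm_sq]
    rw [integral_complex_ofReal, Complex.ofReal_re]
  simpa only [Function.comp_def, e] using h1

lemma of_dominated {c : ℕ → Cn n → ℂ} {c' : Cn n → ℂ} {M : ℝ} (hf : MemLp f 2 volume)
    (hc : ∀ k, Continuous (c k)) (hc' : Continuous c') (hM : ∀ k z, ‖c k z‖ ≤ M)
    (ht : ∀ z, Tendsto (fun k => c k z) atTop (𝓝 (c' z))) :
    L2T (fun k z => c k z * f z) (fun z => c' z * f z) := by
  have hM' : ∀ z, ‖c' z‖ ≤ M := fun z =>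
    le_of_tendsto (ht z).norm (Eventually.of_forall fun k => hM k z)
  have hM0 : 0 ≤ M := (norm_nonneg _).trans (hM' 0)
  refine ⟨fun k => hf.of_le_mul (c := M) ((hc k).aestronglyMeasurable.mul hf.1)
    (ae_of_all _ fun z => ?_), hf.of_le_mul (c := M) (hc'.aestronglyMeasurable.mul hf.1)
    (ae_of_all _ fun z => ?_), ?_⟩
  · rw [norm_mul]; gcongr; exact hM k z
  · rw [norm_mul]; gcongr; exact hM' z
  have key : Tendsto (fun k => ∫⁻ z, ‖((fun z => c k z * f z) - fun z => c' z * f z) z‖ₑ ^ 2)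
      atTop (𝓝 (∫⁻ _ : Cn n, 0)) := by
    refine tendsto_lintegral_of_dominated_convergence'
      (fun z => ENNReal.ofReal (2 * M) ^ 2 * ‖f z‖ₑ ^ 2) (fun k => ?_) (fun k => ?_) ?_ ?_
    · exact ((((hc k).aestronglyMeasurable.mul hf.1).sub
        (hc'.aestronglyMeasurable.mul hf.1)).enorm.pow_const 2)
    · refine ae_of_all _ fun z => ?_
      simp only [Pi.sub_apply]
      rw [← sub_mul, enorm_mul, mul_pow]
      gcongr
      rw [← ofReal_norm]
      refine ENNReal.ofReal_le_ofReal ((norm_sub_le _ _).trans ?_)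
      linarith [hM k z, hM' z]
    · rw [lintegral_const_mul' _ _ (ENNReal.pow_ne_top ENNReal.ofReal_ne_top), ← eLpNorm_two_sq]
      exact ENNReal.mul_ne_top (ENNReal.pow_ne_top ENNReal.ofReal_ne_top)
        (ENNReal.pow_ne_top hf.2.ne)
    · refine ae_of_all _ fun z => ?_
      have h1 : Tendsto (fun k => c k z * f z - c' z * f z) atTop (𝓝 0) := by
        simpa using ((ht z).mul_const (f z)).sub_const (c' z * f z)
      have h2 := (ENNReal.continuous_pow 2).tendsto _ |>.comp
        ((continuous_enorm.tendsto _).comp h1)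
      simpa [Function.comp_def] using h2
  simp_rw [← eLpNorm_two_sq, lintegral_zero] at key
  have h3 := (ENNReal.continuous_rpow_const (y := (1 / 2 : ℝ))).tendsto _ |>.comp key
  have e : ∀ x : ℝ≥0∞, (x ^ 2) ^ (1 / 2 : ℝ) = x := fun x => by
    rw [← ENNReal.rpow_two, ← ENNReal.rpow_mul]; norm_num
  simp only [Function.comp_def, e] at h3
  simpa using h3

lemma cv_rho (hf : MemLp f 2 volume) :
    L2T (fun k : ℕ => cv (cst (rho (1 / (k + 1 : ℝ)))) f) f where
  memk k := by
    have hp : (0:ℝ) < 1 / (k + 1 : ℝ) := by positivity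
    refine ⟨(cv_contDiff (contDiff_crho _) (hasCompactSupport_crho hp)
      (hf.locallyIntegrable (by norm_num))).continuous.aestronglyMeasurable, ?_⟩
    exact (eLpNorm_cv_rho_le hp hf.1).trans_lt hf.2
  mem := hf
  lim := tendsto_eLpNorm_cv_rho hf

end L2T

/-! ### Cutoff functions -/

/-- A smooth cutoff function. -/
def cut1 (z : Cn n) : ℝ := Real.smoothTransition (2 - ∑ j, ‖z j‖ ^ 2)

/-- The rescaled smooth cutoff functions, exhausting `ℂⁿ`. -/
def cut (k : ℕ) (z : Cn n) : ℝ := cut1 ((1 / (k + 1 : ℝ)) • z)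

lemma contDiff_cut1 : ContDiff ℝ ∞ (cut1 : Cn n → ℝ) :=
  Real.smoothTransition.contDiff.comp (contDiff_const.sub contDiff_sum_sq)

lemma contDiff_cut (k : ℕ) : ContDiff ℝ ∞ (cut k : Cn n → ℝ) :=
  contDiff_cut1.comp (contDiff_const_smul _)

lemma cut1_eq_zero {z : Cn n} (h : 2 < ‖z‖) : cut1 z = 0 := by
  refine Real.smoothTransition.zero_of_nonpos ?_
  have : ∃ j, 2 < ‖z j‖ := by
    by_contra! h'
    exact absurd ((pi_norm_le_iff_of_nonneg zero_le_two).2 h') (not_le.2 h)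
  obtain ⟨j, hj⟩ := this
  have := Finset.single_le_sum (f := fun j => ‖z j‖ ^ 2) (fun i _ => by positivity)
    (Finset.mem_univ j)
  have h2 : (2 : ℝ) ≤ ‖z j‖ ^ 2 := by nlinarith
  linarith

lemma hasCompactSupport_cut1 : HasCompactSupport (cut1 : Cn n → ℝ) :=
  HasCompactSupport.of_support_subset_isCompact (isCompact_closedBall (0 : Cn n) 2) fun z hz => by
    by_contra h
    exact hz (cut1_eq_zero (by simpa using h))

lemma cut_eq_zero {k : ℕ} {z : Cn n} (h : 2 * (k + 1 : ℝ) < ‖z‖) : cut k z = 0 := by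
  refine cut1_eq_zero ?_
  have hk : (0:ℝ) < k + 1 := by positivity
  rw [norm_smul, Real.norm_of_nonneg (by positivity), one_div, ← div_eq_inv_mul, lt_div_iff₀ hk]
  exact h

lemma hasCompactSupport_cut (k : ℕ) : HasCompactSupport (cut k : Cn n → ℝ) :=
  HasCompactSupport.of_support_subset_isCompact
    (isCompact_closedBall (0 : Cn n) (2 * (k + 1 : ℝ))) fun z hz => by
    by_contra h
    exact hz (cut_eq_zero (by simpa using h))

lemma norm_cut_le (k : ℕ) (z : Cn n) : ‖(cut k z : ℂ)‖ ≤ 1 := by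
  rw [Complex.norm_real, cut, cut1, Real.norm_of_nonneg (Real.smoothTransition.nonneg _)]
  exact Real.smoothTransition.le_one _

lemma tendsto_inv_smul (z : Cn n) :
    Tendsto (fun k : ℕ => (1 / (k + 1 : ℝ)) • z) atTop (𝓝 0) := by
  simpa using (tendsto_one_div_add_atTop_nhds_zero_nat (𝕜 := ℝ)).smul_const z

lemma tendsto_cut (z : Cn n) : Tendsto (fun k => (cut k z : ℂ)) atTop (𝓝 1) := by
  have h0 : cut1 (0 : Cn n) = 1 := by simp [cut1, Real.smoothTransition.one_of_one_le]
  have h := (contDiff_cut1 (n := n)).continuous.tendsto 0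
  rw [h0] at h
  have := (Complex.continuous_ofReal.tendsto _).comp (h.comp (tendsto_inv_smul z))
  simpa [Function.comp_def, cut] using this

lemma wd_cut {s : ℂ} {j : Fin n} (k : ℕ) (z : Cn n) :
    wd s j (cst (cut k)) z
      = ((1 / (k + 1 : ℝ) : ℝ) : ℂ) * wd s j (cst cut1) ((1 / (k + 1 : ℝ)) • z) := by
  have h1 : HasFDerivAt (cst (cut k))
      ((1 / (k + 1 : ℝ)) • fderiv ℝ (cst (cut1 (n := n))) ((1 / (k + 1 : ℝ)) • z)) z := by
    have := ((contDiff_cut1 (n := n)).cst.dAt ((1 / (k + 1 : ℝ)) • z)).hasFDerivAt.comp z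
      ((hasFDerivAt_id z).const_smul (1 / (k + 1 : ℝ)))
    rw [ContinuousLinearMap.comp_smul, ContinuousLinearMap.comp_id] at this
    exact this
  rw [wd, h1.fderiv, wd]
  simp only [smul_apply, Complex.real_smul]
  ring

lemma exists_bound_wd_cut (s : ℂ) (j : Fin n) :
    ∃ M : ℝ, (∀ k z, ‖wd s j (cst (cut k)) z‖ ≤ M) := by
  have hc : HasCompactSupport (cst (cut1 (n := n))) :=
    hasCompactSupport_cut1.comp_left (g := fun x : ℝ => (x : ℂ)) (by simp)
  obtain ⟨M, hM⟩ := (hc.wd (s := s) (j := j)).exists_bound_of_continuous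
    ((contDiff_cut1 (n := n)).cst.wd).continuous
  refine ⟨M, fun k z => ?_⟩
  rw [wd_cut, norm_mul, Complex.norm_real, Real.norm_of_nonneg (by positivity)]
  refine (mul_le_of_le_one_left (norm_nonneg _) ?_).trans (hM _)
  exact (div_le_one (by positivity)).2 (by linarith [(Nat.cast_nonneg k : (0:ℝ) ≤ k)])

lemma tendsto_wd_cut (s : ℂ) (j : Fin n) (z : Cn n) :
    Tendsto (fun k => wd s j (cst (cut k)) z) atTop (𝓝 0) := by
  simp_rw [wd_cut]
  have h1 : Tendsto (fun k : ℕ => ((1 / (k + 1 : ℝ) : ℝ) : ℂ)) atTop (𝓝 0) := by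
    simpa [Function.comp_def] using (Complex.continuous_ofReal.tendsto _).comp
      (tendsto_one_div_add_atTop_nhds_zero_nat (𝕜 := ℝ))
  have h2 := (((contDiff_cut1 (n := n)).cst.wd (s := s) (j := j)).continuous.tendsto 0).comp
    (tendsto_inv_smul z)
  simpa [Function.comp_def] using h1.mul h2

/-! ### Extension of a priori estimates to weak forms -/

/-- A smooth function with compact support. -/
def IsTest (χ : Cn n → ℂ) : Prop := ContDiff ℝ ∞ χ ∧ HasCompactSupport χ

/-- The a priori estimate for the pairing of test forms with a fixed form. -/
def APriori (Ψ : Cn n → ℝ) (α : Fin n → Cn n → ℂ) (S : ℝ) : Prop :=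
  ∀ β : Fin n → Cn n → ℂ, (∀ j, IsTest (β j)) →
    ‖∫ z, (∑ j, β j z * conj (α j z)) * gw Ψ z‖ ^ 2 ≤
      S * ∫ z, (‖∑ j, del Ψ j (β j) z‖ ^ 2
        + (1 / 2) * ∑ j, ∑ k, ‖dbar k (β j) z - dbar j (β k) z‖ ^ 2) * Real.exp (-Ψ z)

lemma integral_sq_add_sum {A : Cn n → ℂ} {B : Fin n → Fin n → Cn n → ℂ} (hA : MemLp A 2 volume)
    (hB : ∀ j k, MemLp (B j k) 2 volume) :
    ∫ z, (‖A z‖ ^ 2 + (1 / 2) * ∑ j, ∑ k, ‖B j k z‖ ^ 2)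
      = (∫ z, ‖A z‖ ^ 2) + (1 / 2) * ∑ j, ∑ k, ∫ z, ‖B j k z‖ ^ 2 := by
  have hBi : ∀ j k, Integrable (fun z => ‖B j k z‖ ^ 2) := fun j k =>
    (hB j k).integrable_norm_pow two_ne_zero
  rw [integral_add (hA.integrable_norm_pow two_ne_zero)
    ((integrable_finsetSum _ fun j _ => integrable_finsetSum _ fun k _ => hBi j k).const_mul _),
    integral_const_mul, integral_finsetSum _ fun j _ => integrable_finsetSum _ fun k _ => hBi j k]
  congr 2
  exact Finset.sum_congr rfl fun j _ => integral_finsetSum _ fun k _ => hBi j k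

lemma cv_rho_eq_zero {f : Cn n → ℂ} {R ε : ℝ} (hε : 0 < ε) (hε1 : ε ≤ 1)
    (hf : ∀ z, R < ‖z‖ → f z = 0) {z : Cn n} (hz : R + 1 < ‖z‖) : cv (cst (rho ε)) f z = 0 := by
  rw [cv_apply]
  refine integral_eq_zero_of_ae (ae_of_all _ fun t => ?_)
  by_cases ht : ‖t‖ ≤ ε
  · have := norm_sub_norm_le z t
    simp [hf (z - t) (by linarith)]
  · simp [rho_eq_zero hε (not_le.1 ht)]

lemma hasCompactSupport_of_norm {f : Cn n → ℂ} {R : ℝ} (hf : ∀ z, R < ‖z‖ → f z = 0) :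
    HasCompactSupport f :=
  HasCompactSupport.of_support_subset_isCompact (isCompact_closedBall (0 : Cn n) R) fun z hz => by
    by_contra h
    exact hz (hf z (by simpa using h))

lemma wd_cv_eq_integral {s : ℂ} {j : Fin n} {ρ f : Cn n → ℂ} (hρ : IsTest ρ)
    (hf : LocallyIntegrable f) (z : Cn n) :
    wd s j (cv ρ f) z = - ∫ y, f y * wd s j (fun y => ρ (z - y)) y := by
  rw [wd_cv hρ.1 hρ.2 hf, cv_swap, ← integral_neg]
  congr 1; funext y
  rw [wd_comp_const_sub hρ.1]; ring

lemma IsTest.comp_const_sub {ρ : Cn n → ℂ} (hρ : IsTest ρ) (z : Cn n) :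
    IsTest fun y => ρ (z - y) :=
  ⟨hρ.1.comp (contDiff_const.sub contDiff_id), hρ.2.comp_homeomorph (Homeomorph.subLeft z)⟩

lemma IsTest.integrable_mul {f χ : Cn n → ℂ} (hχ : IsTest χ) (hf : LocallyIntegrable f) :
    Integrable fun z => f z * χ z := by
  have := hf.integrable_smul_right_of_hasCompactSupport hχ.1.continuous hχ.2
  simpa only [smul_eq_mul] using this

lemma IsTest.wd {s : ℂ} {j : Fin n} {χ : Cn n → ℂ} (hχ : IsTest χ) : IsTest (wd s j χ) :=
  ⟨hχ.1.wd, hχ.2.wd⟩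

lemma isTest_rho {ε : ℝ} (hε : 0 < ε) : IsTest (cst (rho (n := n) ε)) :=
  ⟨contDiff_crho ε, hasCompactSupport_crho hε⟩

/-- An indicator of a closed ball times a continuous function is bounded and measurable. -/
lemma indicator_bdd {g : Cn n → ℂ} (hg : Continuous g) (R : ℝ) :
    ∃ M : ℝ, AEStronglyMeasurable ((Metric.closedBall (0 : Cn n) R).indicator g) volume ∧
      ∀ z, ‖(Metric.closedBall (0 : Cn n) R).indicator g z‖ ≤ M := by
  obtain ⟨M, hM⟩ := (isCompact_closedBall (0 : Cn n) R).exists_bound_of_continuousOn hg.continuousOn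
  refine ⟨max M 0, (hg.measurable.indicator
    Metric.isClosed_closedBall.measurableSet).aestronglyMeasurable, fun z => ?_⟩
  by_cases h : z ∈ Metric.closedBall (0 : Cn n) R
  · simp [h, hM z h]
  · simp [h]

lemma APriori.compact {Ψ : Cn n → ℝ} (hΨ : ContDiff ℝ ∞ Ψ) {α : Fin n → Cn n → ℂ} {S : ℝ}
    (hα : ∀ j, MemLp (fun z => ((Real.exp (-Ψ z / 2) : ℝ) : ℂ) * α j z) 2 volume)
    (hap : APriori Ψ α S) {C : Fin n → Cn n → ℂ} {h : Cn n → ℂ}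
    {mm : Fin n → Fin n → Cn n → ℂ} {R : ℝ}
    (hC : ∀ j, MemLp (C j) 2 volume) (hh : MemLp h 2 volume)
    (hmm : ∀ j k, MemLp (mm j k) 2 volume) (hC0 : ∀ j z, R < ‖z‖ → C j z = 0)
    (hh0 : ∀ z, R < ‖z‖ → h z = 0) (hmm0 : ∀ j k z, R < ‖z‖ → mm j k z = 0)
    (w1 : ∀ η, IsTest η → ∑ j, ∫ z, C j z * dd j η z = - ∫ z, h z * η z)
    (w2 : ∀ j k η, IsTest η →
      (∫ z, C j z * dbar k η z) - ∫ z, C k z * dbar j η z = - ∫ z, mm j k z * η z) :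
    ‖∫ z, (∑ j, C j z * conj (α j z)) * gw Ψ z‖ ^ 2 ≤
      S * ∫ z, (‖h z - ∑ j, dd j (cst Ψ) z * C j z‖ ^ 2
        + (1 / 2) * ∑ j, ∑ k, ‖mm j k z‖ ^ 2) * Real.exp (-Ψ z) := by
  classical
  set K := Metric.closedBall (0 : Cn n) (R + 1) with hK
  have hnK : ∀ z, z ∉ K → R + 1 < ‖z‖ := fun z hz => by simpa [hK] using hz
  have hcE : Continuous fun z => ((Real.exp (-Ψ z / 2) : ℝ) : ℂ) := by
    have := hΨ.continuous
    fun_prop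
  set E := K.indicator fun z => ((Real.exp (-Ψ z / 2) : ℝ) : ℂ) with hE
  set D : Fin n → Cn n → ℂ := fun j => K.indicator fun z =>
    dd j (cst Ψ) z * ((Real.exp (-Ψ z / 2) : ℝ) : ℂ) with hD
  obtain ⟨ME, hE1, hE2⟩ := indicator_bdd hcE (R + 1)
  have hDb := fun j => indicator_bdd ((hΨ.cst.wd (s := -Complex.I) (j := j)).continuous.mul hcE)
    (R + 1)
  have hexp : ∀ x : ℝ, Real.exp (-x / 2) ^ 2 = Real.exp (-x) := fun x => by
    rw [← Real.exp_nat_mul]; congr 1; push_cast; ring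
  have r2 : ∀ (u : Cn n → ℂ) (c : Fin n → Cn n → ℂ) (m : Fin n → Fin n → Cn n → ℂ),
      (∀ j z, z ∉ K → c j z = 0) → (∀ z, z ∉ K → u z = 0) → (∀ j k z, z ∉ K → m j k z = 0) →
      ∀ z, (‖u z - ∑ j, dd j (cst Ψ) z * c j z‖ ^ 2
        + (1 / 2) * ∑ j, ∑ k, ‖m j k z‖ ^ 2) * Real.exp (-Ψ z)
      = ‖E z * u z - ∑ j, D j z * c j z‖ ^ 2 + (1 / 2) * ∑ j, ∑ k, ‖E z * m j k z‖ ^ 2 := by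
    intro u c m hc hu hm z
    by_cases hz : z ∈ K
    · have e1 : E z * u z - ∑ j, D j z * c j z
          = ((Real.exp (-Ψ z / 2) : ℝ) : ℂ) * (u z - ∑ j, dd j (cst Ψ) z * c j z) := by
        simp only [hE, hD, Set.indicator_of_mem hz, mul_sub, Finset.mul_sum]
        congr 1
        refine Finset.sum_congr rfl fun j _ => ?_
        ring
      have e2 : ∀ j k, ‖E z * m j k z‖ ^ 2 = Real.exp (-Ψ z) * ‖m j k z‖ ^ 2 := by
        intro j k
        rw [norm_mul, mul_pow, hE, Set.indicator_of_mem hz, Complex.norm_real, Real.norm_of_nonneg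
          (Real.exp_pos _).le, hexp]
      rw [e1, norm_mul, mul_pow, Complex.norm_real, Real.norm_of_nonneg (Real.exp_pos _).le, hexp]
      simp_rw [e2, ← Finset.mul_sum]
      ring
    · simp [hu z hz, hc _ z hz, hm _ _ z hz]
  have r3 : ∀ (c : Fin n → Cn n → ℂ), (∀ j, MemLp (c j) 2 volume) →
      (∀ j z, z ∉ K → c j z = 0) →
      ∫ z, (∑ j, c j z * conj (α j z)) * gw Ψ z
        = ∑ j, ∫ z, (E z * c j z) * conj (((Real.exp (-Ψ z / 2) : ℝ) : ℂ) * α j z) := by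
    intro c hcm hc
    rw [← integral_finsetSum]
    · congr 1; funext z
      rw [Finset.sum_mul]
      refine Finset.sum_congr rfl fun j _ => ?_
      by_cases hz : z ∈ K
      · simp only [hE, Set.indicator_of_mem hz, gw, ← hexp, map_mul, Complex.conj_ofReal]
        push_cast; ring
      · simp [hc j z hz]
    · intro j _
      have hm : MemLp (fun z => E z * c j z) 2 volume :=
        (hcm j).of_le_mul (c := ME) (hE1.mul (hcm j).1) (ae_of_all _ fun z => by
          rw [norm_mul]; gcongr; exact hE2 z)
      exact hm.integrable_mul (hα j).star
  let ε : ℕ → ℝ := fun k => 1 / (k + 1 : ℝ)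
  have hε : ∀ k, 0 < ε k := fun k => by simp only [ε]; positivity
  have hε1 : ∀ k, ε k ≤ 1 := fun k =>
    (div_le_one (by positivity)).2 (by linarith [(Nat.cast_nonneg k : (0:ℝ) ≤ k)])
  have hKR : ∀ z, z ∉ K → R < ‖z‖ := fun z hz => by linarith [hnK z hz]
  have hl : ∀ {f : Cn n → ℂ}, MemLp f 2 volume → LocallyIntegrable f := fun hf =>
    hf.locallyIntegrable (by norm_num)
  let β : ℕ → Fin n → Cn n → ℂ := fun k j => cv (cst (rho (ε k))) (C j)
  have hβ : ∀ k j, IsTest (β k j) := fun k j =>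
    ⟨cv_contDiff (contDiff_crho _) (hasCompactSupport_crho (hε k)) (hl (hC j)),
      cv_hasCompactSupport (hasCompactSupport_crho (hε k)) (hasCompactSupport_of_norm (hC0 j))⟩
  have hβ0 : ∀ k j z, z ∉ K → β k j z = 0 := fun k j z hz =>
    cv_rho_eq_zero (hε k) (hε1 k) (hC0 j) (hnK z hz)
  have d1 : ∀ k z, ∑ j, dd j (β k j) z = cv (cst (rho (ε k))) h z := by
    intro k z
    have ht := (isTest_rho (hε k)).comp_const_sub z
    simp only [β]
    simp_rw [fun j => wd_cv_eq_integral (s := -Complex.I) (j := j) (isTest_rho (hε k))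
      (hl (hC j)) z]
    rw [Finset.sum_neg_distrib, w1 _ ht, neg_neg, cv_swap]
    simp_rw [mul_comm]
  have d2 : ∀ k z j l, dbar l (β k j) z - dbar j (β k l) z = cv (cst (rho (ε k))) (mm j l) z := by
    intro k z j l
    have ht := (isTest_rho (hε k)).comp_const_sub z
    simp only [β]
    rw [wd_cv_eq_integral (isTest_rho (hε k)) (hl (hC j)),
      wd_cv_eq_integral (isTest_rho (hε k)) (hl (hC l)), cv_swap]
    have := w2 j l _ ht
    simp_rw [mul_comm (cst (rho (ε k)) _)]
    linear_combination -this
  have d3 : ∀ k z, ∑ j, del Ψ j (β k j) z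
      = cv (cst (rho (ε k))) h z - ∑ j, dd j (cst Ψ) z * β k j z := by
    intro k z
    simp only [del]
    rw [Finset.sum_sub_distrib, d1]
  have hLC : ∀ j, L2T (fun k => β k j) (C j) := fun j => L2T.cv_rho (hC j)
  have hLh : L2T (fun k => cv (cst (rho (ε k))) h) h := L2T.cv_rho hh
  have hLm : ∀ j k, L2T (fun i => cv (cst (rho (ε i))) (mm j k)) (mm j k) := fun j k =>
    L2T.cv_rho (hmm j k)
  have hLA : L2T (fun k z => E z * cv (cst (rho (ε k))) h z - ∑ j, D j z * β k j z)
      (fun z => E z * h z - ∑ j, D j z * C j z) :=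
    (hLh.mul_bdd hE1 hE2).sub (L2T.sum fun j _ => by
      obtain ⟨M, h1, h2⟩ := hDb j
      exact (hLC j).mul_bdd h1 h2)
  have hLB : ∀ j k, L2T (fun i z => E z * cv (cst (rho (ε i))) (mm j k) z)
      (fun z => E z * mm j k z) := fun j k => (hLm j k).mul_bdd hE1 hE2
  have hLα : ∀ j, L2T (fun _ z => ((Real.exp (-Ψ z / 2) : ℝ) : ℂ) * α j z)
      (fun z => ((Real.exp (-Ψ z / 2) : ℝ) : ℂ) * α j z) := fun j =>
    ⟨fun _ => hα j, hα j, by simp⟩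
  have hineq : ∀ k, ‖∑ j, ∫ z, (E z * β k j z) *
        conj (((Real.exp (-Ψ z / 2) : ℝ) : ℂ) * α j z)‖ ^ 2
      ≤ S * ((∫ z, ‖E z * cv (cst (rho (ε k))) h z - ∑ j, D j z * β k j z‖ ^ 2)
        + (1 / 2) * ∑ i, ∑ j, ∫ z, ‖E z * cv (cst (rho (ε k))) (mm i j) z‖ ^ 2) := by
    intro k
    have h1 := hap (β k) (hβ k)
    rw [r3 (β k) (fun j => (hLC j).memk k) (hβ0 k)] at h1
    simp_rw [d2 k, d3 k] at h1
    simp_rw [r2 (cv (cst (rho (ε k))) h) (β k) (fun i j => cv (cst (rho (ε k))) (mm i j)) (hβ0 k)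
      (fun z hz => cv_rho_eq_zero (hε k) (hε1 k) hh0 (hnK z hz))
      (fun i j z hz => cv_rho_eq_zero (hε k) (hε1 k) (hmm0 i j) (hnK z hz))] at h1
    rwa [integral_sq_add_sum (hLA.memk k) fun i j => (hLB i j).memk k] at h1
  rw [r3 C hC fun j z hz => hC0 j z (hKR z hz)]
  simp_rw [r2 h C mm (fun j z hz => hC0 j z (hKR z hz)) (fun z hz => hh0 z (hKR z hz))
    (fun i j z hz => hmm0 i j z (hKR z hz))]
  rw [integral_sq_add_sum hLA.mem fun i j => (hLB i j).mem]
  refine le_of_tendsto_of_tendsto' (b := atTop) ?_ ?_ hineq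
  · exact (tendsto_finsetSum _ fun j _ =>
      ((hLC j).mul_bdd hE1 hE2).tendsto_integral_mul_conj (hLα j)).norm.pow 2
  · exact (hLA.tendsto_integral_sq.add ((tendsto_finsetSum _ fun i _ =>
      tendsto_finsetSum _ fun j _ => (hLB i j).tendsto_integral_sq).const_mul _)).const_mul _

/-- The square root `e^{-Ψ/2}` of the weight. -/
abbrev hw (Ψ : Cn n → ℝ) : Cn n → ℂ := fun z => ((Real.exp (-Ψ z / 2) : ℝ) : ℂ)

lemma continuous_hw {Ψ : Cn n → ℝ} (h : Continuous Ψ) : Continuous (hw Ψ) := by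
  unfold hw; fun_prop

lemma hw_mul_hw (Ψ : Cn n → ℝ) (z : Cn n) : hw Ψ z * hw Ψ z = gw Ψ z := by
  simp only [gw, ← Complex.ofReal_mul, ← Real.exp_add]; congr 3; ring

lemma conj_hw (Ψ : Cn n → ℝ) (z : Cn n) : conj (hw Ψ z) = hw Ψ z := Complex.conj_ofReal _

lemma hw_neg_mul (Ψ : Cn n → ℝ) (z : Cn n) : hw (-Ψ) z * hw Ψ z = 1 := by
  simp only [Pi.neg_apply, ← Complex.ofReal_mul, ← Real.exp_add]
  rw [show -(-Ψ z) / 2 + -Ψ z / 2 = 0 by ring]; simp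

lemma norm_hw_mul_sq (Ψ : Cn n → ℝ) (z : Cn n) (c : ℂ) :
    ‖hw Ψ z * c‖ ^ 2 = ‖c‖ ^ 2 * Real.exp (-Ψ z) := by
  rw [norm_mul, mul_pow, Complex.norm_real, Real.norm_of_nonneg (Real.exp_pos _).le,
    ← Real.exp_nat_mul, mul_comm]
  congr 2; push_cast; ring

lemma eq_hw_neg_mul (Ψ : Cn n → ℝ) (f : Cn n → ℂ) : f = fun z => hw (-Ψ) z * (hw Ψ z * f z) := by
  funext z; rw [← mul_assoc, hw_neg_mul, one_mul]

lemma locallyIntegrable_of_memLp_hw {Ψ : Cn n → ℝ} (h : Continuous Ψ) {f : Cn n → ℂ}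
    (hf : MemLp (fun z => hw Ψ z * f z) 2 volume) : LocallyIntegrable f := by
  rw [eq_hw_neg_mul Ψ f, ← locallyIntegrableOn_univ]
  exact (hf.locallyIntegrable (by norm_num)).locallyIntegrableOn _ |>.continuousOn_mul
    (continuous_hw (Ψ := -Ψ) h.neg).continuousOn isOpen_univ.isLocallyClosed

lemma memLp_mul_of_hw {Ψ : Cn n → ℝ} (h : Continuous Ψ) {f c : Cn n → ℂ}
    (hf : MemLp (fun z => hw Ψ z * f z) 2 volume) (hc : Continuous c) (hcc : HasCompactSupport c) :
    MemLp (fun z => c z * f z) 2 volume := by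
  have h1 : Continuous fun z => c z * hw (-Ψ) z := hc.mul (continuous_hw (Ψ := -Ψ) h.neg)
  obtain ⟨M, hM⟩ := (hcc.mul_right (f' := hw (-Ψ))).exists_bound_of_continuous h1
  have e : (fun z => c z * f z) = fun z => (c z * hw (-Ψ) z) * (hw Ψ z * f z) := by
    funext z; rw [mul_assoc, ← mul_assoc (hw (-Ψ) z), hw_neg_mul, one_mul]
  rw [e]
  exact hf.of_le_mul (c := M) (h1.aestronglyMeasurable.mul hf.1) (ae_of_all _ fun z => by
    rw [norm_mul]; gcongr; exact hM z)

lemma wd_exp {s : ℂ} {j : Fin n} {Ψ : Cn n → ℝ} (h : ContDiff ℝ ∞ Ψ) (z : Cn n) :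
    wd s j (gw (-Ψ)) z = wd s j (cst Ψ) z * gw (-Ψ) z := by
  have := wd_comp_real (s := s) (j := j) (f := Ψ) (θ := Real.exp) (z := z)
    (Real.hasDerivAt_exp (Ψ z)) (h.differentiable (by simp) z)
  have e : gw (-Ψ) = fun y => ((Real.exp (Ψ y) : ℝ) : ℂ) := by funext y; simp [gw]
  rw [e, mul_comm]
  exact this

lemma gw_neg_mul (Ψ : Cn n → ℝ) (z : Cn n) : gw (-Ψ) z * gw Ψ z = 1 := by
  simp only [gw, Pi.neg_apply, ← Complex.ofReal_mul, ← Real.exp_add]; simp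

lemma isTest_cut (k : ℕ) : IsTest (cst (cut (n := n) k)) :=
  ⟨(contDiff_cut k).cst, (hasCompactSupport_cut k).comp_left (g := fun x : ℝ => (x : ℂ)) (by simp)⟩

lemma IsTest.mul {χ c : Cn n → ℂ} (h : IsTest χ) (hc : ContDiff ℝ ∞ c) :
    IsTest fun z => χ z * c z := ⟨h.1.mul hc, h.2.mul_right⟩

lemma wd_cut_eq_zero {s : ℂ} {j : Fin n} {k : ℕ} {z : Cn n} (h : 2 * (k + 1 : ℝ) < ‖z‖) :
    wd s j (cst (cut k)) z = 0 := by
  refine wd_eq_zero_of_notMem fun hz => ?_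
  have : tsupport (cst (cut (n := n) k)) ⊆ Metric.closedBall 0 (2 * (k + 1 : ℝ)) := by
    refine closure_minimal (fun z hz => ?_) Metric.isClosed_closedBall
    by_contra h'
    exact hz (by simp [cut_eq_zero (k := k) (z := z) (by simpa using h')])
  have h2 := this hz
  simp only [Metric.mem_closedBall, dist_zero_right] at h2
  linarith

/-- An a priori estimate extends to weakly closed forms with a weak adjoint derivative. -/
lemma APriori.weak {Ψ : Cn n → ℝ} (hΨ : ContDiff ℝ ∞ Ψ) {α : Fin n → Cn n → ℂ} {S : ℝ}
    (hα : ∀ j, MemLp (fun z => hw Ψ z * α j z) 2 volume)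
    (hap : APriori Ψ α S) {B : Fin n → Cn n → ℂ} {h : Cn n → ℂ}
    (hB : ∀ j, MemLp (fun z => hw Ψ z * B j z) 2 volume)
    (hh : MemLp (fun z => hw Ψ z * h z) 2 volume)
    (w1 : ∀ η, IsTest η → ∑ j, ∫ z, B j z * (dd j η z * gw Ψ z) = - ∫ z, h z * (η z * gw Ψ z))
    (w2 : ∀ j k η, IsTest η → ∫ z, B j z * dbar k η z = ∫ z, B k z * dbar j η z) :
    ‖∑ j, ∫ z, (hw Ψ z * B j z) * conj (hw Ψ z * α j z)‖ ^ 2 ≤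
      S * ∫ z, ‖hw Ψ z * h z‖ ^ 2 := by
  have hΨc := hΨ.continuous
  have hBl := fun j => locallyIntegrable_of_memLp_hw hΨc (hB j)
  have hhl := locallyIntegrable_of_memLp_hw hΨc hh
  have main : ∀ i : ℕ, ‖∫ z, (∑ j, (cut i z * B j z) * conj (α j z)) * gw Ψ z‖ ^ 2 ≤
      S * ∫ z, (‖(cut i z * h z + ∑ j, dd j (cst (cut i)) z * B j z
          + ∑ j, dd j (cst Ψ) z * (cut i z * B j z)) - ∑ j, dd j (cst Ψ) z * (cut i z * B j z)‖ ^ 2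
        + (1 / 2) * ∑ j, ∑ k, ‖dbar k (cst (cut i)) z * B j z - dbar j (cst (cut i)) z * B k z‖ ^ 2)
          * Real.exp (-Ψ z) := by
    intro i
    have ti := isTest_cut (n := n) i
    refine hap.compact (R := 2 * (i + 1 : ℝ)) (C := fun j z => cut i z * B j z)
      (h := fun z => cut i z * h z + ∑ j, dd j (cst (cut i)) z * B j z
          + ∑ j, dd j (cst Ψ) z * (cut i z * B j z))
      (mm := fun j k z => dbar k (cst (cut i)) z * B j z - dbar j (cst (cut i)) z * B k z)
      hΨ hα (fun j => ?_) ?_ (fun j k => ?_) (fun j z hz => ?_) (fun z hz => ?_)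
      (fun j k z hz => ?_) (fun η hη => ?_) (fun j k η hη => ?_)
    · exact memLp_mul_of_hw hΨc (hB j) ti.1.continuous ti.2
    · refine ((memLp_mul_of_hw hΨc hh ti.1.continuous ti.2).add ?_).add ?_
      · exact memLp_finsetSum _ fun j _ =>
          memLp_mul_of_hw hΨc (hB j) (ti.wd (s := -Complex.I) (j := j)).1.continuous ti.wd.2
      · refine memLp_finsetSum _ fun j _ => ?_
        have t2 := ti.mul (hΨ.cst.wd (s := -Complex.I) (j := j))
        have := memLp_mul_of_hw hΨc (hB j) t2.1.continuous t2.2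
        refine this.congr_norm ?_ (ae_of_all _ fun z => by rw [← mul_assoc, mul_comm (dd j (cst Ψ) z)])
        have e : (fun z => cst (cut i) z * dd j (cst Ψ) z * B j z)
          = fun z => dd j (cst Ψ) z * (cut i z * B j z) := by funext z; simp only [cst]; ring
        rw [e] at this
        exact this.1
    · exact (memLp_mul_of_hw hΨc (hB j) (ti.wd (s := Complex.I) (j := k)).1.continuous ti.wd.2).sub
        (memLp_mul_of_hw hΨc (hB k) (ti.wd (s := Complex.I) (j := j)).1.continuous ti.wd.2)
    · simp [cut_eq_zero hz]
    · simp [cut_eq_zero hz, wd_cut_eq_zero hz]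
    · simp [wd_cut_eq_zero hz]
    · have t1 : IsTest fun z => (η z * cst (cut i) z) * gw (-Ψ) z :=
        (hη.mul ti.1).mul (ContDiff.gw (Ψ := -Ψ) hΨ.neg)
      have h1 := w1 _ t1
      have e1 : ∀ j z, B j z * (dd j (fun z => (η z * cst (cut i) z) * gw (-Ψ) z) z * gw Ψ z)
          = (cut i z * B j z) * dd j η z + B j z * (dd j (cst (cut i)) z * η z)
            + B j z * ((dd j (cst Ψ) z * cst (cut i) z) * η z) := by
        intro j z
        rw [wd_mul ((hη.mul ti.1).1.dAt z) ((ContDiff.gw (Ψ := -Ψ) hΨ.neg).dAt z),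
          wd_mul (hη.1.dAt z) (ti.1.dAt z), wd_exp hΨ]
        simp only [cst]
        linear_combination (B j z * (dd j η z * cut i z + η z * dd j (fun z => (cut i z : ℂ)) z
          + η z * cut i z * dd j (fun z => (Ψ z : ℂ)) z)) * gw_neg_mul Ψ z
      have e2 : ∀ z, h z * ((η z * cst (cut i) z) * gw (-Ψ) z * gw Ψ z)
          = h z * (cst (cut i) z * η z) := by
        intro z
        linear_combination (h z * η z * cst (cut i) z) * gw_neg_mul Ψ z
      simp_rw [e1, e2] at h1
      have i1 : ∀ j, Integrable fun z => (cut i z * B j z) * dd j η z := fun j => by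
        refine ((ti.mul (hη.wd (s := -Complex.I) (j := j)).1).integrable_mul (hBl j)).congr
          (ae_of_all _ fun z => ?_)
        simp only [cst]; ring
      have i2 : ∀ j, Integrable fun z => B j z * (dd j (cst (cut i)) z * η z) := fun j =>
        (ti.wd.mul hη.1).integrable_mul (hBl j)
      have i3 : ∀ j, Integrable fun z => B j z * ((dd j (cst Ψ) z * cst (cut i) z) * η z) :=
        fun j => by
        refine (((ti.mul hη.1).mul (hΨ.cst.wd (s := -Complex.I) (j := j))).integrable_mul
          (hBl j)).congr (ae_of_all _ fun z => ?_)
        simp only [cst]; ring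
      have i4 : Integrable fun z => h z * (cst (cut i) z * η z) := (ti.mul hη.1).integrable_mul hhl
      have e3 : ∀ j, ∫ z, ((cut i z * B j z) * dd j η z + B j z * (dd j (cst (cut i)) z * η z)
            + B j z * ((dd j (cst Ψ) z * cst (cut i) z) * η z))
          = (∫ z, (cut i z * B j z) * dd j η z) + (∫ z, B j z * (dd j (cst (cut i)) z * η z))
            + ∫ z, B j z * ((dd j (cst Ψ) z * cst (cut i) z) * η z) := by
        intro j
        have i12 : Integrable fun z => (cut i z * B j z) * dd j η z
          + B j z * (dd j (cst (cut i)) z * η z) := (i1 j).add (i2 j)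
        rw [integral_add i12 (i3 j), integral_add (i1 j) (i2 j)]
      simp_rw [e3, Finset.sum_add_distrib] at h1
      have e4 : ∫ z, (cut i z * h z + ∑ j, dd j (cst (cut i)) z * B j z
          + ∑ j, dd j (cst Ψ) z * (cut i z * B j z)) * η z
          = (∫ z, h z * (cst (cut i) z * η z))
            + (∑ j, ∫ z, B j z * (dd j (cst (cut i)) z * η z))
            + ∑ j, ∫ z, B j z * ((dd j (cst Ψ) z * cst (cut i) z) * η z) := by
        have s2 : Integrable fun z => ∑ j, B j z * (dd j (cst (cut i)) z * η z) :=
          integrable_finsetSum _ fun j _ => i2 j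
        have s3 : Integrable fun z => ∑ j, B j z * ((dd j (cst Ψ) z * cst (cut i) z) * η z) :=
          integrable_finsetSum _ fun j _ => i3 j
        have s12 : Integrable fun z => h z * (cst (cut i) z * η z)
          + ∑ j, B j z * (dd j (cst (cut i)) z * η z) := i4.add s2
        rw [← integral_finsetSum _ fun j _ => i2 j, ← integral_finsetSum _ fun j _ => i3 j,
          ← integral_add i4 s2, ← integral_add s12 s3]
        congr 1; funext z
        rw [add_mul, add_mul, Finset.sum_mul, Finset.sum_mul]
        congr 1
        · congr 1
          · simp only [cst]; ring
          · exact Finset.sum_congr rfl fun j _ => by ring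
        · exact Finset.sum_congr rfl fun j _ => by simp only [cst]; ring
      rw [e4]
      linear_combination h1
    · have h1 := w2 j k _ (hη.mul ti.1)
      have e1 : ∀ j k z, B j z * dbar k (fun z => η z * cst (cut i) z) z
          = (cut i z * B j z) * dbar k η z + B j z * (dbar k (cst (cut i)) z * η z) := by
        intro j k z
        rw [wd_mul (hη.1.dAt z) (ti.1.dAt z)]
        simp only [cst]; ring
      simp_rw [e1] at h1
      have i1 : ∀ j k, Integrable fun z => (cut i z * B j z) * dbar k η z := fun j k => by
        refine ((ti.mul (hη.wd (s := Complex.I) (j := k)).1).integrable_mul (hBl j)).congr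
          (ae_of_all _ fun z => ?_)
        simp only [cst]; ring
      have i2 : ∀ j k, Integrable fun z => B j z * (dbar k (cst (cut i)) z * η z) := fun j k =>
        (ti.wd.mul hη.1).integrable_mul (hBl j)
      rw [integral_add (i1 j k) (i2 j k), integral_add (i1 k j) (i2 k j)] at h1
      have e2 : ∫ z, (dbar k (cst (cut i)) z * B j z - dbar j (cst (cut i)) z * B k z) * η z
          = (∫ z, B j z * (dbar k (cst (cut i)) z * η z))
            - ∫ z, B k z * (dbar j (cst (cut i)) z * η z) := by
        rw [← integral_sub (i2 j k) (i2 k j)]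
        congr 1; funext z; ring
      rw [e2]
      linear_combination h1
  have hLc : ∀ j, L2T (fun i z => (cut i z : ℂ) * (hw Ψ z * B j z))
      (fun z => 1 * (hw Ψ z * B j z)) := fun j =>
    L2T.of_dominated (hB j) (fun i => (contDiff_cut i).cst.continuous) continuous_const
      norm_cut_le tendsto_cut
  have hLh : L2T (fun i z => (cut i z : ℂ) * (hw Ψ z * h z)) (fun z => 1 * (hw Ψ z * h z)) :=
    L2T.of_dominated hh (fun i => (contDiff_cut i).cst.continuous) continuous_const
      norm_cut_le tendsto_cut
  have hLd : ∀ (s : ℂ) j k, L2T (fun i z => wd s k (cst (cut i)) z * (hw Ψ z * B j z))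
      (fun z => 0 * (hw Ψ z * B j z)) := fun s j k => by
    obtain ⟨M, hM⟩ := exists_bound_wd_cut (n := n) s k
    exact L2T.of_dominated (hB j) (fun i => (contDiff_cut i).cst.wd.continuous) continuous_const
      hM (tendsto_wd_cut s k)
  have hLA := hLh.add (L2T.sum (s := Finset.univ) fun j _ => hLd (-Complex.I) j j)
  have hLB := fun j k => (hLd Complex.I j k).sub (hLd Complex.I k j)
  have hLα : ∀ j, L2T (fun _ z => hw Ψ z * α j z) (fun z => hw Ψ z * α j z) := fun j =>
    ⟨fun _ => hα j, hα j, by simp⟩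
  have hineq : ∀ i, ‖∑ j, ∫ z, ((cut i z : ℂ) * (hw Ψ z * B j z)) * conj (hw Ψ z * α j z)‖ ^ 2
      ≤ S * ((∫ z, ‖(cut i z : ℂ) * (hw Ψ z * h z)
          + ∑ j, dd j (cst (cut i)) z * (hw Ψ z * B j z)‖ ^ 2)
        + (1 / 2) * ∑ j, ∑ k, ∫ z, ‖dbar k (cst (cut i)) z * (hw Ψ z * B j z)
          - dbar j (cst (cut i)) z * (hw Ψ z * B k z)‖ ^ 2) := by
    intro i
    rw [← integral_sq_add_sum (hLA.memk i) fun j k => (hLB j k).memk i]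
    convert main i using 3
    · rw [← integral_finsetSum]
      · congr 1; funext z
        rw [Finset.sum_mul]
        refine Finset.sum_congr rfl fun j _ => ?_
        rw [map_mul, conj_hw, ← hw_mul_hw]; ring
      · intro j _
        exact ((hLc j).memk i).integrable_mul (hα j).star
    · funext z
      rw [add_mul, ← norm_hw_mul_sq, mul_assoc, Finset.sum_mul]
      congr 2
      · congr 1
        rw [add_sub_cancel_right, mul_add, Finset.mul_sum]
        congr 1
        · ring
        · exact Finset.sum_congr rfl fun j _ => by ring
      · refine Finset.sum_congr rfl fun j _ => ?_
        rw [Finset.sum_mul]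
        refine Finset.sum_congr rfl fun k _ => ?_
        rw [← norm_hw_mul_sq]
        congr 2; ring
  have hl1 := (tendsto_finsetSum Finset.univ fun j _ =>
      (hLc j).tendsto_integral_mul_conj (hLα j)).norm.pow 2
  have hl2 := (hLA.tendsto_integral_sq.add ((tendsto_finsetSum Finset.univ fun j _ =>
    tendsto_finsetSum Finset.univ fun k _ => (hLB j k).tendsto_integral_sq).const_mul
      (1 / 2 : ℝ))).const_mul S
  have := le_of_tendsto_of_tendsto' hl1 hl2 hineq
  simpa using this

section HilbertLemmas

variable {V : Type*} [NormedAddCommGroup V] [InnerProductSpace ℂ V] [CompleteSpace V]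

lemma exists_proj_of_orthogonal (T : Set V) (b : V) : ∃ b' : V,
    (∀ t ∈ T, inner ℂ t b' = 0) ∧
      ∀ x : V, (∀ t ∈ T, inner ℂ t x = 0) → inner ℂ x (b - b') = 0 := by
  set K : Submodule ℂ V := (Submodule.span ℂ T)ᗮ
  have hmem : ∀ x : V, x ∈ K ↔ ∀ t ∈ T, inner ℂ t x = 0 := fun x => by
    constructor
    · exact fun hx t ht => hx t (Submodule.subset_span ht)
    · intro hx
      have : Submodule.span ℂ T ≤ (ℂ ∙ x)ᗮ := by
        rw [Submodule.span_le]
        intro t ht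
        rw [SetLike.mem_coe, Submodule.mem_orthogonal_singleton_iff_inner_left]
        exact hx t ht
      intro t ht
      exact Submodule.mem_orthogonal_singleton_iff_inner_left.1 (this ht)
  refine ⟨K.starProjection b, (hmem _).1 (Submodule.starProjection_apply_mem K b), fun x hx => ?_⟩
  exact (Submodule.sub_starProjection_mem_orthogonal b) x ((hmem x).2 hx)

lemma norm_sq_le_of_mem_orthogonal_orthogonal {K : Submodule ℂ V} {q : V} (hq : q ∈ Kᗮᗮ) {S : ℝ} (hS0 : 0 ≤ S)
    (hS : ∀ r ∈ K, ‖inner ℂ r q‖ ^ 2 ≤ S * ‖r‖ ^ 2) : ‖q‖ ^ 2 ≤ S := by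
  rw [Submodule.orthogonal_orthogonal_eq_closure] at hq
  have hc : IsClosed {r : V | ‖inner ℂ r q‖ ^ 2 ≤ S * ‖r‖ ^ 2} :=
    isClosed_le (by fun_prop) (by fun_prop)
  have h1 : ‖inner ℂ q q‖ ^ 2 ≤ S * ‖q‖ ^ 2 := closure_minimal hS hc hq
  rw [inner_self_eq_norm_sq_to_K] at h1
  have h2 : ‖((‖q‖ : ℂ)) ^ 2‖ = ‖q‖ ^ 2 := by simp
  rw [show ((RCLike.ofReal ‖q‖ : ℂ)) = (‖q‖ : ℂ) from rfl, h2] at h1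
  by_cases h0 : ‖q‖ ^ 2 = 0
  · rwa [h0]
  · have h3 : 0 < ‖q‖ ^ 2 := lt_of_le_of_ne (by positivity) (Ne.symm h0)
    nlinarith

end HilbertLemmas

lemma inner_toLp {f g : Cn n → ℂ} (hf : MemLp f 2 volume) (hg : MemLp g 2 volume) :
    inner ℂ (hf.toLp f) (hg.toLp g) = ∫ z, g z * conj (f z) := by
  rw [L2.inner_def]
  refine integral_congr_ae ?_
  filter_upwards [hf.coeFn_toLp, hg.coeFn_toLp] with z h1 h2
  rw [h1, h2]; rfl

lemma norm_toLp_sq {f : Cn n → ℂ} (hf : MemLp f 2 volume) :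
    ‖hf.toLp f‖ ^ 2 = ∫ z, ‖f z‖ ^ 2 := by
  have h := inner_toLp hf hf
  rw [inner_self_eq_norm_sq_to_K] at h
  have h2 : ((‖hf.toLp f‖ ^ 2 : ℝ) : ℂ) = ((∫ z, ‖f z‖ ^ 2 : ℝ) : ℂ) := by
    rw [← integral_complex_ofReal]
    push_cast
    refine h.trans (integral_congr_ae (ae_of_all _ fun z => ?_))
    simp [Complex.mul_conj, Complex.normSq_eq_norm_sq]
  exact_mod_cast h2

lemma exists_proj_fun {ι : Type*} [Fintype ι] (T : Set (ι → Cn n → ℂ))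
    (hT : ∀ t ∈ T, ∀ j, MemLp (t j) 2 volume) {v : ι → Cn n → ℂ}
    (hv : ∀ j, MemLp (v j) 2 volume) : ∃ b : ι → Cn n → ℂ, (∀ j, MemLp (b j) 2 volume) ∧
      (∀ t ∈ T, ∑ j, ∫ z, b j z * t j z = 0) ∧
      ∀ x : ι → Cn n → ℂ, (∀ j, MemLp (x j) 2 volume) → (∀ t ∈ T, ∑ j, ∫ z, x j z * t j z = 0) →
        ∑ j, ∫ z, (v j z - b j z) * conj (x j z) = 0 := by
  let V := PiLp 2 fun _ : ι => Lp ℂ 2 (volume : Measure (Cn n))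
  let mk : (x : ι → Cn n → ℂ) → (∀ j, MemLp (x j) 2 volume) → V := fun x hx =>
    WithLp.toLp 2 fun j => (hx j).toLp (x j)
  have hmk : ∀ x hx y hy, inner ℂ (mk x hx) (mk y hy) = ∑ j, ∫ z, y j z * conj (x j z) :=
    fun x hx y hy => by
      rw [PiLp.inner_apply]
      exact Finset.sum_congr rfl fun j _ => inner_toLp (hx j) (hy j)
  obtain ⟨b', h1, h2⟩ := exists_proj_of_orthogonal
    {y : V | ∃ t, ∃ ht : t ∈ T, y = mk (fun j z => conj (t j z)) fun j => (hT t ht j).star} (mk v hv)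
  have hb : b' = mk (fun j => (b' j : Cn n → ℂ)) fun j => Lp.memLp (b' j) := by
    ext1 j
    exact (Lp.toLp_coeFn (b' j) (Lp.memLp (b' j))).symm
  refine ⟨fun j => b' j, fun j => Lp.memLp _, fun t ht => ?_, fun x hx hxt => ?_⟩
  · have := h1 _ ⟨t, ht, rfl⟩
    rw [hb, hmk] at this
    simpa using this
  · have := h2 (mk x hx) (by
      rintro _ ⟨t, ht, rfl⟩
      rw [hmk]
      simpa using hxt t ht)
    rw [hb, inner_sub_right, hmk, hmk, ← Finset.sum_sub_distrib] at this
    rw [← this]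
    refine Finset.sum_congr rfl fun j _ => ?_
    have i1 : Integrable fun z => v j z * conj (x j z) := (hv j).integrable_mul (hx j).star
    have i2 : Integrable fun z => b' j z * conj (x j z) :=
      (Lp.memLp (b' j)).integrable_mul (hx j).star
    rw [← integral_sub i1 i2]
    congr 1; funext z; ring

lemma memLp_hw_of_test {f g : Cn n → ℂ} (hg : Continuous g) (hf : Continuous f)
    (hc : HasCompactSupport f) : MemLp (fun z => g z * f z) 2 volume :=
  (hg.mul hf).memLp_of_hasCompactSupport hc.mul_left

lemma integral_mul_dbar {s : ℂ} {j : Fin n} {w χ : Cn n → ℂ} (hw : ContDiff ℝ ∞ w) (hχ : IsTest χ) :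
    ∫ z, w z * wd s j χ z = - ∫ z, χ z * wd s j w z := by
  have h := integral_wd_eq_zero (s := s) (j := j) (hw.mul hχ.1) hχ.2.mul_left
  have e : ∀ z, wd s j (fun z => w z * χ z) z = w z * wd s j χ z + χ z * wd s j w z := fun z => by
    rw [wd_mul (hw.dAt z) (hχ.1.dAt z)]; ring
  simp_rw [e] at h
  rw [integral_add] at h
  · linear_combination h
  · exact (hw.continuous.mul hχ.1.wd.continuous).integrable_of_hasCompactSupport hχ.wd.2.mul_left
  · exact (hχ.1.continuous.mul hw.wd.continuous).integrable_of_hasCompactSupport hχ.2.mul_right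

lemma contDiff_of_entire {F : Cn n → ℂ} (hF : Differentiable ℂ F) : ContDiff ℝ ∞ F := by
  have : F = cv (cst (rho 1)) F := by
    funext z; exact (cv_rho_of_holo one_pos one_lt_two hF.differentiableOn).symm
  rw [this]
  exact cv_contDiff (contDiff_crho 1) (hasCompactSupport_crho one_pos)
    hF.continuous.locallyIntegrable

/-- Orthogonal projection to the weighted Bergman space. -/
lemma exists_bergman_proj {Ψ : Cn n → ℝ} (hΨ : Continuous Ψ) {v : Cn n → ℂ}
    (hv : MemLp (fun z => hw Ψ z * v z) 2 volume) : ∃ F : Cn n → ℂ, Differentiable ℂ F ∧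
      MemLp (fun z => hw Ψ z * F z) 2 volume ∧
      ∀ F' : Cn n → ℂ, Differentiable ℂ F' → MemLp (fun z => hw Ψ z * F' z) 2 volume →
        ∫ z, (v z - F z) * conj (F' z) * gw Ψ z = 0 := by
  have hcn := continuous_hw (Ψ := -Ψ) hΨ.neg
  obtain ⟨b, hb, h1, h2⟩ := exists_proj_fun (ι := Unit)
    {t | ∃ j χ, IsTest χ ∧ t = fun _ z => hw (-Ψ) z * dbar j χ z}
    (by
      rintro _ ⟨j, χ, hχ, rfl⟩ -
      exact memLp_hw_of_test hcn hχ.1.wd.continuous hχ.wd.2) (v := fun _ z => hw Ψ z * v z) fun _ => hv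
  have e0 : ∀ z, hw Ψ z * (hw (-Ψ) z * b () z) = b () z := fun z => by
    rw [← mul_assoc, mul_comm (hw Ψ z), hw_neg_mul, one_mul]
  have hbm : MemLp (fun z => hw Ψ z * (hw (-Ψ) z * b () z)) 2 volume := by
    simp_rw [e0]; exact hb ()
  obtain ⟨F, hF, hbF⟩ := exists_holo_of_weak (locallyIntegrable_of_memLp_hw hΨ hbm)
    (fun j χ c1 c2 => by
      have := h1 _ ⟨j, χ, ⟨c1, c2⟩, rfl⟩
      simp only [Finset.univ_unique, Finset.sum_singleton] at this
      rw [← this]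
      congr 1; funext z
      change hw (-Ψ) z * b () z * dbar j χ z = b () z * (hw (-Ψ) z * dbar j χ z)
      ring)
  have hFb : (fun z => hw Ψ z * F z) =ᵐ[volume] b () := by
    filter_upwards [hbF] with z hz
    rw [← hz, e0]
  refine ⟨F, hF, (memLp_congr_ae hFb).2 (hb ()), fun F' hF' hm => ?_⟩
  have h3 := h2 (fun _ z => hw Ψ z * F' z) (fun _ => hm) (by
    rintro _ ⟨j, χ, hχ, rfl⟩
    simp only [Finset.univ_unique, Finset.sum_singleton]
    have hF'c : ContDiff ℝ ∞ F' := contDiff_of_entire hF'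
    have := integral_mul_dbar (s := Complex.I) (j := j) hF'c hχ
    have e : ∀ z, hw Ψ z * F' z * (hw (-Ψ) z * dbar j χ z) = F' z * dbar j χ z := fun z => by
      linear_combination (F' z * dbar j χ z) * hw_neg_mul Ψ z
    simp_rw [e]
    rw [this]
    simp [dbar_eq_zero_of_differentiableAt (hF' _)])
  simp only [Finset.univ_unique, Finset.sum_singleton] at h3
  rw [← h3]
  refine integral_congr_ae ?_
  filter_upwards [hFb] with z hz
  change _ = (hw Ψ z * v z - b () z) * conj (hw Ψ z * F' z)
  rw [← hz, map_mul, conj_hw, ← hw_mul_hw]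
  ring

lemma integral_dbar_mul_dbar_comm {s : ℂ} {j k : Fin n} {g χ : Cn n → ℂ} (hg : ContDiff ℝ ∞ g)
    (hχ : IsTest χ) : ∫ z, wd s j g z * wd s k χ z = ∫ z, wd s k g z * wd s j χ z := by
  rw [integral_mul_dbar hg.wd hχ, integral_mul_dbar hg.wd hχ]
  simp_rw [wd_comm (j := k) (k := j) hg]

lemma isTest_pi_single {χ : Cn n → ℂ} (h : IsTest χ) (j i : Fin n) :
    IsTest ((Pi.single j χ : Fin n → Cn n → ℂ) i) := by
  by_cases hij : i = j
  · subst hij; simpa using h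
  · rw [Pi.single_eq_of_ne hij]; exact ⟨contDiff_const, HasCompactSupport.zero⟩

/-- The range of the weighted adjoint of the divergence of test forms. -/
def divRange (Ψ : Cn n → ℝ) : Submodule ℂ (Lp ℂ 2 (volume : Measure (Cn n))) where
  carrier := {r | ∃ η : Fin n → Cn n → ℂ, (∀ j, IsTest (η j)) ∧
    r =ᵐ[volume] fun z => conj (∑ j, dbar j (η j) z) * hw (-Ψ) z}
  zero_mem' := ⟨fun _ _ => 0, fun _ => ⟨contDiff_const, HasCompactSupport.zero⟩, by
    filter_upwards [Lp.coeFn_zero ℂ 2 (volume : Measure (Cn n))] with z hz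
    rw [hz]; simp [wd_const]⟩
  add_mem' := by
    rintro a b ⟨η, hη, ha⟩ ⟨θ, hθ, hb⟩
    refine ⟨fun j z => η j z + θ j z, fun j => ⟨(hη j).1.add (hθ j).1, (hη j).2.add (hθ j).2⟩, ?_⟩
    filter_upwards [Lp.coeFn_add a b, ha, hb] with z h h1 h2
    simp_rw [h, Pi.add_apply, h1, h2, fun j => wd_add (s := Complex.I) (j := j) ((hη j).1.dAt z)
      ((hθ j).1.dAt z), Finset.sum_add_distrib, map_add, add_mul]
  smul_mem' := by
    rintro c a ⟨η, hη, ha⟩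
    refine ⟨fun j z => conj c * η j z, fun j => ⟨contDiff_const.mul (hη j).1, (hη j).2.mul_left⟩, ?_⟩
    filter_upwards [Lp.coeFn_smul c a, ha] with z h h1
    simp_rw [h, Pi.smul_apply, h1, fun j => wd_mul (s := Complex.I) (j := j)
      (differentiableAt_const (conj c)) ((hη j).1.dAt z), wd_const, smul_eq_mul]
    simp only [zero_mul, zero_add, ← Finset.mul_sum, map_mul, Complex.conj_conj, mul_assoc]

lemma weighted_estimate_of_apriori {Ψ : Cn n → ℝ} (hΨ : ContDiff ℝ ∞ Ψ) {w : Cn n → ℂ}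
    (hw0 : ContDiff ℝ ∞ w) (hwm : MemLp (fun z => hw Ψ z * w z) 2 volume)
    (hα : ∀ j, MemLp (fun z => hw Ψ z * dbar j w z) 2 volume)
    (horth : ∀ F : Cn n → ℂ, Differentiable ℂ F → MemLp (fun z => hw Ψ z * F z) 2 volume →
      ∫ z, w z * conj (F z) * gw Ψ z = 0) {S : ℝ} (hS : 0 ≤ S)
    (hap : APriori Ψ (fun j => dbar j w) S) : ∫ z, ‖hw Ψ z * w z‖ ^ 2 ≤ S := by
  have hΨc := hΨ.continuous
  have hcn := continuous_hw (Ψ := -Ψ) hΨc.neg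
  have hcp := continuous_hw hΨc
  have hwn : ∀ z, hw Ψ z * hw (-Ψ) z = 1 := fun z => by rw [mul_comm, hw_neg_mul]
  rw [← norm_toLp_sq hwm]
  refine norm_sq_le_of_mem_orthogonal_orthogonal (K := divRange Ψ) ?_ hS ?_
  · intro x hx
    have e0 : ∀ z, hw Ψ z * (hw (-Ψ) z * x z) = x z := fun z => by
      rw [← mul_assoc, hwn, one_mul]
    have hxm : MemLp (fun z => hw Ψ z * (hw (-Ψ) z * x z)) 2 volume := by
      simp_rw [e0]; exact Lp.memLp x
    obtain ⟨F, hF, hxF⟩ := exists_holo_of_weak (locallyIntegrable_of_memLp_hw hΨc hxm)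
      (fun j χ c1 c2 => by
        have hχ : IsTest χ := ⟨c1, c2⟩
        have hs : ∀ z, ∑ i, dbar i ((Pi.single j χ : Fin n → Cn n → ℂ) i) z = dbar j χ z := by
          intro z
          rw [Finset.sum_eq_single j]
          · simp
          · intro i _ hi
            rw [Pi.single_eq_of_ne hi]; exact wd_const
          · simp
        have hm : MemLp (fun z => conj (dbar j χ z) * hw (-Ψ) z) 2 volume := by
          have := memLp_hw_of_test hcn (Complex.continuous_conj.comp
            (hχ.wd (s := Complex.I) (j := j)).1.continuous)
            (hχ.wd.2.comp_left (g := conj) (map_zero _))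
          refine this.congr_norm ?_ (ae_of_all _ fun z => by
            rw [mul_comm]; rfl)
          exact ((Complex.continuous_conj.comp hχ.1.wd.continuous).mul hcn).aestronglyMeasurable
        have := hx (hm.toLp _) ⟨Pi.single j χ, isTest_pi_single hχ j, by
          simp_rw [hs]; exact hm.coeFn_toLp⟩
        rw [← Lp.toLp_coeFn x (Lp.memLp x), inner_toLp] at this
        rw [← this]
        congr 1; funext z
        rw [map_mul, conj_hw, Complex.conj_conj]; ring)
    have hFx : (fun z => hw Ψ z * F z) =ᵐ[volume] x := by
      filter_upwards [hxF] with z hz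
      rw [← hz, e0]
    rw [← Lp.toLp_coeFn x (Lp.memLp x), inner_toLp, ← horth F hF ((memLp_congr_ae hFx).2 (Lp.memLp x))]
    refine integral_congr_ae ?_
    filter_upwards [hFx] with z hz
    rw [← hz, map_mul, conj_hw, ← hw_mul_hw]; ring
  · rintro r ⟨η, hη, hr⟩
    have hrm : MemLp (fun z => conj (∑ j, dbar j (η j) z) * hw (-Ψ) z) 2 volume :=
      (memLp_congr_ae hr).1 (Lp.memLp r)
    have hrr : r = hrm.toLp _ := by
      rw [← Lp.toLp_coeFn r (Lp.memLp r)]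
      exact (MemLp.toLp_eq_toLp_iff _ _).2 hr
    have hinner : inner ℂ r (hwm.toLp _) = - ∑ j, ∫ z, η j z * dbar j w z := by
      rw [hrr, inner_toLp]
      have e : ∀ z, hw Ψ z * w z * conj (conj (∑ j, dbar j (η j) z) * hw (-Ψ) z)
          = ∑ j, w z * dbar j (η j) z := fun z => by
        rw [map_mul, conj_hw, Complex.conj_conj, ← Finset.mul_sum]
        linear_combination (w z * ∑ j, dbar j (η j) z) * hwn z
      simp_rw [e]
      have hi : ∀ j, Integrable fun z => w z * dbar j (η j) z := fun j => (hw0.continuous.mul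
        (hη j).1.wd.continuous).integrable_of_hasCompactSupport (hη j).wd.2.mul_left
      rw [integral_finsetSum _ fun j _ => hi j]
      simp_rw [integral_mul_dbar hw0 (hη _)]
      rw [Finset.sum_neg_distrib]
    let T : Set (Fin n → Cn n → ℂ) := {t | ∃ j k χ, IsTest χ ∧ t = fun i z =>
      (if i = j then hw (-Ψ) z * dbar k χ z else 0) - (if i = k then hw (-Ψ) z * dbar j χ z else 0)}
    have hm1 : ∀ (i j k : Fin n) χ, IsTest χ →
        MemLp (fun z => if i = j then hw (-Ψ) z * dbar k χ z else 0) 2 volume := by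
      intro i j k χ hχ
      by_cases h : i = j
      · simp only [h, if_true]
        exact memLp_hw_of_test hcn hχ.1.wd.continuous hχ.wd.2
      · simp only [h, if_false]; exact MemLp.zero
    have hTm : ∀ t ∈ T, ∀ j, MemLp (t j) 2 volume := by
      rintro _ ⟨j, k, χ, hχ, rfl⟩ i
      exact (hm1 i j k χ hχ).sub (hm1 i k j χ hχ)
    have hTsum : ∀ x : Fin n → Cn n → ℂ, (∀ j, MemLp (x j) 2 volume) → ∀ j k χ, IsTest χ →
        ∑ i, ∫ z, x i z * ((if i = j then hw (-Ψ) z * dbar k χ z else 0)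
          - (if i = k then hw (-Ψ) z * dbar j χ z else 0))
        = (∫ z, hw (-Ψ) z * x j z * dbar k χ z) - ∫ z, hw (-Ψ) z * x k z * dbar j χ z := by
      intro x hx j k χ hχ
      have e1 : ∀ i, ∫ z, x i z * ((if i = j then hw (-Ψ) z * dbar k χ z else 0)
          - (if i = k then hw (-Ψ) z * dbar j χ z else 0))
          = (∫ z, x i z * (if i = j then hw (-Ψ) z * dbar k χ z else 0))
            - ∫ z, x i z * (if i = k then hw (-Ψ) z * dbar j χ z else 0) := fun i => by
        have i1 : Integrable fun z => x i z * (if i = j then hw (-Ψ) z * dbar k χ z else 0) :=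
          (hx i).integrable_mul (hm1 i j k χ hχ)
        have i2 : Integrable fun z => x i z * (if i = k then hw (-Ψ) z * dbar j χ z else 0) :=
          (hx i).integrable_mul (hm1 i k j χ hχ)
        rw [← integral_sub i1 i2]
        congr 1; funext z; ring
      have e2 : ∀ j k, ∑ i, ∫ z, x i z * (if i = j then hw (-Ψ) z * dbar k χ z else 0)
          = ∫ z, hw (-Ψ) z * x j z * dbar k χ z := fun j k => by
        rw [Finset.sum_eq_single j]
        · congr 1; funext z; simp; ring
        · intro i _ hi; simp [hi]
        · simp
      simp_rw [e1]
      rw [Finset.sum_sub_distrib, e2, e2]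
    have hK : ∀ g : Cn n → ℂ, ContDiff ℝ ∞ g →
        (∀ j, MemLp (fun z => hw Ψ z * dbar j g z) 2 volume) →
        ∀ t ∈ T, ∑ i, ∫ z, (hw Ψ z * dbar i g z) * t i z = 0 := by
      rintro g hg hgm _ ⟨j, k, χ, hχ, rfl⟩
      rw [hTsum (fun i z => hw Ψ z * dbar i g z) hgm j k χ hχ]
      have e : ∀ j k z, hw (-Ψ) z * (hw Ψ z * dbar j g z) * dbar k χ z = dbar j g z * dbar k χ z :=
        fun j k z => by rw [← mul_assoc, hw_neg_mul, one_mul]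
      simp_rw [e]
      rw [integral_dbar_mul_dbar_comm hg hχ, sub_self]
    have hηc : ∀ j, Continuous fun z => conj (η j z) := fun j =>
      Complex.continuous_conj.comp (hη j).1.continuous
    have hηs : ∀ j, HasCompactSupport fun z => conj (η j z) := fun j =>
      (hη j).2.comp_left (g := conj) (map_zero _)
    obtain ⟨b, hb, hbT, hbp⟩ := exists_proj_fun T hTm (v := fun j z => hw (-Ψ) z * conj (η j z))
      fun j => memLp_hw_of_test hcn (hηc j) (hηs j)
    have hproj : ∀ g : Cn n → ℂ, ContDiff ℝ ∞ g →
        (∀ j, MemLp (fun z => hw Ψ z * dbar j g z) 2 volume) →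
        ∑ j, ∫ z, b j z * conj (hw Ψ z * dbar j g z) = ∑ j, ∫ z, conj (η j z) * conj (dbar j g z) := by
      intro g hg hgm
      have h := hbp _ hgm (hK g hg hgm)
      have e : ∀ j, ∫ z, (hw (-Ψ) z * conj (η j z) - b j z) * conj (hw Ψ z * dbar j g z)
          = (∫ z, conj (η j z) * conj (dbar j g z)) - ∫ z, b j z * conj (hw Ψ z * dbar j g z) := by
        intro j
        have i1 : Integrable fun z => conj (η j z) * conj (dbar j g z) :=
          ((hηc j).mul (Complex.continuous_conj.comp
            hg.wd.continuous)).integrable_of_hasCompactSupport (hηs j).mul_right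
        have i2 : Integrable fun z => b j z * conj (hw Ψ z * dbar j g z) :=
          (hb j).integrable_mul (hgm j).star
        rw [← integral_sub i1 i2]
        congr 1; funext z
        rw [map_mul, conj_hw]
        linear_combination (conj (η j z) * conj (dbar j g z)) * hw_neg_mul Ψ z
      simp_rw [e, Finset.sum_sub_distrib] at h
      linear_combination -h
    have eb0 : ∀ j z, hw Ψ z * (hw (-Ψ) z * b j z) = b j z := fun j z => by
      rw [← mul_assoc, hwn, one_mul]
    have eh0 : ∀ z, hw Ψ z * (conj (∑ j, dbar j (η j) z) * gw (-Ψ) z)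
        = conj (∑ j, dbar j (η j) z) * hw (-Ψ) z := fun z => by
      rw [← hw_mul_hw]
      linear_combination (conj (∑ j, dbar j (η j) z) * hw (-Ψ) z) * hwn z
    have key := hap.weak hΨ hα (B := fun j z => hw (-Ψ) z * b j z)
      (h := fun z => conj (∑ j, dbar j (η j) z) * gw (-Ψ) z)
      (fun j => by simp_rw [eb0]; exact hb j) (by simp_rw [eh0]; exact hrm)
      (by
        intro χ hχ
        have hχ' : IsTest fun z => conj (χ z) :=
          ⟨hχ.1.conj_comp, hχ.2.comp_left (g := conj) (map_zero _)⟩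
        have h := hproj _ hχ'.1 fun j => memLp_hw_of_test hcp hχ'.1.wd.continuous hχ'.wd.2
        have e1 : ∀ j z, hw (-Ψ) z * b j z * (dd j χ z * gw Ψ z)
            = b j z * conj (hw Ψ z * dbar j (fun z => conj (χ z)) z) := fun j z => by
          rw [map_mul, conj_hw, dbar_conj (hχ.1.dAt z), Complex.conj_conj, ← hw_mul_hw]
          linear_combination (b j z * dd j χ z * hw Ψ z) * hw_neg_mul Ψ z
        simp_rw [e1]
        rw [h]
        have e2 : ∀ j, ∫ z, conj (η j z) * conj (dbar j (fun z => conj (χ z)) z)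
            = - ∫ z, χ z * conj (dbar j (η j) z) := fun j => by
          have := integral_mul_dbar (s := -Complex.I) (j := j) (hη j).1.conj_comp hχ
          simp_rw [dd_conj ((hη j).1.dAt _)] at this
          rw [← this]
          simp_rw [dbar_conj (hχ.1.dAt _), Complex.conj_conj]
        simp_rw [e2]
        rw [Finset.sum_neg_distrib, ← integral_finsetSum]
        · congr 2; funext z
          rw [map_sum, Finset.sum_mul, Finset.sum_mul]
          refine Finset.sum_congr rfl fun j _ => ?_
          linear_combination (-conj (dbar j (η j) z) * χ z) * gw_neg_mul Ψ z
        · exact fun j _ => (hχ.1.continuous.mul (Complex.continuous_conj.comp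
            (hη j).1.wd.continuous)).integrable_of_hasCompactSupport hχ.2.mul_right)
      (by
        intro j k χ hχ
        have := hbT _ ⟨j, k, χ, hχ, rfl⟩
        rw [hTsum b hb j k χ hχ] at this
        exact sub_eq_zero.1 this)
    simp_rw [eb0, eh0] at key
    rw [hproj w hw0 hα, ← norm_toLp_sq hrm, ← hrr] at key
    rw [hinner, norm_neg]
    convert key using 2
    rw [← Complex.norm_conj, map_sum]
    congr 1
    refine Finset.sum_congr rfl fun j _ => ?_
    rw [← integral_conj]
    simp_rw [map_mul]

lemma continuous_levi {Ψ : Cn n → ℝ} (h : ContDiff ℝ ∞ Ψ) {β : Fin n → Cn n → ℂ}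
    (hβ : ∀ j, Continuous (β j)) : Continuous fun z => levi Ψ z fun j => β j z := by
  have h1 : ∀ j k, Continuous (dd j (dbar k (cst Ψ))) := fun j k => h.cst.wd.wd.continuous
  unfold levi
  fun_prop

/-- The a priori estimate follows from a pointwise lower bound of the Levi form. -/
lemma APriori.of_levi {Ψ : Cn n → ℝ} (h : ContDiff ℝ ∞ Ψ) {α : Fin n → Cn n → ℂ} {s : Cn n → ℝ}
    (hl : ∀ z b, 0 ≤ levi Ψ z b) (hs0 : ∀ z, 0 ≤ s z)
    (hs : Integrable fun z => s z * Real.exp (-Ψ z))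
    (hb : ∀ z b, ‖∑ j, b j * conj (α j z)‖ ^ 2 ≤ levi Ψ z b * s z) :
    APriori Ψ α (∫ z, s z * Real.exp (-Ψ z)) := by
  intro β hβ
  have hi : Integrable fun z => levi Ψ z (fun j => β j z) * Real.exp (-Ψ z) := by
    refine ((continuous_levi h fun j => (hβ j).1.continuous).mul
      (Real.continuous_exp.comp h.continuous.neg)).integrable_of_hasCompactSupport ?_
    refine HasCompactSupport.mul_right ?_
    have hc : IsCompact (⋃ j, tsupport (β j)) := isCompact_iUnion fun j => (hβ j).2
    refine HasCompactSupport.intro hc fun z hz => ?_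
    have : ∀ j, β j z = 0 := fun j =>
      image_eq_zero_of_notMem_tsupport fun h => hz (Set.mem_iUnion.2 ⟨j, h⟩)
    simp [levi, this]
  set L := ∫ z, levi Ψ z (fun j => β j z) * Real.exp (-Ψ z) with hL
  set S := ∫ z, s z * Real.exp (-Ψ z) with hS
  set N := ‖∫ z, (∑ j, β j z * conj (α j z)) * gw Ψ z‖ with hN
  have hS0 : 0 ≤ S := integral_nonneg fun z => mul_nonneg (hs0 z) (Real.exp_pos _).le
  have hL0 : 0 ≤ L := integral_nonneg fun z => mul_nonneg (hl z _) (Real.exp_pos _).le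
  have hN0 : 0 ≤ N := norm_nonneg _
  have hNc : ∀ c : ℝ, 2 * c * N ≤ c ^ 2 * L + S := by
    intro c
    rcases le_or_gt c 0 with hc | hc
    · have : 0 ≤ c ^ 2 * L := by positivity
      nlinarith [mul_nonneg_of_nonpos_of_nonpos hc (neg_nonpos.2 hN0)]
    rw [hL, hS, ← integral_const_mul, ← integral_add (hi.const_mul _) hs]
    have h2 : N ≤ ∫ z, (1 / (2 * c)) * (c ^ 2 * (levi Ψ z (fun j => β j z) * Real.exp (-Ψ z))
        + s z * Real.exp (-Ψ z)) := by
      refine norm_integral_le_of_norm_le (((hi.const_mul _).add hs).const_mul _)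
        (ae_of_all _ fun z => ?_)
      have e0 : ‖gw Ψ z‖ = Real.exp (-Ψ z) := by
        simp only [gw]; rw [Complex.norm_real, Real.norm_of_nonneg (Real.exp_pos _).le]
      rw [norm_mul, e0, show (1 / (2 * c)) * (c ^ 2 * (levi Ψ z (fun j => β j z) * Real.exp (-Ψ z))
        + s z * Real.exp (-Ψ z)) = ((1 / (2 * c)) * (c ^ 2 * (levi Ψ z (fun j => β j z))
        + s z)) * Real.exp (-Ψ z) by ring]
      refine mul_le_mul_of_nonneg_right ?_ (Real.exp_pos _).le
      have h3 := hb z fun j => β j z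
      rw [one_div_mul_eq_div, le_div_iff₀ (by positivity)]
      set p := ‖∑ j, β j z * conj (α j z)‖
      set l := levi Ψ z fun j => β j z
      have hl0 : 0 ≤ l := hl z _
      have hs00 := hs0 z
      refine abs_le_of_sq_le_sq' ?_ (by positivity) |>.2
      nlinarith [sq_nonneg (c ^ 2 * l - s z), mul_le_mul_of_nonneg_left h3 (sq_nonneg c)]
    rw [integral_const_mul, one_div_mul_eq_div, le_div_iff₀ (by positivity)] at h2
    linarith
  have hd : N ^ 2 ≤ S * L := by
    have := discrim_le_zero (a := L) (b := -2 * N) (c := S) fun c => by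
      have := hNc c; nlinarith
    rw [discrim] at this
    nlinarith
  exact hd.trans (mul_le_mul_of_nonneg_left (basic_inequality h (fun j => (hβ j).1) fun j => (hβ j).2)
    hS0)

lemma levi_add {Ψ₁ Ψ₂ : Cn n → ℝ} (h₁ : ContDiff ℝ ∞ Ψ₁) (h₂ : ContDiff ℝ ∞ Ψ₂) (z : Cn n)
    (b : Fin n → ℂ) : levi (fun z => Ψ₁ z + Ψ₂ z) z b = levi Ψ₁ z b + levi Ψ₂ z b := by
  have e : ∀ k, dbar k (cst fun z => Ψ₁ z + Ψ₂ z) = fun z =>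
      dbar k (cst Ψ₁) z + dbar k (cst Ψ₂) z := fun k => by
    funext z
    rw [← wd_add (h₁.cst.dAt z) (h₂.cst.dAt z)]
    congr 1; funext y; simp [cst]
  simp only [levi, e, ← Complex.add_re, ← Finset.sum_add_distrib]
  congr 1
  refine Finset.sum_congr rfl fun j _ => Finset.sum_congr rfl fun k _ => ?_
  rw [wd_add (h₁.cst.wd.dAt z) (h₂.cst.wd.dAt z)]
  ring

/-- The squared Euclidean norm. -/
def nsq (z : Cn n) : ℝ := ∑ j, ‖z j‖ ^ 2

lemma contDiff_nsq : ContDiff ℝ ∞ (nsq (n := n)) := contDiff_sum_sq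

lemma nsq_nonneg (z : Cn n) : 0 ≤ nsq z := Finset.sum_nonneg fun _ _ => by positivity

lemma norm_sq_le_nsq (z : Cn n) : ‖z‖ ^ 2 ≤ nsq z := by
  have h1 : ‖z‖ ≤ Real.sqrt (nsq z) := (pi_norm_le_iff_of_nonneg (Real.sqrt_nonneg _)).2 fun j =>
    Real.le_sqrt_of_sq_le (Finset.single_le_sum (f := fun j => ‖z j‖ ^ 2)
      (fun _ _ => by positivity) (Finset.mem_univ j))
  calc ‖z‖ ^ 2 ≤ Real.sqrt (nsq z) ^ 2 := by gcongr
    _ = nsq z := Real.sq_sqrt (nsq_nonneg z)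

lemma nsq_le (z : Cn n) : nsq z ≤ n * ‖z‖ ^ 2 := by
  have : nsq z ≤ ∑ _j : Fin n, ‖z‖ ^ 2 := Finset.sum_le_sum fun j _ => by
    gcongr; exact norm_le_pi_norm z j
  simpa using this

lemma wd_coord {s : ℂ} {j k : Fin n} {z : Cn n} :
    wd s j (fun y : Cn n => y k) z = if k = j then (1 / 2) * (1 + s * Complex.I) else 0 := by
  have h : fderiv ℝ (fun y : Cn n => y k) z = ContinuousLinearMap.proj (R := ℝ) (φ := fun _ => ℂ) k :=
    (ContinuousLinearMap.proj (R := ℝ) (φ := fun _ => ℂ) k).hasFDerivAt.fderiv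
  rw [wd, h]
  by_cases hkj : k = j
  · subst hkj; simp [eb]
  · simp [eb, hkj]

lemma differentiableAt_coord (k : Fin n) (z : Cn n) : DifferentiableAt ℝ (fun y : Cn n => y k) z :=
  differentiableAt_apply k z

lemma cst_nsq : cst (nsq (n := n)) = fun z => ∑ j, z j * conj (z j) := by
  funext z
  simp [cst, nsq, Complex.mul_conj, Complex.normSq_eq_norm_sq]

lemma differentiableAt_conj_coord (k : Fin n) (z : Cn n) :
    DifferentiableAt ℝ (fun y : Cn n => conj (y k)) z :=
  (Complex.conjCLE.differentiableAt).comp z (differentiableAt_coord k z)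

lemma dbar_nsq (k : Fin n) (z : Cn n) : dbar k (cst nsq) z = z k := by
  have hd : ∀ i ∈ Finset.univ, DifferentiableAt ℝ (fun y : Cn n => y i * conj (y i)) z :=
    fun i _ => (differentiableAt_coord i z).mul (differentiableAt_conj_coord i z)
  rw [cst_nsq, wd_sum hd]
  simp_rw [wd_mul (differentiableAt_coord _ z) (differentiableAt_conj_coord _ z),
    dbar_conj (differentiableAt_coord _ z), wd_coord]
  rw [Finset.sum_eq_single k]
  · have h2 : conj (2 : ℂ) = 2 := Complex.conj_ofReal 2
    simp only [if_true, map_mul, map_div₀, map_one, h2, map_add, map_neg, Complex.conj_I]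
    linear_combination (1 / 2) * (conj (z k) - z k) * Complex.I_mul_I
  · intro i _ hi; simp [hi]
  · simp

lemma dd_nsq (k : Fin n) (z : Cn n) : dd k (cst nsq) z = conj (z k) := by
  rw [← dbar_nsq k z, ← dd_conj (contDiff_nsq.cst.dAt z)]
  congr 1; funext y; simp [cst]

/-- The Levi form of a radial function. -/
lemma levi_radial {h h' h'' : ℝ → ℝ} (h1 : ∀ x, 0 ≤ x → HasDerivAt h (h' x) x)
    (h2 : ∀ x, 0 ≤ x → HasDerivAt h' (h'' x) x) (z : Cn n) (b : Fin n → ℂ) :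
    levi (fun z => h (nsq z)) z b = h'' (nsq z) * ‖∑ j, b j * conj (z j)‖ ^ 2
      + h' (nsq z) * ∑ j, ‖b j‖ ^ 2 := by
  have hd : ∀ z, DifferentiableAt ℝ (nsq (n := n)) z := fun z => contDiff_nsq.differentiable (by simp) z
  have e1 : ∀ k, dbar k (cst fun z : Cn n => h (nsq z)) = fun z => ((h' (nsq z) : ℝ) : ℂ) * z k := by
    intro k; funext z
    rw [wd_comp_real (h1 _ (nsq_nonneg z)) (hd z)]
    rw [← dbar_nsq k z]
  have hd' : ∀ z, DifferentiableAt ℝ (fun z : Cn n => ((h' (nsq z) : ℝ) : ℂ)) z := fun z =>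
    Complex.ofRealCLM.differentiableAt.comp z
      ((h2 _ (nsq_nonneg z)).differentiableAt.comp z (hd z))
  have e2 : ∀ j k, dd j (fun z : Cn n => ((h' (nsq z) : ℝ) : ℂ) * z k) z
      = h'' (nsq z) * conj (z j) * z k + h' (nsq z) * (if k = j then 1 else 0) := by
    intro j k
    rw [wd_mul (hd' z) (differentiableAt_coord k z), wd_comp_real (h2 _ (nsq_nonneg z)) (hd z),
      show wd (-Complex.I) j (fun y : Cn n => (nsq y : ℂ)) z = conj (z j) from dd_nsq j z, wd_coord]
    congr 2
    by_cases hkj : k = j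
    · simp [hkj]; norm_num
    · simp [hkj]
  simp only [levi, e1, e2]
  have e3 : ∑ j, ∑ k, ((h'' (nsq z) : ℂ) * conj (z j) * z k
        + h' (nsq z) * (if k = j then 1 else 0)) * b j * conj (b k)
      = h'' (nsq z) * ((∑ j, b j * conj (z j)) * conj (∑ j, b j * conj (z j)))
        + h' (nsq z) * ∑ j, b j * conj (b j) := by
    simp_rw [add_mul, Finset.sum_add_distrib]
    congr 1
    · rw [map_sum, Finset.sum_mul_sum, Finset.mul_sum]
      refine Finset.sum_congr rfl fun j _ => ?_
      rw [Finset.mul_sum]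
      refine Finset.sum_congr rfl fun k _ => ?_
      rw [map_mul, Complex.conj_conj]; ring
    · rw [Finset.mul_sum]
      refine Finset.sum_congr rfl fun j _ => ?_
      rw [Finset.sum_eq_single j]
      · simp; ring
      · intro k _ hk; simp [hk]
      · simp
  rw [e3, Complex.mul_conj]
  simp_rw [Complex.mul_conj, Complex.normSq_eq_norm_sq]
  rw [← Complex.ofReal_sum, ← Complex.ofReal_mul, ← Complex.ofReal_mul, ← Complex.ofReal_add,
    Complex.ofReal_re]

/-- The logarithmic variable `t = log (1 + 1 / (x + e))` of the twisting functions. -/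
def tf (e x : ℝ) : ℝ := Real.log (x + e + 1) - Real.log (x + e)

/-- An increasing concave bounded function. -/
def sf (a t : ℝ) : ℝ := a * (1 - Real.exp (-t / a))

/-- The function `s + 2 - e^{-s}`. -/
def gf (s : ℝ) : ℝ := s + 2 - Real.exp (-s)

/-- The twisting function. -/
def lam (a t : ℝ) : ℝ := -Real.log (gf (sf a t))

/-- The derivative of `lam`. -/
def lam1 (a t : ℝ) : ℝ := -((1 + Real.exp (-sf a t)) * Real.exp (-t / a) / gf (sf a t))

/-- The gain `lam'' - lam' ^ 2` of the twisting function. -/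
def gain (a t : ℝ) : ℝ :=
  (Real.exp (-sf a t) * Real.exp (-t / a) ^ 2 + (1 + Real.exp (-sf a t)) * Real.exp (-t / a) / a)
    / gf (sf a t)

lemma hasDerivAt_tf {e x : ℝ} (he : 0 < e) (hx : 0 ≤ x) :
    HasDerivAt (tf e) (1 / (x + e + 1) - 1 / (x + e)) x := by
  have h1 : HasDerivAt (fun x : ℝ => x + e + 1) 1 x := ((hasDerivAt_id x).add_const e).add_const 1
  have h2 : HasDerivAt (fun x : ℝ => x + e) 1 x := (hasDerivAt_id x).add_const e
  exact (h1.log (by positivity)).sub (h2.log (by positivity))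

lemma hasDerivAt_tf_deriv {e x : ℝ} (he : 0 < e) (hx : 0 ≤ x) :
    HasDerivAt (fun x => 1 / (x + e + 1) - 1 / (x + e))
      (1 / (x + e) ^ 2 - 1 / (x + e + 1) ^ 2) x := by
  have h1 : HasDerivAt (fun x : ℝ => x + e + 1) 1 x := ((hasDerivAt_id x).add_const e).add_const 1
  have h2 : HasDerivAt (fun x : ℝ => x + e) 1 x := (hasDerivAt_id x).add_const e
  have h3 := (h1.fun_inv (by positivity)).sub (h2.fun_inv (by positivity))
  simp only [one_div]
  exact h3.congr_deriv (by ring)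

lemma tf_nonneg {e x : ℝ} (he : 0 < e) (hx : 0 ≤ x) : 0 ≤ tf e x :=
  sub_nonneg.2 (Real.log_le_log (by positivity) (by linarith))

lemma exp_tf {e x : ℝ} (he : 0 < e) (hx : 0 ≤ x) : Real.exp (tf e x) = (x + e + 1) / (x + e) := by
  rw [tf, Real.exp_sub, Real.exp_log (by positivity), Real.exp_log (by positivity)]

lemma hasDerivAt_sf {a : ℝ} (ha : 1 ≤ a) (t : ℝ) : HasDerivAt (sf a) (Real.exp (-t / a)) t := by
  have h1 : HasDerivAt (fun t : ℝ => -t / a) (-1 / a) t := (hasDerivAt_id t).neg.div_const a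
  have h := (h1.exp.const_sub 1).const_mul a
  exact h.congr_deriv (by have : a ≠ 0 := by positivity
                          field_simp)

lemma hasDerivAt_gf (s : ℝ) : HasDerivAt gf (1 + Real.exp (-s)) s := by
  have h1 : HasDerivAt (fun t : ℝ => -t) (-1) s := hasDerivAt_neg s
  have h := ((hasDerivAt_id s).add_const (2 : ℝ)).sub h1.exp
  exact h.congr_deriv (by ring)

lemma exp_neg_div_le_one {a t : ℝ} (ha : 1 ≤ a) (ht : 0 ≤ t) : Real.exp (-t / a) ≤ 1 :=
  Real.exp_le_one_iff.2 (div_nonpos_of_nonpos_of_nonneg (by linarith) (by linarith))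

lemma sf_nonneg {a t : ℝ} (ha : 1 ≤ a) (ht : 0 ≤ t) : 0 ≤ sf a t :=
  mul_nonneg (by linarith) (sub_nonneg.2 (exp_neg_div_le_one ha ht))

lemma sf_le {a t : ℝ} (ha : 1 ≤ a) : sf a t ≤ a := by
  have := Real.exp_pos (-t / a)
  unfold sf; nlinarith

lemma sf_le_self {a t : ℝ} (ha : 1 ≤ a) : sf a t ≤ t := by
  have h := Real.add_one_le_exp (-t / a)
  have h2 : a * (1 - Real.exp (-t / a)) ≤ a * (t / a) := by
    refine mul_le_mul_of_nonneg_left ?_ (by linarith)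
    rw [neg_div] at h ⊢; linarith
  rwa [mul_div_cancel₀ _ (by positivity)] at h2

lemma one_le_gf {s : ℝ} (hs : 0 ≤ s) : 1 ≤ gf s := by
  have : Real.exp (-s) ≤ 1 := Real.exp_le_one_iff.2 (by linarith)
  unfold gf; linarith

lemma gf_le {s : ℝ} : gf s ≤ s + 2 := by
  have := Real.exp_pos (-s)
  unfold gf; linarith

lemma gf_sf_pos {a t : ℝ} (ha : 1 ≤ a) (ht : 0 ≤ t) : 0 < gf (sf a t) :=
  lt_of_lt_of_le one_pos (one_le_gf (sf_nonneg ha ht))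

lemma hasDerivAt_lam {a t : ℝ} (ha : 1 ≤ a) (ht : 0 ≤ t) : HasDerivAt (lam a) (lam1 a t) t :=
  (((hasDerivAt_gf (sf a t)).comp t (hasDerivAt_sf ha t)).log (gf_sf_pos ha ht).ne').neg

lemma hasDerivAt_lam1 {a t : ℝ} (ha : 1 ≤ a) (ht : 0 ≤ t) :
    HasDerivAt (lam1 a) (gain a t + lam1 a t ^ 2) t := by
  have hs := hasDerivAt_sf ha t
  have h1 : HasDerivAt (fun t : ℝ => -t / a) (-1 / a) t := (hasDerivAt_id t).neg.div_const a
  have hg := (hasDerivAt_gf (sf a t)).comp t hs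
  have h := (((hs.fun_neg.exp.const_add 1).mul h1.exp).div hg (gf_sf_pos ha ht).ne').neg
  have hp := (gf_sf_pos ha ht).ne'
  have ha0 : a ≠ 0 := by positivity
  refine h.congr_deriv ?_
  simp only [gain, lam1, Function.comp_apply, Pi.mul_apply]
  field_simp
  ring

lemma exp_lam {a t : ℝ} (ha : 1 ≤ a) (ht : 0 ≤ t) : Real.exp (lam a t) = 1 / gf (sf a t) := by
  rw [lam, Real.exp_neg, Real.exp_log (gf_sf_pos ha ht), one_div]

lemma lam_nonpos {a t : ℝ} (ha : 1 ≤ a) (ht : 0 ≤ t) : lam a t ≤ 0 :=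
  neg_nonpos.2 (Real.log_nonneg (one_le_gf (sf_nonneg ha ht)))

lemma exp_neg_sf_le_one {a t : ℝ} (ha : 1 ≤ a) (ht : 0 ≤ t) : Real.exp (-sf a t) ≤ 1 :=
  Real.exp_le_one_iff.2 (by linarith [sf_nonneg ha ht])

lemma lam1_nonpos {a t : ℝ} (ha : 1 ≤ a) (ht : 0 ≤ t) : lam1 a t ≤ 0 := by
  have := gf_sf_pos ha ht
  exact neg_nonpos.2 (by positivity)

lemma neg_two_le_lam1 {a t : ℝ} (ha : 1 ≤ a) (ht : 0 ≤ t) : -2 ≤ lam1 a t := by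
  have h1 := one_le_gf (sf_nonneg ha ht)
  have h2 := exp_neg_sf_le_one ha ht
  have h3 := exp_neg_div_le_one ha ht
  refine neg_le_neg ((div_le_iff₀ (gf_sf_pos ha ht)).2 ?_)
  nlinarith [Real.exp_pos (-sf a t), Real.exp_pos (-t / a)]

lemma gain_pos {a t : ℝ} (ha : 1 ≤ a) (ht : 0 ≤ t) : 0 < gain a t := by
  have := gf_sf_pos ha ht
  unfold gain; positivity

/-- The lower bound for the gained coefficient. -/
lemma coefficient_bound {a t : ℝ} (ha : 1 ≤ a) (ht : 0 ≤ t) :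
    (Real.exp (-sf a t) * Real.exp (-t / a) + 1 / a) / 12
      ≤ gain a t * Real.exp (lam a t) / (gain a t + lam1 a t ^ 2) := by
  have hG := gf_sf_pos ha ht
  have hg := gain_pos ha ht
  have ha0 : 0 < a := by linarith
  rw [exp_lam ha ht, le_div_iff₀ (by positivity)]
  have h2 := exp_neg_sf_le_one ha ht
  have h3 := exp_neg_div_le_one ha ht
  have hG2 : gf (sf a t) ≤ sf a t + 2 := gf_le
  have hG3 : gf (sf a t) ≤ 3 * a := by linarith [sf_le (t := t) ha]
  have h5 : Real.exp (-sf a t) * (sf a t + 2) ≤ 2 := by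
    have h6 := Real.add_one_le_exp (sf a t)
    have h7 := sf_nonneg ha ht
    rw [Real.exp_neg, inv_mul_le_iff₀ (Real.exp_pos _)]
    linarith
  unfold gain lam1
  set G := gf (sf a t)
  set p := Real.exp (-sf a t)
  set q := Real.exp (-t / a)
  have hp : 0 < p := Real.exp_pos _
  have hq : 0 < q := Real.exp_pos _
  have h8 : p * G ≤ 2 := (mul_le_mul_of_nonneg_left hG2 hp.le).trans h5
  have h9 : G / a ≤ 3 := (div_le_iff₀ ha0).2 hG3
  have e1 : (p * q + 1 / a) / 12 * ((p * q ^ 2 + (1 + p) * q / a) / G + (-((1 + p) * q / G)) ^ 2)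
      = (p * q + 1 / a) * (q * (q * (p * G) + (1 + p) * (G / a) + (1 + p) ^ 2 * q)) / (12 * G ^ 2) := by
    field_simp
  have e2 : (p * q ^ 2 + (1 + p) * q / a) / G * (1 / G)
      = q * (12 * (p * q + (1 + p) / a)) / (12 * G ^ 2) := by
    field_simp
  rw [e1, e2]
  refine div_le_div_of_nonneg_right ?_ (by positivity)
  have h10 : q * (p * G) + (1 + p) * (G / a) + (1 + p) ^ 2 * q ≤ 12 := by
    have : q * (p * G) ≤ 1 * 2 := by gcongr
    have : (1 + p) * (G / a) ≤ (1 + 1) * 3 := by gcongr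
    have : (1 + p) ^ 2 * q ≤ (1 + 1) ^ 2 * 1 := by gcongr
    linarith
  have h11 : 1 / a ≤ (1 + p) / a := by gcongr; linarith
  calc (p * q + 1 / a) * (q * (q * (p * G) + (1 + p) * (G / a) + (1 + p) ^ 2 * q))
      ≤ (p * q + (1 + p) / a) * (q * 12) := by gcongr
    _ = _ := by ring

lemma coefficient_bound_exp {a t : ℝ} (ha : 1 ≤ a) (ht : 0 ≤ t) :
    Real.exp (-t) / 36 ≤ gain a t * Real.exp (lam a t) / (gain a t + lam1 a t ^ 2) := by
  refine le_trans ?_ (coefficient_bound ha ht)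
  have ha0 : 0 < a := by linarith
  have hp := Real.exp_pos (-sf a t)
  have hq := Real.exp_pos (-t / a)
  have : Real.exp (-t) ≤ 3 * (Real.exp (-sf a t) * Real.exp (-t / a) + 1 / a) := by
    rcases le_or_gt t a with h | h
    · have h1 : Real.exp (-t) ≤ Real.exp (-sf a t) := Real.exp_le_exp.2 (by linarith [sf_le_self (t := t) ha])
      have h2 : Real.exp (-1) ≤ Real.exp (-t / a) := Real.exp_le_exp.2 (by
        rw [neg_div]; exact neg_le_neg ((div_le_one ha0).2 h))
      have h3 : 1 ≤ 3 * Real.exp (-1) := by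
        rw [Real.exp_neg, ← div_eq_mul_inv, one_le_div (Real.exp_pos _)]
        exact Real.exp_one_lt_three.le
      have h4 : 0 < 1 / a := by positivity
      nlinarith
    · have h1 : Real.exp (-t) ≤ 1 / a := by
        rw [Real.exp_neg, ← one_div]
        exact one_div_le_one_div_of_le ha0 (by linarith [Real.add_one_le_exp t])
      have h4 : 0 < 1 / a := by positivity
      nlinarith [mul_pos hp hq]
  linarith

lemma coefficient_bound_inv {a t : ℝ} (ha : 1 ≤ a) (ht : 0 ≤ t) :
    1 / (12 * a) ≤ gain a t * Real.exp (lam a t) / (gain a t + lam1 a t ^ 2) := by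
  refine le_trans ?_ (coefficient_bound ha ht)
  have hp := Real.exp_pos (-sf a t)
  have hq := Real.exp_pos (-t / a)
  rw [one_div, mul_inv]
  have := mul_pos hp hq
  rw [div_eq_inv_mul, one_div]
  nlinarith

lemma cost_bound {a t : ℝ} (ha : 1 ≤ a) (ht : 0 ≤ t) (ht2 : t ≤ 2 * a) :
    Real.exp (lam a t) / gain a t ≤ 9 * a := by
  have hG := gf_sf_pos ha ht
  have ha0 : 0 < a := by linarith
  rw [exp_lam ha ht, div_le_iff₀ (gain_pos ha ht), gain]
  have hp := Real.exp_pos (-sf a t)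
  have hq : 1 ≤ 9 * Real.exp (-t / a) := by
    have h2 : Real.exp (-2) ≤ Real.exp (-t / a) := Real.exp_le_exp.2 (by
      rw [neg_div]; exact neg_le_neg ((div_le_iff₀ ha0).2 ht2))
    have h3 : 1 ≤ 9 * Real.exp (-2) := by
      rw [Real.exp_neg, ← div_eq_mul_inv, one_le_div (Real.exp_pos _),
        show (2 : ℝ) = 1 + 1 by norm_num, Real.exp_add]
      nlinarith [Real.exp_one_lt_three, Real.exp_pos 1]
    linarith
  rw [← mul_div_assoc]
  refine div_le_div_of_nonneg_right ?_ hG.le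
  have hq0 := Real.exp_pos (-t / a)
  have e : 9 * a * (Real.exp (-sf a t) * Real.exp (-t / a) ^ 2
      + (1 + Real.exp (-sf a t)) * Real.exp (-t / a) / a)
      = 9 * a * (Real.exp (-sf a t) * Real.exp (-t / a) ^ 2)
        + 9 * (1 + Real.exp (-sf a t)) * Real.exp (-t / a) := by field_simp
  rw [e]
  have : 0 ≤ 9 * a * (Real.exp (-sf a t) * Real.exp (-t / a) ^ 2) := by positivity
  nlinarith [mul_pos hp hq0]

/-- Completion of the square for the twisted estimate. -/
lemma twist_square {V l D : ℝ} {u : ℂ} (hD : 0 < D) :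
    ‖(V : ℂ) + u * l‖ ^ 2 / (D + l ^ 2) ≤
      ‖u‖ ^ 2 - ‖u‖ ^ 2 * (D / (D + l ^ 2)) / 2 + 2 * V ^ 2 / D := by
  have hL : 0 < D + l ^ 2 := by positivity
  have h1 : ‖(V : ℂ) + u * l‖ ≤ |V| + ‖u‖ * |l| := by
    refine (norm_add_le _ _).trans ?_
    rw [norm_mul, Complex.norm_real, Complex.norm_real, Real.norm_eq_abs, Real.norm_eq_abs]
  have h2 : ‖(V : ℂ) + u * l‖ ^ 2 ≤ (|V| + ‖u‖ * |l|) ^ 2 := by gcongr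
  rw [div_le_iff₀ hL]
  refine h2.trans ?_
  have e : (‖u‖ ^ 2 - ‖u‖ ^ 2 * (D / (D + l ^ 2)) / 2 + 2 * V ^ 2 / D) * (D + l ^ 2)
      = (|V| + ‖u‖ * |l|) ^ 2 + (V ^ 2 + (D * ‖u‖ - 2 * |V| * |l|) ^ 2 / (2 * D)) := by
    have hv : V ^ 2 = |V| ^ 2 := (sq_abs V).symm
    have hl : l ^ 2 = |l| ^ 2 := (sq_abs l).symm
    rw [hl] at hL ⊢
    rw [hv]
    field_simp
    ring
  rw [e]
  have : 0 ≤ V ^ 2 + (D * ‖u‖ - 2 * |V| * |l|) ^ 2 / (2 * D) := by positivity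
  linarith

/-- The twisting weight. -/
def psi (a e : ℝ) (z : Cn n) : ℝ := lam a (tf e (nsq z))

/-- The singular auxiliary weight, regularized at scale `e`. -/
def aux (e : ℝ) (z : Cn n) : ℝ := n * Real.log (nsq z + e) + 4 * nsq z

lemma contDiff_tf_nsq {e : ℝ} (he : 0 < e) : ContDiff ℝ ∞ fun z : Cn n => tf e (nsq z) := by
  unfold tf
  refine ContDiff.sub (ContDiff.log ((contDiff_nsq.add contDiff_const).add contDiff_const) fun z => ?_)
    (ContDiff.log (contDiff_nsq.add contDiff_const) fun z => ?_) <;>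
  · have := nsq_nonneg z
    positivity

lemma contDiff_psi {a e : ℝ} (ha : 1 ≤ a) (he : 0 < e) : ContDiff ℝ ∞ (psi (n := n) a e) := by
  have ht := contDiff_tf_nsq (n := n) he
  have hs : ContDiff ℝ ∞ fun z : Cn n => sf a (tf e (nsq z)) :=
    contDiff_const.mul (contDiff_const.sub (Real.contDiff_exp.comp (ht.neg.div_const a)))
  have hg : ContDiff ℝ ∞ fun z : Cn n => gf (sf a (tf e (nsq z))) :=
    (hs.add contDiff_const).sub (Real.contDiff_exp.comp hs.neg)
  exact (hg.log fun z => (gf_sf_pos ha (tf_nonneg he (nsq_nonneg z))).ne').neg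

lemma contDiff_aux {e : ℝ} (he : 0 < e) : ContDiff ℝ ∞ (aux (n := n) e) := by
  refine (contDiff_const.mul (ContDiff.log (contDiff_nsq.add contDiff_const) fun z => ?_)).add
    (contDiff_const.mul contDiff_nsq)
  have := nsq_nonneg z
  positivity

/-- The derivative of `tf e`. -/
def tf1 (e x : ℝ) : ℝ := 1 / (x + e + 1) - 1 / (x + e)

lemma norm_sum_mul_conj_sq_le (z : Cn n) (b : Fin n → ℂ) :
    ‖∑ j, b j * conj (z j)‖ ^ 2 ≤ nsq z * ∑ j, ‖b j‖ ^ 2 := by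
  have h : ‖∑ j, b j * conj (z j)‖ ≤ ∑ j, ‖b j‖ * ‖z j‖ :=
    (norm_sum_le _ _).trans_eq (Finset.sum_congr rfl fun j _ => by rw [norm_mul, RCLike.norm_conj])
  refine (pow_le_pow_left₀ (norm_nonneg _) h 2).trans ?_
  rw [mul_comm]
  exact Finset.sum_mul_sq_le_sq_mul_sq _ _ _

lemma le_levi_twisted {Φ : Cn n → ℝ} (hΦ : ContDiff ℝ ∞ Φ) (hl : ∀ z b, 0 ≤ levi Φ z b) {a e : ℝ}
    (ha : 1 ≤ a) (he : 0 < e) (z : Cn n) (b : Fin n → ℂ) :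
    (gain a (tf e (nsq z)) + lam1 a (tf e (nsq z)) ^ 2) * tf1 e (nsq z) ^ 2
      * ‖∑ j, b j * conj (z j)‖ ^ 2 ≤ levi (fun z => Φ z + aux e z + psi a e z) z b := by
  rw [levi_add (hΦ.add (contDiff_aux he)) (contDiff_psi ha he), levi_add hΦ (contDiff_aux he)]
  have h1 : levi (aux (n := n) e) z b
      = -(n * (1 / (nsq z + e) ^ 2)) * ‖∑ j, b j * conj (z j)‖ ^ 2
        + (n * (1 / (nsq z + e)) + 4) * ∑ j, ‖b j‖ ^ 2 := by
    refine levi_radial (h := fun x => n * Real.log (x + e) + 4 * x)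
      (h' := fun x => n * (1 / (x + e)) + 4) (h'' := fun x => -(n * (1 / (x + e) ^ 2)))
      (fun x hx => ?_) (fun x hx => ?_) z b
    · have h2 : HasDerivAt (fun x : ℝ => x + e) 1 x := (hasDerivAt_id x).add_const e
      exact ((((h2.log (by positivity)).const_mul (n : ℝ)).add
        ((hasDerivAt_id x).const_mul 4)).congr_deriv (by simp))
    · have h2 : HasDerivAt (fun x : ℝ => x + e) 1 x := (hasDerivAt_id x).add_const e
      simp only [one_div]
      exact (((h2.fun_inv (by positivity)).const_mul (n : ℝ)).add_const 4).congr_deriv (by ring)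
  have h2 : levi (psi (n := n) a e) z b
      = ((gain a (tf e (nsq z)) + lam1 a (tf e (nsq z)) ^ 2) * tf1 e (nsq z) * tf1 e (nsq z)
          + lam1 a (tf e (nsq z)) * (1 / (nsq z + e) ^ 2 - 1 / (nsq z + e + 1) ^ 2))
          * ‖∑ j, b j * conj (z j)‖ ^ 2
        + lam1 a (tf e (nsq z)) * tf1 e (nsq z) * ∑ j, ‖b j‖ ^ 2 := by
    refine levi_radial (h := fun x => lam a (tf e x))
      (h' := fun x => lam1 a (tf e x) * tf1 e x)
      (h'' := fun x => (gain a (tf e x) + lam1 a (tf e x) ^ 2) * tf1 e x * tf1 e x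
          + lam1 a (tf e x) * (1 / (x + e) ^ 2 - 1 / (x + e + 1) ^ 2))
      (fun x hx => ?_) (fun x hx => ?_) z b
    · exact (hasDerivAt_lam ha (tf_nonneg he hx)).comp x (hasDerivAt_tf he hx)
    · exact ((hasDerivAt_lam1 ha (tf_nonneg he hx)).comp x (hasDerivAt_tf he hx)).mul
        (hasDerivAt_tf_deriv he hx)
  rw [h1, h2]
  have hx := nsq_nonneg z
  have h3 := hl z b
  have h4 := norm_sum_mul_conj_sq_le z b
  have h5 := lam1_nonpos ha (tf_nonneg he hx)
  have h6 := neg_two_le_lam1 ha (tf_nonneg he hx)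
  set y := ‖∑ j, b j * conj (z j)‖ ^ 2
  set B := ∑ j, ‖b j‖ ^ 2
  have hB : 0 ≤ B := Finset.sum_nonneg fun _ _ => by positivity
  have hy : 0 ≤ y := by positivity
  set L := lam1 a (tf e (nsq z))
  set A := nsq z + e with hA
  have hA0 : 0 < A := by positivity
  have hyA : y ≤ A * B := h4.trans (by gcongr; linarith)
  have h7 : 0 ≤ -(n * (1 / A ^ 2)) * y + n * (1 / A) * B := by
    have : n * (1 / A ^ 2) * y ≤ n * (1 / A ^ 2) * (A * B) := by gcongr
    have e2 : n * (1 / A ^ 2) * (A * B) = n * (1 / A) * B := by field_simp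
    linarith
  have h8 : (1 / A ^ 2 - 1 / (A + 1) ^ 2) * y + tf1 e (nsq z) * B ≤ B := by
    have h9 : 0 ≤ 1 / A ^ 2 - 1 / (A + 1) ^ 2 :=
      sub_nonneg.2 (one_div_le_one_div_of_le (by positivity) (by gcongr; linarith))
    have h10 : (1 / A ^ 2 - 1 / (A + 1) ^ 2) * y ≤ (1 / A ^ 2 - 1 / (A + 1) ^ 2) * (A * B) := by
      gcongr
    have h11 : (1 / A ^ 2 - 1 / (A + 1) ^ 2) * (A * B) + tf1 e (nsq z) * B
        = B * (1 / (A + 1) ^ 2) := by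
      rw [tf1, ← hA]; field_simp; ring
    have h12 : 1 / (A + 1) ^ 2 ≤ 1 := by
      rw [div_le_one (by positivity)]; nlinarith
    nlinarith
  have h13 : -2 * B ≤ L * ((1 / A ^ 2 - 1 / (A + 1) ^ 2) * y + tf1 e (nsq z) * B) := by
    set q := (1 / A ^ 2 - 1 / (A + 1) ^ 2) * y + tf1 e (nsq z) * B
    nlinarith [mul_nonneg (neg_nonneg.2 h5) (sub_nonneg.2 h8), mul_nonneg hB (by linarith : 0 ≤ L + 2)]
  nlinarith

lemma dbar_comp_nsq {θ : ℝ → ℝ} {θ' : ℝ} {z : Cn n} (h : HasDerivAt θ θ' (nsq z)) (j : Fin n) :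
    dbar j (fun y => ((θ (nsq y) : ℝ) : ℂ)) z = θ' * z j := by
  rw [wd_comp_real h (contDiff_nsq.differentiable (by simp) z)]
  exact congrArg _ (dbar_nsq j z)

lemma norm_tf1_mul_le {e : ℝ} (he : 0 < e) (z : Cn n) (j : Fin n) :
    ‖((tf1 e (nsq z) : ℝ) : ℂ) * z j‖ ≤ 1 / e := by
  have hx := nsq_nonneg z
  have h1 : ‖z j‖ ^ 2 ≤ nsq z := (pow_le_pow_left₀ (norm_nonneg _) (norm_le_pi_norm z j) 2).trans
    (norm_sq_le_nsq z)
  have h2 : ‖z j‖ ≤ nsq z + e + 1 := by nlinarith [norm_nonneg (z j)]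
  have h3 : tf1 e (nsq z) = -(1 / ((nsq z + e) * (nsq z + e + 1))) := by
    rw [tf1]; field_simp; ring
  rw [norm_mul, Complex.norm_real, h3, norm_neg, Real.norm_of_nonneg (by positivity)]
  calc 1 / ((nsq z + e) * (nsq z + e + 1)) * ‖z j‖
      ≤ 1 / ((nsq z + e) * (nsq z + e + 1)) * (nsq z + e + 1) := by gcongr
    _ = 1 / (nsq z + e) := by field_simp
    _ ≤ 1 / e := one_div_le_one_div_of_le he (by linarith)

lemma tf_le {e x : ℝ} (he : 0 < e) (hx : 0 ≤ x) : tf e x ≤ 1 / (x + e) := by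
  have h := Real.add_one_le_exp (1 / (x + e))
  rw [← Real.exp_le_exp, exp_tf he hx]
  refine le_trans (le_of_eq ?_) h
  field_simp; ring

lemma hasCompactSupport_comp_tf {e a : ℝ} (ha : 1 ≤ a) (he : 0 < e) {V : ℝ → ℝ}
    (hV : ∀ t < a, V t = 0) :
    HasCompactSupport fun z : Cn n => ((V (tf e (nsq z)) : ℝ) : ℂ) := by
  refine HasCompactSupport.of_support_subset_isCompact (isCompact_closedBall (0 : Cn n) 1) ?_
  intro z hz
  by_contra hc
  rw [mem_closedBall_zero_iff, not_le] at hc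
  apply hz
  have h1 : 1 < nsq z := lt_of_lt_of_le (by nlinarith) (norm_sq_le_nsq z)
  have : tf e (nsq z) < a := lt_of_le_of_lt (tf_le he (nsq_nonneg z)) (lt_of_lt_of_le (by
    rw [div_lt_one (by linarith)]; linarith) ha)
  simp only [hV _ this, Complex.ofReal_zero]

lemma continuous_lam1_tf {a e : ℝ} (ha : 1 ≤ a) (he : 0 < e) :
    Continuous fun z : Cn n => lam1 a (tf e (nsq z)) := by
  have ht := (contDiff_tf_nsq (n := n) he).continuous
  have hc : ∀ z : Cn n, ContinuousAt (lam1 a) (tf e (nsq z)) := fun z =>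
    (hasDerivAt_lam1 ha (tf_nonneg he (nsq_nonneg z))).continuousAt
  exact continuous_iff_continuousAt.2 fun z =>
    ContinuousAt.comp (f := fun z : Cn n => tf e (nsq z)) (hc z) ht.continuousAt

lemma continuous_gain_tf {a e : ℝ} (ha : 1 ≤ a) (he : 0 < e) :
    Continuous fun z : Cn n => gain a (tf e (nsq z)) := by
  have ht := (contDiff_tf_nsq (n := n) he).continuous
  have hs : Continuous fun z : Cn n => sf a (tf e (nsq z)) := by unfold sf; fun_prop
  unfold gain
  refine Continuous.div (by fun_prop) (by unfold gf; fun_prop) fun z =>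
    (gf_sf_pos ha (tf_nonneg he (nsq_nonneg z))).ne'

/-- The twisted `L²` estimate for the Bergman projection of a radial cutoff. -/
theorem exists_entire_twisted {Φ : Cn n → ℝ} (hΦ : ContDiff ℝ ∞ Φ) (hl : ∀ z b, 0 ≤ levi Φ z b)
    {a e : ℝ} (ha : 1 ≤ a) (he : 0 < e) {V V' : ℝ → ℝ} (hV : ContDiff ℝ ∞ V)
    (hV' : ∀ t, HasDerivAt V (V' t) t) (hVs : ∀ t < a, V t = 0) (hVs' : ∀ t < a, V' t = 0)
    (hVc : Continuous V') :
    ∃ F : Cn n → ℂ, Differentiable ℂ F ∧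
      Integrable (fun z : Cn n => ‖(V (tf e (nsq z)) : ℂ) - F z‖ ^ 2 *
          (gain a (tf e (nsq z)) * Real.exp (psi a e z)
            / (gain a (tf e (nsq z)) + lam1 a (tf e (nsq z)) ^ 2)) * Real.exp (-(Φ z + aux e z))) ∧
      ∫ z : Cn n, ‖(V (tf e (nsq z)) : ℂ) - F z‖ ^ 2 *
          (gain a (tf e (nsq z)) * Real.exp (psi a e z)
            / (gain a (tf e (nsq z)) + lam1 a (tf e (nsq z)) ^ 2)) * Real.exp (-(Φ z + aux e z))
        ≤ 4 * ∫ z : Cn n, V' (tf e (nsq z)) ^ 2 *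
          (Real.exp (psi a e z) / gain a (tf e (nsq z))) * Real.exp (-(Φ z + aux e z)) := by
  set Φ₀ : Cn n → ℝ := fun z => Φ z + aux e z with hΦ₀
  have hΦ₀s : ContDiff ℝ ∞ Φ₀ := hΦ.add (contDiff_aux he)
  have hψ := contDiff_psi (n := n) ha he
  set ψ : Cn n → ℝ := psi a e with hψdef
  set Ψ : Cn n → ℝ := fun z => Φ₀ z + ψ z with hΨdef
  have hΨ : ContDiff ℝ ∞ Ψ := hΦ₀s.add hψ
  set T : Cn n → ℝ := fun z => tf e (nsq z) with hT
  have hT0 : ∀ z, 0 ≤ T z := fun z => tf_nonneg he (nsq_nonneg z)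
  have hTs : ContDiff ℝ ∞ T := contDiff_tf_nsq he
  have hTc := hTs.continuous
  set D : Cn n → ℝ := fun z => gain a (T z) with hD
  set L : Cn n → ℝ := fun z => lam1 a (T z) with hL
  have hDc : Continuous D := continuous_gain_tf ha he
  have hLc : Continuous L := continuous_lam1_tf ha he
  have hD0 : ∀ z, 0 < D z := fun z => gain_pos ha (hT0 z)
  have hψ0 : ∀ z, ψ z ≤ 0 := fun z => lam_nonpos ha (hT0 z)
  have hL2 : ∀ z, |L z| ≤ 2 := fun z => abs_le.2
    ⟨neg_two_le_lam1 ha (hT0 z), (lam1_nonpos ha (hT0 z)).trans (by norm_num)⟩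
  set v : Cn n → ℂ := fun z => ((V (T z) : ℝ) : ℂ) with hv
  have hvs : ContDiff ℝ ∞ v := Complex.ofRealCLM.contDiff.comp (hV.comp hTs)
  have hvm : MemLp (fun z => hw Φ₀ z * v z) 2 volume :=
    memLp_hw_of_test (continuous_hw hΦ₀s.continuous) hvs.continuous
      (hasCompactSupport_comp_tf ha he hVs)
  set v' : Cn n → ℂ := fun z => ((V' (T z) : ℝ) : ℂ) with hv'
  have hv'c : Continuous v' := Complex.continuous_ofReal.comp (hVc.comp hTc)
  have hv's : HasCompactSupport v' := hasCompactSupport_comp_tf ha he hVs'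
  have hv'm : MemLp (fun z => hw Φ₀ z * v' z) 2 volume :=
    memLp_hw_of_test (continuous_hw hΦ₀s.continuous) hv'c hv's
  obtain ⟨F, hF, hFm, horth⟩ := exists_bergman_proj hΦ₀s.continuous hvm
  have hFs := contDiff_of_entire hF
  set u : Cn n → ℂ := fun z => v z - F z with hu
  have hus : ContDiff ℝ ∞ u := hvs.sub hFs
  have huc := hus.continuous
  have hum : MemLp (fun z => hw Φ₀ z * u z) 2 volume := by
    refine (hvm.sub hFm).congr_norm ?_ (ae_of_all _ fun z => ?_)
    · exact ((continuous_hw hΦ₀s.continuous).mul huc).aestronglyMeasurable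
    · simp [hu, mul_sub]
  have hui : Integrable fun z => ‖u z‖ ^ 2 * Real.exp (-Φ₀ z) := by
    have := hum.integrable_norm_pow (p := 2) (by norm_num)
    simpa only [norm_hw_mul_sq] using this
  have hexp : ∀ z, Real.exp (ψ z) ≤ 1 := fun z => Real.exp_le_one_iff.2 (hψ0 z)
  have hsplit : ∀ z, Real.exp (-Ψ z) = Real.exp (-Φ₀ z) * Real.exp (-ψ z) := fun z => by
    rw [← Real.exp_add]; congr 1; simp only [hΨdef]; ring
  have hhw : ∀ z (c : ℂ), hw Ψ z * (c * gw (-ψ) z) = hw Φ₀ z * c * ((Real.exp (ψ z / 2) : ℝ) : ℂ) := by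
    intro z c
    have : hw Ψ z * gw (-ψ) z = hw Φ₀ z * ((Real.exp (ψ z / 2) : ℝ) : ℂ) := by
      simp only [gw, Pi.neg_apply, ← Complex.ofReal_mul, ← Real.exp_add]
      congr 2; simp only [hΨdef]; ring
    linear_combination c * this
  have hhalf : ∀ z, ‖((Real.exp (ψ z / 2) : ℝ) : ℂ)‖ ≤ 1 := fun z => by
    rw [Complex.norm_real, Real.norm_of_nonneg (Real.exp_pos _).le]
    exact Real.exp_le_one_iff.2 (by linarith [hψ0 z])
  have hgs : ContDiff ℝ ∞ (gw (-ψ)) := ContDiff.gw hψ.neg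
  set w : Cn n → ℂ := fun z => u z * gw (-ψ) z with hwdef
  have hws : ContDiff ℝ ∞ w := hus.mul hgs
  have hdw : ∀ j z, dbar j w z
      = (v' z + u z * L z) * (((tf1 e (nsq z) : ℝ) : ℂ) * z j) * gw (-ψ) z := by
    intro j z
    have h1 : dbar j v z = ((V' (T z) * tf1 e (nsq z) : ℝ) : ℂ) * z j :=
      dbar_comp_nsq (θ := fun x => V (tf e x)) ((hV' _).comp _ (hasDerivAt_tf he (nsq_nonneg z))) j
    have h2 : dbar j (cst ψ) z = ((lam1 a (T z) * tf1 e (nsq z) : ℝ) : ℂ) * z j :=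
      dbar_comp_nsq (θ := fun x => lam a (tf e x))
        ((hasDerivAt_lam ha (tf_nonneg he (nsq_nonneg z))).comp _ (hasDerivAt_tf he (nsq_nonneg z))) j
    rw [wd_mul (hus.dAt z) (hgs.dAt z), wd_sub (hvs.dAt z) (hFs.dAt z),
      dbar_eq_zero_of_differentiableAt (hF z), wd_exp hψ, h1, h2]
    simp only [hv', hL]
    push_cast
    ring
  have hwm : MemLp (fun z => hw Ψ z * w z) 2 volume := by
    refine hum.of_le ((continuous_hw hΨ.continuous).mul hws.continuous).aestronglyMeasurable
      (ae_of_all _ fun z => ?_)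
    rw [hwdef, hhw, norm_mul]
    exact mul_le_of_le_one_right (norm_nonneg _) (hhalf z)
  have hα : ∀ j, MemLp (fun z => hw Ψ z * dbar j w z) 2 volume := by
    intro j
    have hm : MemLp (fun z => hw Φ₀ z * v' z + (hw Φ₀ z * u z) * L z) 2 volume := by
      refine hv'm.add (hum.of_le_mul (c := 2) (hum.1.mul
        (Complex.continuous_ofReal.comp hLc).aestronglyMeasurable) (ae_of_all _ fun z => ?_))
      rw [norm_mul, mul_comm, Complex.norm_real, Real.norm_eq_abs]
      gcongr
      exact hL2 z
    refine hm.of_le_mul (c := 1 / e)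
      ((continuous_hw hΨ.continuous).mul hws.wd.continuous).aestronglyMeasurable
      (ae_of_all _ fun z => ?_)
    rw [hdw, hhw, norm_mul]
    refine (mul_le_of_le_one_right (norm_nonneg _) (hhalf z)).trans (le_of_eq_of_le ?_
      (mul_le_mul_of_nonneg_right (norm_tf1_mul_le he z j) (norm_nonneg _)))
    rw [← norm_mul]; congr 1; ring
  have ho : ∀ F' : Cn n → ℂ, Differentiable ℂ F' → MemLp (fun z => hw Ψ z * F' z) 2 volume →
      ∫ z, w z * conj (F' z) * gw Ψ z = 0 := by
    intro F' hF' hm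
    rw [← horth F' hF' (hm.of_le ((continuous_hw hΦ₀s.continuous).mul
      hF'.continuous).aestronglyMeasurable (ae_of_all _ fun z => ?_))]
    · congr 1; funext z
      have : gw (-ψ) z * gw Ψ z = gw Φ₀ z := by
        simp only [gw, Pi.neg_apply, ← Complex.ofReal_mul, ← Real.exp_add]
        congr 2; simp only [hΨdef]; ring
      rw [← this, hwdef]; ring
    · rw [norm_mul, norm_mul]
      refine mul_le_mul_of_nonneg_right ?_ (norm_nonneg _)
      rw [Complex.norm_real, Complex.norm_real, Real.norm_of_nonneg (Real.exp_pos _).le,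
        Real.norm_of_nonneg (Real.exp_pos _).le, Real.exp_le_exp]
      simp only [hΨdef]
      linarith [hψ0 z]
  set s : Cn n → ℝ := fun z => Real.exp (ψ z) ^ 2 * (‖v' z + u z * L z‖ ^ 2 / (D z + L z ^ 2)) with hs
  have hDL : ∀ z, 0 < D z + L z ^ 2 := fun z => by have := hD0 z; positivity
  have hs0 : ∀ z, 0 ≤ s z := fun z => by have := hDL z; positivity
  have hsE : ∀ z, s z * Real.exp (-Ψ z)
      = ‖v' z + u z * L z‖ ^ 2 / (D z + L z ^ 2) * Real.exp (ψ z) * Real.exp (-Φ₀ z) := by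
    intro z
    have : Real.exp (ψ z) * Real.exp (-ψ z) = 1 := by rw [← Real.exp_add]; simp
    rw [hsplit, hs]
    linear_combination (‖v' z + u z * L z‖ ^ 2 / (D z + L z ^ 2) * Real.exp (ψ z)
      * Real.exp (-Φ₀ z)) * this
  have hψc := hψ.continuous
  have hΦc := hΦ₀s.continuous
  have i1 : Integrable fun z : Cn n => ‖u z‖ ^ 2 * Real.exp (ψ z) * Real.exp (-Φ₀ z) := by
    refine hui.mono' (by fun_prop) (ae_of_all _ fun z => ?_)
    rw [Real.norm_of_nonneg (by positivity)]
    gcongr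
    exact mul_le_of_le_one_right (by positivity) (hexp z)
  have hdiv : Continuous fun z => D z / (D z + L z ^ 2) :=
    hDc.div (by fun_prop) fun z => (hDL z).ne'
  have i2 : Integrable fun z : Cn n =>
      ‖u z‖ ^ 2 * (D z * Real.exp (ψ z) / (D z + L z ^ 2)) * Real.exp (-Φ₀ z) := by
    have e : (fun z : Cn n => ‖u z‖ ^ 2 * (D z * Real.exp (ψ z) / (D z + L z ^ 2)) * Real.exp (-Φ₀ z))
        = fun z => (D z / (D z + L z ^ 2)) * (‖u z‖ ^ 2 * Real.exp (ψ z) * Real.exp (-Φ₀ z)) := by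
      funext z; ring
    rw [e]
    refine i1.mono' (by fun_prop) (ae_of_all _ fun z => ?_)
    have := hDL z
    have h0 := hD0 z
    rw [Real.norm_of_nonneg (by positivity)]
    refine mul_le_of_le_one_left (by positivity) ?_
    rw [div_le_one this]; nlinarith [sq_nonneg (L z)]
  refine ⟨F, hF, i2, ?_⟩
  have i3 : Integrable fun z : Cn n =>
      V' (T z) ^ 2 * (Real.exp (ψ z) / D z) * Real.exp (-Φ₀ z) := by
    refine Continuous.integrable_of_hasCompactSupport ?_ ?_
    · have : Continuous fun z => Real.exp (ψ z) / D z :=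
        Continuous.div (by fun_prop) hDc fun z => (hD0 z).ne'
      fun_prop
    · refine hv's.mono fun z hz hz' => hz ?_
      have : V' (T z) = 0 := by simpa [hv'] using hz'
      simp [this]
  have hpt : ∀ z, s z * Real.exp (-Ψ z) ≤ ‖u z‖ ^ 2 * Real.exp (ψ z) * Real.exp (-Φ₀ z)
      - (1 / 2) * (‖u z‖ ^ 2 * (D z * Real.exp (ψ z) / (D z + L z ^ 2)) * Real.exp (-Φ₀ z))
      + 2 * (V' (T z) ^ 2 * (Real.exp (ψ z) / D z) * Real.exp (-Φ₀ z)) := by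
    intro z
    rw [hsE]
    have h := twist_square (V := V' (T z)) (l := L z) (u := u z) (hD0 z)
    have h2 := mul_le_mul_of_nonneg_right h
      (mul_pos (Real.exp_pos (ψ z)) (Real.exp_pos (-Φ₀ z))).le
    refine le_trans (le_of_eq ?_) (h2.trans (le_of_eq ?_))
    · simp only [hv']; ring
    · ring
  have i4 := (i1.sub (i2.const_mul (1 / 2))).add (i3.const_mul 2)
  have hsi : Integrable fun z => s z * Real.exp (-Ψ z) := by
    refine i4.mono' ?_ (ae_of_all _ fun z => ?_)
    · simp only [hsE]
      have : Continuous fun z => ‖v' z + u z * L z‖ ^ 2 / (D z + L z ^ 2) :=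
        Continuous.div (by fun_prop) (by fun_prop) fun z => (hDL z).ne'
      exact Continuous.aestronglyMeasurable (by fun_prop)
    · rw [Real.norm_of_nonneg (mul_nonneg (hs0 z) (Real.exp_pos _).le)]
      exact hpt z
  have hlev : ∀ z b, (D z + L z ^ 2) * tf1 e (nsq z) ^ 2 * ‖∑ j, b j * conj (z j)‖ ^ 2
      ≤ levi Ψ z b := fun z b => le_levi_twisted hΦ hl ha he z b
  have hap : APriori Ψ (fun j => dbar j w) (∫ z, s z * Real.exp (-Ψ z)) := by
    refine APriori.of_levi hΨ (fun z b => le_trans ?_ (hlev z b)) hs0 hsi fun z b => ?_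
    · have := hDL z; positivity
    · refine le_trans (le_of_eq ?_) (mul_le_mul_of_nonneg_right (hlev z b) (hs0 z))
      have e1 : ∑ j, b j * conj (dbar j w z)
          = conj ((v' z + u z * L z) * gw (-ψ) z) * tf1 e (nsq z) * ∑ j, b j * conj (z j) := by
        rw [Finset.mul_sum]
        refine Finset.sum_congr rfl fun j _ => ?_
        rw [hdw]
        simp only [map_mul, Complex.conj_ofReal]
        ring
      have e2 : ‖gw (-ψ) z‖ = Real.exp (ψ z) := by
        simp only [gw, Pi.neg_apply, neg_neg, Complex.norm_real]
        exact Real.norm_of_nonneg (Real.exp_pos _).le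
      have := (hDL z).ne'
      rw [e1, norm_mul, norm_mul, RCLike.norm_conj, norm_mul, e2, Complex.norm_real, mul_pow,
        mul_pow, mul_pow, Real.norm_eq_abs, sq_abs, hs]
      field_simp
  have hest := weighted_estimate_of_apriori hΨ hws hwm hα ho
    (integral_nonneg fun z => mul_nonneg (hs0 z) (Real.exp_pos _).le) hap
  have hlhs : ∫ z, ‖hw Ψ z * w z‖ ^ 2 = ∫ z, ‖u z‖ ^ 2 * Real.exp (ψ z) * Real.exp (-Φ₀ z) := by
    congr 1; funext z
    rw [norm_hw_mul_sq, hsplit, hwdef, norm_mul]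
    have e2 : ‖gw (-ψ) z‖ = Real.exp (ψ z) := by
      simp only [gw, Pi.neg_apply, neg_neg, Complex.norm_real]
      exact Real.norm_of_nonneg (Real.exp_pos _).le
    have : Real.exp (ψ z) * Real.exp (-ψ z) = 1 := by rw [← Real.exp_add]; simp
    rw [e2]
    linear_combination (‖u z‖ ^ 2 * Real.exp (ψ z) * Real.exp (-Φ₀ z)) * this
  rw [hlhs] at hest
  have hmono := hest.trans (integral_mono hsi i4 hpt)
  rw [integral_add' (i1.sub (i2.const_mul (1 / 2))) (i3.const_mul 2),
    integral_sub' i1 (i2.const_mul (1 / 2)), integral_const_mul, integral_const_mul] at hmono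
  change ∫ z, ‖u z‖ ^ 2 * (D z * Real.exp (ψ z) / (D z + L z ^ 2)) * Real.exp (-Φ₀ z) ≤
    4 * ∫ z, V' (T z) ^ 2 * (Real.exp (ψ z) / D z) * Real.exp (-Φ₀ z)
  linarith

lemma finrank_cn : Module.finrank ℝ (Cn n) = 2 * n := by
  rw [Module.finrank_pi_fintype]; simp [mul_comm]

/-- The function `‖z‖ ^ (-2 * n)` cut off to a spherical shell. -/
def shell (n : ℕ) (r₁ r₂ y : ℝ) : ℝ := (Set.Icc r₁ r₂).indicator (fun y => (y ^ (2 * n))⁻¹) y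

lemma shell_nonneg {r₁ r₂ : ℝ} (h : 0 < r₁) (y : ℝ) : 0 ≤ shell n r₁ r₂ y :=
  Set.indicator_nonneg (fun _ hy => by have := h.trans_le hy.1; positivity) y

/-- The normalizing constant of polar coordinates. -/
def polarC (n : ℕ) : ℝ := 2 * n * (volume : Measure (Cn n)).real (Metric.ball 0 1)

lemma polarC_pos (hn : 0 < n) : 0 < polarC n := by
  have : 0 < (volume : Measure (Cn n)).real (Metric.ball 0 1) :=
    ENNReal.toReal_pos (Metric.measure_ball_pos _ _ one_pos).ne' measure_ball_lt_top.ne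
  unfold polarC; positivity

lemma shell_integrand (hn : 0 < n) {r₁ r₂ : ℝ} (h : 0 < r₁) :
    (fun y : ℝ => y ^ (2 * n - 1) • shell n r₁ r₂ y) = (Set.Icc r₁ r₂).indicator fun y => y⁻¹ := by
  funext y
  by_cases hy : y ∈ Set.Icc r₁ r₂
  · have h0 : 0 < y := h.trans_le hy.1
    rw [shell, Set.indicator_of_mem hy, Set.indicator_of_mem hy, smul_eq_mul]
    obtain ⟨k, rfl⟩ : ∃ k, n = k + 1 := ⟨n - 1, by omega⟩
    rw [show 2 * (k + 1) - 1 = 2 * k + 1 by omega, show 2 * (k + 1) = 2 * k + 1 + 1 by ring, pow_succ y (2 * k + 1)]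
    field_simp
  · rw [shell, Set.indicator_of_notMem hy, Set.indicator_of_notMem hy, smul_zero]

lemma integrableOn_inv_Icc {r₁ r₂ : ℝ} (h : 0 < r₁) : IntegrableOn (fun y : ℝ => y⁻¹) (Set.Icc r₁ r₂) :=
  (continuousOn_inv₀.mono fun _ hy => (h.trans_le hy.1).ne').integrableOn_compact isCompact_Icc

lemma integrable_shell (hn : 0 < n) {r₁ r₂ : ℝ} (h : 0 < r₁) :
    Integrable fun z : Cn n => shell n r₁ r₂ ‖z‖ := by
  have : Nontrivial (Cn n) := by
    have : Nonempty (Fin n) := ⟨⟨0, hn⟩⟩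
    infer_instance
  rw [integrable_fun_norm_addHaar, finrank_cn, shell_integrand hn h]
  exact ((integrableOn_inv_Icc h).integrable_indicator measurableSet_Icc).integrableOn

lemma integral_shell (hn : 0 < n) {r₁ r₂ : ℝ} (h : 0 < r₁) (h2 : r₁ ≤ r₂) :
    ∫ z : Cn n, shell n r₁ r₂ ‖z‖ = polarC n * Real.log (r₂ / r₁) := by
  have : Nontrivial (Cn n) := by
    have : Nonempty (Fin n) := ⟨⟨0, hn⟩⟩
    infer_instance
  rw [integral_fun_norm_addHaar, finrank_cn, shell_integrand hn h,
    setIntegral_indicator measurableSet_Icc,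
    Set.inter_eq_right.2 fun y (hy : y ∈ Set.Icc r₁ r₂) => Set.mem_Ioi.2 (h.trans_le hy.1),
    integral_Icc_eq_integral_Ioc, ← intervalIntegral.integral_of_le h2,
    integral_inv_of_pos h (h.trans_le h2), polarC, smul_eq_mul, nsmul_eq_mul, mul_assoc]
  push_cast; ring

lemma deriv_smoothTransition_eq_zero {x : ℝ} (hx : x ∉ Set.Icc (0 : ℝ) 1) :
    deriv Real.smoothTransition x = 0 := by
  rw [Set.mem_Icc, not_and_or, not_le, not_le] at hx
  rcases hx with hx | hx
  · have : Real.smoothTransition =ᶠ[𝓝 x] fun _ => 0 := by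
      filter_upwards [Iio_mem_nhds hx] with y hy
      exact Real.smoothTransition.zero_of_nonpos (le_of_lt hy)
    rw [this.deriv_eq]; simp
  · have : Real.smoothTransition =ᶠ[𝓝 x] fun _ => 1 := by
      filter_upwards [Ioi_mem_nhds hx] with y hy
      exact Real.smoothTransition.one_of_one_le (le_of_lt hy)
    rw [this.deriv_eq]; simp

lemma continuous_deriv_smoothTransition : Continuous (deriv Real.smoothTransition) :=
  (Real.smoothTransition.contDiff (n := 1)).continuous_deriv le_rfl

lemma exists_deriv_smoothTransition_bound :
    ∃ M : ℝ, 0 ≤ M ∧ ∀ x, |deriv Real.smoothTransition x| ≤ M := by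
  obtain ⟨M, hM⟩ := isCompact_Icc.exists_bound_of_continuousOn (s := Set.Icc (0 : ℝ) 1)
    continuous_deriv_smoothTransition.continuousOn
  have h0 := (norm_nonneg _).trans (hM 0 (by simp))
  refine ⟨M, h0, fun x => ?_⟩
  by_cases hx : x ∈ Set.Icc (0 : ℝ) 1
  · exact hM x hx
  · rw [deriv_smoothTransition_eq_zero hx, abs_zero]
    exact h0

/-- The value of `x + e` at which `tf e x = t`. -/
def tinv (t : ℝ) : ℝ := 1 / (Real.exp t - 1)

lemma tinv_pos {t : ℝ} (ht : 0 < t) : 0 < tinv t :=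
  one_div_pos.2 (sub_pos.2 (Real.one_lt_exp_iff.2 ht))

lemma le_tf_iff {e x t : ℝ} (he : 0 < e) (hx : 0 ≤ x) (ht : 0 < t) :
    t ≤ tf e x ↔ x + e ≤ tinv t := by
  have h1 : 0 < Real.exp t - 1 := sub_pos.2 (Real.one_lt_exp_iff.2 ht)
  rw [← Real.exp_le_exp, exp_tf he hx, tinv, le_div_iff₀ (by positivity), le_div_iff₀ h1]
  constructor <;> intro h <;> linarith

lemma tf_le_iff {e x t : ℝ} (he : 0 < e) (hx : 0 ≤ x) (ht : 0 < t) :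
    tf e x ≤ t ↔ tinv t ≤ x + e := by
  have h1 : 0 < Real.exp t - 1 := sub_pos.2 (Real.one_lt_exp_iff.2 ht)
  rw [← Real.exp_le_exp, exp_tf he hx, tinv, div_le_iff₀ (by positivity), div_le_iff₀ h1]
  constructor <;> intro h <;> linarith

lemma tinv_le {t : ℝ} (ht : 0 < t) : tinv t ≤ 1 / t :=
  one_div_le_one_div_of_le ht (by linarith [Real.add_one_le_exp t])

lemma tinv_div_tinv {a : ℝ} (ha : 0 < a) : tinv a / tinv (2 * a) = Real.exp a + 1 := by
  have h1 : Real.exp a - 1 ≠ 0 := (sub_pos.2 (Real.one_lt_exp_iff.2 ha)).ne'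
  have h2 : Real.exp (2 * a) - 1 = (Real.exp a - 1) * (Real.exp a + 1) := by
    rw [two_mul, Real.exp_add]; ring
  have h3 : Real.exp a + 1 ≠ 0 := by positivity
  rw [tinv, tinv, h2]
  field_simp

lemma exp_neg_aux {e : ℝ} (he : 0 < e) (z : Cn n) :
    Real.exp (-aux e z) = ((nsq z + e) ^ n)⁻¹ * Real.exp (-4 * nsq z) := by
  have := nsq_nonneg z
  rw [aux, neg_add, Real.exp_add, Real.exp_neg, Real.exp_nat_mul, Real.exp_log (by positivity)]
  congr 2; ring

lemma nsq_add_le_of_norm {e : ℝ} {z : Cn n} (hn : 0 < n) {α : ℝ} (hα : 0 ≤ α) (he : e ≤ α / 2)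
    (hz : ‖z‖ ≤ Real.sqrt (α / (2 * n))) : nsq z + e ≤ α := by
  have h1 : ‖z‖ ^ 2 ≤ α / (2 * n) := by
    rw [← Real.sq_sqrt (by positivity : 0 ≤ α / (2 * n))]; gcongr
  have h2 := nsq_le z
  have hn' : (0 : ℝ) < n := by exact_mod_cast hn
  have h3 : n * ‖z‖ ^ 2 ≤ α / 2 := by
    rw [le_div_iff₀ (by positivity)] at h1; linarith
  linarith

lemma cost_le (hn : 0 < n) {Φ : Cn n → ℝ} {a e M : ℝ} (ha : 1 ≤ a) (he : 0 < e)
    (hea : e ≤ tinv (2 * a) / 2)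
    (hΦ : ∀ z : Cn n, ‖z‖ ^ 2 ≤ tinv a → Real.exp (-Φ z) ≤ 2 * Real.exp (-Φ 0)) {V' : ℝ → ℝ}
    (hV : ∀ t, |V' t| ≤ M / a) (hV0 : ∀ t, t ∉ Set.Icc a (2 * a) → V' t = 0) :
    ∫ z : Cn n, V' (tf e (nsq z)) ^ 2 * (Real.exp (psi a e z) / gain a (tf e (nsq z)))
        * Real.exp (-(Φ z + aux e z))
      ≤ 18 * M ^ 2 * (polarC n * (Real.log (4 * n) + 1)) * Real.exp (-Φ 0) := by
  have ha0 : 0 < a := by linarith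
  have hn' : (0 : ℝ) < n := by exact_mod_cast hn
  have hα : 0 < tinv (2 * a) := tinv_pos (by positivity)
  have hβ : 0 < tinv a := tinv_pos ha0
  set r₁ := Real.sqrt (tinv (2 * a) / (2 * n)) with hr₁
  set r₂ := Real.sqrt (tinv a) with hr₂
  have hr₁0 : 0 < r₁ := Real.sqrt_pos.2 (by positivity)
  have hq : r₂ / r₁ = Real.sqrt (2 * n * (Real.exp a + 1)) := by
    rw [hr₁, hr₂, ← Real.sqrt_div hβ.le, ← tinv_div_tinv ha0]
    congr 1; field_simp
  have hn1 : (1 : ℝ) ≤ n := by exact_mod_cast hn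
  have hlog4 : 0 ≤ Real.log (4 * n) := Real.log_nonneg (by linarith)
  have hlog : Real.log (r₂ / r₁) ≤ a * (Real.log (4 * n) + 1) := by
    rw [hq, Real.log_sqrt (by positivity)]
    have h1 : Real.log (2 * n * (Real.exp a + 1)) ≤ Real.log (4 * n * Real.exp a) := by
      refine Real.log_le_log (by positivity) ?_
      have := Real.one_le_exp ha0.le
      nlinarith
    rw [Real.log_mul (x := 4 * n) (by positivity) (by positivity), Real.log_exp] at h1
    nlinarith
  have h12 : r₁ ≤ r₂ := by
    have : 1 ≤ r₂ / r₁ := by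
      rw [hq, Real.one_le_sqrt]
      have := Real.one_le_exp ha0.le
      nlinarith
    rwa [one_le_div hr₁0] at this
  have hpt : ∀ z : Cn n, V' (tf e (nsq z)) ^ 2 * (Real.exp (psi a e z) / gain a (tf e (nsq z)))
        * Real.exp (-(Φ z + aux e z)) ≤ 18 * M ^ 2 / a * Real.exp (-Φ 0) * shell n r₁ r₂ ‖z‖ := by
    intro z
    have hx := nsq_nonneg z
    have hs := shell_nonneg (n := n) (r₂ := r₂) hr₁0 ‖z‖
    by_cases hT : tf e (nsq z) ∈ Set.Icc a (2 * a)
    · have h1 : nsq z + e ≤ tinv a := (le_tf_iff he hx ha0).1 hT.1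
      have h2 : tinv (2 * a) ≤ nsq z + e := (tf_le_iff he hx (by positivity)).1 hT.2
      have hb : ‖z‖ ^ 2 ≤ tinv a := (norm_sq_le_nsq z).trans (by linarith)
      have hz1 : r₁ ≤ ‖z‖ := by
        refine Real.sqrt_le_iff.2 ⟨norm_nonneg _, ?_⟩
        rw [div_le_iff₀ (by positivity)]
        have := nsq_le z
        linarith
      have hz2 : ‖z‖ ≤ r₂ := Real.le_sqrt_of_sq_le hb
      have hz0 : 0 < ‖z‖ := hr₁0.trans_le hz1
      have e1 : shell n r₁ r₂ ‖z‖ = (‖z‖ ^ (2 * n))⁻¹ :=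
        Set.indicator_of_mem (Set.mem_Icc.2 ⟨hz1, hz2⟩) _
      have h3 : Real.exp (-aux e z) ≤ (‖z‖ ^ (2 * n))⁻¹ := by
        rw [exp_neg_aux he]
        refine (mul_le_of_le_one_right (by positivity) (Real.exp_le_one_iff.2 (by linarith))).trans ?_
        rw [pow_mul]
        gcongr
        exact (norm_sq_le_nsq z).trans (by linarith)
      have h4 := hΦ z hb
      have h5 := cost_bound ha (tf_nonneg he hx) hT.2
      have h6 : V' (tf e (nsq z)) ^ 2 ≤ (M / a) ^ 2 := by
        rw [← sq_abs]; gcongr; exact hV _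
      have hg := gain_pos ha (tf_nonneg he hx)
      rw [neg_add, Real.exp_add, e1]
      calc V' (tf e (nsq z)) ^ 2 * (Real.exp (psi a e z) / gain a (tf e (nsq z)))
            * (Real.exp (-Φ z) * Real.exp (-aux e z))
          ≤ (M / a) ^ 2 * (9 * a) * ((2 * Real.exp (-Φ 0)) * (‖z‖ ^ (2 * n))⁻¹) := by
            gcongr
            exact h5
        _ = _ := by field_simp; ring
    · rw [hV0 _ hT]
      have : 0 ≤ 18 * M ^ 2 / a * Real.exp (-Φ 0) * shell n r₁ r₂ ‖z‖ := by positivity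
      simpa using this
  refine (integral_mono_of_nonneg (ae_of_all _ fun z => ?_)
    ((integrable_shell hn hr₁0).const_mul _) (ae_of_all _ hpt)).trans ?_
  · have := gain_pos ha (tf_nonneg he (nsq_nonneg z))
    simp only [Pi.zero_apply]
    positivity
  · rw [integral_const_mul, integral_shell hn hr₁0 h12]
    have hp := polarC_pos hn
    calc 18 * M ^ 2 / a * Real.exp (-Φ 0) * (polarC n * Real.log (r₂ / r₁))
        ≤ 18 * M ^ 2 / a * Real.exp (-Φ 0) * (polarC n * (a * (Real.log (4 * n) + 1))) := by gcongr
      _ = _ := by field_simp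

/-- The density `(nsq + e) ^ (-n)` on a ball. -/
def bden (e r : ℝ) (z : Cn n) : ℝ := (Metric.closedBall (0 : Cn n) r).indicator
  (fun z => ((nsq z + e) ^ n)⁻¹) z

lemma bden_nonneg {e r : ℝ} (he : 0 < e) (z : Cn n) : 0 ≤ bden e r z :=
  Set.indicator_nonneg (fun z _ => by have := nsq_nonneg z; positivity) z

lemma continuous_bden_aux {e : ℝ} (he : 0 < e) :
    Continuous fun z : Cn n => ((nsq z + e) ^ n)⁻¹ := by
  have := (contDiff_nsq (n := n)).continuous
  refine Continuous.inv₀ (by fun_prop) fun z => ?_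
  have := nsq_nonneg z
  positivity

lemma integrable_bden {e r : ℝ} (he : 0 < e) : Integrable (bden (n := n) e r) :=
  ((continuous_bden_aux he).continuousOn.integrableOn_compact
    (isCompact_closedBall _ _)).integrable_indicator Metric.isClosed_closedBall.measurableSet

lemma le_integral_bden (hn : 0 < n) {e r : ℝ} (he : 0 < e) (hr : Real.sqrt e ≤ r) :
    ((n + 1 : ℝ) ^ n)⁻¹ * (polarC n * Real.log (r / Real.sqrt e)) ≤ ∫ z : Cn n, bden e r z := by
  have hs : 0 < Real.sqrt e := Real.sqrt_pos.2 he
  rw [← integral_shell hn hs hr, ← integral_const_mul]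
  refine integral_mono ((integrable_shell hn hs).const_mul _) (integrable_bden he) fun z => ?_
  by_cases hz : ‖z‖ ∈ Set.Icc (Real.sqrt e) r
  · have hz' : z ∈ Metric.closedBall (0 : Cn n) r := by simpa using hz.2
    have hz0 : 0 < ‖z‖ := hs.trans_le hz.1
    have h1 : e ≤ ‖z‖ ^ 2 := by rw [← Real.sq_sqrt he.le]; gcongr; exact hz.1
    simp only [shell, bden, Set.indicator_of_mem hz, Set.indicator_of_mem hz']
    rw [← mul_inv, pow_mul, ← mul_pow]
    have := nsq_nonneg z
    gcongr
    linarith [nsq_le z]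
  · simp only [shell, Set.indicator_of_notMem hz, mul_zero]
    exact bden_nonneg he z

lemma tendsto_log_div_sqrt {r : ℝ} (hr : 0 < r) :
    Tendsto (fun e : ℝ => Real.log (r / Real.sqrt e)) (𝓝[>] 0) atTop := by
  refine Real.tendsto_log_atTop.comp ?_
  have h : Tendsto Real.sqrt (𝓝[>] 0) (𝓝[>] 0) := by
    refine tendsto_nhdsWithin_of_tendsto_nhds_of_eventually_within _ ?_ ?_
    · have := (Real.continuous_sqrt.tendsto 0).mono_left (nhdsWithin_le_nhds (s := Set.Ioi 0))
      rwa [Real.sqrt_zero] at this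
    · filter_upwards [self_mem_nhdsWithin] with x hx using Real.sqrt_pos.2 hx
  simp only [div_eq_mul_inv]
  exact (tendsto_inv_nhdsGT_zero.comp h).const_mul_atTop hr

lemma norm_apply_zero_le_half {p : Cn n → ℝ} {f : Cn n → ℂ} {R : ℝ} (hp : Integrable p)
    (hp0 : ∀ z, 0 ≤ p z) (hinv : ∀ c : ℂ, ‖c‖ = 1 → ∀ z, p (c • z) = p z)
    (hs : ∀ z, R < ‖z‖ → p z = 0) (hf : Differentiable ℂ f)
    (hi : Integrable fun z => p z * ‖f z‖ ^ 2) (hpos : 0 < ∫ z, p z)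
    (hle : ∫ z, p z * ‖f z‖ ^ 2 ≤ (1 / 4) * ∫ z, p z) : ‖f 0‖ ≤ 1 / 2 := by
  have h1 := integral_mul_of_holo (R' := R + 1) hp hinv hs (by linarith) hf.differentiableOn
  have h2 : ‖f 0‖ * ∫ z, p z ≤ ∫ z, (p z * ‖f z‖ ^ 2 + (1 / 4) * p z) := by
    have : ‖f 0‖ * ∫ z, p z = ‖∫ z, (p z : ℂ) * f z‖ := by
      rw [h1, norm_mul, Complex.norm_real, Real.norm_of_nonneg hpos.le, mul_comm]
    rw [this]
    refine norm_integral_le_of_norm_le (hi.add (hp.const_mul _)) (ae_of_all _ fun z => ?_)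
    rw [norm_mul, Complex.norm_real, Real.norm_of_nonneg (hp0 z)]
    nlinarith [mul_nonneg (hp0 z) (sq_nonneg (‖f z‖ - 1 / 2))]
  rw [integral_add hi (hp.const_mul _), integral_const_mul] at h2
  nlinarith

lemma nsq_smul {c : ℂ} (hc : ‖c‖ = 1) (z : Cn n) : nsq (c • z) = nsq z := by
  simp [nsq, hc]

theorem one_le_pow_mul_inv (hn : 0 < n) {A : ℝ} (hA : 0 < A) (h : A ≤ n + 1) :
    1 ≤ (n + 2) * (n + 1 : ℝ) ^ n * ((A + 1) / A)⁻¹ * (A ^ n)⁻¹ := by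
  obtain ⟨k, rfl⟩ : ∃ k, n = k + 1 := ⟨n - 1, by omega⟩
  push_cast at h ⊢
  have e3 : ((k : ℝ) + 1 + 2) * ((k : ℝ) + 1 + 1) ^ (k + 1) * ((A + 1) / A)⁻¹ * (A ^ (k + 1))⁻¹
      = (((k : ℝ) + 1 + 2) / (A + 1)) * ((((k : ℝ) + 1 + 1) ^ k / A ^ k) * ((k : ℝ) + 1 + 1)) := by
    rw [pow_succ, pow_succ]; field_simp
  rw [e3]
  refine one_le_mul_of_one_le_of_one_le ?_ (one_le_mul_of_one_le_of_one_le ?_ ?_)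
  · rw [one_le_div (by positivity)]; linarith
  · rw [one_le_div (by positivity)]; gcongr
  · linarith [Nat.cast_nonneg (α := ℝ) k]

set_option maxHeartbeats 1000000 in
/-- Entire functions of controlled weighted norm with a prescribed lower bound at the origin. -/
theorem exists_entire_at_zero (hn : 0 < n) : ∃ C : ℝ, 0 ≤ C ∧ ∀ Φ : Cn n → ℝ, ContDiff ℝ ∞ Φ →
    (∀ z b, 0 ≤ levi Φ z b) → ∃ F : Cn n → ℂ, Differentiable ℂ F ∧ 1 / 2 ≤ ‖F 0‖ ∧
      ∫ z in Metric.closedBall (0 : Cn n) 1, ‖F z‖ ^ 2 * Real.exp (-Φ z) ≤ C * Real.exp (-Φ 0) := by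
  obtain ⟨M, hM0, hM⟩ := exists_deriv_smoothTransition_bound
  have hn1 : (1 : ℝ) ≤ n := by exact_mod_cast hn
  have hn' : (0 : ℝ) < n := by linarith
  have hpc := polarC_pos hn
  have hlog4 : 0 ≤ Real.log (4 * n) := Real.log_nonneg (by linarith)
  set K : ℝ := 4 * (18 * M ^ 2 * (polarC n * (Real.log (4 * n) + 1))) with hK
  have hK0 : 0 ≤ K := by positivity
  set c₁ : ℝ := 36 * (n + 2) * (n + 1) ^ n * Real.exp (4 * n) with hc₁
  have hc₁0 : 0 ≤ c₁ := by positivity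
  refine ⟨4 * (volume : Measure (Cn n)).real (Metric.closedBall 0 1) + 2 * c₁ * K, by positivity,
    fun Φ hΦ hl => ?_⟩
  have hΦc := hΦ.continuous
  -- the scale on which `Φ` is nearly constant
  obtain ⟨δ, hδ0, hδ1, hδ⟩ : ∃ δ : ℝ, 0 < δ ∧ δ ≤ 1 ∧ ∀ z : Cn n, ‖z‖ ^ 2 ≤ δ →
      Real.exp (-Φ z) ≤ 2 * Real.exp (-Φ 0) ∧ Real.exp (-Φ 0) ≤ 2 * Real.exp (-Φ z) := by
    have hc : Continuous fun z => Real.exp (-Φ z) := by fun_prop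
    have h1 : ∀ᶠ z in 𝓝 (0 : Cn n), Real.exp (-Φ z) < 2 * Real.exp (-Φ 0) :=
      hc.continuousAt.eventually_lt continuousAt_const (by linarith [Real.exp_pos (-Φ 0)])
    have h2 : ∀ᶠ z in 𝓝 (0 : Cn n), Real.exp (-Φ 0) < 2 * Real.exp (-Φ z) :=
      continuousAt_const.eventually_lt (hc.continuousAt.const_mul 2) (by linarith [Real.exp_pos (-Φ 0)])
    obtain ⟨η, hη, h⟩ := Metric.eventually_nhds_iff.1 (h1.and h2)
    refine ⟨min 1 ((η / 2) ^ 2), by positivity, min_le_left _ _, fun z hz => ?_⟩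
    have : ‖z‖ < η := by
      have := abs_le_of_sq_le_sq (hz.trans (min_le_right _ _)) (by positivity)
      linarith [abs_norm z]
    obtain ⟨h3, h4⟩ := h (y := z) (by simpa using this)
    exact ⟨h3.le, h4.le⟩
  set a : ℝ := max 1 (1 / δ) with ha'
  have ha : 1 ≤ a := le_max_left _ _
  have ha0 : 0 < a := by linarith
  have haδ : 1 / a ≤ δ := by
    rw [div_le_iff₀ ha0]
    have : δ * (1 / δ) ≤ δ * a := mul_le_mul_of_nonneg_left (le_max_right _ _) hδ0.le
    rwa [mul_one_div_cancel hδ0.ne'] at this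
  have hβδ : tinv a ≤ δ := (tinv_le ha0).trans haδ
  set α := tinv (2 * a) with hα'
  have hα : 0 < α := tinv_pos (by positivity)
  have hαδ : α ≤ δ := (tinv_le (by positivity)).trans
    ((one_div_le_one_div_of_le ha0 (by linarith)).trans haδ)
  set r := Real.sqrt (α / (2 * n)) with hr
  have hr0 : 0 < r := Real.sqrt_pos.2 (by positivity)
  set Bd : ℝ := 24 * a * Real.exp 4 * K with hBd
  obtain ⟨e, he, heα, he1, her, hbig⟩ : ∃ e : ℝ, 0 < e ∧ e ≤ α / 2 ∧ e ≤ 1 ∧ Real.sqrt e ≤ r ∧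
      4 * Bd + 1 ≤ ((n + 1 : ℝ) ^ n)⁻¹ * (polarC n * Real.log (r / Real.sqrt e)) := by
    have h1 : ∀ᶠ e : ℝ in 𝓝[>] 0, 0 < e := self_mem_nhdsWithin
    have h2 : ∀ᶠ e : ℝ in 𝓝[>] 0, e < min (min (α / 2) 1) (r ^ 2) :=
      mem_nhdsWithin_of_mem_nhds (Iio_mem_nhds (by positivity))
    have h3 := ((tendsto_log_div_sqrt hr0).const_mul_atTop hpc).const_mul_atTop
      (show 0 < ((n + 1 : ℝ) ^ n)⁻¹ by positivity)
    obtain ⟨e, h1, h2, h3⟩ := (h1.and (h2.and (h3.eventually_ge_atTop (4 * Bd + 1)))).exists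
    simp only [lt_min_iff] at h2
    exact ⟨e, h1, h2.1.1.le, h2.1.2.le, Real.sqrt_le_iff.2 ⟨hr0.le, h2.2.le⟩, h3⟩
  -- the cutoff
  set V : ℝ → ℝ := fun t => Real.smoothTransition (t / a - 1) with hVdef
  set V' : ℝ → ℝ := fun t => deriv Real.smoothTransition (t / a - 1) * (1 / a) with hV'def
  have hVs : ContDiff ℝ ∞ V :=
    Real.smoothTransition.contDiff.comp ((contDiff_id.div_const a).sub contDiff_const)
  have hVd : ∀ t, HasDerivAt V (V' t) t := fun t => by
    have h1 : HasDerivAt (fun t : ℝ => t / a - 1) (1 / a) t :=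
      ((hasDerivAt_id t).div_const a).sub_const 1
    exact ((Real.smoothTransition.contDiff (n := 1)).differentiable (by simp) _).hasDerivAt.comp t h1
  have hVz : ∀ t ≤ a, V t = 0 := fun t ht =>
    Real.smoothTransition.zero_of_nonpos (sub_nonpos.2 ((div_le_one ha0).2 ht))
  have hV'z : ∀ t, t ∉ Set.Icc a (2 * a) → V' t = 0 := by
    intro t ht
    have : t / a - 1 ∉ Set.Icc (0 : ℝ) 1 := fun h => ht
      ⟨by have := h.1; rwa [sub_nonneg, one_le_div ha0] at this,
        by have h2 := h.2; rw [sub_le_iff_le_add, div_le_iff₀ ha0] at h2; linarith⟩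
    simp only [hV'def, deriv_smoothTransition_eq_zero this, zero_mul]
  have hV'c : Continuous V' :=
    (continuous_deriv_smoothTransition.comp (by fun_prop)).mul continuous_const
  have hV'b : ∀ t, |V' t| ≤ M / a := fun t => by
    rw [hV'def, abs_mul, abs_of_pos (one_div_pos.2 ha0), ← div_eq_mul_one_div]
    gcongr; exact hM _
  obtain ⟨F, hF, hgi, hest⟩ := exists_entire_twisted hΦ hl ha he hVs hVd (fun t ht => hVz t ht.le)
    (fun t ht => hV'z t fun h => absurd h.1 (not_le.2 ht)) hV'c
  have hcost := cost_le hn ha he heα (fun z hz => (hδ z (hz.trans hβδ)).1) hV'b hV'z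
  set g : Cn n → ℝ := fun z => ‖(V (tf e (nsq z)) : ℂ) - F z‖ ^ 2 *
          (gain a (tf e (nsq z)) * Real.exp (psi a e z)
            / (gain a (tf e (nsq z)) + lam1 a (tf e (nsq z)) ^ 2)) * Real.exp (-(Φ z + aux e z)) with hg
  have hgK : ∫ z, g z ≤ K * Real.exp (-Φ 0) := by
    refine hest.trans ?_
    rw [hK]; linarith
  have hE0 := Real.exp_pos (-Φ 0)
  have hg0 : ∀ z, 0 ≤ g z := fun z => by
    have := gain_pos ha (tf_nonneg he (nsq_nonneg z))
    positivity
  refine ⟨F, hF, ?_, ?_⟩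
  · -- the value at the origin
    have hpt : ∀ z : Cn n, bden e r z * ‖1 - F z‖ ^ 2
        ≤ 24 * a * Real.exp 4 * Real.exp (Φ 0) * g z := by
      intro z
      by_cases hz : z ∈ Metric.closedBall (0 : Cn n) r
      · have hx := nsq_nonneg z
        have hz' : ‖z‖ ≤ r := by simpa using hz
        have h1 := nsq_add_le_of_norm hn hα.le heα hz'
        have h2 : 2 * a ≤ tf e (nsq z) := (le_tf_iff he hx (by positivity)).2 h1
        have h3 : V (tf e (nsq z)) = 1 := Real.smoothTransition.one_of_one_le (by
          rw [le_sub_iff_add_le, le_div_iff₀ ha0]; linarith)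
        have h4 := coefficient_bound_inv ha (tf_nonneg he hx)
        have h5 := (hδ z ((norm_sq_le_nsq z).trans (by linarith))).2
        have h6 : Real.exp (-4) ≤ Real.exp (-4 * nsq z) := Real.exp_le_exp.2 (by linarith)
        rw [bden, Set.indicator_of_mem hz, hg]
        simp only [h3, Complex.ofReal_one]
        rw [neg_add, Real.exp_add, exp_neg_aux he]
        have e1 : Real.exp 4 * Real.exp (-4) = 1 := by rw [← Real.exp_add]; simp
        have e2 : Real.exp (Φ 0) * Real.exp (-Φ 0) = 1 := by rw [← Real.exp_add]; simp
        calc ((nsq z + e) ^ n)⁻¹ * ‖1 - F z‖ ^ 2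
            = 24 * a * Real.exp 4 * Real.exp (Φ 0) * (‖1 - F z‖ ^ 2 * (1 / (12 * a)) *
              ((Real.exp (-Φ 0) / 2) * (((nsq z + e) ^ n)⁻¹ * Real.exp (-4)))) := by
              field_simp
              linear_combination (-‖1 - F z‖ ^ 2 * 24) * (e1 * Real.exp (Φ 0) * Real.exp (-Φ 0) + e2)
          _ ≤ _ := by
              have h7 : Real.exp (-Φ 0) / 2 ≤ Real.exp (-Φ z) := by linarith
              have hgp := gain_pos ha (tf_nonneg he hx)
              have hp : psi a e z = lam a (tf e (nsq z)) := rfl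
              rw [hp]
              generalize gain a (tf e (nsq z)) * Real.exp (lam a (tf e (nsq z)))
                / (gain a (tf e (nsq z)) + lam1 a (tf e (nsq z)) ^ 2) = X at h4 ⊢
              have hX : 0 ≤ X := le_trans (by positivity) h4
              gcongr
      · rw [bden, Set.indicator_of_notMem hz, zero_mul]
        have := hg0 z
        positivity
    have hb0 := bden_nonneg (n := n) (r := r) he
    have hi : Integrable fun z : Cn n => bden e r z * ‖1 - F z‖ ^ 2 := by
      refine (hgi.const_mul (24 * a * Real.exp 4 * Real.exp (Φ 0))).mono'
        ((integrable_bden he).1.mul ?_) (ae_of_all _ fun z => ?_)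
      · exact ((continuous_const.sub hF.continuous).norm.pow 2).aestronglyMeasurable
      · rw [Real.norm_of_nonneg (mul_nonneg (hb0 z) (by positivity))]
        exact hpt z
    have hinteg : ∫ z : Cn n, bden e r z * ‖1 - F z‖ ^ 2 ≤ Bd := by
      refine (integral_mono hi (hgi.const_mul _) hpt).trans ?_
      rw [integral_const_mul]
      have e2 : Real.exp (Φ 0) * Real.exp (-Φ 0) = 1 := by rw [← Real.exp_add]; simp
      calc 24 * a * Real.exp 4 * Real.exp (Φ 0) * ∫ z, g z
          ≤ 24 * a * Real.exp 4 * Real.exp (Φ 0) * (K * Real.exp (-Φ 0)) := by gcongr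
        _ = Bd := by rw [hBd]; linear_combination (24 * a * Real.exp 4 * K) * e2
    have hlow := hbig.trans (le_integral_bden hn he her)
    have hBd0 : 0 ≤ Bd := by positivity
    have := norm_apply_zero_le_half (p := bden e r) (f := fun z => 1 - F z) (R := r) (integrable_bden he)
      hb0 (fun c hc z => ?_) (fun z hz => Set.indicator_of_notMem (by simpa using hz) _)
      ((differentiable_const _).sub hF) hi (by linarith) (by linarith)
    · have h1 : ‖(1 : ℂ)‖ ≤ ‖1 - F 0‖ + ‖F 0‖ := by
        simpa using norm_add_le (1 - F 0) (F 0)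
      rw [norm_one] at h1
      linarith
    · simp [bden, Set.indicator, norm_smul, hc, nsq_smul]
  · -- the norm estimate
    have hpt : ∀ z ∈ Metric.closedBall (0 : Cn n) 1, ‖F z‖ ^ 2 * Real.exp (-Φ z)
        ≤ 4 * Real.exp (-Φ 0) + 2 * c₁ * g z := by
      intro z hz
      have hz' : ‖z‖ ≤ 1 := by simpa using hz
      have hx := nsq_nonneg z
      have hxn : nsq z ≤ n := (nsq_le z).trans (by
        have : ‖z‖ ^ 2 ≤ 1 := pow_le_one₀ (norm_nonneg _) hz'
        nlinarith)
      have hv : V (tf e (nsq z)) ^ 2 * Real.exp (-Φ z) ≤ 2 * Real.exp (-Φ 0) := by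
        rcases le_or_gt (tf e (nsq z)) a with h | h
        · rw [hVz _ h]; simp; positivity
        · have h1 := (le_tf_iff he hx ha0).1 h.le
          have h2 := (hδ z ((norm_sq_le_nsq z).trans (by linarith))).1
          have h3 : V (tf e (nsq z)) ^ 2 ≤ 1 :=
            pow_le_one₀ (Real.smoothTransition.nonneg _) (Real.smoothTransition.le_one _)
          calc _ ≤ 1 * (2 * Real.exp (-Φ 0)) := by gcongr
            _ = _ := one_mul _
      set u := (V (tf e (nsq z)) : ℂ) - F z with hu
      have hFu : ‖F z‖ ^ 2 ≤ 2 * V (tf e (nsq z)) ^ 2 + 2 * ‖u‖ ^ 2 := by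
        have h1 : ‖F z‖ ≤ |V (tf e (nsq z))| + ‖u‖ := by
          have := norm_sub_le (V (tf e (nsq z)) : ℂ) u
          rw [hu, sub_sub_cancel, Complex.norm_real, Real.norm_eq_abs] at this
          exact this
        rw [← sq_abs (V _)]
        nlinarith [norm_nonneg (F z), sq_nonneg (|V (tf e (nsq z))| - ‖u‖),
          pow_le_pow_left₀ (norm_nonneg _) h1 2]
      have hug : ‖u‖ ^ 2 * Real.exp (-Φ z) ≤ c₁ * g z := by
        have h4 := coefficient_bound_exp ha (tf_nonneg he hx)
        rw [Real.exp_neg, exp_tf he hx] at h4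
        rw [hg]
        simp only
        rw [neg_add, Real.exp_add, exp_neg_aux he]
        have h6 : Real.exp (-(4 * n)) ≤ Real.exp (-4 * nsq z) := Real.exp_le_exp.2 (by linarith)
        have e1 : Real.exp (4 * n) * Real.exp (-(4 * n)) = 1 := by rw [← Real.exp_add]; simp
        have hA : 0 < nsq z + e := by positivity
        have h7 := one_le_pow_mul_inv hn hA (by linarith)
        have hgp := gain_pos ha (tf_nonneg he hx)
        calc ‖u‖ ^ 2 * Real.exp (-Φ z) = 1 * (‖u‖ ^ 2 * Real.exp (-Φ z)) := (one_mul _).symm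
          _ ≤ ((n + 2) * (n + 1 : ℝ) ^ n * ((nsq z + e + 1) / (nsq z + e))⁻¹
            * ((nsq z + e) ^ n)⁻¹) * (‖u‖ ^ 2 * Real.exp (-Φ z)) := by gcongr
          _ = c₁ * (‖u‖ ^ 2 * (((nsq z + e + 1) / (nsq z + e))⁻¹ / 36) *
              (Real.exp (-Φ z) * (((nsq z + e) ^ n)⁻¹ * Real.exp (-(4 * n))))) := by
              rw [hc₁]
              linear_combination (-((n + 2) * (n + 1 : ℝ) ^ n * ((nsq z + e + 1) / (nsq z + e))⁻¹
                * ((nsq z + e) ^ n)⁻¹ * ‖u‖ ^ 2 * Real.exp (-Φ z))) * e1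
          _ ≤ _ := by
              have hp : psi a e z = lam a (tf e (nsq z)) := rfl
              rw [hp]
              generalize gain a (tf e (nsq z)) * Real.exp (lam a (tf e (nsq z)))
                / (gain a (tf e (nsq z)) + lam1 a (tf e (nsq z)) ^ 2) = X at h4 ⊢
              have hX : 0 ≤ X := le_trans (by positivity) h4
              gcongr
      have hE := Real.exp_pos (-Φ z)
      calc ‖F z‖ ^ 2 * Real.exp (-Φ z)
          ≤ (2 * V (tf e (nsq z)) ^ 2 + 2 * ‖u‖ ^ 2) * Real.exp (-Φ z) := by gcongr
        _ ≤ _ := by linarith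
    have hFc := hF.continuous
    have hcont : Continuous fun z => ‖F z‖ ^ 2 * Real.exp (-Φ z) := by fun_prop
    have hcb : IntegrableOn (fun _ : Cn n => 4 * Real.exp (-Φ 0)) (Metric.closedBall 0 1) :=
      continuous_const.continuousOn.integrableOn_compact (isCompact_closedBall _ _)
    have hgc := (hgi.const_mul (2 * c₁))
    refine (setIntegral_mono_on (hcont.continuousOn.integrableOn_compact (isCompact_closedBall _ _))
      (hcb.add hgc.integrableOn) Metric.isClosed_closedBall.measurableSet hpt).trans ?_
    rw [integral_add' hcb hgc.integrableOn, setIntegral_const, integral_const_mul, smul_eq_mul]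
    have h1 : ∫ z in Metric.closedBall (0 : Cn n) 1, g z ≤ ∫ z, g z :=
      setIntegral_le_integral hgi (ae_of_all _ hg0)
    have h2 : 2 * c₁ * ∫ z in Metric.closedBall (0 : Cn n) 1, g z
        ≤ 2 * c₁ * (K * Real.exp (-Φ 0)) := by gcongr; exact h1.trans hgK
    linarith

/-! ### The sub-mean value property: from local to global -/

/-- Entire functions with the mean value property on all circles. -/
structure IsMeanValue (H : ℂ → ℂ) : Prop where
  cont : Continuous H
  avg : ∀ c r, Real.circleAverage H c r = H c

lemma IsMeanValue.of_differentiable {H : ℂ → ℂ} (h : Differentiable ℂ H) : IsMeanValue H :=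
  ⟨h.continuous, fun _ _ => h.diffContOnCl.circleAverage⟩

lemma IsMeanValue.conj {H : ℂ → ℂ} (h : IsMeanValue H) : IsMeanValue fun ζ => conj (H ζ) := by
  refine ⟨Complex.continuous_conj.comp h.cont, fun c r => ?_⟩
  have := Complex.conjCLE.toContinuousLinearMap.circleAverage_comp_comm (f := H) (c := c) (R := r)
    h.cont.continuousOn.circleIntegrable'
  rw [h.avg] at this
  exact this

lemma IsMeanValue.add {H K : ℂ → ℂ} (h : IsMeanValue H) (k : IsMeanValue K) :
    IsMeanValue fun ζ => H ζ + K ζ := by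
  refine ⟨h.cont.add k.cont, fun c r => ?_⟩
  rw [Real.circleAverage_fun_add h.cont.continuousOn.circleIntegrable'
    k.cont.continuousOn.circleIntegrable', h.avg, k.avg]

lemma IsMeanValue.const_mul {H : ℂ → ℂ} (h : IsMeanValue H) (a : ℂ) :
    IsMeanValue fun ζ => a * H ζ := by
  refine ⟨h.cont.const_mul a, fun c r => ?_⟩
  have := Real.circleAverage_fun_smul (f := H) (a := a) (c := c) (R := r)
  simp only [smul_eq_mul] at this
  rw [this, h.avg]

lemma IsMeanValue.re {H : ℂ → ℂ} (h : IsMeanValue H) (c : ℂ) (r : ℝ) :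
    Real.circleAverage (fun ζ => (H ζ).re) c r = (H c).re := by
  have := Complex.reCLM.circleAverage_comp_comm (f := H) (c := c) (R := r)
    h.cont.continuousOn.circleIntegrable'
  rw [h.avg] at this
  exact this

/-- Continuous functions on the unit circle are uniformly approximated by boundary values of
functions with the mean value property. -/
theorem exists_isMeanValue_near {g : ℂ → ℝ} (hg : Continuous g) {η : ℝ} (hη : 0 < η) :
    ∃ H : ℂ → ℂ, IsMeanValue H ∧ ∀ ζ : ℂ, ‖ζ‖ = 1 → |g ζ - (H ζ).re| < η := by
  have : Fact (0 < 2 * Real.pi) := ⟨Real.two_pi_pos⟩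
  let f : C(AddCircle (2 * Real.pi), ℂ) :=
    ⟨fun x => (g (AddCircle.toCircle x : ℂ) : ℂ), by
      have := (AddCircle.continuous_toCircle (T := 2 * Real.pi)); fun_prop⟩
  have hf : f ∈ (Submodule.span ℂ (Set.range <| @fourier (2 * Real.pi))).topologicalClosure := by
    rw [span_fourier_closure_eq_top]; trivial
  have hf' : f ∈ closure
      (Submodule.span ℂ (Set.range <| @fourier (2 * Real.pi)) : Set C(AddCircle (2 * Real.pi), ℂ)) := hf
  obtain ⟨p, hp, hpf⟩ := Metric.mem_closure_iff.1 hf' η hη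
  have key : ∃ H : ℂ → ℂ, IsMeanValue H ∧
      ∀ x : AddCircle (2 * Real.pi), H (AddCircle.toCircle x : ℂ) = p x := by
    refine Submodule.span_induction (p := fun p _ => ∃ H : ℂ → ℂ, IsMeanValue H ∧
      ∀ x : AddCircle (2 * Real.pi), H (AddCircle.toCircle x : ℂ) = p x) ?_ ?_ ?_ ?_ hp
    · rintro _ ⟨k, rfl⟩
      have hpow : ∀ k : ℕ, ∀ x : AddCircle (2 * Real.pi),
          (AddCircle.toCircle x : ℂ) ^ k = fourier (k : ℤ) x := fun k x => by
        rw [fourier_apply, natCast_zsmul, AddCircle.toCircle_nsmul, Circle.coe_pow]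
      rcases Int.eq_nat_or_neg k with ⟨k, rfl | rfl⟩
      · exact ⟨fun ζ => ζ ^ k, .of_differentiable (by fun_prop), hpow k⟩
      · refine ⟨fun ζ => conj (ζ ^ k),
          (IsMeanValue.of_differentiable (by fun_prop)).conj, fun x => ?_⟩
        rw [fourier_neg, ← hpow]
    · exact ⟨fun _ => 0, .of_differentiable (by fun_prop), fun _ => rfl⟩
    · rintro p q _ _ ⟨H, hH, hHp⟩ ⟨K, hK, hKq⟩
      exact ⟨_, hH.add hK, fun x => by simp [hHp, hKq]⟩
    · rintro a p _ ⟨H, hH, hHp⟩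
      exact ⟨_, hH.const_mul a, fun x => by simp [hHp]⟩
  obtain ⟨H, hH, hHp⟩ := key
  refine ⟨H, hH, fun ζ hζ => ?_⟩
  obtain ⟨x, hx⟩ := (AddCircle.homeomorphCircle Real.two_pi_pos.ne').surjective
    (⟨ζ, mem_sphere_zero_iff_norm.2 hζ⟩ : Circle)
  rw [AddCircle.homeomorphCircle_apply] at hx
  have hx' : (AddCircle.toCircle x : ℂ) = ζ := congrArg Subtype.val hx
  have h1 := (ContinuousMap.dist_apply_le_dist (f := f) (g := p) x).trans_lt hpf
  rw [dist_eq_norm, ← hHp, hx'] at h1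
  have h2 : f x = (g ζ : ℂ) := by rw [← hx']; rfl
  rw [h2] at h1
  refine lt_of_le_of_lt ?_ h1
  simpa using Complex.abs_re_le_norm ((g ζ : ℂ) - H ζ)

/-- A continuous function with the local sub-mean value property satisfies the sub-mean value
inequality on the unit circle. -/
theorem le_circleAverage_of_local {g : ℂ → ℝ} (hg : Continuous g)
    (hl : ∀ ζ, ∃ ε > 0, ∀ r, 0 < r → r < ε → g ζ ≤ Real.circleAverage g ζ r) :
    g 0 ≤ Real.circleAverage g 0 1 := by
  refine le_of_forall_pos_le_add fun η' hη' => ?_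
  obtain ⟨η, hη, rfl⟩ : ∃ η > 0, η' = 3 * η := ⟨η' / 3, by positivity, by ring⟩
  obtain ⟨H, hH, hgH⟩ := exists_isMeanValue_near hg hη
  have hHr : Continuous fun ζ => (H ζ).re := Complex.continuous_re.comp hH.cont
  let v : ℂ → ℝ := fun ζ => g ζ - (H ζ).re + η * ‖ζ‖ ^ 2
  have hv : Continuous v := by fun_prop
  obtain ⟨ζ₀, hζ₀, hmax⟩ := (isCompact_closedBall (0 : ℂ) 1).exists_isMaxOn ⟨0, by simp⟩ hv.continuousOn
  have hζ₁ : ‖ζ₀‖ = 1 := by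
    by_contra hne
    have hlt : ‖ζ₀‖ < 1 := lt_of_le_of_ne (by simpa using hζ₀) hne
    obtain ⟨ε, hε, hsub⟩ := hl ζ₀
    set r := min ε (1 - ‖ζ₀‖) / 2 with hr
    have hm : 0 < min ε (1 - ‖ζ₀‖) := lt_min hε (by linarith)
    have hr0 : 0 < r := by positivity
    have hrε : r < ε := by have := min_le_left ε (1 - ‖ζ₀‖); linarith
    have hr1 : r ≤ 1 - ‖ζ₀‖ := by have := min_le_right ε (1 - ‖ζ₀‖); linarith
    have h1 := hsub r hr0 hrε
    have hci : ∀ {f : ℂ → ℝ}, Continuous f → CircleIntegrable f ζ₀ r :=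
      fun hf => hf.continuousOn.circleIntegrable'
    have h2 : Real.circleAverage (fun ζ : ℂ => ‖ζ‖ ^ 2) ζ₀ r = ‖ζ₀‖ ^ 2 + r ^ 2 := by
      have e : Set.EqOn (fun ζ : ℂ => ‖ζ‖ ^ 2) (fun ζ => (2 * conj ζ₀ * ζ).re + (r ^ 2 - ‖ζ₀‖ ^ 2))
          (Metric.sphere ζ₀ |r|) := by
        intro ζ hζ
        have : ‖ζ - ζ₀‖ = r := by rw [← dist_eq_norm, Metric.mem_sphere.1 hζ, abs_of_pos hr0]
        simp only [← this, Complex.sq_norm, Complex.normSq_apply]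
        simp; ring
      have hh : IsMeanValue fun ζ => 2 * conj ζ₀ * ζ := .of_differentiable (by fun_prop)
      have hhc : Continuous fun ζ => (2 * conj ζ₀ * ζ).re := by fun_prop
      rw [Real.circleAverage_congr_sphere e, Real.circleAverage_fun_add
        (hci hhc) (hci continuous_const), hh.re, Real.circleAverage_const, Complex.sq_norm, Complex.normSq_apply]
      simp; ring
    have h3 : Real.circleAverage v ζ₀ r
        = Real.circleAverage g ζ₀ r - (H ζ₀).re + η * (‖ζ₀‖ ^ 2 + r ^ 2) := by
      have := Real.circleAverage_fun_smul (f := fun ζ : ℂ => ‖ζ‖ ^ 2) (a := η) (c := ζ₀) (R := r)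
      simp only [smul_eq_mul] at this
      rw [← h2, ← this, ← hH.re ζ₀ r, ← Real.circleAverage_fun_sub (hci hg) (hci hHr),
        ← Real.circleAverage_fun_add (hci (by fun_prop : Continuous fun ζ => g ζ - (H ζ).re))
          (hci (by fun_prop : Continuous fun ζ : ℂ => η * ‖ζ‖ ^ 2))]
    have h4 : Real.circleAverage v ζ₀ r ≤ v ζ₀ := by
      refine Real.circleAverage_mono_on_of_le_circle (hci hv) fun ζ hζ => hmax ?_
      rw [abs_of_pos hr0] at hζ
      have h5 := norm_add_le (ζ - ζ₀) ζ₀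
      rw [sub_add_cancel, ← dist_eq_norm, Metric.mem_sphere.1 hζ] at h5
      simp; linarith
    have h6 : v ζ₀ = g ζ₀ - (H ζ₀).re + η * ‖ζ₀‖ ^ 2 := rfl
    have : 0 < η * r ^ 2 := by positivity
    nlinarith
  have h0 : v 0 ≤ v ζ₀ := hmax (by simp)
  have h1 : v ζ₀ = g ζ₀ - (H ζ₀).re + η := by simp [v, hζ₁]
  have h2 : v 0 = g 0 - (H 0).re := by simp [v]
  have h3 := (abs_lt.1 (hgH ζ₀ hζ₁)).2
  have h4 : (H 0).re ≤ Real.circleAverage g 0 1 + η := by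
    rw [← hH.re 0 1]
    have := Real.circleAverage_fun_add (f₁ := g) (f₂ := fun _ => η) (c := 0) (R := 1)
      hg.continuousOn.circleIntegrable' continuous_const.continuousOn.circleIntegrable'
    rw [Real.circleAverage_const] at this
    rw [← this]
    refine Real.circleAverage_mono hHr.continuousOn.circleIntegrable'
      (by fun_prop : Continuous fun ζ => g ζ + η).continuousOn.circleIntegrable' fun ζ hζ => ?_
    have := (abs_lt.1 (hgH ζ (by simpa using hζ))).1
    linarith
  linarith

/-! ### Smooth functions with the sub-mean value property have nonnegative Levi form -/

/-- The sub-mean value inequality on all closed discs. -/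
def GlobSubmean (φ : Cn n → ℝ) : Prop :=
  ∀ z w : Cn n, φ z ≤ Real.circleAverage (fun ζ : ℂ => φ (z + ζ • w)) 0 1

lemma fderiv_cst {Ψ : Cn n → ℝ} (h : ContDiff ℝ ∞ Ψ) (z v w : Cn n) :
    fderiv ℝ (fderiv ℝ (cst Ψ)) z v w = ((fderiv ℝ (fderiv ℝ Ψ) z v w : ℝ) : ℂ) := by
  have h1 : fderiv ℝ (cst Ψ) = fun z => (Complex.ofRealCLM).comp (fderiv ℝ Ψ z) := by
    funext z
    exact (Complex.ofRealCLM.hasFDerivAt.comp z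
      (h.differentiable (by simp) z).hasFDerivAt).fderiv
  have h2 : ContDiff ℝ ∞ (fderiv ℝ Ψ) := h.fderiv_right (by simp)
  have h3 := ((ContinuousLinearMap.compL ℝ (Cn n) ℝ ℂ Complex.ofRealCLM).hasFDerivAt.comp z
    (h2.differentiable (by simp) z).hasFDerivAt).fderiv
  have h4 : fderiv ℝ (fderiv ℝ (cst Ψ)) z
      = (ContinuousLinearMap.compL ℝ (Cn n) ℝ ℂ Complex.ofRealCLM).comp
        (fderiv ℝ (fderiv ℝ Ψ) z) := by
    rw [h1]; exact h3
  rw [h4]; rfl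

lemma levi_eq {Ψ : Cn n → ℝ} (h : ContDiff ℝ ∞ Ψ) (z b : Cn n) :
    levi Ψ z b = (1 / 4) * (fderiv ℝ (fderiv ℝ Ψ) z b b
      + fderiv ℝ (fderiv ℝ Ψ) z (Complex.I • b) (Complex.I • b)) := by
  set S := fderiv ℝ (fderiv ℝ Ψ) z with hS
  have hb : b = ∑ j, ((b j).re • eb j + (b j).im • (Complex.I • eb j)) := by
    conv_lhs => rw [sum_smul_eb b]
    refine Finset.sum_congr rfl fun j _ => ?_
    funext k
    simp only [Pi.smul_apply, Pi.add_apply, smul_eq_mul, Complex.real_smul]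
    conv_lhs => rw [← Complex.re_add_im (b j)]
    ring
  have hib : Complex.I • b = ∑ j, ((b j).re • (Complex.I • eb j) + (-(b j).im) • eb j) := by
    conv_lhs => rw [sum_smul_eb b, Finset.smul_sum]
    refine Finset.sum_congr rfl fun j _ => ?_
    funext k
    simp only [Pi.smul_apply, Pi.add_apply, smul_eq_mul, Complex.real_smul]
    conv_lhs => rw [← Complex.re_add_im (b j)]
    push_cast
    linear_combination ((b j).im * eb j k : ℂ) * Complex.I_mul_I
  have e1 : S b b = ∑ j, ∑ k, S ((b j).re • eb j + (b j).im • (Complex.I • eb j))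
      ((b k).re • eb k + (b k).im • (Complex.I • eb k)) := by
    conv_lhs => rw [hb]
    simp only [map_sum, sum_apply]
    rw [Finset.sum_comm]
  have e2 : S (Complex.I • b) (Complex.I • b)
      = ∑ j, ∑ k, S ((b j).re • (Complex.I • eb j) + (-(b j).im) • eb j)
      ((b k).re • (Complex.I • eb k) + (-(b k).im) • eb k) := by
    conv_lhs => rw [hib]
    simp only [map_sum, sum_apply]
    rw [Finset.sum_comm]
  rw [e1, e2, levi, Complex.re_sum, ← Finset.sum_add_distrib, Finset.mul_sum]
  refine Finset.sum_congr rfl fun j _ => ?_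
  rw [Complex.re_sum, ← Finset.sum_add_distrib, Finset.mul_sum]
  refine Finset.sum_congr rfl fun k _ => ?_
  rw [wd_wd h.cst]
  simp only [fderiv_cst h, ← hS, map_add, map_smul, add_apply, smul_apply, smul_eq_mul]
  have e4 : (1 / 4 : ℂ) = ((1 / 4 : ℝ) : ℂ) := by norm_num
  rw [e4]
  simp
  ring

lemma levi_comp_add {Ψ : Cn n → ℝ} (h : ContDiff ℝ ∞ Ψ) (a z b : Cn n) :
    levi (fun y => Ψ (a + y)) z b = levi Ψ (a + z) b := by
  have h' : ContDiff ℝ ∞ fun y => Ψ (a + y) := h.comp (contDiff_const.add contDiff_id)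
  have e : fderiv ℝ (fun y => Ψ (a + y)) = fun y => fderiv ℝ Ψ (a + y) :=
    funext fun y => fderiv_comp_add_left a
  rw [levi_eq h', levi_eq h, e, fderiv_comp_add_left (f := fderiv ℝ Ψ) a]

lemma taylor_two {E : Type*} [NormedAddCommGroup E] [NormedSpace ℝ E] {φ : E → ℝ}
    (h : ContDiff ℝ ∞ φ) (z : E) {η : ℝ} (hη : 0 < η) :
    ∃ δ > 0, ∀ v : E, ‖v‖ < δ →
      φ (z + v) ≤ φ z + fderiv ℝ φ z v + (1 / 2) * fderiv ℝ (fderiv ℝ φ) z v v + η * ‖v‖ ^ 2 := by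
  have h2 : ContDiff ℝ ∞ (fderiv ℝ φ) := h.fderiv_right (by simp)
  set S := fderiv ℝ (fderiv ℝ φ) z with hS
  have hsymm : IsSymmSndFDerivAt ℝ φ z := h.contDiffAt.isSymmSndFDerivAt
    (by simpa using WithTop.coe_le_coe.2 (le_top : (2 : ℕ∞) ≤ ⊤))
  have hd := (h2.differentiable (by simp) z).hasFDerivAt
  rw [← hS, hasFDerivAt_iff_isLittleO_nhds_zero] at hd
  obtain ⟨δ, hδ, hball⟩ := Metric.eventually_nhds_iff.1 (hd.def hη)
  refine ⟨δ, hδ, fun v hv => ?_⟩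
  let g : E → ℝ := fun v => φ (z + v) - fderiv ℝ φ z v - (1 / 2) * S v v
  have hg : ∀ x, HasFDerivAt g (fderiv ℝ φ (z + x) - fderiv ℝ φ z - S x) x := by
    intro x
    have a1 : HasFDerivAt (fun v => φ (z + v)) (fderiv ℝ φ (z + x)) x := by
      have := ((h.differentiable (by simp) (z + x)).hasFDerivAt.comp x
        ((hasFDerivAt_id x).const_add z))
      exact this
    have a2 : HasFDerivAt (fun v => S v v) ((S x) + (S.flip x)) x := by
      exact S.hasFDerivAt (x := x) |>.clm_apply (hasFDerivAt_id x)
    have a3 := (a1.sub (fderiv ℝ φ z).hasFDerivAt).sub (a2.const_mul (1 / 2))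
    refine a3.congr_fderiv ?_
    refine ContinuousLinearMap.ext fun w => ?_
    have := hsymm.eq x w
    rw [← hS] at this
    simp [this]
    ring
  have hb := Convex.norm_image_sub_le_of_norm_hasFDerivWithin_le (f := g) (C := η * ‖v‖)
    (s := Metric.closedBall 0 ‖v‖) (x := 0) (y := v)
    (fun x _ => (hg x).hasFDerivWithinAt) (fun x hx => ?_) (convex_closedBall _ _) (by simp) (by simp)
  · have := (le_abs_self _).trans hb
    simp only [g, add_zero, map_zero, sub_zero, mul_zero] at this
    nlinarith
  · have hx' : ‖x‖ ≤ ‖v‖ := by simpa using hx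
    have := hball (y := x) (by simpa using hx'.trans_lt hv)
    exact this.trans (by gcongr)

theorem GlobSubmean.levi_nonneg {φ : Cn n → ℝ} (h : ContDiff ℝ ∞ φ) (hs : GlobSubmean φ)
    (z b : Cn n) : 0 ≤ levi φ z b := by
  rw [levi_eq h]
  set S := fderiv ℝ (fderiv ℝ φ) z with hS
  set Q := S b b + S (Complex.I • b) (Complex.I • b) with hQ
  suffices hh : ∀ η > 0, -(4 * ‖b‖ ^ 2) * η ≤ Q by
    have : Tendsto (fun η : ℝ => -(4 * ‖b‖ ^ 2) * η) (𝓝[>] 0) (𝓝 (-(4 * ‖b‖ ^ 2) * 0)) :=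
      (continuous_const.mul continuous_id).continuousAt.tendsto.mono_left nhdsWithin_le_nhds
    have := le_of_tendsto this (eventually_nhdsWithin_of_forall hh)
    linarith
  intro η hη
  obtain ⟨δ, hδ, ht⟩ := taylor_two h z hη
  set r := δ / (2 * (‖b‖ + 1)) with hr
  have hr0 : 0 < r := by positivity
  have hrb : r * ‖b‖ < δ := by
    rw [hr, div_mul_eq_mul_div, div_lt_iff₀ (by positivity)]
    nlinarith [norm_nonneg b]
  set D := fderiv ℝ φ z with hD
  let α : ℂ := ⟨D b, -D (Complex.I • b)⟩
  let c : ℂ := ⟨(S b b - S (Complex.I • b) (Complex.I • b)) / 4,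
    -(S b (Complex.I • b) + S (Complex.I • b) b) / 4⟩
  let P : ℂ → ℂ := fun ζ => (r * α) * ζ + (r ^ 2 * c) * ζ ^ 2
  have hP : IsMeanValue P := .of_differentiable (by fun_prop)
  have hPc := hP.cont
  have h1 := hs z ((r : ℂ) • b)
  have hφc : Continuous φ := h.continuous
  have h2 : Real.circleAverage (fun ζ : ℂ => φ (z + ζ • (r : ℂ) • b)) 0 1
      ≤ Real.circleAverage (fun ζ => (P ζ).re + (φ z + r ^ 2 / 4 * Q + η * (r * ‖b‖) ^ 2)) 0 1 := by
    refine Real.circleAverage_mono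
      (by fun_prop : Continuous fun ζ : ℂ => φ (z + ζ • (r : ℂ) • b)).continuousOn.circleIntegrable'
      (by fun_prop : Continuous fun ζ => (P ζ).re + (φ z + r ^ 2 / 4 * Q + η * (r * ‖b‖) ^ 2)).continuousOn.circleIntegrable'
      fun ζ hζ => ?_
    have hζ1 : ‖ζ‖ = 1 := by simpa using hζ
    have hn : ‖ζ • (r : ℂ) • b‖ = r * ‖b‖ := by
      rw [norm_smul, norm_smul, hζ1, one_mul, Complex.norm_real, Real.norm_of_nonneg hr0.le]
    have h3 := ht (ζ • (r : ℂ) • b) (by rw [hn]; exact hrb)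
    rw [hn] at h3
    have hdec : ζ • (r : ℂ) • b = (r * ζ.re) • b + (r * ζ.im) • (Complex.I • b) := by
      funext k
      simp only [Pi.smul_apply, Pi.add_apply, smul_eq_mul, Complex.real_smul]
      conv_lhs => rw [← Complex.re_add_im ζ]
      push_cast; ring
    have hsq : ζ.re ^ 2 + ζ.im ^ 2 = 1 := by
      have := Complex.sq_norm ζ
      rw [hζ1, Complex.normSq_apply] at this; linarith
    refine h3.trans (le_of_eq ?_)
    rw [hdec]
    simp only [map_add, map_smul, add_apply, smul_apply, smul_eq_mul]
    have : (P ζ).re = r * (ζ.re * D b + ζ.im * D (Complex.I • b)) + r ^ 2 *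
        ((ζ.re ^ 2 - ζ.im ^ 2) * ((S b b - S (Complex.I • b) (Complex.I • b)) / 4)
          + 2 * ζ.re * ζ.im * ((S b (Complex.I • b) + S (Complex.I • b) b) / 4)) := by
      simp only [P, α, c, pow_two]
      simp
      ring
    rw [this, hQ]
    linear_combination (r ^ 2 / 4) * (S b b + S (Complex.I • b) (Complex.I • b)) * hsq
  have h3 : Real.circleAverage (fun ζ => (P ζ).re + (φ z + r ^ 2 / 4 * Q + η * (r * ‖b‖) ^ 2)) 0 1
      = φ z + r ^ 2 / 4 * Q + η * (r * ‖b‖) ^ 2 := by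
    rw [Real.circleAverage_fun_add
      (by fun_prop : Continuous fun ζ => (P ζ).re).continuousOn.circleIntegrable'
      continuous_const.continuousOn.circleIntegrable', hP.re, Real.circleAverage_const]
    simp [P]
  rw [h3] at h2
  have h4 : 0 ≤ r ^ 2 * (Q / 4 + η * ‖b‖ ^ 2) := by linarith
  have h5 := (mul_nonneg_iff_of_pos_left (by positivity : 0 < r ^ 2)).1 h4
  linarith

/-! ### Sup-convolution and mollification -/

/-- The sub-mean value inequality on all small circles, for real-valued functions. -/
def LocSubmean (u : Cn n → ℝ) : Prop := ∀ z w : Cn n, ∃ ε > 0, ∀ r, 0 < r → r < ε →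
  u z ≤ Real.circleAverage (fun ζ : ℂ => u (z + ζ • w)) 0 r

lemma LocSubmean.glob {u : Cn n → ℝ} (hu : Continuous u) (h : LocSubmean u) : GlobSubmean u := by
  intro z w
  have := le_circleAverage_of_local (g := fun ζ => u (z + ζ • w)) (by fun_prop) fun ζ => ?_
  · simpa using this
  · obtain ⟨ε, hε, hs⟩ := h (z + ζ • w) w
    refine ⟨ε, hε, fun r hr hrε => (hs r hr hrε).trans (le_of_eq ?_)⟩
    rw [← Real.circleAverage_map_add_const (c := ζ)]
    congr 1; funext ξ
    congr 1; rw [add_smul, add_assoc, add_comm (ζ • w)]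

lemma circleIntegrable_of_usc {u : Cn n → ℝ} (hu : UpperSemicontinuous u) {L A B : ℝ}
    (hB : 0 ≤ B) (hl : ∀ y, L ≤ u y) (hA : ∀ y, u y ≤ A + B * ‖y‖) (z w : Cn n) (r : ℝ) :
    CircleIntegrable (fun ζ : ℂ => u (z + ζ • w)) 0 r := by
  have hm : Measurable u := hu.measurable
  have hc : Continuous fun θ : ℝ => z + circleMap 0 r θ • w := by fun_prop
  have hb : ∀ θ : ℝ, ‖z + circleMap 0 r θ • w‖ ≤ ‖z‖ + |r| * ‖w‖ := fun θ => by
    refine (norm_add_le _ _).trans ?_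
    rw [norm_smul]; simp
  refine (intervalIntegrable_const (c := |L| + |A| + B * (‖z‖ + |r| * ‖w‖))).mono_fun
    (hm.comp hc.measurable).aestronglyMeasurable (ae_of_all _ fun θ => ?_)
  have h1 := hl (z + circleMap 0 r θ • w)
  have h2 := hA (z + circleMap 0 r θ • w)
  have h3 := mul_le_mul_of_nonneg_left (hb θ) hB
  have h4 : 0 ≤ B * (‖z‖ + |r| * ‖w‖) := by positivity
  change |u (z + circleMap 0 r θ • w)| ≤ ‖|L| + |A| + B * (‖z‖ + |r| * ‖w‖)‖
  rw [Real.norm_of_nonneg (by positivity), abs_le]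
  constructor <;> linarith [neg_abs_le L, le_abs_self A, abs_nonneg A, abs_nonneg L]

lemma continuous_of_le_add {U : Cn n → ℝ} {k : ℝ} (hk : 0 ≤ k)
    (h : ∀ z z', U z ≤ U z' + k * ‖z - z'‖) : Continuous U := by
  have : LipschitzWith k.toNNReal U := LipschitzWith.of_le_add_mul _ fun a b => by
    rw [Real.coe_toNNReal _ hk, dist_eq_norm]
    exact h a b
  exact this.continuous

/-- The sup-convolution: a Lipschitz majorant with the sub-mean value property. -/
theorem exists_lipschitz_majorant {u : Cn n → ℝ} (hu : UpperSemicontinuous u)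
    (hs : LocSubmean u) {L A B k : ℝ} (hB : 0 ≤ B) (hk : B < k) (hl : ∀ y, L ≤ u y)
    (hA : ∀ y, u y ≤ A + B * ‖y‖) :
    ∃ U : Cn n → ℝ, (∀ z z', U z ≤ U z' + k * ‖z - z'‖) ∧ LocSubmean U ∧ (∀ z, u z ≤ U z) ∧
      ∀ z, ∃ y, U z = u y - k * ‖z - y‖ := by
  have hatt : ∀ z : Cn n, ∃ y, ∀ x, u x - k * ‖z - x‖ ≤ u y - k * ‖z - y‖ := by
    intro z
    set R := max ‖z‖ ((A + k * ‖z‖ - u z) / (k - B)) with hR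
    have hcont : Continuous fun x : Cn n => -(k * ‖z - x‖) := by fun_prop
    have husc : UpperSemicontinuous fun x => u x + -(k * ‖z - x‖) :=
      hu.add hcont.upperSemicontinuous
    obtain ⟨y, _, hy⟩ := UpperSemicontinuousOn.exists_isMaxOn (s := Metric.closedBall (0 : Cn n) R)
      ⟨z, by simp [hR]⟩ (isCompact_closedBall _ _) (husc.upperSemicontinuousOn _)
    refine ⟨y, fun x => ?_⟩
    have hzy : u z - k * ‖z - z‖ ≤ u y - k * ‖z - y‖ := by
      have := hy (show z ∈ Metric.closedBall (0 : Cn n) R by simp [hR])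
      simp only [Set.mem_ofPred_eq] at this
      linarith
    rcases le_or_gt ‖x‖ R with hx | hx
    · have := hy (show x ∈ Metric.closedBall (0 : Cn n) R by simpa using hx)
      simp only [Set.mem_ofPred_eq] at this
      linarith
    · have h1 : (A + k * ‖z‖ - u z) / (k - B) < ‖x‖ := (le_max_right _ _).trans_lt hx
      rw [div_lt_iff₀ (by linarith)] at h1
      have h2 := hA x
      have h3 : ‖x‖ - ‖z‖ ≤ ‖z - x‖ := by rw [norm_sub_rev]; exact norm_sub_norm_le x z
      have h4 := mul_le_mul_of_nonneg_left h3 (hB.trans hk.le)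
      simp only [sub_self, norm_zero, mul_zero] at hzy
      linarith
  choose y hy using hatt
  have hk0 : 0 ≤ k := hB.trans hk.le
  have hlip : ∀ a b : Cn n, u (y a) - k * ‖a - y a‖ ≤ u (y b) - k * ‖b - y b‖ + k * ‖a - b‖ := by
    intro a b
    have h1 := hy b (y a)
    have h2 := mul_le_mul_of_nonneg_left (norm_sub_le_norm_sub_add_norm_sub b a (y a)) hk0
    rw [norm_sub_rev b a] at h2
    linarith
  refine ⟨fun z => u (y z) - k * ‖z - y z‖, hlip, fun z w => ?_, fun z => ?_,
    fun z => ⟨y z, rfl⟩⟩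
  · obtain ⟨ε, hε, h⟩ := hs (y z) w
    refine ⟨ε, hε, fun r hr hrε => ?_⟩
    have h1 := h r hr hrε
    have hci := circleIntegrable_of_usc hu hB hl hA (y z) w r
    have h2 : Real.circleAverage (fun ζ : ℂ => u (y z + ζ • w) - k * ‖z - y z‖) 0 r
        = Real.circleAverage (fun ζ : ℂ => u (y z + ζ • w)) 0 r - k * ‖z - y z‖ := by
      rw [Real.circleAverage_fun_sub hci continuous_const.continuousOn.circleIntegrable',
        Real.circleAverage_const]
    have hcont : Continuous fun z => u (y z) - k * ‖z - y z‖ := continuous_of_le_add hk0 hlip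
    have h3 : Real.circleAverage (fun ζ : ℂ => u (y z + ζ • w) - k * ‖z - y z‖) 0 r
        ≤ Real.circleAverage (fun ζ : ℂ => u (y (z + ζ • w)) - k * ‖z + ζ • w - y (z + ζ • w)‖) 0 r := by
      refine Real.circleAverage_mono (hci.sub continuous_const.continuousOn.circleIntegrable')
        (Continuous.continuousOn ?_).circleIntegrable' fun ζ _ => ?_
      · exact hcont.comp (by fun_prop : Continuous fun ζ : ℂ => z + ζ • w)
      · have := hy (z + ζ • w) (y z + ζ • w)
        rwa [add_sub_add_right_eq_sub] at this
    linarith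
  · have := hy z z
    simpa using this

/-- The mollification of a Lipschitz function with the sub-mean value property. -/
theorem exists_smooth_near {U : Cn n → ℝ} {k ε : ℝ} (hk : 0 ≤ k) (hε : 0 < ε)
    (hlip : ∀ z z', U z ≤ U z' + k * ‖z - z'‖) (hs : LocSubmean U) :
    ∃ φ : Cn n → ℝ, ContDiff ℝ ∞ φ ∧ (∀ z b, 0 ≤ levi φ z b) ∧ (∀ z, U z ≤ φ z) ∧
      ∀ z, φ z ≤ U z + k * ε := by
  have hU := continuous_of_le_add hk hlip
  have hG := hs.glob hU
  have hUc : Continuous (cst U) := Complex.continuous_ofReal.comp hU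
  have hUi := hUc.locallyIntegrable (μ := (volume : Measure (Cn n)))
  let φ : Cn n → ℝ := fun z => ∫ t, rho ε t * U (z - t)
  have hφ : ∀ z, cv (cst (rho ε)) (cst U) z = (φ z : ℂ) := fun z => by
    rw [cv_apply, ← integral_complex_ofReal]
    congr 1; funext t; push_cast; rfl
  have hsm : ContDiff ℝ ∞ φ := by
    have := cv_contDiff (contDiff_crho ε) (hasCompactSupport_crho hε) hUi
    have h2 : φ = fun z => (cv (cst (rho ε)) (cst U) z).re := by
      funext z; rw [hφ, Complex.ofReal_re]
    rw [h2]
    exact Complex.reCLM.contDiff.comp this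
  have hρc : Continuous (rho ε : Cn n → ℝ) := (contDiff_rho ε).continuous
  have hinteg : ∀ z, Integrable fun t => rho ε t * U (z - t) := fun z =>
    (hρc.mul (by fun_prop)).integrable_of_hasCompactSupport (hasCompactSupport_rho hε).mul_right
  have hcst : ∀ z, ∫ t : Cn n, rho ε t * U z = U z := fun z => by
    rw [integral_mul_const, integral_rho hε, one_mul]
  have hcsti : ∀ c : ℝ, Integrable fun t : Cn n => rho ε t * c := fun c =>
    (integrable_rho hε).mul_const c
  refine ⟨φ, hsm, fun z b => ?_, fun z => ?_, fun z => ?_⟩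
  · refine GlobSubmean.levi_nonneg hsm (fun z w => ?_) z b
    have hF : Continuous fun q : ℝ × Cn n => rho ε q.2 * U (z + circleMap 0 1 q.1 • w - q.2) := by
      have := continuous_circleMap 0 1; fun_prop
    have hFi : Integrable (Function.uncurry fun (θ : ℝ) (t : Cn n) =>
        rho ε t * U (z + circleMap 0 1 θ • w - t))
        ((volume.restrict (Set.uIoc 0 (2 * Real.pi))).prod volume) := by
      have h1 : IntegrableOn (fun q : ℝ × Cn n => rho ε q.2 * U (z + circleMap 0 1 q.1 • w - q.2))
          (Set.uIcc 0 (2 * Real.pi) ×ˢ Metric.closedBall 0 ε) (volume.prod volume) :=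
        hF.continuousOn.integrableOn_compact (isCompact_uIcc.prod (isCompact_closedBall _ _))
      have h2 : IntegrableOn (fun q : ℝ × Cn n => rho ε q.2 * U (z + circleMap 0 1 q.1 • w - q.2))
          (Set.uIcc 0 (2 * Real.pi) ×ˢ Set.univ) (volume.prod volume) := by
        refine h1.of_forall_sdiff_eq_zero (measurableSet_uIcc.prod MeasurableSet.univ) ?_
        rintro ⟨θ, t⟩ ⟨⟨h3, _⟩, h4⟩
        have : ε < ‖t‖ := by
          by_contra h5
          exact h4 ⟨h3, by simpa using h5⟩
        simp only [rho_eq_zero hε this, zero_mul]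
      rw [IntegrableOn, ← Measure.prod_restrict, Measure.restrict_univ] at h2
      refine h2.mono_measure ?_
      exact Measure.prod_mono (Measure.restrict_mono Set.uIoc_subset_uIcc le_rfl) le_rfl
    have h2 := intervalIntegral_integral_swap (μ := volume) hFi
    have h3 : Real.circleAverage (fun ζ : ℂ => φ (z + ζ • w)) 0 1
        = ∫ t, rho ε t * Real.circleAverage (fun ζ : ℂ => U (z - t + ζ • w)) 0 1 := by
      simp only [Real.circleAverage, φ]
      rw [h2, ← integral_smul]
      congr 1; funext t
      rw [intervalIntegral.integral_const_mul, smul_eq_mul, smul_eq_mul, mul_left_comm]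
      congr 3; funext θ
      congr 1; abel
    rw [h3]
    refine integral_mono (hinteg z) ?_ fun t => mul_le_mul_of_nonneg_left (hG (z - t) w) (rho_nonneg ε t)
    have hc : Continuous fun t : Cn n =>
        Real.circleAverage (fun ζ : ℂ => U (z - t + ζ • w)) 0 1 := by
      simp only [Real.circleAverage, smul_eq_mul]
      refine continuous_const.mul ?_
      refine intervalIntegral.continuous_parametric_intervalIntegral_of_continuous' ?_ _ _
      have := continuous_circleMap 0 1
      fun_prop
    exact (hρc.mul hc).integrable_of_hasCompactSupport (hasCompactSupport_rho hε).mul_right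
  · have h := integral_circleAverage (p := rho ε) (f := fun t => U (z - t)) (R := ε)
      (integrable_rho hε) (fun c hc t => rho_smul ε hc t) (fun t ht => rho_eq_zero hε ht)
      (by fun_prop)
    simp only [smul_eq_mul] at h
    rw [← hcst z]
    simp only [φ]
    rw [h]
    have hc : Continuous fun t : Cn n =>
        Real.circleAverage (fun ζ : ℂ => U (z - ζ • t)) 0 1 := by
      simp only [Real.circleAverage, smul_eq_mul]
      refine continuous_const.mul ?_
      refine intervalIntegral.continuous_parametric_intervalIntegral_of_continuous' ?_ _ _
      have := continuous_circleMap 0 1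
      fun_prop
    refine integral_mono (hcsti _)
      ((hρc.mul hc).integrable_of_hasCompactSupport (hasCompactSupport_rho hε).mul_right) fun t => ?_
    refine mul_le_mul_of_nonneg_left ?_ (rho_nonneg ε t)
    have := hG z (-t)
    simpa only [smul_neg, ← sub_eq_add_neg] using this
  · have h1 : ∫ t : Cn n, rho ε t * (U z + k * ε) = U z + k * ε := by
      rw [integral_mul_const, integral_rho hε, one_mul]
    rw [← h1]
    refine integral_mono (hinteg z) (hcsti _) fun t => ?_
    rcases le_or_gt ‖t‖ ε with ht | ht
    · refine mul_le_mul_of_nonneg_left ?_ (rho_nonneg ε t)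
      have := hlip (z - t) z
      have h2 : ‖z - t - z‖ = ‖t‖ := by rw [sub_sub_cancel_left, norm_neg]
      rw [h2] at this
      exact this.trans (by gcongr)
    · simp only [rho_eq_zero hε ht, zero_mul, le_refl]

/-! ### Plurisubharmonic functions without the nontriviality condition -/

/-- Truncation below at `t`, with real values. -/
def tr (t : ℝ) (x : EReal) : ℝ := (max x (t : EReal)).toReal

lemma coe_tr {t : ℝ} {x : EReal} (hx : x < ⊤) : (tr t x : EReal) = max x (t : EReal) :=
  EReal.coe_toReal (max_lt hx (EReal.coe_lt_top t)).ne
    ((EReal.bot_lt_coe t).trans_le (le_max_right _ _)).ne'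

lemma tr_mono {s t : ℝ} {x y : EReal} (hst : s ≤ t) (hxy : x ≤ y) (hy : y < ⊤) :
    tr s x ≤ tr t y := by
  rw [← EReal.coe_le_coe_iff, coe_tr (hxy.trans_lt hy), coe_tr hy]
  exact max_le_max hxy (EReal.coe_le_coe_iff.2 hst)

lemma le_tr {t : ℝ} {x : EReal} (hx : x < ⊤) : t ≤ tr t x := by
  rw [← EReal.coe_le_coe_iff, coe_tr hx]; exact le_max_right _ _

lemma le_coe_tr {t : ℝ} {x : EReal} (hx : x < ⊤) : x ≤ (tr t x : EReal) := by
  rw [coe_tr hx]; exact le_max_left _ _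

lemma tr_le {t s : ℝ} {x : EReal} (h : x ≤ s) (ht : t ≤ s) : tr t x ≤ s := by
  rw [← EReal.coe_le_coe_iff, coe_tr (h.trans_lt (EReal.coe_lt_top s))]
  exact max_le h (EReal.coe_le_coe_iff.2 ht)

lemma tr_coe (t s : ℝ) : tr t (s : EReal) = max s t := by
  rw [← EReal.coe_eq_coe_iff, coe_tr (EReal.coe_lt_top s)]; rfl

lemma measurable_tr (t : ℝ) : Measurable (tr t) :=
  measurable_ereal_toReal.comp (measurable_id.max measurable_const)

/-- Upper semicontinuous on `Ω` with values in `[-∞, ∞)`. -/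
structure UscOn (u : Cn n → EReal) (Ω : Set (Cn n)) : Prop where
  usc : ∀ z ∈ Ω, ∀ c, u z < c → ∀ᶠ y in 𝓝 z, u y < c
  lt_top : ∀ z ∈ Ω, u z < ⊤

/-- The sub-mean value inequality at `z` on all small circles. -/
def SubAt (u : Cn n → EReal) (z : Cn n) : Prop := ∀ w : Cn n, ∃ ε > 0, ∀ r, 0 < r → r < ε →
  ∀ t : ℝ, u z ≤ ((Real.circleAverage (fun ζ : ℂ => tr t (u (z + ζ • w))) 0 r : ℝ) : EReal)

/-- Plurisubharmonic on `Ω`, or identically `-∞` on some components. -/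
structure SubOn (u : Cn n → EReal) (Ω : Set (Cn n)) : Prop extends UscOn u Ω where
  submean : ∀ z ∈ Ω, SubAt u z

lemma UscOn.mono {u : Cn n → EReal} {Ω Ω' : Set (Cn n)} (h : UscOn u Ω) (hs : Ω' ⊆ Ω) :
    UscOn u Ω' := ⟨fun z hz => h.usc z (hs hz), fun z hz => h.lt_top z (hs hz)⟩

lemma SubOn.mono {u : Cn n → EReal} {Ω Ω' : Set (Cn n)} (h : SubOn u Ω) (hs : Ω' ⊆ Ω) :
    SubOn u Ω' := ⟨h.toUscOn.mono hs, fun z hz => h.submean z (hs hz)⟩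

lemma eventually_circle {P : Cn n → Prop} {z : Cn n} (h : ∀ᶠ y in 𝓝 z, P y) (w : Cn n) :
    ∃ ε > 0, ∀ ζ : ℂ, ‖ζ‖ < ε → P (z + ζ • w) := by
  have hc : Tendsto (fun ζ : ℂ => z + ζ • w) (𝓝 0) (𝓝 z) := by
    have : Continuous fun ζ : ℂ => z + ζ • w := by fun_prop
    simpa using this.tendsto 0
  obtain ⟨ε, hε, H⟩ := Metric.eventually_nhds_iff.1 (hc.eventually h)
  exact ⟨ε, hε, fun ζ hζ => H (by simpa using hζ)⟩

lemma UscOn.circleIntegrable {u : Cn n → EReal} {Ω : Set (Cn n)} (h : UscOn u Ω) {z w : Cn n}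
    {r : ℝ} (hr : 0 < r) (hin : ∀ ζ : ℂ, ‖ζ‖ = r → z + ζ • w ∈ Ω) (t : ℝ) :
    CircleIntegrable (fun ζ : ℂ => tr t (u (z + ζ • w))) 0 r := by
  have hin' : ∀ θ : ℝ, z + circleMap 0 r θ • w ∈ Ω := fun θ =>
    hin _ (by rw [norm_circleMap_zero, abs_of_pos hr])
  have hc : Continuous fun θ : ℝ => z + circleMap 0 r θ • w := by fun_prop
  have hu : UpperSemicontinuous fun θ : ℝ => u (z + circleMap 0 r θ • w) := fun θ c hθ =>
    (hc.tendsto θ).eventually (h.usc _ (hin' θ) c hθ)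
  obtain ⟨x, _, hx⟩ := UpperSemicontinuousOn.exists_isMaxOn (s := Set.uIcc 0 (2 * Real.pi))
    ⟨0, Set.left_mem_uIcc⟩ isCompact_uIcc (hu.upperSemicontinuousOn _)
  refine (intervalIntegrable_const (c := |t| + |tr t (u (z + circleMap 0 r x • w))|)).mono_fun
    ((measurable_tr t).comp hu.measurable).aestronglyMeasurable ?_
  rw [Filter.EventuallyLE, ae_restrict_iff' measurableSet_uIoc]
  refine ae_of_all _ fun θ hθ => ?_
  have h1 := tr_mono (le_refl t) (hx (Set.uIoc_subset_uIcc hθ)) (h.lt_top _ (hin' x))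
  have h2 := le_tr (t := t) (h.lt_top _ (hin' θ))
  change |tr t (u (z + circleMap 0 r θ • w))| ≤ ‖|t| + |tr t (u (z + circleMap 0 r x • w))|‖
  rw [Real.norm_of_nonneg (by positivity), abs_le]
  constructor <;> linarith [neg_abs_le t, abs_nonneg t,
    le_abs_self (tr t (u (z + circleMap 0 r x • w))),
    abs_nonneg (tr t (u (z + circleMap 0 r x • w)))]

lemma SubAt.touch {u v : Cn n → EReal} {Ω : Set (Cn n)} (hΩ : IsOpen Ω) {z : Cn n} (hz : z ∈ Ω)
    (hu : UscOn u Ω) (hv : UscOn v Ω) (h : SubAt u z) (hle : ∀ y ∈ Ω, u y ≤ v y)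
    (heq : v z ≤ u z) : SubAt v z := by
  intro w
  obtain ⟨ε₁, hε₁, h₁⟩ := h w
  obtain ⟨ε₂, hε₂, h₂⟩ := eventually_circle (hΩ.mem_nhds hz) w
  refine ⟨min ε₁ ε₂, lt_min hε₁ hε₂, fun r hr hrε t => heq.trans ((h₁ r hr
    (hrε.trans_le (min_le_left _ _)) t).trans (EReal.coe_le_coe_iff.2 ?_))⟩
  have hin : ∀ ζ : ℂ, ‖ζ‖ = r → z + ζ • w ∈ Ω := fun ζ hζ =>
    h₂ ζ (by rw [hζ]; exact hrε.trans_le (min_le_right _ _))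
  refine Real.circleAverage_mono (hu.circleIntegrable hr hin t) (hv.circleIntegrable hr hin t)
    fun ζ hζ => ?_
  have hζ' := hin ζ (by simpa [abs_of_pos hr] using hζ)
  exact tr_mono le_rfl (hle _ hζ') (hv.lt_top _ hζ')

lemma SubAt.of_eq_bot {u : Cn n → EReal} {z : Cn n} (h : u z = ⊥) : SubAt u z := fun _ =>
  ⟨1, one_pos, fun _ _ _ _ => h ▸ bot_le⟩

lemma circleAvg_eq (u : Cn n → EReal) (z w : Cn n) (r : ℝ) (m : ℕ) :
    circleAvg u z w r m = Real.circleAverage (fun ζ : ℂ => tr (-(m : ℝ)) (u (z + ζ • w))) 0 r := by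
  simp only [circleAvg, Real.circleAverage, tr, circleMap, zero_add, smul_eq_mul,
    mul_comm Complex.I]

lemma PSHOn.subOn {u : Cn n → EReal} {Ω : Set (Cn n)} (hΩ : IsOpen Ω) (h : PSHOn u Ω) :
    SubOn u Ω := by
  have hu : UscOn u Ω := ⟨fun z hz c hc => by
    simpa [hΩ.nhdsWithin_eq hz] using h.usc z hz c hc, h.lt_top⟩
  refine ⟨hu, fun z hz w => ?_⟩
  obtain ⟨ε₁, hε₁, h₁⟩ := h.submean z hz w
  obtain ⟨ε₂, hε₂, h₂⟩ := eventually_circle (hΩ.mem_nhds hz) w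
  refine ⟨min ε₁ ε₂, lt_min hε₁ hε₂, fun r hr hrε t => ?_⟩
  obtain ⟨m, hm⟩ := exists_nat_ge (-t)
  refine (h₁ r hr (hrε.trans_le (min_le_left _ _))).trans ((iInf_le _ m).trans
    (EReal.coe_le_coe_iff.2 ?_))
  have hin : ∀ ζ : ℂ, ‖ζ‖ = r → z + ζ • w ∈ Ω := fun ζ hζ =>
    h₂ ζ (by rw [hζ]; exact hrε.trans_le (min_le_right _ _))
  rw [circleAvg_eq]
  refine Real.circleAverage_mono (hu.circleIntegrable hr hin _) (hu.circleIntegrable hr hin t)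
    fun ζ hζ => tr_mono (by linarith) le_rfl ?_
  exact hu.lt_top _ (hin ζ (by simpa [abs_of_pos hr] using hζ))

lemma SubOn.pshNear {u : Cn n → EReal} {R : ℝ} (hR : 0 < R) (h : SubOn u (Metric.ball 0 R))
    {x : Cn n} (hx : x ∈ Metric.ball 0 R) (hux : u x ≠ ⊥) : PSHNear u := by
  refine ⟨Metric.ball 0 R, Metric.ball_mem_nhds _ hR, Metric.isOpen_ball,
    fun z hz c hc => (h.usc z hz c hc).filter_mono nhdsWithin_le_nhds, h.lt_top, fun z hz =>
    ⟨x, ?_, hux⟩, fun z hz w => ?_⟩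
  · rw [(convex_ball (0 : Cn n) R).isPreconnected.connectedComponentIn hz]
    exact hx
  · obtain ⟨ε, hε, H⟩ := h.submean z hz w
    refine ⟨ε, hε, fun r hr hrε => le_iInf fun m => ?_⟩
    rw [circleAvg_eq]
    exact H r hr hrε _

lemma aff_lt_coe_iff {a : ℝ} (ha : 0 < a) (K c : ℝ) (x : EReal) :
    (a : EReal) * x + (K : EReal) < (c : EReal) ↔ x < (((c - K) / a : ℝ) : EReal) := by
  induction x with
  | bot => simp [EReal.coe_mul_bot_of_pos ha, EReal.bot_lt_coe]
  | coe x =>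
    rw [← EReal.coe_mul, ← EReal.coe_add, EReal.coe_lt_coe_iff, EReal.coe_lt_coe_iff,
      lt_div_iff₀ ha]
    constructor <;> intro h <;> linarith
  | top => simp [EReal.coe_mul_top_of_pos ha]

lemma aff_lt_top {a : ℝ} (ha : 0 < a) (K : ℝ) {x : EReal} (hx : x < ⊤) :
    (a : EReal) * x + (K : EReal) < ⊤ := by
  induction x with
  | bot => simp [EReal.coe_mul_bot_of_pos ha]
  | coe x => rw [← EReal.coe_mul, ← EReal.coe_add]; exact EReal.coe_lt_top _
  | top => exact absurd hx (lt_irrefl _)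

lemma aff_mono {a : ℝ} (ha : 0 < a) (K : ℝ) {x y : EReal} (h : x ≤ y) :
    (a : EReal) * x + (K : EReal) ≤ (a : EReal) * y + (K : EReal) :=
  add_le_add (mul_le_mul_of_nonneg_left h (EReal.coe_nonneg.2 ha.le)) le_rfl

lemma tr_aff {a : ℝ} (ha : 0 < a) (K t : ℝ) {x : EReal} (hx : x < ⊤) :
    tr t ((a : EReal) * x + (K : EReal)) = a * tr ((t - K) / a) x + K := by
  induction x with
  | bot =>
    rw [EReal.coe_mul_bot_of_pos ha]
    simp only [EReal.bot_add, tr, bot_le, sup_of_le_right, EReal.toReal_coe]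
    field_simp; ring
  | coe x =>
    rw [← EReal.coe_mul, ← EReal.coe_add, tr_coe, tr_coe, mul_max_of_nonneg _ _ ha.le,
      max_add]
    congr 1
    field_simp; ring
  | top => exact absurd hx (lt_irrefl _)

lemma UscOn.affine {u : Cn n → EReal} {Ω : Set (Cn n)} (h : UscOn u Ω) {a : ℝ} (ha : 0 < a)
    (K : ℝ) : UscOn (fun z => (a : EReal) * u z + (K : EReal)) Ω := by
  refine ⟨fun z hz c hc => ?_, fun z hz => aff_lt_top ha K (h.lt_top z hz)⟩
  induction c with
  | bot => exact absurd hc not_lt_bot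
  | coe c =>
    filter_upwards [h.usc z hz _ ((aff_lt_coe_iff ha K c _).1 hc)] with y hy
    exact (aff_lt_coe_iff ha K c _).2 hy
  | top =>
    filter_upwards [h.usc z hz _ (h.lt_top z hz)] with y hy
    exact aff_lt_top ha K hy

lemma SubOn.affine {u : Cn n → EReal} {Ω : Set (Cn n)} (hΩ : IsOpen Ω) (h : SubOn u Ω) {a : ℝ}
    (ha : 0 < a) (K : ℝ) : SubOn (fun z => (a : EReal) * u z + (K : EReal)) Ω := by
  refine ⟨h.toUscOn.affine ha K, fun z hz w => ?_⟩
  obtain ⟨ε₁, hε₁, h₁⟩ := h.submean z hz w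
  obtain ⟨ε₂, hε₂, h₂⟩ := eventually_circle (hΩ.mem_nhds hz) w
  refine ⟨min ε₁ ε₂, lt_min hε₁ hε₂, fun r hr hrε t => ?_⟩
  have hin : ∀ ζ : ℂ, ‖ζ‖ = r → z + ζ • w ∈ Ω := fun ζ hζ =>
    h₂ ζ (by rw [hζ]; exact hrε.trans_le (min_le_right _ _))
  refine (aff_mono ha K (h₁ r hr (hrε.trans_le (min_le_left _ _)) ((t - K) / a))).trans
    (le_of_eq ?_)
  rw [← EReal.coe_mul, ← EReal.coe_add, EReal.coe_eq_coe_iff]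
  have hci := h.toUscOn.circleIntegrable hr hin ((t - K) / a)
  have h3 : Real.circleAverage (fun ζ : ℂ => tr t ((a : EReal) * u (z + ζ • w) + (K : EReal))) 0 r
      = Real.circleAverage (fun ζ : ℂ => (a • fun ζ => tr ((t - K) / a) (u (z + ζ • w))) ζ + K)
        0 r := by
    refine Real.circleAverage_congr_sphere fun ζ hζ => ?_
    exact tr_aff ha K t (h.lt_top _ (hin ζ (by simpa [abs_of_pos hr] using hζ)))
  rw [h3, Real.circleAverage_fun_add (hci.const_smul (a := a)) (circleIntegrable_const _ _ _),
    Real.circleAverage_const, Real.circleAverage_smul, smul_eq_mul]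

lemma elog_lt_coe_iff {x c : ℝ} : elog x < (c : EReal) ↔ x < Real.exp c := by
  unfold elog
  split_ifs with h
  · simp only [EReal.bot_lt_coe, true_iff]
    exact h.trans_lt (Real.exp_pos c)
  · rw [EReal.coe_lt_coe_iff, Real.log_lt_iff_lt_exp (not_le.1 h)]

lemma elog_lt_top (x : ℝ) : elog x < ⊤ := by
  unfold elog
  split_ifs
  · exact bot_lt_top
  · exact EReal.coe_lt_top _

lemma elog_le_coe_iff {x c : ℝ} : elog x ≤ (c : EReal) ↔ x ≤ Real.exp c := by
  unfold elog
  split_ifs with h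
  · simp only [bot_le, true_iff]
    exact h.trans (Real.exp_pos c).le
  · rw [EReal.coe_le_coe_iff, Real.log_le_iff_le_exp (not_le.1 h)]

lemma UscOn.logAbs {F : Cn n → ℂ} {Ω : Set (Cn n)} (hΩ : IsOpen Ω) (hF : ContinuousOn F Ω) :
    UscOn (logAbs F) Ω := by
  refine ⟨fun z hz c hc => ?_, fun z _ => elog_lt_top _⟩
  induction c with
  | bot => exact absurd hc not_lt_bot
  | coe c =>
    have hc' : ‖F z‖ < Real.exp c := elog_lt_coe_iff.1 hc
    filter_upwards [(hF.continuousAt (hΩ.mem_nhds hz)).norm.eventually_lt_const hc'] with y hy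
    exact elog_lt_coe_iff.2 hy
  | top => exact Eventually.of_forall fun y => elog_lt_top _

lemma SubOn.logAbs {F : Cn n → ℂ} {Ω : Set (Cn n)} (hΩ : IsOpen Ω)
    (hF : DifferentiableOn ℂ F Ω) : SubOn (logAbs F) Ω := by
  have hu := UscOn.logAbs hΩ hF.continuousOn
  refine ⟨hu, fun z hz => ?_⟩
  by_cases h0 : F z = 0
  · exact SubAt.of_eq_bot (by simp [_root_.logAbs, elog, h0])
  intro w
  obtain ⟨ε, hε, h⟩ := eventually_circle ((hΩ.eventually_mem hz).and
    ((hF.continuousOn.continuousAt (hΩ.mem_nhds hz)).eventually_ne h0)) w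
  refine ⟨ε, hε, fun r hr hrε t => ?_⟩
  have hd : DifferentiableOn ℂ (fun ζ : ℂ => F (z + ζ • w)) (Metric.ball 0 ε) := by
    refine hF.comp (Differentiable.differentiableOn (by fun_prop)) fun ζ hζ => ?_
    exact (h ζ (by simpa using hζ)).1
  have hsub : Metric.closedBall (0 : ℂ) |r| ⊆ Metric.ball 0 ε := by
    rw [abs_of_pos hr]; exact Metric.closedBall_subset_ball hrε
  have hca := AnalyticOnNhd.circleAverage_log_norm_of_ne_zero (R := r) (c := 0)
    (g := fun ζ : ℂ => F (z + ζ • w)) ((hd.analyticOnNhd Metric.isOpen_ball).mono hsub)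
    fun ζ hζ => (h ζ (by simpa using hsub hζ)).2
  have e : _root_.logAbs F z = ((Real.log ‖F z‖ : ℝ) : EReal) := by
    simp [_root_.logAbs, elog, h0]
  rw [e, EReal.coe_le_coe_iff]
  simp only [zero_smul, add_zero] at hca
  rw [← hca]
  have hcc : ContinuousOn (fun ζ : ℂ => Real.log ‖F (z + ζ • w)‖) (Metric.sphere 0 |r|) := by
    refine ContinuousOn.log (hd.continuousOn.norm.mono (Metric.sphere_subset_closedBall.trans hsub))
      fun ζ hζ => ?_
    exact norm_ne_zero_iff.2 (h ζ (by simpa using hsub (Metric.sphere_subset_closedBall hζ))).2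
  refine Real.circleAverage_mono hcc.circleIntegrable' (hu.circleIntegrable hr (fun ζ hζ =>
    (h ζ (by rwa [hζ])).1) t) fun ζ hζ => ?_
  have := (h ζ (by simpa using hsub (Metric.sphere_subset_closedBall hζ))).2
  have e2 : _root_.logAbs F (z + ζ • w) = ((Real.log ‖F (z + ζ • w)‖ : ℝ) : EReal) := by
    simp [_root_.logAbs, elog, this]
  rw [e2, tr_coe]
  exact le_max_left _ _

lemma UscOn.aemeasurable {u : Cn n → EReal} {Ω : Set (Cn n)} (hΩ : IsOpen Ω) (h : UscOn u Ω) :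
    AEMeasurable u (volume.restrict Ω) := by
  classical
  refine ⟨Ω.piecewise u fun _ => ⊤, measurable_of_Iio fun c => ?_, ?_⟩
  · have : (Ω.piecewise u fun _ => (⊤ : EReal)) ⁻¹' Set.Iio c = {z | z ∈ Ω ∧ u z < c} := by
      ext z
      by_cases hz : z ∈ Ω <;> simp [hz]
    rw [this]
    refine IsOpen.measurableSet (isOpen_iff_mem_nhds.2 fun z hz => ?_)
    exact (hΩ.eventually_mem hz.1).and (h.usc z hz.1 c hz.2)
  · refine (ae_restrict_iff' hΩ.measurableSet).2 (ae_of_all _ fun z hz => ?_)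
    simp [hz]

lemma norm_le_circleAverage (z w : Cn n) (r : ℝ) :
    ‖z‖ ≤ Real.circleAverage (fun ζ : ℂ => ‖z + ζ • w‖) 0 r := by
  have h1 : Real.circleAverage (fun ζ : ℂ => z + ζ • w) 0 r = z := by
    have hd : Differentiable ℂ fun ζ : ℂ => z + ζ • w := by fun_prop
    have := (hd.diffContOnCl (s := Metric.ball 0 |r|)).circleAverage
    simpa using this
  conv_lhs => rw [← h1]
  rw [Real.circleAverage, Real.circleAverage, norm_smul, Real.norm_of_nonneg (by positivity),
    smul_eq_mul]
  gcongr
  exact intervalIntegral.norm_integral_le_integral_norm (by positivity)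

/-- A smooth plurisubharmonic majorant defined on the whole space. -/
theorem exists_smooth_majorant {Φ : Cn n → EReal} {R ρ C : ℝ} (hρ : 0 < ρ) (hρR : ρ < R)
    (hΦ : SubOn Φ (Metric.ball 0 R)) (hC : ∀ z, ‖z‖ < R → Φ z < C) {j : ℝ} (hj : 0 ≤ j) :
    ∃ φ : Cn n → ℝ, ContDiff ℝ ∞ φ ∧ (∀ z b, 0 ≤ levi φ z b) ∧
      (∀ z, ‖z‖ < ρ → Φ z ≤ (φ z : EReal)) ∧
      ∀ z, ‖z‖ < ρ → ∃ y, φ z ≤ C - (j + 1) * ‖z - y‖ + 1 / (j + 1) ∧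
        ∀ s : ℝ, ‖y‖ < ρ → Φ y ≤ s → C + j / ρ * (‖y‖ - ρ) ≤ s → φ z ≤ s + 1 / (j + 1) := by
  classical
  set Lv : Cn n → ℝ := fun z => C + j / ρ * (‖z‖ - ρ) with hLv
  have hLc : Continuous Lv := by fun_prop
  have hjρ : 0 ≤ j / ρ := by positivity
  have hjj : j / ρ * ρ = j := by field_simp
  set u : Cn n → ℝ := fun z => if ‖z‖ < R then tr (Lv z) (Φ z) else Lv z with hu
  have hlt : ∀ z, ‖z‖ < R → Φ z < ⊤ := fun z hz => hΦ.lt_top z (by simpa using hz)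
  have hLC : ∀ z, ρ ≤ ‖z‖ → C ≤ Lv z := fun z hz => by
    have := mul_nonneg hjρ (sub_nonneg.2 hz)
    simp only [hLv]; linarith
  have hu1 : ∀ z, ρ ≤ ‖z‖ → u z = Lv z := fun z hz => by
    simp only [hu]
    split_ifs with h
    · refine le_antisymm (tr_le ((hC z h).le.trans (EReal.coe_le_coe_iff.2 (hLC z hz))) le_rfl)
        (le_tr (hlt z h))
    · rfl
  have hLu : ∀ z, Lv z ≤ u z := fun z => by
    simp only [hu]
    split_ifs with h
    · exact le_tr (hlt z h)
    · exact le_rfl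
  have hΦu : ∀ z, ‖z‖ < R → Φ z ≤ (u z : EReal) := fun z hz => by
    simp only [hu, if_pos hz]
    exact le_coe_tr (hlt z hz)
  have hule : ∀ z, ‖z‖ < R → ∀ s : ℝ, Φ z ≤ s → Lv z ≤ s → u z ≤ s := fun z hz s h1 h2 => by
    simp only [hu, if_pos hz]
    exact tr_le h1 h2
  have husc : UpperSemicontinuous u := by
    intro z c hc
    rcases lt_or_ge ‖z‖ R with hz | hz
    · obtain ⟨c', h1, h2⟩ := exists_between hc
      have hΦz : Φ z < c' := (hΦu z hz).trans_lt (EReal.coe_lt_coe_iff.2 h1)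
      filter_upwards [hΦ.usc z (by simpa using hz) _ hΦz,
        hLc.continuousAt.eventually_lt_const ((hLu z).trans_lt h1),
        continuous_norm.continuousAt.eventually_lt_const hz] with y h3 h4 h5
      exact (hule y h5 c' h3.le h4.le).trans_lt h2
    · filter_upwards [continuous_norm.continuousAt.eventually_const_lt (hρR.trans_le hz),
        hLc.continuousAt.eventually_lt_const ((hLu z).trans_lt hc)] with y h1 h2
      rwa [hu1 y h1.le]
  have hl : ∀ y, C - j ≤ u y := fun y => by
    refine le_trans ?_ (hLu y)
    have := mul_nonneg hjρ (norm_nonneg y)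
    simp only [hLv, mul_sub, hjj]; linarith
  have hCu : ∀ y, u y ≤ max C (Lv y) := fun y => by
    rcases lt_or_ge ‖y‖ R with hy | hy
    · exact hule y hy _ ((hC y hy).le.trans (EReal.coe_le_coe_iff.2 (le_max_left _ _)))
        (le_max_right _ _)
    · rw [hu1 y (hρR.le.trans hy)]; exact le_max_right _ _
  have hA : ∀ y, u y ≤ C + j / ρ * ‖y‖ := fun y => by
    refine (hCu y).trans (max_le ?_ ?_)
    · linarith [mul_nonneg hjρ (norm_nonneg y)]
    · simp only [hLv, mul_sub, hjj]; linarith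
  have hs : LocSubmean u := by
    intro z w
    by_cases hz : u z = Lv z
    · refine ⟨1, one_pos, fun r hr _ => ?_⟩
      rw [hz]
      have hcn : CircleIntegrable (fun ζ : ℂ => ‖z + ζ • w‖) 0 r :=
        (by fun_prop : Continuous fun ζ : ℂ => ‖z + ζ • w‖).continuousOn.circleIntegrable'
      have h1 : Real.circleAverage (fun ζ : ℂ => Lv (z + ζ • w)) 0 r
          = (C - j) + j / ρ * Real.circleAverage (fun ζ : ℂ => ‖z + ζ • w‖) 0 r := by
        have : (fun ζ : ℂ => Lv (z + ζ • w))
            = fun ζ => (C - j) + ((j / ρ) • fun ζ : ℂ => ‖z + ζ • w‖) ζ := by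
          funext ζ
          simp only [hLv, mul_sub, hjj, Pi.smul_apply, smul_eq_mul]; ring
        rw [this, Real.circleAverage_fun_add (circleIntegrable_const _ _ _)
          (hcn.const_smul (a := j / ρ)), Real.circleAverage_const, Real.circleAverage_smul,
          smul_eq_mul]
      have h2 := mul_le_mul_of_nonneg_left (norm_le_circleAverage z w r) hjρ
      have h3 : Real.circleAverage (fun ζ : ℂ => Lv (z + ζ • w)) 0 r
          ≤ Real.circleAverage (fun ζ : ℂ => u (z + ζ • w)) 0 r :=
        Real.circleAverage_mono (by fun_prop : Continuous fun ζ : ℂ => Lv (z + ζ • w)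
          ).continuousOn.circleIntegrable' (circleIntegrable_of_usc husc hjρ hl hA z w r)
          fun ζ _ => hLu _
      have h4 : Lv z = (C - j) + j / ρ * ‖z‖ := by simp only [hLv, mul_sub, hjj]; ring
      linarith
    · have hzρ : ‖z‖ < ρ := by
        by_contra hcon
        exact hz (hu1 z (not_lt.1 hcon))
      have hzR := hzρ.trans hρR
      have hzu : (u z : EReal) = Φ z := by
        have h1 : (u z : EReal) = max (Φ z) (Lv z : EReal) := by
          simp only [hu, if_pos hzR]; exact coe_tr (hlt z hzR)
        rcases max_choice (Φ z) (Lv z : EReal) with h2 | h2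
        · rw [h1, h2]
        · exact absurd (EReal.coe_eq_coe_iff.1 (h1.trans h2)) hz
      obtain ⟨ε₁, hε₁, h₁⟩ := hΦ.submean z (by simpa using hzR) w
      obtain ⟨ε₂, hε₂, h₂⟩ := eventually_circle
        (Metric.isOpen_ball.eventually_mem (by simpa using hzR : z ∈ Metric.ball 0 R)) w
      refine ⟨min ε₁ ε₂, lt_min hε₁ hε₂, fun r hr hrε => ?_⟩
      have hin : ∀ ζ : ℂ, ‖ζ‖ = r → z + ζ • w ∈ Metric.ball 0 R := fun ζ hζ =>
        h₂ ζ (by rw [hζ]; exact hrε.trans_le (min_le_right _ _))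
      have h3 := h₁ r hr (hrε.trans_le (min_le_left _ _)) (C - j)
      rw [← hzu, EReal.coe_le_coe_iff] at h3
      refine h3.trans (Real.circleAverage_mono (hΦ.toUscOn.circleIntegrable hr hin _)
        (circleIntegrable_of_usc husc hjρ hl hA z w r) fun ζ hζ => ?_)
      have hζ' := hin ζ (by simpa [abs_of_pos hr] using hζ)
      exact tr_le (hΦu _ (by simpa using hζ')) (hl _)
  obtain ⟨U, hlip, hUs, huU, hUy⟩ := exists_lipschitz_majorant husc hs (k := j / ρ + j + 1) hjρ
    (by linarith) hl hA
  have hk : 0 < j / ρ + j + 1 := by positivity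
  obtain ⟨φ, hφ, hlevi, hUφ, hφU⟩ := exists_smooth_near hk.le
    (ε := 1 / ((j / ρ + j + 1) * (j + 1))) (by positivity) hlip hUs
  have he : (j / ρ + j + 1) * (1 / ((j / ρ + j + 1) * (j + 1))) = 1 / (j + 1) := by
    field_simp
  rw [he] at hφU
  refine ⟨φ, hφ, hlevi, fun z hz => (hΦu z (hz.trans hρR)).trans
    (EReal.coe_le_coe_iff.2 ((huU z).trans (hUφ z))), fun z hz => ?_⟩
  obtain ⟨y, hy⟩ := hUy z
  refine ⟨y, ?_, fun s h1 h2 h3 => ?_⟩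
  · have h1 : u y ≤ C + j / ρ * ‖z - y‖ := by
      refine (hCu y).trans (max_le (by linarith [mul_nonneg hjρ (norm_nonneg (z - y))]) ?_)
      have h2 : ‖y‖ - ρ ≤ ‖z - y‖ := by
        have := norm_sub_norm_le y z
        rw [norm_sub_rev] at this
        linarith
      have := mul_le_mul_of_nonneg_left h2 hjρ
      simp only [hLv]; linarith
    have := hφU z
    rw [hy] at this
    linarith
  · have h4 := hule y (h1.trans hρR) s h2 h3
    have := hφU z
    rw [hy] at this
    linarith [mul_nonneg hk.le (norm_nonneg (z - y))]

/-- Approximation from above by smooth plurisubharmonic functions on the whole space. -/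
theorem exists_smooth_approx {Φ : Cn n → EReal} {U : Set (Cn n)} (hU : IsOpen U) (h0 : (0 : Cn n) ∈ U)
    (hΦ : SubOn Φ U) : ∃ ρ > 0, ρ ≤ 1 / 2 ∧ Metric.ball 0 ρ ⊆ U ∧ ∃ A : ℝ, ∃ φ : ℕ → Cn n → ℝ,
      (∀ j, ContDiff ℝ ∞ (φ j)) ∧ (∀ j z b, 0 ≤ levi (φ j) z b) ∧
      (∀ j z, ‖z‖ < ρ → Φ z ≤ (φ j z : EReal)) ∧ (∀ j z, ‖z‖ < ρ → φ j z ≤ A) ∧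
      ∀ z, ‖z‖ < ρ → ∀ c : ℝ, Φ z < c → ∀ᶠ j in atTop, φ j z < c := by
  obtain ⟨C, hC0⟩ : ∃ C : ℝ, Φ 0 < C := by
    obtain ⟨C, h1, _⟩ := EReal.lt_iff_exists_real_btwn.1 (hΦ.lt_top 0 h0)
    exact ⟨C, h1⟩
  obtain ⟨R, hR, hRU⟩ := Metric.mem_nhds_iff.1
    ((hU.eventually_mem h0).and (hΦ.usc 0 h0 _ hC0))
  have hΦR : SubOn Φ (Metric.ball 0 R) := hΦ.mono fun z hz => (hRU hz).1
  have hCR : ∀ z, ‖z‖ < R → Φ z < C := fun z hz => (hRU (by simpa using hz)).2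
  set ρ := min (R / 2) (1 / 2) with hρdef
  have hρ : 0 < ρ := by positivity
  have hρR : ρ < R := (min_le_left _ _).trans_lt (by linarith)
  choose φ hφ hlevi hΦφ hy using fun j : ℕ =>
    exists_smooth_majorant hρ hρR hΦR hCR (Nat.cast_nonneg (α := ℝ) j)
  refine ⟨ρ, hρ, min_le_right _ _, fun z hz => (hRU (Metric.ball_subset_ball hρR.le hz)).1, C + 1,
    φ, hφ, hlevi, hΦφ, fun j z hz => ?_, fun z hz c hc => ?_⟩
  · obtain ⟨y, h1, _⟩ := hy j z hz
    have h2 : (1 : ℝ) / (j + 1) ≤ 1 := by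
      rw [div_le_one (by positivity)]; linarith [Nat.cast_nonneg (α := ℝ) j]
    have h3 : 0 ≤ ((j : ℝ) + 1) * ‖z - y‖ := by positivity
    linarith
  · obtain ⟨c', h1, h2⟩ := EReal.lt_iff_exists_real_btwn.1 hc
    rw [EReal.coe_lt_coe_iff] at h2
    obtain ⟨η, hη, H⟩ := Metric.mem_nhds_iff.1
      ((hΦR.usc z (by simpa using hz.trans hρR) _ h1).and
        (continuous_norm.continuousAt.eventually_lt_const
          (show ‖z‖ < (‖z‖ + ρ) / 2 by linarith)))
    have t1 : Tendsto (fun j : ℕ => (j : ℝ)) atTop atTop := tendsto_natCast_atTop_atTop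
    have t2 : Tendsto (fun j : ℕ => 1 / ((j : ℝ) + 1)) atTop (𝓝 0) :=
      tendsto_one_div_add_atTop_nhds_zero_nat
    have hq : 0 < (ρ - ‖z‖) / (2 * ρ) := div_pos (by linarith) (by positivity)
    filter_upwards [t2.eventually_lt_const (show (0 : ℝ) < c - c' by linarith),
      t2.eventually_lt_const (show (0 : ℝ) < 1 by norm_num),
      (t1.atTop_mul_const hη).eventually_gt_atTop (C + 1 - c),
      (t1.atTop_mul_const hq).eventually_gt_atTop (C - c')] with j e1 e2 e3 e4
    obtain ⟨y, g1, g2⟩ := hy j z hz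
    rcases lt_or_ge ‖z - y‖ η with hzy | hzy
    · obtain ⟨k1, k2⟩ := H (show y ∈ Metric.ball z η by
        rwa [Metric.mem_ball, dist_comm, dist_eq_norm])
      have := g2 c' (by linarith) k1.le ?_
      · linarith
      · have h3 : (j : ℝ) / ρ * (‖y‖ - ρ) ≤ (j : ℝ) / ρ * (-((ρ - ‖z‖) / 2)) :=
          mul_le_mul_of_nonneg_left (by linarith) (by positivity)
        have h4 : (j : ℝ) / ρ * (-((ρ - ‖z‖) / 2)) = -(j * ((ρ - ‖z‖) / (2 * ρ))) := by
          field_simp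
        linarith
    · have h3 := mul_le_mul_of_nonneg_left hzy (Nat.cast_nonneg (α := ℝ) j)
      have h4 := norm_nonneg (z - y)
      linarith

/-! ### Limits of holomorphic functions -/

lemma integrable_indicator_holo {F : Cn n → ℂ} {R M : ℝ}
    (hF : ContinuousOn F (Metric.ball 0 R)) (hM : ∀ z ∈ Metric.ball (0 : Cn n) R, ‖F z‖ ≤ M) :
    Integrable ((Metric.ball 0 R).indicator F) := by
  rw [integrable_indicator_iff Metric.isOpen_ball.measurableSet]
  exact IntegrableOn.of_bound measure_ball_lt_top
    (hF.aestronglyMeasurable Metric.isOpen_ball.measurableSet) M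
    ((ae_restrict_iff' Metric.isOpen_ball.measurableSet).2 (ae_of_all _ hM))

lemma cv_rho_indicator {F : Cn n → ℂ} {R ε : ℝ} (hε : 0 < ε)
    (hF : DifferentiableOn ℂ F (Metric.ball 0 R)) {z : Cn n} (hz : ‖z‖ + ε < R) :
    cv (cst (rho ε)) ((Metric.ball 0 R).indicator F) z = F z := by
  have hsub : Metric.ball z (R - ‖z‖) ⊆ Metric.ball 0 R :=
    Metric.ball_subset_ball' (by simp)
  rw [cv_rho_of_holo hε (R := R - ‖z‖) (by linarith)]
  · rw [Set.indicator_of_mem]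
    simpa using (by linarith : ‖z‖ < R)
  · exact (hF.mono hsub).congr fun y hy => Set.indicator_of_mem (hsub hy) _

lemma tendsto_cv_indicator {F : ℕ → Cn n → ℂ} {G : Cn n → ℂ} {R M : ℝ}
    (hF : ∀ j, ContinuousOn (F j) (Metric.ball 0 R))
    (hM : ∀ j, ∀ z ∈ Metric.ball (0 : Cn n) R, ‖F j z‖ ≤ M)
    (hlim : ∀ z ∈ Metric.ball (0 : Cn n) R, Tendsto (fun j => F j z) atTop (𝓝 (G z)))
    {ρ : Cn n → ℂ} (hρ : Continuous ρ) (hc : HasCompactSupport ρ) (z : Cn n) :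
    Tendsto (fun j => cv ρ ((Metric.ball 0 R).indicator (F j)) z) atTop
      (𝓝 (cv ρ ((Metric.ball 0 R).indicator G) z)) := by
  simp only [cv_swap]
  have hρz : Continuous fun y => ρ (z - y) := by fun_prop
  have hci : Integrable fun y => ρ (z - y) :=
    (hρ.integrable_of_hasCompactSupport hc).comp_sub_left z
  refine tendsto_integral_of_dominated_convergence (fun y => ‖ρ (z - y)‖ * |M|)
    (fun j => hρz.aestronglyMeasurable.mul
      (integrable_indicator_holo (hF j) (hM j)).aestronglyMeasurable)
    (hci.norm.mul_const _) (fun j => ae_of_all _ fun y => ?_) (ae_of_all _ fun y => ?_)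
  · rw [norm_mul]
    refine mul_le_mul_of_nonneg_left ?_ (norm_nonneg _)
    by_cases hy : y ∈ Metric.ball (0 : Cn n) R
    · rw [Set.indicator_of_mem hy]; exact (hM j y hy).trans (le_abs_self M)
    · rw [Set.indicator_of_notMem hy]; simp
  · by_cases hy : y ∈ Metric.ball (0 : Cn n) R
    · simp only [Set.indicator_of_mem hy]
      exact (hlim y hy).const_mul _
    · simp only [Set.indicator_of_notMem hy]
      exact tendsto_const_nhds

/-- Bounded pointwise limits of holomorphic functions are holomorphic. -/
theorem differentiableOn_of_tendsto {F : ℕ → Cn n → ℂ} {G : Cn n → ℂ} {R r M : ℝ} (hr : r < R)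
    (hF : ∀ j, DifferentiableOn ℂ (F j) (Metric.ball 0 R))
    (hM : ∀ j, ∀ z ∈ Metric.ball (0 : Cn n) R, ‖F j z‖ ≤ M)
    (hlim : ∀ z ∈ Metric.ball (0 : Cn n) R, Tendsto (fun j => F j z) atTop (𝓝 (G z))) :
    DifferentiableOn ℂ G (Metric.ball 0 r) := by
  set ε := (R - r) / 2 with hεdef
  have hε : 0 < ε := by rw [hεdef]; linarith
  set g := cv (cst (rho ε)) ((Metric.ball 0 R).indicator G) with hg
  have hρ := contDiff_crho (n := n) ε
  have hc := hasCompactSupport_crho (n := n) hε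
  have hFc := fun j => (hF j).continuousOn
  have hGM : ∀ z ∈ Metric.ball (0 : Cn n) R, ‖G z‖ ≤ M := fun z hz =>
    le_of_tendsto (hlim z hz).norm (Eventually.of_forall fun j => hM j z hz)
  have hFi := fun j => integrable_indicator_holo (hFc j) (hM j)
  have hGi : Integrable ((Metric.ball 0 R).indicator G) := by
    have hmeas : AEStronglyMeasurable ((Metric.ball 0 R).indicator G) volume := by
      refine aestronglyMeasurable_of_tendsto_ae atTop (fun j => (hFi j).aestronglyMeasurable)
        (ae_of_all _ fun y => ?_)
      by_cases hy : y ∈ Metric.ball (0 : Cn n) R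
      · simpa only [Set.indicator_of_mem hy] using hlim y hy
      · simpa only [Set.indicator_of_notMem hy] using tendsto_const_nhds
    rw [integrable_indicator_iff Metric.isOpen_ball.measurableSet]
    exact IntegrableOn.of_bound measure_ball_lt_top ((aestronglyMeasurable_indicator_iff
      Metric.isOpen_ball.measurableSet).1 hmeas) M
      ((ae_restrict_iff' Metric.isOpen_ball.measurableSet).2 (ae_of_all _ hGM))
  have hgs : ContDiff ℝ ∞ g := cv_contDiff hρ hc hGi.locallyIntegrable
  have hgG : ∀ z ∈ Metric.ball (0 : Cn n) r, g z = G z := fun z hz => by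
    have hz' : ‖z‖ < r := by simpa using hz
    have h1 := tendsto_cv_indicator hFc hM hlim hρ.continuous hc z
    have h2 : (fun j => cv (cst (rho ε)) ((Metric.ball 0 R).indicator (F j)) z)
        = fun j => F j z := funext fun j => cv_rho_indicator hε (hF j) (by linarith)
    rw [h2] at h1
    exact tendsto_nhds_unique h1 (hlim z (by simpa using hz'.trans hr))
  refine DifferentiableOn.congr (f := g) (fun z hz => ?_) fun z hz => (hgG z hz).symm
  refine (differentiableAt_of_dbar_eq_zero (hgs.differentiable (by simp) z) fun k => ?_
    ).differentiableWithinAt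
  have hz' : ‖z‖ < r := by simpa using hz
  rw [hg, wd_cv hρ hc hGi.locallyIntegrable]
  have h1 := tendsto_cv_indicator hFc hM hlim (hρ.wd (s := Complex.I) (j := k)).continuous
    (hc.wd (s := Complex.I) (j := k)) z
  refine tendsto_nhds_unique h1 (tendsto_const_nhds.congr fun j => ?_)
  rw [← wd_cv hρ hc (hFi j).locallyIntegrable]
  have hev : cv (cst (rho ε)) ((Metric.ball 0 R).indicator (F j)) =ᶠ[𝓝 z] F j := by
    filter_upwards [Metric.isOpen_ball.mem_nhds hz] with y hy
    have hy' : ‖y‖ < r := by simpa using hy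
    exact cv_rho_indicator hε (hF j) (by linarith)
  have hd : DifferentiableAt ℂ (cv (cst (rho ε)) ((Metric.ball 0 R).indicator (F j))) z :=
    hev.differentiableAt_iff.2 ((hF j).differentiableAt
      (Metric.isOpen_ball.mem_nhds (by simpa using hz'.trans hr)))
  exact (dbar_eq_zero_of_differentiableAt hd k).symm

/-- Uniform Lipschitz estimate for bounded holomorphic functions. -/
lemma exists_lipschitz_bound {R r M : ℝ} (hr : r < R) (hM0 : 0 ≤ M) : ∃ L : ℝ, 0 ≤ L ∧
    ∀ F : Cn n → ℂ, DifferentiableOn ℂ F (Metric.ball 0 R) →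
    (∀ z ∈ Metric.ball (0 : Cn n) R, ‖F z‖ ≤ M) →
    ∀ z ∈ Metric.ball (0 : Cn n) r, ∀ z' ∈ Metric.ball (0 : Cn n) r,
      ‖F z - F z'‖ ≤ L * ‖z - z'‖ := by
  set ε := (R - r) / 2 with hεdef
  have hε : 0 < ε := by rw [hεdef]; linarith
  have hρ := contDiff_crho (n := n) ε
  have hc := hasCompactSupport_crho (n := n) hε
  obtain ⟨K, hK⟩ := hρ.lipschitzWith_of_hasCompactSupport hc (by simp)
  refine ⟨K * M * volume.real (Metric.ball (0 : Cn n) R), by positivity,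
    fun F hF hFM z hz z' hz' => ?_⟩
  have h1 : ‖z‖ < r := by simpa using hz
  have h2 : ‖z'‖ < r := by simpa using hz'
  have hFi := integrable_indicator_holo hF.continuousOn hFM
  have hinteg : ∀ x : Cn n, Integrable fun y => cst (rho ε) (x - y) *
      (Metric.ball 0 R).indicator F y := fun x => by
    obtain ⟨B, hB⟩ := hc.exists_bound_of_continuous hρ.continuous
    exact hFi.bdd_mul (c := B) (hρ.continuous.comp (continuous_const.sub continuous_id)
      ).aestronglyMeasurable (ae_of_all _ fun y => hB _)
  rw [← cv_rho_indicator hε hF (z := z) (by linarith),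
    ← cv_rho_indicator hε hF (z := z') (by linarith), cv_swap, cv_swap,
    ← integral_sub (hinteg z) (hinteg z')]
  have h3 : ∀ y, ‖cst (rho ε) (z - y) * (Metric.ball 0 R).indicator F y
      - cst (rho ε) (z' - y) * (Metric.ball 0 R).indicator F y‖
      ≤ (Metric.ball (0 : Cn n) R).indicator (fun _ => K * ‖z - z'‖ * M) y := fun y => by
    by_cases hy : y ∈ Metric.ball (0 : Cn n) R
    · rw [Set.indicator_of_mem hy, Set.indicator_of_mem hy, ← sub_mul, norm_mul]
      have h4 := hK.norm_sub_le (z - y) (z' - y)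
      rw [sub_sub_sub_cancel_right] at h4
      exact mul_le_mul h4 (hFM y hy) (norm_nonneg _) (by positivity)
    · simp [Set.indicator_of_notMem hy]
  refine (norm_integral_le_of_norm_le ((integrable_indicator_iff
    Metric.isOpen_ball.measurableSet).2 (integrableOn_const measure_ball_lt_top.ne))
    (ae_of_all _ h3)).trans (le_of_eq ?_)
  rw [integral_indicator Metric.isOpen_ball.measurableSet, setIntegral_const, smul_eq_mul]
  ring

/-- Local boundedness of square integrable holomorphic functions. -/
lemma exists_bound_of_sq_integral {R r : ℝ} (hr : r < R) : ∃ B : ℝ, 0 ≤ B ∧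
    ∀ F : Cn n → ℂ, DifferentiableOn ℂ F (Metric.ball 0 R) → ∀ z ∈ Metric.ball (0 : Cn n) r,
      ‖F z‖ₑ ^ 2 ≤ ENNReal.ofReal B * ∫⁻ y in Metric.ball (0 : Cn n) R, ‖F y‖ₑ ^ 2 := by
  set ε := (R - r) / 2 with hεdef
  have hε : 0 < ε := by rw [hεdef]; linarith
  obtain ⟨B, hB⟩ := (hasCompactSupport_crho (n := n) hε).exists_bound_of_continuous
    (contDiff_crho (n := n) ε).continuous
  have hB0 : 0 ≤ B := (norm_nonneg _).trans (hB 0)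
  refine ⟨B, hB0, fun F hF z hz => ?_⟩
  have h1 : ‖z‖ < r := by simpa using hz
  have hm : AEStronglyMeasurable ((Metric.ball 0 R).indicator F) volume :=
    (aestronglyMeasurable_indicator_iff Metric.isOpen_ball.measurableSet).2
      (hF.continuousOn.aestronglyMeasurable Metric.isOpen_ball.measurableSet)
  rw [← cv_rho_indicator hε hF (z := z) (by linarith)]
  refine (enorm_cv_rho_sq_le hε hm z).trans ?_
  calc ∫⁻ t, ENNReal.ofReal (rho ε t) * ‖(Metric.ball 0 R).indicator F (z - t)‖ₑ ^ 2
      ≤ ∫⁻ t, ENNReal.ofReal B * ‖(Metric.ball 0 R).indicator F (z - t)‖ₑ ^ 2 := by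
        refine lintegral_mono fun t => mul_le_mul_left (ENNReal.ofReal_le_ofReal ?_) _
        have := hB t
        rw [Complex.norm_real] at this
        exact (le_abs_self _).trans this
    _ = ENNReal.ofReal B * ∫⁻ t, ‖(Metric.ball 0 R).indicator F (z - t)‖ₑ ^ 2 := by
        rw [lintegral_const_mul' _ _ ENNReal.ofReal_ne_top]
    _ = ENNReal.ofReal B * ∫⁻ y in Metric.ball (0 : Cn n) R, ‖F y‖ₑ ^ 2 := by
        rw [lintegral_sub_left_eq_self (fun y => ‖(Metric.ball 0 R).indicator F y‖ₑ ^ 2) z,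
          ← lintegral_indicator Metric.isOpen_ball.measurableSet]
        congr 2; funext y
        by_cases hy : y ∈ Metric.ball (0 : Cn n) R
        · simp only [Set.indicator_of_mem hy]
        · simp [Set.indicator_of_notMem hy]

/-- Montel's theorem for balls. -/
theorem exists_tendsto_subseq {F : ℕ → Cn n → ℂ} {R r M : ℝ} (hr : r < R)
    (hF : ∀ j, DifferentiableOn ℂ (F j) (Metric.ball 0 R))
    (hM : ∀ j, ∀ z ∈ Metric.ball (0 : Cn n) R, ‖F j z‖ ≤ M) :
    ∃ (ψ : ℕ → ℕ) (G : Cn n → ℂ), StrictMono ψ ∧ DifferentiableOn ℂ G (Metric.ball 0 r) ∧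
      ∀ z ∈ Metric.ball (0 : Cn n) r, Tendsto (fun j => F (ψ j) z) atTop (𝓝 (G z)) := by
  classical
  set r' := (r + R) / 2 with hr'
  have hr1 : r < r' := by rw [hr']; linarith
  have hr2 : r' < R := by rw [hr']; linarith
  set d := TopologicalSpace.denseSeq (Cn n) with hd
  let x : ℕ → ℕ → ℂ := fun j k => if d k ∈ Metric.ball (0 : Cn n) R then F j (d k) else 0
  have hcpt : IsCompact (Set.pi Set.univ fun _ : ℕ => Metric.closedBall (0 : ℂ) |M|) :=
    isCompact_univ_pi fun _ => isCompact_closedBall _ _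
  have hx : ∀ j, x j ∈ Set.pi Set.univ fun _ : ℕ => Metric.closedBall (0 : ℂ) |M| := by
    intro j k _
    simp only [x, mem_closedBall_zero_iff]
    split_ifs with h
    · exact (hM j _ h).trans (le_abs_self M)
    · simp
  obtain ⟨a, _, ψ, hψ, hlim⟩ := hcpt.tendsto_subseq hx
  obtain ⟨L, hL0, hL⟩ := exists_lipschitz_bound (n := n) hr2 (abs_nonneg M)
  have hL' := fun j => hL (F j) (hF j) fun z hz => (hM j z hz).trans (le_abs_self M)
  have hcau : ∀ z ∈ Metric.ball (0 : Cn n) r', ∃ c, Tendsto (fun j => F (ψ j) z) atTop (𝓝 c) := by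
    intro z hz
    refine cauchySeq_tendsto_of_complete (Metric.cauchySeq_iff.2 fun δ hδ => ?_)
    obtain ⟨k, hy1, hy2⟩ := (TopologicalSpace.denseRange_denseSeq (Cn n)
      ).exists_mem_open (Metric.isOpen_ball.inter Metric.isOpen_ball)
      (⟨z, Metric.mem_ball_self (show 0 < δ / (3 * (L + 1)) by positivity), hz⟩ :
        (Metric.ball z (δ / (3 * (L + 1))) ∩ Metric.ball 0 r').Nonempty)
    have hk : CauchySeq fun j => F (ψ j) (d k) := by
      have h1 := (tendsto_pi_nhds.1 hlim k).cauchySeq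
      have h2 : (fun j => F (ψ j) (d k)) = fun j => (x ∘ ψ) j k := by
        funext j
        simp only [x, Function.comp]
        rw [if_pos (Metric.ball_subset_ball hr2.le hy2)]
      rwa [h2]
    obtain ⟨N, hN⟩ := Metric.cauchySeq_iff.1 hk (δ / 3) (by positivity)
    refine ⟨N, fun i hi j hj => ?_⟩
    have hzk : L * ‖z - d k‖ < δ / 3 := by
      have h1 : ‖z - d k‖ < δ / (3 * (L + 1)) := by
        rw [norm_sub_rev, ← dist_eq_norm]; exact hy1
      rw [lt_div_iff₀ (by positivity)] at h1
      nlinarith [norm_nonneg (z - d k)]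
    have e1 := hL' (ψ i) z hz (d k) hy2
    have e2 := hL' (ψ j) z hz (d k) hy2
    have e3 := hN i hi j hj
    calc dist (F (ψ i) z) (F (ψ j) z)
        ≤ dist (F (ψ i) z) (F (ψ i) (d k)) + dist (F (ψ i) (d k)) (F (ψ j) (d k))
          + dist (F (ψ j) (d k)) (F (ψ j) z) := dist_triangle4 _ _ _ _
      _ < δ := by
        rw [dist_comm (F (ψ j) (d k)), dist_eq_norm (F (ψ i) z), dist_eq_norm (F (ψ j) z)]
        linarith
  choose! G hG using hcau
  exact ⟨ψ, G, hψ, differentiableOn_of_tendsto hr1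
    (fun j => (hF (ψ j)).mono (Metric.ball_subset_ball hr2.le))
    (fun j z hz => hM (ψ j) z (Metric.ball_subset_ball hr2.le hz)) hG,
    fun z hz => hG z (Metric.ball_subset_ball hr1.le hz)⟩

/-! ### Holomorphic functions with prescribed growth -/

lemma wexp_eq (c : ℝ) (φ : Cn n → EReal) (z : Cn n) : wexp c φ z = EReal.exp (φ z) ^ c := by
  rw [← EReal.exp_mul, mul_comm, wexp]
  generalize (c : EReal) * φ z = x
  induction x <;> simp [expE]

lemma wexp_coe (c : ℝ) {φ : Cn n → EReal} {z : Cn n} {x : ℝ} (h : φ z = x) :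
    wexp c φ z = ENNReal.ofReal (Real.exp (c * x)) := by
  rw [wexp_eq, h, EReal.exp_coe, ENNReal.ofReal_rpow_of_pos (Real.exp_pos _), ← Real.exp_mul,
    mul_comm]

lemma exp_rpow_neg_anti {s : ℝ} (hs : 0 ≤ s) {x y : EReal} (h : x ≤ y) :
    EReal.exp y ^ (-s) ≤ EReal.exp x ^ (-s) := by
  rw [ENNReal.rpow_neg, ENNReal.rpow_neg, ENNReal.inv_le_inv]
  exact ENNReal.rpow_le_rpow (EReal.exp_monotone h) hs

lemma UscOn.aemeasurable_wexp {u : Cn n → EReal} {Ω : Set (Cn n)} (hΩ : IsOpen Ω)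
    (h : UscOn u Ω) (c : ℝ) : AEMeasurable (wexp c u) (volume.restrict Ω) := by
  have : wexp c u = fun z => EReal.exp (u z) ^ c := funext (wexp_eq c u)
  rw [this]
  exact (EReal.measurable_exp.comp_aemeasurable (h.aemeasurable hΩ)).pow_const c

lemma levi_const_mul {Ψ : Cn n → ℝ} (h : ContDiff ℝ ∞ Ψ) (s : ℝ) (z b : Cn n) :
    levi (fun y => s * Ψ y) z b = s * levi Ψ z b := by
  have h1 : ∀ y, fderiv ℝ (fun y => s * Ψ y) y = s • fderiv ℝ Ψ y := fun y =>
    fderiv_const_mul (h.differentiable (by simp) y) s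
  have hd : ContDiff ℝ ∞ (fderiv ℝ Ψ) := h.fderiv_right (by simp)
  have h2 : fderiv ℝ (fderiv ℝ fun y => s * Ψ y) z = s • fderiv ℝ (fderiv ℝ Ψ) z := by
    rw [show fderiv ℝ (fun y => s * Ψ y) = fun y => s • fderiv ℝ Ψ y from funext h1]
    exact fderiv_const_smul (hd.differentiable (by simp) z) s
  rw [levi_eq (contDiff_const.mul h), levi_eq h, h2]
  simp only [smul_apply, smul_eq_mul]
  ring

lemma exists_holo_peak_smooth (hn : 0 < n) : ∃ C : ℝ, 0 ≤ C ∧ ∀ Φ : Cn n → ℝ,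
    ContDiff ℝ ∞ Φ → (∀ z b, 0 ≤ levi Φ z b) → ∀ z₀ : Cn n, ‖z₀‖ ≤ 1 / 2 →
    ∃ F : Cn n → ℂ, Differentiable ℂ F ∧ 1 / 2 ≤ ‖F z₀‖ ∧
      ∫⁻ z in Metric.ball (0 : Cn n) (1 / 2), ‖F z‖ₑ ^ 2 * ENNReal.ofReal (Real.exp (-Φ z)) ≤
        ENNReal.ofReal (C * Real.exp (-Φ z₀)) := by
  obtain ⟨C, hC, H⟩ := exists_entire_at_zero hn
  refine ⟨C, hC, fun Φ hΦ hl z₀ hz₀ => ?_⟩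
  obtain ⟨F, hF, h0, hI⟩ := H (fun y => Φ (z₀ + y)) (hΦ.comp (contDiff_const.add contDiff_id))
    (fun z b => by rw [levi_comp_add hΦ]; exact hl _ _)
  refine ⟨fun z => F (z - z₀), hF.comp (differentiable_id.sub_const z₀), by simpa using h0, ?_⟩
  have hcont : Continuous fun z => ‖F z‖ ^ 2 * Real.exp (-Φ (z₀ + z)) := by
    have := hF.continuous
    have := hΦ.continuous
    fun_prop
  calc ∫⁻ z in Metric.ball (0 : Cn n) (1 / 2),
        ‖F (z - z₀)‖ₑ ^ 2 * ENNReal.ofReal (Real.exp (-Φ z))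
      ≤ ∫⁻ z, (Metric.closedBall (0 : Cn n) 1).indicator
          (fun y => ENNReal.ofReal (‖F y‖ ^ 2 * Real.exp (-Φ (z₀ + y)))) (z - z₀) := by
        rw [← lintegral_indicator Metric.isOpen_ball.measurableSet]
        refine lintegral_mono fun z => ?_
        by_cases hz : z ∈ Metric.ball (0 : Cn n) (1 / 2); swap
        · exact (Set.indicator_of_notMem hz _).trans_le zero_le
        rw [Set.indicator_of_mem hz, Set.indicator_of_mem]
        · rw [ENNReal.ofReal_mul (by positivity), ENNReal.ofReal_pow (norm_nonneg _), ofReal_norm]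
          simp
        · rw [mem_closedBall_zero_iff]
          rw [mem_ball_zero_iff] at hz
          linarith [norm_sub_le z z₀]
    _ = ∫⁻ z in Metric.closedBall (0 : Cn n) 1,
          ENNReal.ofReal (‖F z‖ ^ 2 * Real.exp (-Φ (z₀ + z))) := by
        rw [lintegral_sub_right_eq_self (μ := volume) (fun z => (Metric.closedBall (0 : Cn n) 1).indicator
          (fun y => ENNReal.ofReal (‖F y‖ ^ 2 * Real.exp (-Φ (z₀ + y)))) z) z₀,
          lintegral_indicator Metric.isClosed_closedBall.measurableSet]
    _ = ENNReal.ofReal (∫ z in Metric.closedBall (0 : Cn n) 1,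
          ‖F z‖ ^ 2 * Real.exp (-Φ (z₀ + z))) := by
        rw [ofReal_integral_eq_lintegral_ofReal]
        · exact hcont.continuousOn.integrableOn_compact (isCompact_closedBall _ _)
        · exact Eventually.of_forall fun z => by positivity
    _ ≤ _ := ENNReal.ofReal_le_ofReal (by simpa using hI)

lemma exists_holo_peak (hn : 0 < n) {U : Set (Cn n)} (hU : IsOpen U) (h0 : (0 : Cn n) ∈ U)
    {Φ : Cn n → EReal} (hΦ : SubOn Φ U) : ∃ R > 0, Metric.ball 0 R ⊆ U ∧ ∀ s : ℝ, 0 < s →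
    ∃ C : ℝ, 0 ≤ C ∧ ∀ z₀ ∈ Metric.ball (0 : Cn n) R, Φ z₀ ≠ ⊥ → ∃ F : Cn n → ℂ,
      DifferentiableOn ℂ F (Metric.ball 0 R) ∧ 1 / 2 ≤ ‖F z₀‖ ∧
      ∫⁻ z in Metric.ball 0 R, ‖F z‖ₑ ^ 2 * wexp (-s) Φ z ≤
        ENNReal.ofReal C * wexp (-s) Φ z₀ := by
  obtain ⟨ρ, hρ, hρ2, hρU, A, φ, hφ, hl, hle, hA, hlim⟩ := exists_smooth_approx hU h0 hΦ
  obtain ⟨C, hC, H⟩ := exists_holo_peak_smooth hn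
  obtain ⟨B, hB, hBd⟩ := exists_bound_of_sq_integral (n := n)
    (show 3 * ρ / 4 < ρ by linarith)
  have hsub : Metric.ball (0 : Cn n) (ρ / 2) ⊆ Metric.ball 0 ρ :=
    Metric.ball_subset_ball (by linarith)
  refine ⟨ρ / 2, by positivity, hsub.trans hρU, fun s hs => ⟨C, hC, fun z₀ hz₀ hbot => ?_⟩⟩
  have hz₀ρ : ‖z₀‖ < ρ := by simpa using hsub hz₀
  choose F hF hF0 hFI using fun j : ℕ => H (fun z => s * φ j z) (contDiff_const.mul (hφ j))
    (fun z b => by rw [levi_const_mul (hφ j)]; exact mul_nonneg hs.le (hl j z b)) z₀ (by linarith)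
  have hw : ∀ j z, ENNReal.ofReal (Real.exp (-(s * φ j z))) =
      EReal.exp ((φ j z : ℝ) : EReal) ^ (-s) := fun j z => by
    rw [EReal.exp_coe, ENNReal.ofReal_rpow_of_pos (Real.exp_pos _), ← Real.exp_mul]
    congr 2; ring
  have hI : ∀ j, ∫⁻ z in Metric.ball (0 : Cn n) ρ,
      ‖F j z‖ₑ ^ 2 * EReal.exp ((φ j z : ℝ) : EReal) ^ (-s) ≤
      ENNReal.ofReal C * wexp (-s) Φ z₀ := fun j => by
    calc _ ≤ ∫⁻ z in Metric.ball (0 : Cn n) (1 / 2),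
          ‖F j z‖ₑ ^ 2 * ENNReal.ofReal (Real.exp (-(s * φ j z))) := by
          simp only [hw]
          exact lintegral_mono_set (Metric.ball_subset_ball hρ2)
      _ ≤ _ := hFI j
      _ ≤ _ := by
          rw [ENNReal.ofReal_mul hC, hw, wexp_eq]
          exact mul_le_mul_right (exp_rpow_neg_anti hs.le (hle j z₀ hz₀ρ)) _
  have hfin : ENNReal.ofReal C * wexp (-s) Φ z₀ ≠ ⊤ := by
    refine ENNReal.mul_ne_top ENNReal.ofReal_ne_top ?_
    have h1 : Φ z₀ ≠ ⊤ := (hΦ.lt_top z₀ (hρU (hsub hz₀))).ne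
    rw [wexp_coe (-s) (EReal.coe_toReal h1 hbot).symm]
    exact ENNReal.ofReal_ne_top
  have hL2 : ∀ j, ∫⁻ z in Metric.ball (0 : Cn n) ρ, ‖F j z‖ₑ ^ 2 ≤
      ENNReal.ofReal (Real.exp (s * A)) * (ENNReal.ofReal C * wexp (-s) Φ z₀) := fun j => by
    refine le_trans ?_ (mul_le_mul_right (hI j) _)
    rw [← lintegral_const_mul' _ _ ENNReal.ofReal_ne_top]
    refine setLIntegral_mono' Metric.isOpen_ball.measurableSet fun z hz => ?_
    have h1 : (1 : ℝ≥0∞) ≤ ENNReal.ofReal (Real.exp (s * A)) *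
        ENNReal.ofReal (Real.exp (-(s * φ j z))) := by
      rw [← ENNReal.ofReal_mul (Real.exp_pos _).le, ← Real.exp_add, ENNReal.one_le_ofReal,
        Real.one_le_exp_iff]
      nlinarith [hA j z (by simpa using hz)]
    rw [hw] at h1
    calc ‖F j z‖ₑ ^ 2 = 1 * ‖F j z‖ₑ ^ 2 := (one_mul _).symm
      _ ≤ _ := mul_le_mul_left h1 _
      _ = _ := by ring
  set M : ℝ≥0∞ := ENNReal.ofReal B * (ENNReal.ofReal (Real.exp (s * A)) *
    (ENNReal.ofReal C * wexp (-s) Φ z₀)) with hM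
  have hMtop : M ≠ ⊤ := ENNReal.mul_ne_top ENNReal.ofReal_ne_top
    (ENNReal.mul_ne_top ENNReal.ofReal_ne_top hfin)
  have hbound : ∀ j, ∀ z ∈ Metric.ball (0 : Cn n) (3 * ρ / 4), ‖F j z‖ ≤ √M.toReal :=
    fun j z hz => by
    have h1 := (hBd (F j) (hF j).differentiableOn z hz).trans (mul_le_mul_right (hL2 j) _)
    refine Real.le_sqrt_of_sq_le ?_
    rw [← ofReal_norm, ← ENNReal.ofReal_pow (norm_nonneg _)] at h1
    exact (ENNReal.ofReal_le_iff_le_toReal hMtop).1 h1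
  obtain ⟨ψ, G, hψ, hG, hGlim⟩ := exists_tendsto_subseq (show ρ / 2 < 3 * ρ / 4 by linarith)
    (fun j => (hF j).differentiableOn) hbound
  refine ⟨G, hG, ge_of_tendsto' (hGlim z₀ hz₀).norm fun j => hF0 (ψ j), ?_⟩
  have hpt : ∀ z ∈ Metric.ball (0 : Cn n) (ρ / 2), ‖G z‖ₑ ^ 2 * wexp (-s) Φ z ≤
      liminf (fun j => ‖F (ψ j) z‖ₑ ^ 2 * EReal.exp ((φ (ψ j) z : ℝ) : EReal) ^ (-s)) atTop :=
    fun z hz => by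
    rcases eq_or_ne (G z) 0 with h | h
    · simp [h]
    have hzρ : ‖z‖ < ρ := by simpa using hsub hz
    have t1 : Tendsto (fun j => ((φ j z : ℝ) : EReal)) atTop (𝓝 (Φ z)) := by
      refine tendsto_order.2 ⟨fun a ha => Eventually.of_forall fun j => ha.trans_le (hle j z hzρ),
        fun a ha => ?_⟩
      obtain ⟨c, h1, h2⟩ := EReal.lt_iff_exists_real_btwn.1 ha
      filter_upwards [hlim z hzρ c h1] with j hj
      exact (EReal.coe_lt_coe_iff.2 hj).trans h2
    have t2 : Tendsto (fun j => EReal.exp ((φ (ψ j) z : ℝ) : EReal) ^ (-s)) atTop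
        (𝓝 (wexp (-s) Φ z)) := by
      rw [wexp_eq]
      exact ((ENNReal.continuous_rpow_const.comp ENNReal.continuous_exp).tendsto _).comp
        (t1.comp hψ.tendsto_atTop)
    have t3 : Tendsto (fun j => ‖F (ψ j) z‖ₑ ^ 2) atTop (𝓝 (‖G z‖ₑ ^ 2)) :=
      ((ENNReal.continuous_pow 2).tendsto _).comp (hGlim z hz).enorm
    rw [(ENNReal.Tendsto.mul t3 (Or.inl (by simpa using h)) t2 (Or.inr (by simp))).liminf_eq]
  calc _ ≤ ∫⁻ z in Metric.ball (0 : Cn n) (ρ / 2),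
        liminf (fun j => ‖F (ψ j) z‖ₑ ^ 2 * EReal.exp ((φ (ψ j) z : ℝ) : EReal) ^ (-s)) atTop :=
      setLIntegral_mono' Metric.isOpen_ball.measurableSet hpt
    _ ≤ liminf (fun j => ∫⁻ z in Metric.ball (0 : Cn n) (ρ / 2),
        ‖F (ψ j) z‖ₑ ^ 2 * EReal.exp ((φ (ψ j) z : ℝ) : EReal) ^ (-s)) atTop := by
      refine lintegral_liminf_le fun j => ?_
      simp only [← hw]
      have h1 := (hF (ψ j)).continuous
      have h2 := (hφ (ψ j)).continuous
      exact ((h1.enorm.measurable.pow_const 2).mul (ENNReal.measurable_ofReal.comp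
        (Real.continuous_exp.comp (continuous_const.mul h2).neg).measurable))
    _ ≤ _ := by
      refine liminf_le_of_le (by isBoundedDefault) fun b hb => ?_
      obtain ⟨j, hj⟩ := hb.exists
      exact hj.trans ((lintegral_mono_set hsub).trans (hI (ψ j)))

/-! ### Zhou weights on a fixed ball -/

lemma SubOn.of_attained {ι : Type*} {u : ι → Cn n → EReal} {v : Cn n → EReal} {Ω : Set (Cn n)}
    (hΩ : IsOpen Ω) (hu : ∀ i, SubOn (u i) Ω) (hv : UscOn v Ω) (hle : ∀ i, ∀ z ∈ Ω, u i z ≤ v z)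
    (hatt : ∀ z ∈ Ω, ∃ i, v z ≤ u i z) : SubOn v Ω where
  toUscOn := hv
  submean z hz := by
    obtain ⟨i, hi⟩ := hatt z hz
    exact SubAt.touch hΩ hz (hu i).toUscOn hv ((hu i).submean z hz) (hle i) hi

lemma SubOn.max {u v : Cn n → EReal} {Ω : Set (Cn n)} (hΩ : IsOpen Ω) (hu : SubOn u Ω)
    (hv : SubOn v Ω) : SubOn (fun z => max (u z) (v z)) Ω := by
  refine SubOn.of_attained (u := fun b : Bool => bif b then u else v) hΩ
    (by rintro (_ | _) <;> simpa) ⟨fun z hz c hc => ?_, fun z hz => ?_⟩ ?_ fun z _ => ?_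
  · filter_upwards [hu.usc z hz c ((le_max_left _ _).trans_lt hc),
      hv.usc z hz c ((le_max_right _ _).trans_lt hc)] with y h1 h2 using max_lt h1 h2
  · exact max_lt (hu.lt_top z hz) (hv.lt_top z hz)
  · rintro (_ | _) z _ <;> simp
  · rcases le_total (u z) (v z) with h | h
    · exact ⟨false, by simp [h]⟩
    · exact ⟨true, by simp [h]⟩

lemma SubOn.iSup {u : ℕ → Cn n → EReal} {Ω : Set (Cn n)} (hΩ : IsOpen Ω)
    (hu : ∀ i, SubOn (u i) Ω) (htail : ∀ c : ℝ, ∃ N, ∀ i, N ≤ i → ∀ z ∈ Ω, u i z ≤ c) :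
    SubOn (fun z => ⨆ i, u i z) Ω := by
  have hatt : ∀ z ∈ Ω, ∃ i, (⨆ i, u i z) ≤ u i z := fun z hz => by
    by_cases h : ∀ i, u i z = ⊥
    · exact ⟨0, by simp [h]⟩
    push Not at h
    obtain ⟨i₀, hi₀⟩ := h
    obtain ⟨c, _, hc⟩ := EReal.lt_iff_exists_real_btwn.1 (bot_lt_iff_ne_bot.2 hi₀)
    obtain ⟨N, hN⟩ := htail c
    obtain ⟨i, hi, hmax⟩ := Finset.exists_max_image (Finset.range (N + i₀ + 1)) (fun i => u i z)
      ⟨0, by simp⟩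
    refine ⟨i, iSup_le fun j => ?_⟩
    rcases lt_or_ge j (N + i₀ + 1) with hj | hj
    · exact hmax j (by simpa using hj)
    · exact (hN j (by omega) z hz).trans (hc.le.trans (hmax i₀ (by simp)))
  refine SubOn.of_attained hΩ hu ⟨fun z hz c hc => ?_, fun z hz => ?_⟩
    (fun i z _ => le_iSup (fun i => u i z) i) hatt
  · obtain ⟨c', h1, h2⟩ := EReal.lt_iff_exists_real_btwn.1 hc
    obtain ⟨N, hN⟩ := htail c'
    have h3 : ∀ᶠ y in 𝓝 z, ∀ i ∈ Finset.range N, u i y < c' :=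
      (Finset.eventually_all _).2 fun i _ =>
        (hu i).usc z hz c' ((le_iSup (fun i => u i z) i).trans_lt h1)
    filter_upwards [h3, hΩ.eventually_mem hz] with y hy hyΩ
    refine (iSup_le fun i => ?_).trans_lt h2
    rcases lt_or_ge i N with hi | hi
    · exact (hy i (by simpa using hi)).le
    · exact hN i hi y hyΩ
  · obtain ⟨i, hi⟩ := hatt z hz
    exact hi.trans_lt ((hu i).lt_top z hz)

/-- The properties of a Zhou weight, made uniform on the ball of radius `R`. -/
structure ZhouBall (W : Cn n → ℝ≥0∞) (Φ : Cn n → EReal) (R : ℝ) : Prop where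
  pos : 0 < R
  sub : SubOn Φ (Metric.ball 0 R)
  meas : AEMeasurable W (volume.restrict (Metric.ball 0 R))
  bdd : ∃ B : ℝ≥0∞, B ≠ ⊤ ∧ ∀ z ∈ Metric.ball 0 R, W z ≤ B
  fin : ∀ r > 0, ∫⁻ z in Metric.ball 0 R \ Metric.ball 0 r, W z * wexp (-2) Φ z < ⊤
  nonint : ¬ IntNear fun z => W z * wexp (-2) Φ z
  ne_bot : ∀ r > 0, ∃ z ∈ Metric.ball 0 r, Φ z ≠ ⊥
  ae_ne_bot : ∀ᵐ z ∂(volume.restrict (Metric.ball 0 R)), W z ≠ 0 → Φ z ≠ ⊥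
  maximal : ∀ r > 0, ∀ u : Cn n → EReal, SubOn u (Metric.ball 0 r) →
    (∀ z ∈ Metric.ball 0 r, Φ z ≤ u z) → (¬ IntNear fun z => W z * wexp (-2) u z) → leO u Φ

lemma ZhouBall.mono {W : Cn n → ℝ≥0∞} {Φ : Cn n → EReal} {R r : ℝ} (h : ZhouBall W Φ R)
    (hr : 0 < r) (hrR : r ≤ R) : ZhouBall W Φ r where
  pos := hr
  sub := h.sub.mono (Metric.ball_subset_ball hrR)
  meas := h.meas.mono_measure (Measure.restrict_mono (Metric.ball_subset_ball hrR) le_rfl)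
  bdd := let ⟨B, hB, H⟩ := h.bdd; ⟨B, hB, fun z hz => H z (Metric.ball_subset_ball hrR hz)⟩
  fin s hs := (lintegral_mono_set (Set.sdiff_subset_sdiff_left
    (Metric.ball_subset_ball hrR))).trans_lt (h.fin s hs)
  nonint := h.nonint
  ne_bot := h.ne_bot
  ae_ne_bot := ae_mono (Measure.restrict_mono (Metric.ball_subset_ball hrR) le_rfl) h.ae_ne_bot
  maximal := h.maximal

lemma IntNear.exists_ball {g : Cn n → ℝ≥0∞} (h : IntNear g) :
    ∃ r > 0, ∫⁻ z in Metric.ball 0 r, g z < ⊤ := by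
  obtain ⟨U, hU, hI⟩ := h
  obtain ⟨r, hr, hrU⟩ := Metric.mem_nhds_iff.1 hU
  exact ⟨r, hr, (lintegral_mono_set hrU).trans_lt hI⟩

lemma IntNear.of_ball {g : Cn n → ℝ≥0∞} {r : ℝ} (hr : 0 < r)
    (h : ∫⁻ z in Metric.ball 0 r, g z < ⊤) : IntNear g :=
  ⟨_, Metric.ball_mem_nhds 0 hr, h⟩

lemma wexp_neg_of_bot {Φ : Cn n → EReal} {z : Cn n} (h : Φ z = ⊥) {s : ℝ} (hs : 0 < s) :
    wexp (-s) Φ z = ⊤ := by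
  rw [wexp_eq, h, EReal.exp_bot, ENNReal.zero_rpow_of_neg (by linarith)]

lemma IsZhouWeightFor.exists_zhouBall (hn : 0 < n) {m : ℕ} {f : Fin m → Cn n → ℂ}
    (hf : ∀ j, HoloNear (f j)) {Φ : Cn n → EReal} (hZ : IsZhouWeightFor (normSq2 f) Φ) :
    ∃ R, ZhouBall (normSq2 f) Φ R := by
  have : Nonempty (Fin n) := ⟨⟨0, hn⟩⟩
  obtain ⟨U, hU0, hU, hpsh⟩ := hZ.psh
  have hsub := hpsh.subOn hU
  choose V hV0 hV hd using hf
  obtain ⟨N, hN⟩ := hZ.intN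
  obtain ⟨R₁, hR₁, hinteg⟩ := (hN N le_rfl).exists_ball
  have hcont : ∀ z ∈ ⋂ j, V j, ContinuousAt (normSq2 f) z := fun z hz => by
    refine tendsto_finsetSum _ fun j _ => ?_
    have h1 : ContinuousAt (f j) z := ((hd j).differentiableAt
      ((hV j).mem_nhds (Set.mem_iInter.1 hz j))).continuousAt
    exact ((ENNReal.continuous_pow 2).tendsto _).comp
      (ENNReal.tendsto_coe.2 h1.nnnorm)
  have hVo : IsOpen (⋂ j, V j) := isOpen_iInter_of_finite hV
  have hV0' : (0 : Cn n) ∈ ⋂ j, V j := Set.mem_iInter.2 fun j => mem_of_mem_nhds (hV0 j)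
  have htop : normSq2 f 0 < ⊤ := by simp [normSq2]
  have hbd : ∀ᶠ z in 𝓝 (0 : Cn n), normSq2 f z < normSq2 f 0 + 1 :=
    (hcont 0 hV0').eventually_lt_const (ENNReal.lt_add_right htop.ne one_ne_zero)
  obtain ⟨R₂, hR₂, hsub₂⟩ := Metric.mem_nhds_iff.1
    (Filter.inter_mem hU0 (Filter.inter_mem (hVo.mem_nhds hV0') hbd))
  set R := min R₁ R₂
  have hR : 0 < R := lt_min hR₁ hR₂
  have hRs : Metric.ball (0 : Cn n) R ⊆ Metric.ball 0 R₂ :=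
    Metric.ball_subset_ball (min_le_right _ _)
  have hfin : ∀ r > 0, ∫⁻ z in Metric.ball 0 R \ Metric.ball 0 r,
      normSq2 f z * wexp (-2) Φ z < ⊤ := fun r hr => by
    have hr0 : ENNReal.ofReal (r ^ (2 * N)) ≠ 0 := by simp; positivity
    refine lt_of_le_of_lt (b := (ENNReal.ofReal (r ^ (2 * N)))⁻¹ *
      ∫⁻ z in Metric.ball 0 R₁, normSq2 f z * ENNReal.ofReal (‖z‖ ^ (2 * N)) * wexp (-2) Φ z)
      ?_ (ENNReal.mul_lt_top (by simpa [pos_iff_ne_zero] using hr0) hinteg)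
    rw [← lintegral_const_mul' _ _ (by simpa using hr0)]
    refine le_trans ?_ (lintegral_mono_set (s := Metric.ball 0 R \ Metric.ball 0 r)
      (Set.sdiff_subset.trans (Metric.ball_subset_ball (min_le_left _ _))))
    refine setLIntegral_mono' (Metric.isOpen_ball.measurableSet.diff
      Metric.isOpen_ball.measurableSet) fun z hz => ?_
    have hz' : r ≤ ‖z‖ := by simpa using hz.2
    calc normSq2 f z * wexp (-2) Φ z = ((ENNReal.ofReal (r ^ (2 * N)))⁻¹ *
          ENNReal.ofReal (r ^ (2 * N))) * (normSq2 f z * wexp (-2) Φ z) := by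
          rw [ENNReal.inv_mul_cancel hr0 ENNReal.ofReal_ne_top, one_mul]
      _ ≤ ((ENNReal.ofReal (r ^ (2 * N)))⁻¹ *
          ENNReal.ofReal (‖z‖ ^ (2 * N))) * (normSq2 f z * wexp (-2) Φ z) := by gcongr
      _ = _ := by ring
  have hmeas : AEMeasurable (normSq2 f) (volume.restrict (Metric.ball 0 R)) :=
    ContinuousOn.aemeasurable
      (fun z hz => (hcont z (hsub₂ (hRs hz)).2.1).continuousWithinAt)
      Metric.isOpen_ball.measurableSet
  have hsubR : SubOn Φ (Metric.ball 0 R) := hsub.mono fun z hz => (hsub₂ (hRs hz)).1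
  have hmW : AEMeasurable (fun z => normSq2 f z * wexp (-2) Φ z)
      (volume.restrict (Metric.ball 0 R)) :=
    hmeas.mul (hsubR.toUscOn.aemeasurable_wexp Metric.isOpen_ball _)
  have hae : ∀ᵐ z ∂(volume.restrict (Metric.ball 0 R)), normSq2 f z ≠ 0 → Φ z ≠ ⊥ := by
    have h1 : ∀ k : ℕ, ∀ᵐ z, z ∈ Metric.ball (0 : Cn n) R \ Metric.ball 0 (1 / ((k : ℝ) + 1)) →
        normSq2 f z * wexp (-2) Φ z < ⊤ := fun k => by
      rw [← ae_restrict_iff' (Metric.isOpen_ball.measurableSet.diff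
        Metric.isOpen_ball.measurableSet)]
      exact ae_lt_top' (hmW.mono_measure (Measure.restrict_mono Set.sdiff_subset le_rfl))
        (hfin _ (by positivity)).ne
    have h2 : ∀ᵐ z : Cn n, z ≠ 0 := by simp [ae_iff]
    rw [ae_restrict_iff' Metric.isOpen_ball.measurableSet]
    filter_upwards [ae_all_iff.2 h1, h2] with z hz hz0 hzR hW hbot
    obtain ⟨k, hk⟩ := exists_nat_one_div_lt (norm_pos_iff.2 hz0)
    have := hz k ⟨hzR, by simpa using hk.le⟩
    rw [wexp_neg_of_bot hbot two_pos, ENNReal.mul_top hW] at this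
    exact lt_irrefl _ this
  have hne : ∀ r > 0, ∃ z ∈ Metric.ball (0 : Cn n) r, Φ z ≠ ⊥ := fun r hr => by
    by_contra! hcon
    refine hZ.nonint (IntNear.of_ball (lt_min hr hR) ?_)
    refine lt_of_eq_of_lt (lintegral_eq_zero_of_ae_eq_zero ?_) ENNReal.zero_lt_top
    have h3 : ∀ᵐ z ∂(volume.restrict (Metric.ball 0 (min r R))), normSq2 f z ≠ 0 → Φ z ≠ ⊥ :=
      ae_mono (Measure.restrict_mono (Metric.ball_subset_ball (min_le_right _ _)) le_rfl) hae
    filter_upwards [h3, ae_restrict_mem Metric.isOpen_ball.measurableSet] with z hz hzr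
    have := hcon z (Metric.ball_subset_ball (min_le_left _ _) hzr)
    by_cases h : normSq2 f z = 0
    · simp [h]
    · exact absurd this (hz h)
  refine ⟨R, hR, hsubR, hmeas, ⟨normSq2 f 0 + 1, by simp [htop.ne],
    fun z hz => (hsub₂ (hRs hz)).2.2.le⟩, hfin, hZ.nonint, hne, hae, fun r hr u hu hle hni => ?_⟩
  obtain ⟨x, hx, hxb⟩ := hne r hr
  have hpu : PSHNear u := SubOn.pshNear hr hu hx
    (bot_lt_iff_ne_bot.1 ((bot_lt_iff_ne_bot.2 hxb).trans_le (hle x hx)))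
  refine (hZ.maximal u hpu ⟨0, ?_⟩ hni).1
  filter_upwards [Metric.ball_mem_nhds 0 hr] with z hz
  simpa using hle z hz

lemma le_aff_of_inv_mul_le {a C : ℝ} (ha : 0 < a) {x y : EReal}
    (h : ((a⁻¹ : ℝ) : EReal) * x ≤ y + (C : EReal)) :
    x ≤ (a : EReal) * y + ((a * C : ℝ) : EReal) := by
  induction y with
  | bot =>
    induction x with
    | bot => exact bot_le
    | coe x => simp [← EReal.coe_mul] at h
    | top => rw [EReal.coe_mul_top_of_pos (inv_pos.2 ha)] at h; simp at h
  | top => rw [EReal.coe_mul_top_of_pos ha, EReal.top_add_coe]; exact le_top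
  | coe y =>
    induction x with
    | bot => exact bot_le
    | coe x =>
      norm_cast at h ⊢
      rw [inv_mul_le_iff₀ ha] at h
      linarith
    | top =>
      rw [EReal.coe_mul_top_of_pos (inv_pos.2 ha), ← EReal.coe_add] at h
      exact absurd h (not_le.2 (EReal.coe_lt_top _))

lemma wexp_le_of_lt_log {Φ : Cn n → EReal} {F : Cn n → ℂ} {z : Cn n} {m : ℝ} (hm : 1 < m)
    (h : Φ z < (((m - 1)⁻¹ : ℝ) : EReal) * logAbs F z) :
    wexp (-2) Φ z ≤ ‖F z‖ₑ ^ 2 * wexp (-(2 * m)) Φ z := by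
  have hF : F z ≠ 0 := fun h0 => by
    simp [logAbs, elog, h0, EReal.coe_mul_bot_of_pos (inv_pos.2 (sub_pos.2 hm))] at h
  have hl : logAbs F z = ((Real.log ‖F z‖ : ℝ) : EReal) := by simp [logAbs, elog, hF]
  rcases eq_or_ne (Φ z) ⊥ with hb | hb
  · rw [wexp_neg_of_bot hb two_pos, wexp_neg_of_bot hb (by linarith), ENNReal.mul_top (by simpa)]
  rw [hl, ← EReal.coe_mul] at h
  lift Φ z to ℝ using ⟨(h.trans (EReal.coe_lt_top _)).ne, hb⟩ with x hx
  rw [wexp_coe _ hx.symm, wexp_coe _ hx.symm, ← ofReal_norm,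
    ← ENNReal.ofReal_pow (norm_nonneg _), ← ENNReal.ofReal_mul (by positivity)]
  refine ENNReal.ofReal_le_ofReal ?_
  rw [EReal.coe_lt_coe_iff, lt_inv_mul_iff₀ (sub_pos.2 hm)] at h
  calc Real.exp (-2 * x) ≤ Real.exp (2 * Real.log ‖F z‖ + -(2 * m) * x) :=
        Real.exp_le_exp.2 (by linarith)
    _ = _ := by
        rw [Real.exp_add, two_mul, Real.exp_add, Real.exp_log (norm_pos_iff.2 hF), sq]

lemma ZhouBall.tame {W : Cn n → ℝ≥0∞} {Φ : Cn n → EReal} {R : ℝ} (h : ZhouBall W Φ R)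
    {F : Cn n → ℂ} (hF : HoloNear F) {m : ℝ} (hm : 1 < m)
    (hI : IntNear fun z => ‖F z‖ₑ ^ 2 * wexp (-(2 * m)) Φ z) :
    leO (logAbs F) fun z => ((m - 1 : ℝ) : EReal) * Φ z := by
  obtain ⟨U, hU0, hU, hd⟩ := hF
  obtain ⟨r₁, hr₁, hI⟩ := hI.exists_ball
  obtain ⟨r₂, hr₂, hrU⟩ := Metric.mem_nhds_iff.1 hU0
  set r := min R (min r₁ r₂)
  have hr : 0 < r := lt_min h.pos (lt_min hr₁ hr₂)
  have hm' : 0 < (m - 1)⁻¹ := inv_pos.2 (sub_pos.2 hm)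
  have hrR : Metric.ball (0 : Cn n) r ⊆ Metric.ball 0 R := Metric.ball_subset_ball (min_le_left _ _)
  have hr1 : Metric.ball (0 : Cn n) r ⊆ Metric.ball 0 r₁ :=
    Metric.ball_subset_ball ((min_le_right _ _).trans (min_le_left _ _))
  have hr2 : Metric.ball (0 : Cn n) r ⊆ Metric.ball 0 r₂ :=
    Metric.ball_subset_ball ((min_le_right _ _).trans (min_le_right _ _))
  set u : Cn n → EReal := fun z =>
    max (Φ z) ((((m - 1)⁻¹ : ℝ) : EReal) * logAbs F z + ((0 : ℝ) : EReal)) with hu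
  have hus : SubOn u (Metric.ball 0 r) := (h.sub.mono hrR).max Metric.isOpen_ball
    ((SubOn.logAbs Metric.isOpen_ball (hd.mono (hr2.trans hrU))).affine Metric.isOpen_ball hm' 0)
  obtain ⟨C, hC⟩ := h.maximal r hr u hus (fun z _ => le_max_left _ _) fun hcon => by
    obtain ⟨r₃, hr₃, hI3⟩ := hcon.exists_ball
    obtain ⟨B, hB, hWB⟩ := h.bdd
    have hs1 : Metric.ball (0 : Cn n) (min r r₃) ⊆ Metric.ball 0 r :=
      Metric.ball_subset_ball (min_le_left _ _)
    refine h.nonint (IntNear.of_ball (lt_min hr hr₃) ?_)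
    calc ∫⁻ z in Metric.ball 0 (min r r₃), W z * wexp (-2) Φ z
        ≤ ∫⁻ z in Metric.ball 0 (min r r₃), (W z * wexp (-2) u z +
            B * (‖F z‖ₑ ^ 2 * wexp (-(2 * m)) Φ z)) := by
          refine setLIntegral_mono' Metric.isOpen_ball.measurableSet fun z hz => ?_
          rcases le_or_gt ((((m - 1)⁻¹ : ℝ) : EReal) * logAbs F z) (Φ z) with hle | hlt
          · have : u z = Φ z := by simp [hu, hle]
            rw [wexp_eq (-2) u, this, ← wexp_eq]
            exact le_self_add
          · exact (mul_le_mul' (hWB z (hrR (hs1 hz))) (wexp_le_of_lt_log hm hlt)).trans le_add_self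
      _ = (∫⁻ z in Metric.ball 0 (min r r₃), W z * wexp (-2) u z) +
            B * ∫⁻ z in Metric.ball 0 (min r r₃), ‖F z‖ₑ ^ 2 * wexp (-(2 * m)) Φ z := by
          rw [lintegral_add_left', lintegral_const_mul' _ _ hB]
          exact (h.meas.mono_measure (Measure.restrict_mono (hs1.trans hrR) le_rfl)).mul
            ((hus.mono hs1).toUscOn.aemeasurable_wexp Metric.isOpen_ball _)
      _ < ⊤ := ENNReal.add_lt_top.2
          ⟨(lintegral_mono_set (Metric.ball_subset_ball (min_le_right _ _))).trans_lt hI3,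
            ENNReal.mul_lt_top hB.lt_top ((lintegral_mono_set (hs1.trans hr1)).trans_lt hI)⟩
  refine ⟨(m - 1) * C, ?_⟩
  filter_upwards [hC] with z hz
  refine le_aff_of_inv_mul_le (sub_pos.2 hm) (le_trans ?_ hz)
  simp [hu]

/-! ### From holomorphic functions back to weights -/

lemma sq_tsum_quarter_le (x : ℕ → ℝ≥0∞) :
    (∑' j, (4⁻¹ : ℝ≥0∞) ^ j * x j) ^ 2 ≤ 4 * ∑' j, (4⁻¹ : ℝ≥0∞) ^ j * x j ^ 2 := by
  set T := ∑' j, (4⁻¹ : ℝ≥0∞) ^ j * x j ^ 2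
  have h4 : (4⁻¹ : ℝ≥0∞) = 2⁻¹ ^ 2 := by
    rw [← ENNReal.inv_pow]; norm_num
  have h1 : ∀ j, (2⁻¹ : ℝ≥0∞) ^ j * x j ≤ T ^ (1 / 2 : ℝ) := fun j => by
    have h2 : ((2⁻¹ : ℝ≥0∞) ^ j * x j) ^ 2 ≤ T := by
      refine le_trans (le_of_eq ?_) (ENNReal.le_tsum j)
      rw [h4]; ring
    calc (2⁻¹ : ℝ≥0∞) ^ j * x j = (((2⁻¹ : ℝ≥0∞) ^ j * x j) ^ 2) ^ (1 / 2 : ℝ) := by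
          rw [← ENNReal.rpow_natCast ((2⁻¹ : ℝ≥0∞) ^ j * x j), ← ENNReal.rpow_mul]; norm_num
      _ ≤ _ := ENNReal.rpow_le_rpow h2 (by norm_num)
  have h3 : ∑' j, (4⁻¹ : ℝ≥0∞) ^ j * x j ≤ 2 * T ^ (1 / 2 : ℝ) := by
    calc _ ≤ ∑' j, (2⁻¹ : ℝ≥0∞) ^ j * T ^ (1 / 2 : ℝ) := by
          refine ENNReal.tsum_le_tsum fun j => ?_
          rw [h4, ← pow_mul, mul_comm 2 j, pow_mul, sq, mul_assoc]
          exact mul_le_mul_right (h1 j) _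
      _ = _ := by
          rw [ENNReal.tsum_mul_right, ENNReal.tsum_geometric, ENNReal.one_sub_inv_two, inv_inv]
  calc _ ≤ (2 * T ^ (1 / 2 : ℝ)) ^ 2 := pow_le_pow_left' h3 2
    _ = 4 * T := by
      rw [mul_pow, ← ENNReal.rpow_natCast (T ^ (1 / 2 : ℝ)), ← ENNReal.rpow_mul]; norm_num

section Series

variable {G : ℕ → Cn n → ℂ} {R r r' M : ℝ} {w : Cn n → ℝ≥0∞} {D : ℝ≥0∞}

lemma norm_series_term_le (hM : ∀ j, ∀ z ∈ Metric.ball (0 : Cn n) r, ‖G j z‖ ≤ M) {a : ℕ → ℂ}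
    {A : ℝ} (ha : ∀ j, ‖a j‖ ≤ A) {z : Cn n} (hz : z ∈ Metric.ball 0 r) (j : ℕ) :
    ‖(4⁻¹ : ℂ) ^ j * (a j * G j z)‖ ≤ (4⁻¹ : ℝ) ^ j * (A * M) := by
  rw [norm_mul, norm_pow, norm_inv, norm_mul]
  have h0 : 0 ≤ A := (norm_nonneg _).trans (ha 0)
  gcongr
  · simp
  · exact ha j
  · exact hM j z hz

lemma summable_quarter (c : ℝ) : Summable fun j : ℕ => (4⁻¹ : ℝ) ^ j * c :=
  (summable_geometric_of_lt_one (by norm_num) (by norm_num)).mul_right c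

lemma differentiableOn_series (hG : ∀ j, DifferentiableOn ℂ (G j) (Metric.ball 0 R))
    (hM : ∀ j, ∀ z ∈ Metric.ball (0 : Cn n) r, ‖G j z‖ ≤ M) (hr' : r' < r) (hrR : r ≤ R)
    {a : ℕ → ℂ} {A : ℝ} (ha : ∀ j, ‖a j‖ ≤ A) :
    DifferentiableOn ℂ (fun z => ∑' j, (4⁻¹ : ℂ) ^ j * (a j * G j z)) (Metric.ball 0 r') := by
  have hs := summable_quarter (A * M)
  refine differentiableOn_of_tendsto (F := fun N z => ∑ j ∈ Finset.range N,
    (4⁻¹ : ℂ) ^ j * (a j * G j z)) (M := ∑' j : ℕ, (4⁻¹ : ℝ) ^ j * (A * M)) hr' (fun N => ?_)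
    (fun N z hz => ?_) fun z hz => ?_
  · refine DifferentiableOn.fun_sum fun j _ => ?_
    exact (((hG j).mono (Metric.ball_subset_ball hrR)).const_mul _).const_mul _
  · refine (norm_sum_le _ _).trans ((Finset.sum_le_sum fun j _ =>
      norm_series_term_le hM ha hz j).trans (hs.sum_le_tsum _ fun j _ => ?_))
    exact (norm_nonneg _).trans (norm_series_term_le hM ha hz j)
  · exact (Summable.of_norm_bounded hs (norm_series_term_le hM ha hz)).hasSum.tendsto_sum_nat

lemma lintegral_series_lt_top (hG : ∀ j, DifferentiableOn ℂ (G j) (Metric.ball 0 R))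
    (hw : AEMeasurable w (volume.restrict (Metric.ball 0 R))) (hD : D ≠ ⊤)
    (hI : ∀ j, ∫⁻ z in Metric.ball 0 R, ‖G j z‖ₑ ^ 2 * w z ≤ D)
    {a : ℕ → ℂ} {A : ℝ} (ha : ∀ j, ‖a j‖ ≤ A) :
    ∫⁻ z in Metric.ball 0 R, ‖∑' j, (4⁻¹ : ℂ) ^ j * (a j * G j z)‖ₑ ^ 2 * w z < ⊤ := by
  have h1 : ∀ z, ‖∑' j, (4⁻¹ : ℂ) ^ j * (a j * G j z)‖ₑ ^ 2 * w z ≤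
      4 * ∑' j, (4⁻¹ : ℝ≥0∞) ^ j * (ENNReal.ofReal A ^ 2 * (‖G j z‖ₑ ^ 2 * w z)) := fun z => by
    calc _ ≤ (∑' j, ‖(4⁻¹ : ℂ) ^ j * (a j * G j z)‖ₑ) ^ 2 * w z := by
          gcongr; exact enorm_tsum_le_tsum_enorm
      _ ≤ (∑' j, (4⁻¹ : ℝ≥0∞) ^ j * (ENNReal.ofReal A * ‖G j z‖ₑ)) ^ 2 * w z := by
          gcongr with j
          rw [enorm_mul, enorm_pow, enorm_mul, enorm_inv (by norm_num)]
          have h4 : ‖(4 : ℂ)‖ₑ = 4 := by rw [← ofReal_norm]; norm_num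
          rw [h4]
          gcongr
          rw [← ofReal_norm]
          exact ENNReal.ofReal_le_ofReal (ha j)
      _ ≤ 4 * (∑' j, (4⁻¹ : ℝ≥0∞) ^ j * (ENNReal.ofReal A * ‖G j z‖ₑ) ^ 2) * w z := by
          gcongr; exact sq_tsum_quarter_le _
      _ = _ := by
          rw [mul_assoc, ← ENNReal.tsum_mul_right]
          congr 1
          exact tsum_congr fun j => by ring
  have hm : ∀ j, AEMeasurable (fun z => (4⁻¹ : ℝ≥0∞) ^ j *
      (ENNReal.ofReal A ^ 2 * (‖G j z‖ₑ ^ 2 * w z))) (volume.restrict (Metric.ball 0 R)) :=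
    fun j => (((((hG j).continuousOn.aemeasurable Metric.isOpen_ball.measurableSet).enorm.pow_const
      2).mul hw).const_mul _).const_mul _
  refine (lintegral_mono h1).trans_lt ?_
  rw [lintegral_const_mul' _ _ (by norm_num), lintegral_tsum hm]
  refine ENNReal.mul_lt_top (by norm_num) ?_
  calc _ ≤ ∑' j : ℕ, (4⁻¹ : ℝ≥0∞) ^ j * (ENNReal.ofReal A ^ 2 * D) := by
        refine ENNReal.tsum_le_tsum fun j => ?_
        rw [lintegral_const_mul' _ _ (by simp), lintegral_const_mul' _ _ (by simp)]
        gcongr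
        exact hI j
    _ < ⊤ := by
        rw [ENNReal.tsum_mul_right, ENNReal.tsum_geometric]
        refine ENNReal.mul_lt_top ?_ (ENNReal.mul_lt_top (by simp) hD.lt_top)
        simp only [ENNReal.inv_lt_top, tsub_pos_iff_lt, ENNReal.inv_lt_one]
        norm_num

end Series

lemma exists_holo_unbounded {G : ℕ → Cn n → ℂ} {r M : ℝ}
    (hM : ∀ j, ∀ z ∈ Metric.ball (0 : Cn n) r, ‖G j z‖ ≤ M) {z : ℕ → Cn n}
    (hz : ∀ k, z k ∈ Metric.ball 0 r) {s : ℕ → ℝ}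
    (hs : ∀ k, 8 ^ k ≤ ‖(s k : ℂ) * G k (z k)‖) :
    ∃ a : ℕ → ℂ, (∃ A, ∀ j, ‖a j‖ ≤ A) ∧
      ∀ B : ℝ, ∃ k, B < ‖(s k : ℂ) * ∑' j, (4⁻¹ : ℂ) ^ j * (a j * G j (z k))‖ := by
  by_contra! hcon
  have hsm : ∀ (a : BoundedContinuousFunction ℕ ℂ) k,
      Summable fun j => (4⁻¹ : ℂ) ^ j * (a j * G j (z k)) := fun a k =>
    Summable.of_norm_bounded (summable_quarter _)
      (norm_series_term_le hM a.norm_coe_le_norm (hz k))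
  let L : ℕ → BoundedContinuousFunction ℕ ℂ →L[ℂ] ℂ := fun k => LinearMap.mkContinuous
    { toFun := fun a => (s k : ℂ) * ∑' j, (4⁻¹ : ℂ) ^ j * (a j * G j (z k))
      map_add' := fun a b => by
        rw [← mul_add, ← (hsm a k).tsum_add (hsm b k)]
        congr 1
        exact tsum_congr fun j => by rw [BoundedContinuousFunction.add_apply]; ring
      map_smul' := fun c a => by
        rw [RingHom.id_apply, smul_eq_mul, mul_left_comm]
        congr 1
        rw [← tsum_mul_left]
        exact tsum_congr fun j => by
          rw [BoundedContinuousFunction.smul_apply, smul_eq_mul]; ring }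
    (|s k| * ∑' j : ℕ, (4⁻¹ : ℝ) ^ j * M) fun a => by
      simp only [LinearMap.coe_mk, AddHom.coe_mk, norm_mul, Complex.norm_real, Real.norm_eq_abs]
      rw [mul_assoc]
      gcongr
      rw [← tsum_mul_right]
      refine tsum_of_norm_bounded ?_ (norm_series_term_le hM a.norm_coe_le_norm (hz k))
      have := ((summable_quarter M).mul_right ‖a‖).hasSum
      simpa only [mul_assoc, mul_comm M] using this
  obtain ⟨C, hC⟩ := banach_steinhaus (g := L) fun a => by
    obtain ⟨B, hB⟩ := hcon a ⟨‖a‖, a.norm_coe_le_norm⟩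
    exact ⟨B, hB⟩
  have h2 : ∀ k : ℕ, (2 : ℝ) ^ k ≤ C := fun k => by
    let e : BoundedContinuousFunction ℕ ℂ :=
      BoundedContinuousFunction.ofNormedAddCommGroupDiscrete (fun j => if j = k then 1 else 0) 1
        (fun j => by split_ifs <;> simp)
    have he : ‖e‖ ≤ 1 := (BoundedContinuousFunction.norm_le zero_le_one).2
      (fun j => by change ‖if j = k then (1 : ℂ) else 0‖ ≤ 1; split_ifs <;> simp)
    have h3 : L k e = (s k : ℂ) * ((4⁻¹ : ℂ) ^ k * G k (z k)) := by
      change (s k : ℂ) * ∑' j, (4⁻¹ : ℂ) ^ j * ((if j = k then 1 else 0) * G j (z k)) = _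
      rw [tsum_eq_single k (fun j hj => by simp [hj])]
      simp
    have h4 : ‖L k e‖ ≤ C := ((L k).le_opNorm e).trans
      ((mul_le_of_le_one_right (norm_nonneg _) he).trans (hC k))
    rw [h3, mul_left_comm, norm_mul, norm_pow, norm_inv, RCLike.norm_ofNat] at h4
    have h5 : (4⁻¹ : ℝ) ^ k * 8 ^ k = 2 ^ k := by rw [← mul_pow]; norm_num
    calc (2 : ℝ) ^ k = (4⁻¹ : ℝ) ^ k * 8 ^ k := h5.symm
      _ ≤ _ := by gcongr; exact hs k
      _ ≤ C := h4
  obtain ⟨k, hk⟩ := pow_unbounded_of_one_lt C (one_lt_two (α := ℝ))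
  linarith [h2 k]

lemma enorm_sq_mul_wexp_const_mul (c : ℂ) (F : Cn n → ℂ) (w : ℝ≥0∞) (z : Cn n) :
    ‖c * F z‖ₑ ^ 2 * w = ‖c‖ₑ ^ 2 * (‖F z‖ₑ ^ 2 * w) := by
  rw [enorm_mul]; ring

lemma leO_of_forall_holo (hn : 0 < n) {U : Set (Cn n)} (hU : IsOpen U) (h0 : (0 : Cn n) ∈ U)
    {φ : Cn n → EReal} (hφ : SubOn φ U) {m : ℝ} (hm : 0 < m) {g : Cn n → EReal}
    (H : ∀ F : Cn n → ℂ, HoloNear F → (IntNear fun z => ‖F z‖ₑ ^ 2 * wexp (-(2 * m)) φ z) →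
      leO (logAbs F) g) : leO (fun z => (m : EReal) * φ z) g := by
  obtain ⟨A, hA, -⟩ := EReal.lt_iff_exists_real_btwn.1 (hφ.lt_top 0 h0)
  obtain ⟨R₀, hR₀, hR₀U⟩ := Metric.mem_nhds_iff.1
    (Filter.inter_mem (hU.mem_nhds h0) (hφ.usc 0 h0 A hA))
  obtain ⟨R, hR, hRR₀, hpeak⟩ := exists_holo_peak hn Metric.isOpen_ball
    (Metric.mem_ball_self hR₀) (hφ.mono fun z hz => (hR₀U hz).1)
  obtain ⟨C, hC, hpeak⟩ := hpeak (2 * m) (by positivity)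
  obtain ⟨B, hB, hBd⟩ := exists_bound_of_sq_integral (n := n) (show R / 2 < R by linarith)
  have hφR : SubOn φ (Metric.ball 0 R) := hφ.mono fun z hz => (hR₀U (hRR₀ hz)).1
  by_contra hcon
  have hfreq : ∀ k : ℕ, ∃ z ∈ Metric.ball (0 : Cn n) (min (R / 4) (1 / (k + 1))),
      g z + ((Real.log (2 * 8 ^ k) : ℝ) : EReal) < (m : EReal) * φ z := fun k => by
    by_contra! hk
    exact hcon ⟨Real.log (2 * 8 ^ k), by
      filter_upwards [Metric.ball_mem_nhds 0 (show 0 < min (R / 4) (1 / ((k : ℝ) + 1)) by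
        positivity)] with z hz using hk z hz⟩
  choose z hzb hz using hfreq
  have hzR4 : ∀ k, z k ∈ Metric.ball (0 : Cn n) (R / 4) := fun k =>
    Metric.ball_subset_ball (min_le_left _ _) (hzb k)
  have hzR : ∀ k, z k ∈ Metric.ball (0 : Cn n) R := fun k =>
    Metric.ball_subset_ball (by linarith) (hzR4 k)
  have hzlim : Tendsto z atTop (𝓝 0) := by
    rw [tendsto_iff_norm_sub_tendsto_zero]
    refine squeeze_zero (fun k => norm_nonneg _) (fun k => ?_)
      tendsto_one_div_add_atTop_nhds_zero_nat
    have := Metric.ball_subset_ball (min_le_right _ _) (hzb k)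
    simpa using (mem_ball_zero_iff.1 this).le
  have hbot : ∀ k, φ (z k) ≠ ⊥ := fun k h => by
    have := hz k
    rw [h, EReal.coe_mul_bot_of_pos hm] at this
    exact not_lt_bot this
  have hx : ∀ k, ∃ x : ℝ, φ (z k) = x := fun k =>
    ⟨_, (EReal.coe_toReal (hφR.lt_top _ (hzR k)).ne (hbot k)).symm⟩
  choose x hx using hx
  choose F hFd hF0 hFI using fun k => hpeak (z k) (hzR k) (hbot k)
  set t : ℕ → ℝ := fun k => Real.exp (m * x k) with ht
  set G : ℕ → Cn n → ℂ := fun k y => (t k : ℂ) * F k y with hG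
  have htpos : ∀ k, 0 < t k := fun k => Real.exp_pos _
  have hGd : ∀ k, DifferentiableOn ℂ (G k) (Metric.ball 0 R) := fun k => (hFd k).const_mul _
  have hGI : ∀ k, ∫⁻ y in Metric.ball 0 R, ‖G k y‖ₑ ^ 2 * wexp (-(2 * m)) φ y ≤
      ENNReal.ofReal C := fun k => by
    simp only [hG, enorm_sq_mul_wexp_const_mul]
    rw [lintegral_const_mul' _ _ (by simp)]
    refine (mul_le_mul_right (hFI k) _).trans (le_of_eq ?_)
    rw [wexp_coe _ (hx k), ← ofReal_norm, Complex.norm_real, Real.norm_of_nonneg (htpos k).le,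
      ← ENNReal.ofReal_pow (htpos k).le, ← ENNReal.ofReal_mul hC,
      ← ENNReal.ofReal_mul (by positivity)]
    congr 1
    rw [mul_left_comm, ht, ← Real.exp_nat_mul, ← Real.exp_add]
    convert mul_one C
    rw [Real.exp_eq_one_iff]; push_cast; ring
  have hL2 : ∀ k, ∫⁻ y in Metric.ball (0 : Cn n) R, ‖G k y‖ₑ ^ 2 ≤
      ENNReal.ofReal (Real.exp (2 * m * A)) * ENNReal.ofReal C := fun k => by
    refine le_trans ?_ (mul_le_mul_right (hGI k) _)
    rw [← lintegral_const_mul' _ _ ENNReal.ofReal_ne_top]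
    refine setLIntegral_mono' Metric.isOpen_ball.measurableSet fun y hy => ?_
    have h1 : (1 : ℝ≥0∞) ≤ ENNReal.ofReal (Real.exp (2 * m * A)) * wexp (-(2 * m)) φ y := by
      calc (1 : ℝ≥0∞) = ENNReal.ofReal (Real.exp (2 * m * A)) *
            EReal.exp (A : EReal) ^ (-(2 * m)) := by
            rw [EReal.exp_coe, ENNReal.ofReal_rpow_of_pos (Real.exp_pos _), ← Real.exp_mul,
              ← ENNReal.ofReal_mul (Real.exp_pos _).le, ← Real.exp_add]
            simp [mul_comm A]
        _ ≤ _ := by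
            rw [wexp_eq]
            exact mul_le_mul_right (exp_rpow_neg_anti (by positivity) (hR₀U (hRR₀ hy)).2.le) _
    calc ‖G k y‖ₑ ^ 2 = 1 * ‖G k y‖ₑ ^ 2 := (one_mul _).symm
      _ ≤ _ := mul_le_mul_left h1 _
      _ = _ := by ring
  set M : ℝ≥0∞ := ENNReal.ofReal B *
    (ENNReal.ofReal (Real.exp (2 * m * A)) * ENNReal.ofReal C) with hM
  have hMtop : M ≠ ⊤ := ENNReal.mul_ne_top ENNReal.ofReal_ne_top
    (ENNReal.mul_ne_top ENNReal.ofReal_ne_top ENNReal.ofReal_ne_top)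
  have hbound : ∀ k, ∀ y ∈ Metric.ball (0 : Cn n) (R / 2), ‖G k y‖ ≤ √M.toReal := fun k y hy => by
    have h1 := (hBd (G k) (hGd k) y hy).trans (mul_le_mul_right (hL2 k) _)
    refine Real.le_sqrt_of_sq_le ?_
    rw [← ofReal_norm, ← ENNReal.ofReal_pow (norm_nonneg _)] at h1
    exact (ENNReal.ofReal_le_iff_le_toReal hMtop).1 h1
  set s : ℕ → ℝ := fun k => 2 * 8 ^ k / t k with hs
  have hspos : ∀ k, 0 < s k := fun k => div_pos (by positivity) (htpos k)
  obtain ⟨a, ⟨A', hA'⟩, hunb⟩ := exists_holo_unbounded hbound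
    (fun k => Metric.ball_subset_ball (by linarith) (hzR4 k)) (s := s) fun k => by
      rw [norm_mul, Complex.norm_real, Real.norm_of_nonneg (hspos k).le, hG, norm_mul,
        Complex.norm_real, Real.norm_of_nonneg (htpos k).le, ← mul_assoc, hs,
        div_mul_cancel₀ _ (htpos k).ne']
      nlinarith [hF0 k, pow_pos (show (0 : ℝ) < 8 by norm_num) k]
  set Fa : Cn n → ℂ := fun y => ∑' j, (4⁻¹ : ℂ) ^ j * (a j * G j y) with hFa
  obtain ⟨C', hC'⟩ := H Fa ⟨_, Metric.ball_mem_nhds 0 (by positivity), Metric.isOpen_ball,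
    differentiableOn_series (r' := R / 4) hGd hbound (by linarith) (by linarith) hA'⟩
    (IntNear.of_ball hR (lintegral_series_lt_top hGd
      (hφR.toUscOn.aemeasurable_wexp Metric.isOpen_ball _) ENNReal.ofReal_ne_top hGI hA'))
  have hev : ∀ᶠ k in atTop, ‖(s k : ℂ) * Fa (z k)‖ ≤ Real.exp C' := by
    filter_upwards [hzlim.eventually hC'] with k hk
    have h1 := hz k
    rw [hx k, ← EReal.coe_mul] at h1
    rcases eq_or_ne (Fa (z k)) 0 with h2 | h2
    · rw [h2]; simp [(Real.exp_pos C').le]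
    rw [logAbs, elog, if_neg (by simpa using h2)] at hk
    have hg1 : g (z k) ≠ ⊤ := fun h => by simp [h] at h1
    have hg2 : g (z k) ≠ ⊥ := fun h => by
      rw [h, EReal.bot_add] at hk; simp at hk
    lift g (z k) to ℝ using ⟨hg1, hg2⟩ with y
    rw [← EReal.coe_add, EReal.coe_lt_coe_iff, Real.log_mul (by norm_num) (by positivity)] at h1
    rw [← EReal.coe_add, EReal.coe_le_coe_iff] at hk
    rw [norm_mul, Complex.norm_real, Real.norm_of_nonneg (hspos k).le,
      ← Real.exp_log (hspos k), ← Real.exp_log (norm_pos_iff.2 h2), ← Real.exp_add,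
      Real.exp_le_exp, hs, Real.log_div (by positivity) (htpos k).ne', ht, Real.log_exp,
      Real.log_mul (by norm_num) (by positivity)]
    linarith
  obtain ⟨B', hB'⟩ := (Filter.isBoundedUnder_of_eventually_le hev).bddAbove_range
  obtain ⟨k, hk⟩ := hunb B'
  exact absurd (hB' ⟨k, rfl⟩) (not_le.2 hk)

/-! ### Comparison up to an arbitrarily small loss -/

lemma leO.trans {u v w : Cn n → EReal} (h₁ : leO u v) (h₂ : leO v w) : leO u w := by
  obtain ⟨C₁, h₁⟩ := h₁
  obtain ⟨C₂, h₂⟩ := h₂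
  refine ⟨C₂ + C₁, ?_⟩
  filter_upwards [h₁, h₂] with z hz₁ hz₂
  rw [EReal.coe_add, ← add_assoc]
  exact hz₁.trans (add_le_add_left hz₂ _)

lemma UscOn.exists_lt {u : Cn n → EReal} {Ω : Set (Cn n)} (h : UscOn u Ω) {z : Cn n}
    (hz : z ∈ Ω) : ∃ A : ℝ, 0 ≤ A ∧ ∀ᶠ y in 𝓝 z, u y < A := by
  obtain ⟨A, hA, -⟩ := EReal.lt_iff_exists_real_btwn.1 (h.lt_top z hz)
  exact ⟨max A 0, le_max_right _ _, h.usc z hz _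
    (hA.trans_le (EReal.coe_le_coe_iff.2 (le_max_left _ _)))⟩

lemma leO_mul_of_le {Φ : Cn n → EReal} {Ω : Set (Cn n)} (h : UscOn Φ Ω) (h0 : (0 : Cn n) ∈ Ω)
    {a b : ℝ} (ha : 0 ≤ a) (hab : a ≤ b) :
    leO (fun z => (b : EReal) * Φ z) fun z => (a : EReal) * Φ z := by
  obtain ⟨A, hA, hev⟩ := h.exists_lt h0
  refine ⟨(b - a) * A, ?_⟩
  filter_upwards [hev] with z hz
  rcases hab.eq_or_lt with rfl | hlt
  · simp
  have hb : 0 < b := ha.trans_lt hlt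
  rcases eq_or_ne (Φ z) ⊥ with h1 | h1
  · rw [h1, EReal.coe_mul_bot_of_pos hb]; exact bot_le
  lift Φ z to ℝ using ⟨(hz.trans (EReal.coe_lt_top _)).ne, h1⟩ with x
  norm_cast at hz ⊢
  nlinarith

lemma leO_logAbs_sub {F G : Cn n → ℂ} {g : Cn n → EReal} (hF : leO (logAbs F) g)
    (hG : leO (logAbs G) g) : leO (logAbs fun z => F z - G z) g := by
  obtain ⟨C₁, hF⟩ := hF
  obtain ⟨C₂, hG⟩ := hG
  refine ⟨max C₁ C₂ + Real.log 2, ?_⟩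
  filter_upwards [hF, hG] with z h1 h2
  simp only [logAbs] at *
  induction h : g z with
  | bot =>
    rw [h, EReal.bot_add, le_bot_iff] at h1 h2
    have h3 : F z = 0 := by
      by_contra h0; simp [elog, h0] at h1
    have h4 : G z = 0 := by
      by_contra h0; simp [elog, h0] at h2
    simp [h3, h4, elog]
  | top => rw [EReal.top_add_coe]; exact le_top
  | coe y =>
    rw [h, ← EReal.coe_add, elog_le_coe_iff] at h1 h2
    rw [← EReal.coe_add, elog_le_coe_iff]
    calc ‖F z - G z‖ ≤ ‖F z‖ + ‖G z‖ := norm_sub_le _ _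
      _ ≤ Real.exp (y + max C₁ C₂) + Real.exp (y + max C₁ C₂) :=
        add_le_add (h1.trans (Real.exp_le_exp.2 (by linarith [le_max_left C₁ C₂])))
          (h2.trans (Real.exp_le_exp.2 (by linarith [le_max_right C₁ C₂])))
      _ = _ := by
        rw [← add_assoc, Real.exp_add _ (Real.log 2), Real.exp_log two_pos]; ring

lemma HoloNear.add {F G : Cn n → ℂ} (hF : HoloNear F) (hG : HoloNear G) :
    HoloNear fun z => F z + G z := by
  obtain ⟨U, hU, hUo, hF⟩ := hF
  obtain ⟨V, hV, hVo, hG⟩ := hG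
  exact ⟨U ∩ V, Filter.inter_mem hU hV, hUo.inter hVo,
    (hF.mono Set.inter_subset_left).add (hG.mono Set.inter_subset_right)⟩

lemma IntNear.add_holo {F G : Cn n → ℂ} (hF : HoloNear F) {w : Cn n → ℝ≥0∞} {R : ℝ}
    (hR : 0 < R) (hw : AEMeasurable w (volume.restrict (Metric.ball 0 R)))
    (hFI : IntNear fun z => ‖F z‖ₑ ^ 2 * w z) (hGI : IntNear fun z => ‖G z‖ₑ ^ 2 * w z) :
    IntNear fun z => ‖F z + G z‖ₑ ^ 2 * w z := by
  obtain ⟨U, hU, hUo, hF⟩ := hF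
  obtain ⟨r, hr, hrU⟩ := Metric.mem_nhds_iff.1 hU
  obtain ⟨r₁, hr₁, hFI⟩ := hFI.exists_ball
  obtain ⟨r₂, hr₂, hGI⟩ := hGI.exists_ball
  obtain ⟨ρ, hρ, e1, e2, e3, e4⟩ : ∃ ρ > 0, ρ ≤ R ∧ ρ ≤ r ∧ ρ ≤ r₁ ∧ ρ ≤ r₂ :=
    ⟨min (min R r) (min r₁ r₂), by positivity, by simp, by simp, by simp, by simp⟩
  refine IntNear.of_ball hρ ?_
  have h1 : ∀ z, ‖F z + G z‖ₑ ^ 2 * w z ≤ 4 * (‖F z‖ₑ ^ 2 * w z) + 4 * (‖G z‖ₑ ^ 2 * w z) :=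
    fun z => by
    rw [← mul_add, ← add_mul, ← mul_assoc]
    refine mul_le_mul_left ?_ _
    calc ‖F z + G z‖ₑ ^ 2 ≤ (2 * max ‖F z‖ₑ ‖G z‖ₑ) ^ 2 := by
          gcongr
          refine (enorm_add_le _ _).trans ?_
          rw [two_mul]
          exact add_le_add (le_max_left _ _) (le_max_right _ _)
      _ = 4 * max ‖F z‖ₑ ‖G z‖ₑ ^ 2 := by rw [mul_pow]; norm_num
      _ ≤ _ := by
          gcongr
          rcases max_cases ‖F z‖ₑ ‖G z‖ₑ with ⟨h, _⟩ | ⟨h, _⟩ <;> rw [h]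
          exacts [le_self_add, le_add_self]
  refine (lintegral_mono h1).trans_lt ?_
  rw [lintegral_add_left', lintegral_const_mul' _ _ (by norm_num),
    lintegral_const_mul' _ _ (by norm_num)]
  · exact ENNReal.add_lt_top.2 ⟨ENNReal.mul_lt_top (by norm_num)
      ((lintegral_mono_set (Metric.ball_subset_ball e3)).trans_lt hFI),
      ENNReal.mul_lt_top (by norm_num)
      ((lintegral_mono_set (Metric.ball_subset_ball e4)).trans_lt hGI)⟩
  · refine (AEMeasurable.mul ?_ ?_).const_mul _
    · exact ((hF.continuousOn.mono ((Metric.ball_subset_ball e2).trans hrU)).aemeasurable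
        Metric.isOpen_ball.measurableSet).enorm.pow_const 2
    · exact hw.mono_measure (Measure.restrict_mono (Metric.ball_subset_ball e1) le_rfl)

/-- The set whose supremum is the Zhou number. -/
def typeSet (ψ Φ : Cn n → EReal) : Set ℝ := {b : ℝ | 0 ≤ b ∧ leO ψ fun z => (b : EReal) * Φ z}

lemma ZhouBall.leO_of_not_bddAbove {W : Cn n → ℝ≥0∞} {Φ ψ : Cn n → EReal} {R : ℝ}
    (h : ZhouBall W Φ R) (hψ : ¬ BddAbove (typeSet ψ Φ)) {a : ℝ} (ha : 0 ≤ a) :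
    leO ψ fun z => (a : EReal) * Φ z := by
  rw [not_bddAbove_iff] at hψ
  obtain ⟨b, hb, hab⟩ := hψ a
  exact hb.2.trans (leO_mul_of_le h.sub.toUscOn (Metric.mem_ball_self h.pos) ha hab.le)

lemma ZhouBall.exists_bddAbove (hn : 0 < n) {W : Cn n → ℝ≥0∞} {Φ : Cn n → EReal} {R : ℝ}
    (h : ZhouBall W Φ R) {m : ℝ} (hm : 0 < m) : ∃ G : Cn n → ℂ, HoloNear G ∧
      (IntNear fun z => ‖G z‖ₑ ^ 2 * wexp (-(2 * m)) Φ z) ∧ BddAbove (typeSet (logAbs G) Φ) := by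
  by_contra! hcon
  obtain ⟨C, hC⟩ := leO_of_forall_holo hn Metric.isOpen_ball (Metric.mem_ball_self h.pos) h.sub hm
    (g := fun z => ((m + 1 : ℝ) : EReal) * Φ z)
    fun F hF hI => h.leO_of_not_bddAbove (hcon F hF hI) (by linarith)
  obtain ⟨r, hr, hrs⟩ := Metric.mem_nhds_iff.1
    (Filter.inter_mem (Metric.ball_mem_nhds 0 h.pos) hC)
  obtain ⟨B, hB, hWB⟩ := h.bdd
  refine h.nonint (IntNear.of_ball hr ?_)
  have h1 : ∀ᵐ z ∂(volume.restrict (Metric.ball (0 : Cn n) r)),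
      W z * wexp (-2) Φ z ≤ B * ENNReal.ofReal (Real.exp (2 * C)) := by
    filter_upwards [ae_mono (Measure.restrict_mono (fun z hz => (hrs hz).1) le_rfl) h.ae_ne_bot,
      ae_restrict_mem Metric.isOpen_ball.measurableSet] with z h2 h3
    by_cases hW : W z = 0
    · simp [hW]
    refine mul_le_mul' (hWB z (hrs h3).1) ?_
    have h4 : (m : EReal) * Φ z ≤ ((m + 1 : ℝ) : EReal) * Φ z + (C : EReal) := (hrs h3).2
    have hx := (EReal.coe_toReal (h.sub.lt_top z (hrs h3).1).ne (h2 hW)).symm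
    rw [wexp_coe _ hx]
    rw [hx] at h4
    norm_cast at h4
    exact ENNReal.ofReal_le_ofReal (Real.exp_le_exp.2 (by linarith))
  refine (lintegral_mono_ae h1).trans_lt ?_
  rw [setLIntegral_const]
  exact ENNReal.mul_lt_top (ENNReal.mul_lt_top hB.lt_top ENNReal.ofReal_lt_top)
    measure_ball_lt_top

lemma ZhouBall.leO_mul_sub_two (hn : 0 < n) {W₁ W₂ : Cn n → ℝ≥0∞} {φ₁ φ₂ : Cn n → EReal}
    {R₁ R₂ : ℝ} (h₁ : ZhouBall W₁ φ₁ R₁) (h₂ : ZhouBall W₂ φ₂ R₂)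
    (hσ : ∀ f, HoloNear f → zhouNumber (logAbs f) φ₁ ≤ zhouNumber (logAbs f) φ₂)
    {m : ℝ} (hm : 2 < m) :
    leO (fun z => (m : EReal) * φ₁ z) fun z => ((m - 2 : ℝ) : EReal) * φ₂ z := by
  obtain ⟨G, hG, hGI, hGb⟩ := h₁.exists_bddAbove hn (show 0 < m by linarith)
  have key : ∀ F, HoloNear F → (IntNear fun z => ‖F z‖ₑ ^ 2 * wexp (-(2 * m)) φ₁ z) →
      BddAbove (typeSet (logAbs F) φ₁) →
      leO (logAbs F) fun z => ((m - 2 : ℝ) : EReal) * φ₂ z := fun F hF hI hb => by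
    have h3 : m - 1 ≤ zhouNumber (logAbs F) φ₂ :=
      (le_csSup hb ⟨by linarith, h₁.tame hF (by linarith) hI⟩).trans (hσ F hF)
    by_contra hcon
    have h4 : zhouNumber (logAbs F) φ₂ ≤ m - 2 := by
      refine Real.sSup_le (fun b hb => ?_) (by linarith)
      by_contra! hlt
      exact hcon (hb.2.trans (leO_mul_of_le h₂.sub.toUscOn (Metric.mem_ball_self h₂.pos)
        (by linarith) hlt.le))
    linarith
  refine leO_of_forall_holo hn Metric.isOpen_ball (Metric.mem_ball_self h₁.pos) h₁.sub
    (by linarith) fun F hF hI => ?_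
  by_cases hb : BddAbove (typeSet (logAbs F) φ₁)
  · exact key F hF hI hb
  have hFG := hF.add hG
  have hFGI := IntNear.add_holo hF h₁.pos
    (h₁.sub.toUscOn.aemeasurable_wexp Metric.isOpen_ball (-(2 * m))) hI hGI
  have hFGb : BddAbove (typeSet (logAbs fun z => F z + G z) φ₁) := by
    by_contra hcon
    rw [bddAbove_def] at hGb
    obtain ⟨b, hb'⟩ := hGb
    have h5 := leO_logAbs_sub (h₁.leO_of_not_bddAbove hcon (a := |b| + 1) (by positivity))
      (h₁.leO_of_not_bddAbove hb (by positivity))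
    simp only [add_sub_cancel_left] at h5
    linarith [hb' (|b| + 1) ⟨by positivity, h5⟩, le_abs_self b]
  have h6 := leO_logAbs_sub (key _ hFG hFGI hFGb) (key G hG hGI hGb)
  simpa only [add_sub_cancel_right] using h6

/-! ### Removing the loss by maximality -/

lemma wexp_le_of_le_add {u Φ : Cn n → EReal} {z : Cn n} {c : ℝ} (hΦ : Φ z < ⊤)
    (h : u z ≤ Φ z + (c : EReal)) :
    wexp (-2) Φ z ≤ ENNReal.ofReal (Real.exp (2 * c)) * wexp (-2) u z := by
  have hpos : ENNReal.ofReal (Real.exp (2 * c)) ≠ 0 := by simp [Real.exp_pos]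
  rcases eq_or_ne (u z) ⊥ with hb | hb
  · rw [wexp_neg_of_bot hb two_pos, ENNReal.mul_top hpos]; exact le_top
  rcases eq_or_ne (Φ z) ⊥ with hb' | hb'
  · rw [hb', EReal.bot_add, le_bot_iff] at h; exact absurd h hb
  have hx := (EReal.coe_toReal hΦ.ne hb').symm
  have hut : u z ≠ ⊤ := by
    rw [hx, ← EReal.coe_add] at h
    exact (h.trans_lt (EReal.coe_lt_top _)).ne
  have hy := (EReal.coe_toReal hut hb).symm
  rw [wexp_coe _ hx, wexp_coe _ hy, ← ENNReal.ofReal_mul (Real.exp_pos _).le, ← Real.exp_add]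
  rw [hx, hy, ← EReal.coe_add, EReal.coe_le_coe_iff] at h
  exact ENNReal.ofReal_le_ofReal (Real.exp_le_exp.2 (by linarith))

section Competitors

variable {W : Cn n → ℝ≥0∞} {Φ φ : Cn n → EReal} {R : ℝ}

lemma ZhouBall.lintegral_eq_top (h : ZhouBall W Φ R) {r : ℝ} (hr : 0 < r) :
    ∫⁻ z in Metric.ball 0 r, W z * wexp (-2) Φ z = ⊤ := by
  by_contra hne
  exact h.nonint (IntNear.of_ball hr (lt_top_iff_ne_top.2 hne))

lemma ZhouBall.aemeasurable (h : ZhouBall W Φ R) : AEMeasurable (fun z => W z * wexp (-2) Φ z)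
    (volume.restrict (Metric.ball 0 R)) :=
  h.meas.mul (h.sub.toUscOn.aemeasurable_wexp Metric.isOpen_ball _)

lemma ZhouBall.aemeasurable_indicator (h : ZhouBall W Φ R) {v : Cn n → EReal}
    (hv : SubOn v (Metric.ball 0 R)) {r : ℝ} :
    AEMeasurable (({z | Φ z < v z} \ Metric.ball 0 r).indicator fun z => W z * wexp (-2) Φ z)
      (volume.restrict (Metric.ball 0 R)) := by
  refine h.aemeasurable.indicator₀ (NullMeasurableSet.diff ?_
    Metric.isOpen_ball.measurableSet.nullMeasurableSet)
  exact nullMeasurableSet_lt (h.sub.toUscOn.aemeasurable Metric.isOpen_ball)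
    (hv.toUscOn.aemeasurable Metric.isOpen_ball)

lemma ZhouBall.lintegral_le_of_competitor (h : ZhouBall W Φ R) {v : ℕ → Cn n → EReal}
    (hv : ∀ i, SubOn (v i) (Metric.ball 0 R)) {u : Cn n → EReal} (hu : SubOn u (Metric.ball 0 R))
    (huv : ∀ z, u z = max (Φ z) (⨆ i, v i z)) {ρ : ℕ → ℝ} {T : Set (Cn n)} (hT : MeasurableSet T)
    (hTR : T ⊆ Metric.ball 0 R) {c : ℝ} (hc : 0 ≤ c)
    (hTc : ∀ z ∈ T, ∀ i, z ∈ Metric.ball (0 : Cn n) (ρ i) → v i z ≤ Φ z + (c : EReal)) :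
    ∫⁻ z in T, W z * wexp (-2) Φ z ≤
      ENNReal.ofReal (Real.exp (2 * c)) * (∫⁻ z in T, W z * wexp (-2) u z) +
      ∑' i, ∫⁻ z in Metric.ball 0 R, ({z | Φ z < v i z} \ Metric.ball 0 (ρ i)).indicator
        (fun z => W z * wexp (-2) Φ z) z := by
  set X : ℕ → Set (Cn n) := fun i => {z | Φ z < v i z} \ Metric.ball 0 (ρ i)
  have hmono : volume.restrict T ≤ volume.restrict (Metric.ball (0 : Cn n) R) :=
    Measure.restrict_mono hTR le_rfl
  calc _ ≤ ∫⁻ z in T, (ENNReal.ofReal (Real.exp (2 * c)) * (W z * wexp (-2) u z) +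
        ∑' i, (X i).indicator (fun z => W z * wexp (-2) Φ z) z) := by
        refine setLIntegral_mono' hT fun z hz => ?_
        by_cases hX : ∃ i, z ∈ X i
        · obtain ⟨i, hi⟩ := hX
          exact le_trans (le_of_eq (Set.indicator_of_mem hi
            (fun z => W z * wexp (-2) Φ z)).symm) ((ENNReal.le_tsum i).trans le_add_self)
        · push Not at hX
          refine le_trans ?_ le_self_add
          rw [mul_left_comm]
          refine mul_le_mul_right (wexp_le_of_le_add (h.sub.lt_top z (hTR hz)) ?_) _
          have hΦc : Φ z ≤ Φ z + (c : EReal) := by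
            simpa using add_le_add_right (EReal.coe_le_coe_iff.2 hc) (Φ z)
          rw [huv]
          refine max_le hΦc (iSup_le fun i => ?_)
          by_cases hzi : z ∈ Metric.ball (0 : Cn n) (ρ i)
          · exact hTc z hz i hzi
          · refine le_trans ?_ hΦc
            by_contra! hlt
            exact hX i ⟨hlt, hzi⟩
    _ = ENNReal.ofReal (Real.exp (2 * c)) * (∫⁻ z in T, W z * wexp (-2) u z) +
        ∑' i, ∫⁻ z in T, (X i).indicator (fun z => W z * wexp (-2) Φ z) z := by
        rw [lintegral_add_left', lintegral_const_mul' _ _ ENNReal.ofReal_ne_top, lintegral_tsum]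
        · exact fun i => (h.aemeasurable_indicator (hv i)).mono_measure hmono
        · exact ((h.meas.mul (hu.toUscOn.aemeasurable_wexp Metric.isOpen_ball _)).mono_measure
            hmono).const_mul _
    _ ≤ _ := by
        gcongr with i

lemma ZhouBall.exists_small_excess (h : ZhouBall W Φ R) (hφ : SubOn φ (Metric.ball 0 R))
    (hneg : ∀ z ∈ Metric.ball 0 R, φ z ≤ 0) {a r : ℝ} (ha : 0 < a) (hr : 0 < r) {η : ℝ≥0∞}
    (hη : η ≠ 0) : ∃ K₀ : ℝ, ∀ K, K₀ ≤ K → ∫⁻ z in Metric.ball 0 R,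
      ({z | Φ z < (a : EReal) * φ z + ((-K : ℝ) : EReal)} \ Metric.ball 0 r).indicator
        (fun z => W z * wexp (-2) Φ z) z ≤ η := by
  set g : Cn n → ℝ≥0∞ := fun z => W z * wexp (-2) Φ z
  set X : ℝ → Set (Cn n) := fun K =>
    {z | Φ z < (a : EReal) * φ z + ((-K : ℝ) : EReal)} \ Metric.ball 0 r
  have hsub : ∀ K, SubOn (fun z => (a : EReal) * φ z + ((-K : ℝ) : EReal)) (Metric.ball 0 R) :=
    fun K => hφ.affine Metric.isOpen_ball ha (-K)
  have hle : ∀ K, ∀ z ∈ Metric.ball (0 : Cn n) R,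
      (a : EReal) * φ z + ((-K : ℝ) : EReal) ≤ ((-K : ℝ) : EReal) := fun K z hz => by
    have : (a : EReal) * φ z ≤ 0 := by
      have := mul_le_mul_of_nonneg_left (hneg z hz) (EReal.coe_nonneg.2 ha.le)
      simpa using this
    simpa using add_le_add_left this ((-K : ℝ) : EReal)
  have ht : Tendsto (fun k : ℕ => ∫⁻ z in Metric.ball 0 R, (X k).indicator g z) atTop
      (𝓝 (∫⁻ _ in Metric.ball (0 : Cn n) R, 0)) := by
    refine tendsto_lintegral_of_dominated_convergence' ((Metric.ball 0 r)ᶜ.indicator g)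
      (fun k => h.aemeasurable_indicator (hsub k)) (fun k => Eventually.of_forall fun z => ?_) ?_ ?_
    · exact Set.indicator_le_indicator_of_subset (fun z hz => hz.2) (fun z => zero_le) z
    · rw [lintegral_indicator Metric.isOpen_ball.measurableSet.compl,
        Measure.restrict_restrict Metric.isOpen_ball.measurableSet.compl, Set.inter_comm,
        ← Set.sdiff_eq]
      exact (h.fin r hr).ne
    · filter_upwards [h.ae_ne_bot, ae_restrict_mem Metric.isOpen_ball.measurableSet] with z h1 h2
      by_cases hW : W z = 0
      · have : ∀ k : ℕ, (X k).indicator g z = 0 := fun k =>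
          Set.indicator_apply_eq_zero.2 fun _ => by simp [g, hW]
        simp [this]
      · obtain ⟨k₀, hk₀⟩ := exists_nat_gt (-(Φ z).toReal)
        refine tendsto_const_nhds.congr' ?_
        filter_upwards [eventually_ge_atTop k₀] with k hk
        refine (Set.indicator_of_notMem (fun hz => ?_) _).symm
        have h3 := hz.1.trans_le (hle k z h2)
        rw [← EReal.coe_toReal (h.sub.lt_top z h2).ne (h1 hW), EReal.coe_lt_coe_iff] at h3
        have : (k₀ : ℝ) ≤ k := Nat.cast_le.2 hk
        linarith
  rw [lintegral_zero] at ht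
  obtain ⟨k, hk⟩ := (ht.eventually_lt_const (pos_iff_ne_zero.2 hη)).exists
  refine ⟨k, fun K hK => le_trans (lintegral_mono fun z => ?_) hk.le⟩
  have hXK : X K ⊆ X k := fun y hy =>
    ⟨lt_of_lt_of_le hy.1 (add_le_add_right (EReal.coe_le_coe_iff.2 (by linarith)) _), hy.2⟩
  exact Set.indicator_le_indicator_of_subset hXK (fun z => zero_le) z

lemma ZhouBall.leO_of_competitor (h : ZhouBall W Φ R) (hφ : SubOn φ (Metric.ball 0 R))
    (hneg : ∀ z ∈ Metric.ball 0 R, φ z ≤ 0) {a K ρ c : ℕ → ℝ} (ha : ∀ i, 0 < a i)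
    (hK : ∀ i : ℕ, (i : ℝ) ≤ K i)
    (hex : ∀ i, ∫⁻ z in Metric.ball 0 R,
      ({z | Φ z < (a i : EReal) * φ z + ((-K i : ℝ) : EReal)} \ Metric.ball 0 (ρ i)).indicator
        (fun z => W z * wexp (-2) Φ z) z ≤ 2⁻¹ ^ i)
    {T : ℕ → Set (Cn n)} (hT : ∀ j, MeasurableSet (T j)) (hTR : ∀ j, T j ⊆ Metric.ball 0 R)
    (hTs : ∀ r > 0, ∀ᶠ j in atTop, T j ⊆ Metric.ball 0 r) (hc : ∀ j, 0 ≤ c j)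
    (hTc : ∀ j, ∀ z ∈ T j, ∀ i, z ∈ Metric.ball (0 : Cn n) (ρ i) →
      (a i : EReal) * φ z + ((-K i : ℝ) : EReal) ≤ Φ z + (c j : EReal))
    (hTm : ∀ j : ℕ, ENNReal.ofReal (Real.exp (2 * c j)) * j + 2 <
      ∫⁻ z in T j, W z * wexp (-2) Φ z) :
    ∃ r > 0, ∃ C : ℝ, ∀ i, ∀ z ∈ Metric.ball (0 : Cn n) r,
      (a i : EReal) * φ z + ((-K i : ℝ) : EReal) ≤ Φ z + (C : EReal) := by
  set v : ℕ → Cn n → EReal := fun i z => (a i : EReal) * φ z + ((-K i : ℝ) : EReal) with hvdef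
  have hv : ∀ i, SubOn (v i) (Metric.ball 0 R) :=
    fun i => hφ.affine Metric.isOpen_ball (ha i) (-K i)
  set u : Cn n → EReal := fun z => max (Φ z) (⨆ i, v i z) with hudef
  have hu : SubOn u (Metric.ball 0 R) := by
    refine h.sub.max Metric.isOpen_ball (SubOn.iSup Metric.isOpen_ball hv fun x => ?_)
    obtain ⟨N, hN⟩ := exists_nat_ge (-x)
    refine ⟨N, fun i hi z hz => ?_⟩
    have h1 : (a i : EReal) * φ z ≤ 0 := by
      have := mul_le_mul_of_nonneg_left (hneg z hz) (EReal.coe_nonneg.2 (ha i).le)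
      simpa using this
    have h2 : v i z ≤ ((-K i : ℝ) : EReal) := by
      simpa [hvdef] using add_le_add_left h1 ((-K i : ℝ) : EReal)
    refine h2.trans (EReal.coe_le_coe_iff.2 ?_)
    linarith [hK i, Nat.cast_le (α := ℝ) |>.2 hi]
  have hnon : ¬ IntNear fun z => W z * wexp (-2) u z := fun hI => by
    obtain ⟨r, hr, hI⟩ := hI.exists_ball
    obtain ⟨k, hk⟩ := ENNReal.exists_nat_gt hI.ne
    obtain ⟨j, hjT, hkj⟩ := ((hTs r hr).and (eventually_ge_atTop k)).exists
    refine absurd (hTm j) (not_lt.2 ((h.lintegral_le_of_competitor hv hu (fun z => rfl) (hT j)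
      (hTR j) (hc j) (hTc j)).trans (add_le_add ?_ ?_)))
    · refine mul_le_mul_right ((lintegral_mono_set hjT).trans (hk.le.trans ?_)) _
      exact_mod_cast hkj
    · refine (ENNReal.tsum_le_tsum hex).trans (le_of_eq ?_)
      rw [ENNReal.tsum_geometric, ENNReal.one_sub_inv_two, inv_inv]
  obtain ⟨C, hC⟩ := h.maximal R h.pos u hu (fun z _ => le_max_left _ _) hnon
  obtain ⟨r, hr, hrs⟩ := Metric.mem_nhds_iff.1 hC
  exact ⟨r, hr, C, fun i z hz => ((le_iSup (fun i => v i z) i).trans (le_max_right _ _)).trans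
    (hrs hz)⟩

end Competitors

section AlmostComparison

variable {W : Cn n → ℝ≥0∞} {Φ φ : Cn n → EReal} {R : ℝ}

lemma coe_mul_le_coe_mul_of_nonpos {a b : ℝ} (hab : a ≤ b) {x : EReal} (hx : x ≤ 0) :
    (b : EReal) * x ≤ (a : EReal) * x := by
  have h : (-x) * (a : EReal) ≤ (-x) * (b : EReal) :=
    mul_le_mul_of_nonneg_left (EReal.coe_le_coe_iff.2 hab) (EReal.neg_nonneg.2 hx)
  rw [EReal.neg_mul, EReal.neg_mul, EReal.neg_le_neg_iff] at h
  rwa [mul_comm, mul_comm (a : EReal)]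

lemma ZhouBall.exists_uniform_ball (h : ZhouBall W Φ R) (hφ : SubOn φ (Metric.ball 0 R))
    (hneg : ∀ z ∈ Metric.ball 0 R, φ z ≤ 0)
    (hδ : ∀ δ : ℝ, 0 < δ → leO (fun z => ((1 + δ : ℝ) : EReal) * φ z) Φ) :
    ∃ r > 0, ∀ δ : ℝ, 0 < δ → ∃ C : ℝ, ∀ z ∈ Metric.ball (0 : Cn n) r,
      ((1 + δ : ℝ) : EReal) * φ z ≤ Φ z + (C : EReal) := by
  have hpos : ∀ i : ℕ, (0 : ℝ) < 1 / ((i : ℝ) + 1) := fun i => Nat.one_div_pos_of_nat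
  have hloc : ∀ i : ℕ, ∃ ρ > 0, ∃ C : ℝ, ∀ z ∈ Metric.ball (0 : Cn n) ρ,
      ((1 + 1 / ((i : ℝ) + 1) : ℝ) : EReal) * φ z ≤ Φ z + (C : EReal) := fun i => by
    obtain ⟨C, hC⟩ := hδ _ (hpos i)
    obtain ⟨ρ, hρ, hs⟩ := Metric.mem_nhds_iff.1 hC
    exact ⟨ρ, hρ, C, fun z hz => hs hz⟩
  choose ρ hρ C hC using hloc
  have hsm : ∀ i : ℕ, _ := fun i => h.exists_small_excess hφ hneg
    (a := 1 + 1 / ((i : ℝ) + 1)) (by linarith [hpos i]) (hρ i) (η := 2⁻¹ ^ i) (by simp)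
  choose K₀ hK₀ using hsm
  obtain ⟨r, hr, D, hD⟩ := h.leO_of_competitor hφ hneg
    (a := fun i => 1 + 1 / ((i : ℝ) + 1)) (K := fun i => max (max i (C i)) (K₀ i)) (ρ := ρ)
    (c := fun _ => 0) (T := fun j => Metric.ball 0 (min R (1 / ((j : ℝ) + 1))))
    (fun i => by linarith [hpos i]) (fun i => (le_max_left _ _).trans (le_max_left _ _))
    (fun i => hK₀ i _ (le_max_right _ _)) (fun j => Metric.isOpen_ball.measurableSet)
    (fun j => Metric.ball_subset_ball (min_le_left _ _)) (fun r hr => by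
      filter_upwards [tendsto_one_div_add_atTop_nhds_zero_nat.eventually_le_const hr] with j hj
      exact Metric.ball_subset_ball ((min_le_right _ _).trans hj)) (fun _ => le_rfl)
    (fun j z _ i hz => by
      have h1 := add_le_add_left (hC i z hz) ((-(max (max (i : ℝ) (C i)) (K₀ i)) : ℝ) : EReal)
      refine h1.trans ?_
      rw [add_assoc, ← EReal.coe_add]
      refine add_le_add_right (EReal.coe_le_coe_iff.2 ?_) _
      linarith [(le_max_right (i : ℝ) (C i)).trans (le_max_left _ (K₀ i))])
    (fun j => by
      rw [h.lintegral_eq_top (lt_min h.pos (hpos j))]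
      exact ENNReal.add_lt_top.2 ⟨ENNReal.mul_lt_top ENNReal.ofReal_lt_top
        (ENNReal.natCast_lt_top j), ENNReal.ofNat_lt_top⟩)
  refine ⟨min r R, lt_min hr h.pos, fun δ hδ0 => ?_⟩
  obtain ⟨i, hi⟩ := exists_nat_one_div_lt hδ0
  refine ⟨D + max (max (i : ℝ) (C i)) (K₀ i), fun z hz => ?_⟩
  have h1 := hD i z (Metric.ball_subset_ball (min_le_left _ _) hz)
  have h2 := hneg z (Metric.ball_subset_ball (min_le_right _ _) hz)
  refine (coe_mul_le_coe_mul_of_nonpos (by linarith : 1 + 1 / ((i : ℝ) + 1) ≤ 1 + δ) h2).trans ?_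
  have h3 := add_le_add_left h1 ((max (max (i : ℝ) (C i)) (K₀ i) : ℝ) : EReal)
  rwa [add_assoc, add_assoc, ← EReal.coe_add, ← EReal.coe_add, neg_add_cancel, EReal.coe_zero,
    add_zero] at h3

lemma ZhouBall.exists_annulus (hn : 0 < n) (h : ZhouBall W Φ R) {r ε : ℝ} (hr : 0 < r)
    (hε : 0 < ε) {M : ℝ≥0∞} (hM : M ≠ ⊤) : ∃ s, 0 < s ∧ s ≤ ε ∧ s ≤ r ∧
      M < ∫⁻ z in Metric.ball 0 r \ Metric.ball 0 s, W z * wexp (-2) Φ z := by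
  have : Nonempty (Fin n) := ⟨⟨0, hn⟩⟩
  set t : ℕ → ℝ := fun k => min (min ε r) (1 / ((k : ℝ) + 1))
  have ht : ∀ k, 0 < t k := fun k => lt_min (lt_min hε hr) Nat.one_div_pos_of_nat
  have hanti : Antitone t := fun k l hkl => min_le_min_left _ (Nat.one_div_le_one_div hkl)
  have hU : (⋃ k, Metric.ball (0 : Cn n) r \ Metric.ball 0 (t k)) = Metric.ball 0 r \ {0} := by
    ext z
    simp only [Set.mem_iUnion, Set.mem_sdiff, Set.mem_singleton_iff, exists_and_left]
    refine and_congr_right fun _ => ⟨?_, fun hz => ?_⟩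
    · rintro ⟨k, hk⟩ rfl
      exact hk (Metric.mem_ball_self (ht k))
    · obtain ⟨k, hk⟩ := exists_nat_one_div_lt (norm_pos_iff.2 hz)
      refine ⟨k, fun hzk => ?_⟩
      rw [mem_ball_zero_iff] at hzk
      linarith [min_le_right (min ε r) (1 / ((k : ℝ) + 1))]
  have htop : M < ∫⁻ z in ⋃ k, Metric.ball (0 : Cn n) r \ Metric.ball 0 (t k),
      W z * wexp (-2) Φ z := by
    rw [hU, setLIntegral_congr (sdiff_null_ae_eq_self (measure_singleton _)),
      h.lintegral_eq_top hr]
    exact lt_top_iff_ne_top.2 hM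
  rw [setLIntegral_iUnion_of_directed _ (Monotone.directed_le fun k l hkl =>
    Set.sdiff_subset_sdiff_right (Metric.ball_subset_ball (hanti hkl))), lt_iSup_iff] at htop
  obtain ⟨k, hk⟩ := htop
  exact ⟨t k, ht k, (min_le_left _ _).trans (min_le_left _ _),
    (min_le_left _ _).trans (min_le_right _ _), hk⟩

lemma ZhouBall.exists_radii (hn : 0 < n) (h : ZhouBall W Φ R) {M : ℕ → ℝ≥0∞}
    (hM : ∀ j, M j ≠ ⊤) : ∃ ρ : ℕ → ℝ, Antitone ρ ∧ (∀ i, 0 < ρ i) ∧ (∀ i, ρ i ≤ R) ∧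
      (∀ i : ℕ, ρ i ≤ 1 / ((i : ℝ) + 1)) ∧ ∀ j,
      M j < ∫⁻ z in Metric.ball 0 (ρ j) \ Metric.ball 0 (ρ (j + 1)), W z * wexp (-2) Φ z := by
  have hex : ∀ (j : ℕ) (r : {r : ℝ // 0 < r}), ∃ s : {s : ℝ // 0 < s},
      (s : ℝ) ≤ 1 / (((j + 1 : ℕ) : ℝ) + 1) ∧ (s : ℝ) ≤ r ∧
      M j < ∫⁻ z in Metric.ball 0 (r : ℝ) \ Metric.ball 0 (s : ℝ), W z * wexp (-2) Φ z :=
    fun j r => by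
      obtain ⟨s, h0, h1, h2, h3⟩ := h.exists_annulus hn r.2
        (Nat.one_div_pos_of_nat (n := j + 1)) (hM j)
      exact ⟨⟨s, h0⟩, h1, h2, h3⟩
  choose F hF1 hF2 hF3 using hex
  let ρ : ℕ → {r : ℝ // 0 < r} := fun i =>
    Nat.rec ⟨min R 1, lt_min h.pos one_pos⟩ (fun j r => F j r) i
  have hanti : Antitone (fun i => (ρ i).1 : ℕ → ℝ) :=
    antitone_nat_of_succ_le fun j => hF2 j (ρ j)
  refine ⟨fun i => (ρ i).1, hanti, fun i => (ρ i).2,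
    fun i => (hanti (Nat.zero_le i)).trans (min_le_left _ _), fun i => ?_, fun j => hF3 j (ρ j)⟩
  cases i with
  | zero => simp [ρ]
  | succ j => exact hF1 j (ρ j)

lemma exists_mul_gt_of_lt {x y : EReal} (hx : x ≤ 0) (h : y < x) :
    ∃ δ : ℝ, 0 < δ ∧ y < ((1 + δ : ℝ) : EReal) * x := by
  obtain ⟨t, hyt, htx⟩ := EReal.lt_iff_exists_real_btwn.1 h
  have hxt : x ≠ ⊤ := (hx.trans_lt EReal.zero_lt_top).ne
  have hxb : x ≠ ⊥ := (bot_le.trans_lt htx).ne'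
  lift x to ℝ using ⟨hxt, hxb⟩
  rw [EReal.coe_lt_coe_iff] at htx
  have hx0 : x ≤ 0 := by exact_mod_cast hx
  refine ⟨(x - t) / (1 - x), div_pos (by linarith) (by linarith), hyt.trans_le ?_⟩
  rw [← EReal.coe_mul, EReal.coe_le_coe_iff]
  have h1 : (x - t) / (1 - x) * (1 - x) = x - t := div_mul_cancel₀ _ (by linarith)
  have h2 : 0 < (x - t) / (1 - x) := div_pos (by linarith) (by linarith)
  nlinarith

lemma ZhouBall.exists_calibrated (h : ZhouBall W Φ R) (hφ : SubOn φ (Metric.ball 0 R))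
    (hneg : ∀ z ∈ Metric.ball 0 R, φ z ≤ 0)
    (hδ : ∀ δ : ℝ, 0 < δ → ∃ C : ℝ, ∀ z ∈ Metric.ball (0 : Cn n) R,
      ((1 + δ : ℝ) : EReal) * φ z ≤ Φ z + (C : EReal))
    (hnot : ¬ leO φ Φ) {r : ℝ} (hr : 0 < r) (hrR : r ≤ R) {η : ℝ≥0∞} (hη : η ≠ 0) (c : ℝ) :
    ∃ δ K : ℝ, 0 < δ ∧ c ≤ K ∧
      (∫⁻ z in Metric.ball 0 R,
        ({z | Φ z < ((1 + δ : ℝ) : EReal) * φ z + ((-K : ℝ) : EReal)} \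
          Metric.ball 0 r).indicator (fun z => W z * wexp (-2) Φ z) z ≤ η) ∧
      (∀ z ∈ Metric.ball (0 : Cn n) r,
        ((1 + δ : ℝ) : EReal) * φ z + ((-K : ℝ) : EReal) ≤ Φ z + (c : EReal)) ∧
      ∃ z ∈ Metric.ball (0 : Cn n) r,
        Φ z + ((c - 1 : ℝ) : EReal) < ((1 + δ : ℝ) : EReal) * φ z + ((-K : ℝ) : EReal) := by
  obtain ⟨K₀, hK₀⟩ := h.exists_small_excess hφ hneg one_pos hr hη
  set B : ℝ := max c K₀ + c with hB
  have hbig : ∃ z ∈ Metric.ball (0 : Cn n) r, Φ z + (B : EReal) < φ z := by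
    by_contra! hcon
    refine hnot ⟨B, ?_⟩
    filter_upwards [Metric.ball_mem_nhds (0 : Cn n) hr] with z hz using hcon z hz
  obtain ⟨z₀, hz₀, hlt⟩ := hbig
  obtain ⟨δ, hδ0, hδlt⟩ := exists_mul_gt_of_lt (hneg z₀ (Metric.ball_subset_ball hrR hz₀)) hlt
  classical
  have hP : ∃ k : ℕ, ∀ w ∈ Metric.ball (0 : Cn n) r,
      ((1 + δ : ℝ) : EReal) * φ w ≤ Φ w + ((B + k : ℝ) : EReal) := by
    obtain ⟨C, hC⟩ := hδ δ hδ0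
    obtain ⟨k, hk⟩ := exists_nat_ge (C - B)
    refine ⟨k, fun w hw => (hC w (Metric.ball_subset_ball hrR hw)).trans ?_⟩
    exact add_le_add_right (EReal.coe_le_coe_iff.2 (by linarith)) _
  have hk0 : Nat.find hP ≠ 0 := fun h0 => by
    have := Nat.find_spec hP z₀ hz₀
    rw [h0, Nat.cast_zero, add_zero] at this
    exact absurd hδlt (not_lt.2 this)
  obtain ⟨k, hk⟩ := Nat.exists_eq_succ_of_ne_zero hk0
  have hspec := Nat.find_spec hP
  have hmin := Nat.find_min hP (m := k) (by omega)
  rw [hk] at hspec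
  push_cast at hspec
  push Not at hmin
  obtain ⟨w, hw, hwlt⟩ := hmin
  have hk1 : (0 : ℝ) ≤ k := Nat.cast_nonneg k
  refine ⟨δ, B + k + 1 - c, hδ0, ?_, ?_, fun z hz => ?_, w, hw, ?_⟩
  · linarith [le_max_left c K₀]
  · refine le_trans (setLIntegral_mono' Metric.isOpen_ball.measurableSet fun z hz => ?_)
      (hK₀ (B + k + 1 - c) (by linarith [le_max_right c K₀]))
    refine Set.indicator_apply_le' (fun hzX => ?_) fun _ => zero_le
    rw [Set.indicator_of_mem]
    exact ⟨lt_of_lt_of_le hzX.1 (add_le_add_left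
      (coe_mul_le_coe_mul_of_nonpos (by linarith) (hneg z hz)) _), hzX.2⟩
  · have h1 := add_le_add_left (hspec z hz) ((-(B + k + 1 - c) : ℝ) : EReal)
    refine h1.trans (le_of_eq ?_)
    rw [add_assoc]
    norm_cast
    congr 2
    push_cast
    ring
  · have h1 := EReal.add_lt_add_right_coe hwlt (-(B + k + 1 - c))
    refine lt_of_eq_of_lt ?_ h1
    rw [add_assoc, ← EReal.coe_add]
    congr 2
    ring

lemma ZhouBall.leO_of_almost (hn : 0 < n) (h : ZhouBall W Φ R) (hφ : SubOn φ (Metric.ball 0 R))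
    (hneg : ∀ z ∈ Metric.ball 0 R, φ z ≤ 0)
    (hδ : ∀ δ : ℝ, 0 < δ → leO (fun z => ((1 + δ : ℝ) : EReal) * φ z) Φ) : leO φ Φ := by
  obtain ⟨r₀, hr₀, hunif⟩ := h.exists_uniform_ball hφ hneg hδ
  by_contra hnot
  have hsub : Metric.ball (0 : Cn n) (min r₀ R) ⊆ Metric.ball 0 R :=
    Metric.ball_subset_ball (min_le_right _ _)
  replace h := h.mono (lt_min hr₀ h.pos) (min_le_right _ _)
  replace hφ := hφ.mono hsub
  replace hneg : ∀ z ∈ Metric.ball (0 : Cn n) (min r₀ R), φ z ≤ 0 := fun z hz => hneg z (hsub hz)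
  replace hunif : ∀ δ : ℝ, 0 < δ → ∃ C : ℝ, ∀ z ∈ Metric.ball (0 : Cn n) (min r₀ R),
      ((1 + δ : ℝ) : EReal) * φ z ≤ Φ z + (C : EReal) := fun δ hδ => by
    obtain ⟨C, hC⟩ := hunif δ hδ
    exact ⟨C, fun z hz => hC z (Metric.ball_subset_ball (min_le_left _ _) hz)⟩
  obtain ⟨ρ, hanti, hρ, hρR, hρ1, hmass⟩ := h.exists_radii hn
    (M := fun j => ENNReal.ofReal (Real.exp (2 * (j : ℝ))) * j + 2) fun j =>
      ENNReal.add_ne_top.2 ⟨ENNReal.mul_ne_top ENNReal.ofReal_ne_top (ENNReal.natCast_ne_top j),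
        ENNReal.ofNat_ne_top⟩
  have hcal : ∀ i : ℕ, _ := fun i => h.exists_calibrated hφ hneg hunif hnot (hρ i) (hρR i)
    (η := 2⁻¹ ^ i) (by simp) (i : ℝ)
  choose δ K hδ0 hK hex hle z hz hgt using hcal
  have hsmall : ∀ r > 0, ∀ᶠ j in atTop, ρ j ≤ r := fun r hr => by
    filter_upwards [tendsto_one_div_add_atTop_nhds_zero_nat.eventually_le_const hr] with j hj
    exact (hρ1 j).trans hj
  obtain ⟨r, hr, C, hC⟩ := h.leO_of_competitor hφ hneg (a := fun i => 1 + δ i) (K := K) (ρ := ρ)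
    (c := fun j => j) (T := fun j => Metric.ball 0 (ρ j) \ Metric.ball 0 (ρ (j + 1)))
    (fun i => by linarith [hδ0 i]) hK hex
    (fun j => Metric.isOpen_ball.measurableSet.diff Metric.isOpen_ball.measurableSet)
    (fun j => Set.sdiff_subset.trans (Metric.ball_subset_ball (hρR j)))
    (fun r hr => (hsmall r hr).mono fun j hj =>
      Set.sdiff_subset.trans (Metric.ball_subset_ball hj))
    (fun j => Nat.cast_nonneg j) (fun j w hw i hwi => by
      rcases le_or_gt i j with hij | hij
      · exact (hle i w hwi).trans
          (add_le_add_right (EReal.coe_le_coe_iff.2 (Nat.cast_le.2 hij)) _)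
      · exact absurd (Metric.ball_subset_ball (hanti hij) hwi) hw.2)
    hmass
  obtain ⟨k, hk⟩ := exists_nat_ge (C + 1)
  obtain ⟨i, hi, hki⟩ := ((hsmall r hr).and (eventually_ge_atTop k)).exists
  have h1 := (hgt i).trans_le (hC i (z i) (Metric.ball_subset_ball hi (hz i)))
  refine absurd h1 (not_lt.2 (add_le_add_right (EReal.coe_le_coe_iff.2 ?_) _))
  have : (k : ℝ) ≤ i := Nat.cast_le.2 hki
  linarith

end AlmostComparison

/-! ### Comparison of Zhou weights -/

lemma ZhouBall.leO_of_zhouNumber_le (hn : 0 < n) {W₁ W₂ : Cn n → ℝ≥0∞} {φ₁ φ₂ : Cn n → EReal}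
    {R₁ R₂ : ℝ} (h₁ : ZhouBall W₁ φ₁ R₁) (h₂ : ZhouBall W₂ φ₂ R₂)
    (hσ : ∀ f : Cn n → ℂ, HoloNear f →
      zhouNumber (logAbs f) φ₁ ≤ zhouNumber (logAbs f) φ₂) : leO φ₁ φ₂ := by
  have hδ : ∀ δ : ℝ, 0 < δ → leO (fun z => ((1 + δ : ℝ) : EReal) * φ₁ z) φ₂ := fun δ hδ => by
    have hinv : (δ / 2)⁻¹ * (1 + δ) - 2 = (δ / 2)⁻¹ := by field_simp; ring
    have hpos : 0 < (δ / 2)⁻¹ := by positivity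
    obtain ⟨C, hC⟩ := h₁.leO_mul_sub_two hn h₂ hσ (m := (δ / 2)⁻¹ * (1 + δ)) (by linarith)
    refine ⟨δ / 2 * C, ?_⟩
    filter_upwards [hC] with z hz
    have h := le_aff_of_inv_mul_le (a := δ / 2) (x := ((1 + δ : ℝ) : EReal) * φ₁ z)
      (y := (((δ / 2)⁻¹ : ℝ) : EReal) * φ₂ z) (C := C) (by positivity) (by
        rw [← mul_assoc, ← EReal.coe_mul]
        rwa [hinv] at hz)
    rwa [← mul_assoc, ← EReal.coe_mul, mul_inv_cancel₀ (by positivity), EReal.coe_one,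
      one_mul] at h
  obtain ⟨A, hA, hlt⟩ := h₁.sub.toUscOn.exists_lt (Metric.mem_ball_self h₁.pos)
  obtain ⟨r, hr, hrA⟩ := Metric.mem_nhds_iff.1 hlt
  have hR : 0 < min (min R₁ R₂) r := lt_min (lt_min h₁.pos h₂.pos) hr
  have hsub := (h₁.sub.mono (Metric.ball_subset_ball
    ((min_le_left _ r).trans (min_le_left R₁ R₂)))).affine Metric.isOpen_ball one_pos (-A)
  have hle : ∀ z, ((1 : ℝ) : EReal) * φ₁ z + ((-A : ℝ) : EReal) ≤ φ₁ z := fun z => by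
    rw [EReal.coe_one, one_mul]
    simpa using add_le_add_right (EReal.coe_le_coe_iff.2 (neg_nonpos.2 hA)) (φ₁ z)
  obtain ⟨C, hC⟩ := (h₂.mono hR ((min_le_left _ _).trans (min_le_right _ _))).leO_of_almost hn
    hsub (fun z hz => by
      have h := add_le_add_left (hrA (Metric.ball_subset_ball (min_le_right _ _) hz)).le
        ((-A : ℝ) : EReal)
      rwa [← EReal.coe_add, add_neg_cancel, EReal.coe_zero, ← one_mul (φ₁ z),
        ← EReal.coe_one] at h)
    (fun δ hδ0 => by
      obtain ⟨C, hC⟩ := hδ δ hδ0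
      refine ⟨C, hC.mono fun z hz => le_trans ?_ hz⟩
      exact mul_le_mul_of_nonneg_left (hle z) (EReal.coe_nonneg.2 (by linarith)))
  refine ⟨C + A, hC.mono fun z hz => ?_⟩
  have h := add_le_add_left hz (A : EReal)
  beta_reduce at h
  rwa [EReal.coe_one, one_mul, add_assoc, add_assoc, ← EReal.coe_add, ← EReal.coe_add,
    neg_add_cancel, EReal.coe_zero, add_zero] at h

lemma leO.mul_left {φ ψ : Cn n → EReal} (h : leO φ ψ) {b : ℝ} (hb : 0 ≤ b) :
    leO (fun z => (b : EReal) * φ z) fun z => (b : EReal) * ψ z := by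
  rcases hb.eq_or_lt with rfl | hb
  · exact ⟨0, by simp⟩
  · obtain ⟨C, hC⟩ := h
    refine ⟨b * C, hC.mono fun z hz => le_aff_of_inv_mul_le hb ?_⟩
    rwa [← mul_assoc, ← EReal.coe_mul, inv_mul_cancel₀ hb.ne', EReal.coe_one, one_mul]

lemma zhouNumber_congr {φ₁ φ₂ : Cn n → EReal} (h : eqO φ₁ φ₂) (ψ : Cn n → EReal) :
    zhouNumber ψ φ₁ = zhouNumber ψ φ₂ := by
  unfold zhouNumber
  congr 1
  ext b
  exact ⟨fun hb => ⟨hb.1, hb.2.trans (h.1.mul_left hb.1)⟩,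
    fun hb => ⟨hb.1, hb.2.trans (h.2.mul_left hb.1)⟩⟩

lemma IsZhouWeightFor.dim_pos {m : ℕ} {f : Fin m → Cn n → ℂ} {Φ : Cn n → EReal}
    (h : IsZhouWeightFor (normSq2 f) Φ) : 0 < n := by
  rcases Nat.eq_zero_or_pos n with rfl | hn
  · exfalso
    obtain ⟨U, hU, -, hpsh⟩ := h.psh
    have h0 := mem_of_mem_nhds hU
    obtain ⟨w, -, hw⟩ := hpsh.not_botOnComponents 0 h0
    rw [Subsingleton.elim w 0] at hw
    have hx := (EReal.coe_toReal (hpsh.lt_top 0 h0).ne hw).symm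
    refine h.nonint ⟨Metric.ball 0 1, Metric.ball_mem_nhds _ one_pos, ?_⟩
    have hc : (fun z => normSq2 f z * wexp (-2) Φ z) = fun _ => normSq2 f 0 * wexp (-2) Φ 0 := by
      funext z
      rw [Subsingleton.elim z 0]
    rw [hc, lintegral_const, Measure.restrict_apply_univ, wexp_coe _ hx]
    refine ENNReal.mul_lt_top (ENNReal.mul_lt_top ?_ ENNReal.ofReal_lt_top) measure_ball_lt_top
    exact ENNReal.sum_lt_top.2 fun j _ => ENNReal.pow_lt_top ENNReal.coe_lt_top
  · exact hn

/-- comparison of Zhou weights via Zhou valuations of holomorphic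
functions. -/
theorem statement16 {n m₁ m₂ : ℕ} (f₁ : Fin m₁ → Cn n → ℂ) (f₂ : Fin m₂ → Cn n → ℂ)
    (hf₁ : ∀ j, HoloNear (f₁ j)) (hf₂ : ∀ j, HoloNear (f₂ j))
    (φ₁ φ₂ : Cn n → EReal)
    (hZ₁ : IsZhouWeightFor (normSq2 f₁) φ₁) (hZ₂ : IsZhouWeightFor (normSq2 f₂) φ₂) :
    ((∀ f : Cn n → ℂ, HoloNear f →
        zhouNumber (logAbs f) φ₁ ≤ zhouNumber (logAbs f) φ₂) → leO φ₁ φ₂) ∧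
    ((∀ f : Cn n → ℂ, HoloNear f →
        zhouNumber (logAbs f) φ₁ = zhouNumber (logAbs f) φ₂) ↔ eqO φ₁ φ₂) := by
  have hn := hZ₁.dim_pos
  obtain ⟨R₁, h₁⟩ := hZ₁.exists_zhouBall hn hf₁
  obtain ⟨R₂, h₂⟩ := hZ₂.exists_zhouBall hn hf₂
  refine ⟨h₁.leO_of_zhouNumber_le hn h₂, fun h => ⟨?_, ?_⟩, fun h f _ => zhouNumber_congr h _⟩
  · exact h₁.leO_of_zhouNumber_le hn h₂ fun f hf => (h f hf).le
  · exact h₂.leO_of_zhouNumber_le hn h₁ fun f hf => (h f hf).ge
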